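/- Suppose $m\in\mathrm{C}^\infty(\mathbb{R}^2\setminus\{(0,0)\})$ satisfies $|\partial_{\tau_1}^{\beta_1}\partial_{\tau_2}^{\beta_2}m(\tau_1,\tau_2)|\le C_{\beta_1,\beta_2}(|\tau_1|+|\tau_2|)^{-\beta_1-\beta_2}$ for all integers $\beta_1,\beta_2\ge 0$, and that $\mathrm{supp}\, m \subseteq \{(\tau_1,\tau_2):|\tau_1|\le c|\tau_2|\}$ for some constant $c>0$. Define $T_m(f,g)(x,y) := \int_{\mathbb{R}^4} m(\xi_1,\eta_2) e^{2\pi i (x (\xi_1+\eta_1) + y (\xi_2+\eta_2))} \widehat{f}(\xi_1,\xi_2) \widehat{g}(\eta_1,\eta_2)\, d\xi_1 d\xi_2 d\eta_1 d\eta_2$ for Schwartz $f,g$ on $\mathbb{R}^2$. Then for every $s\ge 0$ and all exponents $1<p,q,r<\infty$ with $\frac{1}{p}+\frac{1}{q}=\frac{1}{r}>\frac{1}{2}$ there is a constant $C$ (depending on $p,q,r,s$, finitely many of the constants $C_{\beta_1,\beta_2}$, and $c$) such that $\|T_m(f,g)\|_{\mathrm{L}^r_y(\mathrm{W}^{s,r}_x)}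 \le C\|f\|_{\mathrm{L}^p}\|g\|_{\mathrm{W}^{s,q}}$ for all Schwartz $f,g$. -/

import Mathlib

open MeasureTheory Filter
open scoped ENNReal NNReal Topology

noncomputable section

/-- `e2π t = exp(2πit)`. -/
def e2π (t : ℝ) : ℂ := Complex.exp (2 * (Real.pi : ℂ) * Complex.I * (t : ℂ))

/-- Two-dimensional Fourier transform `f̂(ζ) = ∫ f(u) e^{-2πi u·ζ} du`. -/
def FT2 (f : ℝ × ℝ → ℂ) (ζ : ℝ × ℝ) : ℂ :=
  ∫ u : ℝ × ℝ, f u * e2π (-(u.1 * ζ.1 + u.2 * ζ.2))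

/-- One-dimensional Fourier transform. -/
def FT1 (φ : ℝ → ℂ) (ξ : ℝ) : ℂ := ∫ t : ℝ, φ t * e2π (-(t * ξ))

/-- The bilinear Fourier multiplier with symbol `μ` on `ℝ⁴`. -/
def Tmu (μ : (ℝ × ℝ) × (ℝ × ℝ) → ℂ) (f g : ℝ × ℝ → ℂ) (z : ℝ × ℝ) : ℂ :=
  ∫ w : (ℝ × ℝ) × (ℝ × ℝ),
    μ w * e2π (z.1 * (w.1.1 + w.2.1) + z.2 * (w.1.2 + w.2.2)) * FT2 f w.1 * FT2 g w.2

/-- The bilinear operator with `(x,y)`-dependent symbol `σ(x,y,ξ₁,η₂)`. -/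
def Tsigma (σ : (ℝ × ℝ) → (ℝ × ℝ) → ℂ) (f g : ℝ × ℝ → ℂ) (z : ℝ × ℝ) : ℂ :=
  ∫ w : (ℝ × ℝ) × (ℝ × ℝ),
    σ z (w.1.1, w.2.2) * e2π (z.1 * (w.1.1 + w.2.1) + z.2 * (w.1.2 + w.2.2)) *
      FT2 f w.1 * FT2 g w.2

/-- The `L^p(ℝ²)` norm. -/
def LpNorm (p : ℝ) (f : ℝ × ℝ → ℂ) : ℝ≥0∞ := eLpNorm f (ENNReal.ofReal p) volume

/-- `(I - Δ)^{s/2} f`, the Fourier multiplier with symbol `(1+4π²|ζ|²)^{s/2}`. -/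
def JsFull (s : ℝ) (f : ℝ × ℝ → ℂ) (x : ℝ × ℝ) : ℂ :=
  ∫ ζ : ℝ × ℝ,
    (((1 + 4 * Real.pi ^ 2 * (ζ.1 ^ 2 + ζ.2 ^ 2)) ^ (s / 2) : ℝ) : ℂ) * FT2 f ζ *
      e2π (x.1 * ζ.1 + x.2 * ζ.2)

/-- `(I - Δ_x)^{s/2} f`, the Fourier multiplier with symbol `(1+4π²ζ₁²)^{s/2}`. -/
def JsX (s : ℝ) (f : ℝ × ℝ → ℂ) (x : ℝ × ℝ) : ℂ :=
  ∫ ζ : ℝ × ℝ,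
    (((1 + 4 * Real.pi ^ 2 * ζ.1 ^ 2) ^ (s / 2) : ℝ) : ℂ) * FT2 f ζ *
      e2π (x.1 * ζ.1 + x.2 * ζ.2)

/-- The non-homogeneous Sobolev norm `‖f‖_{W^{s,p}}`. -/
def WNorm (s p : ℝ) (f : ℝ × ℝ → ℂ) : ℝ≥0∞ := eLpNorm (JsFull s f) (ENNReal.ofReal p) volume

/-- The mixed Sobolev norm `‖f‖_{L^p_y(W^{s,p}_x)}`. -/
def WxNorm (s r : ℝ) (f : ℝ × ℝ → ℂ) : ℝ≥0∞ := eLpNorm (JsX s f) (ENNReal.ofReal r) volume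

/-- `L¹`-normalized dilate `φ_k(t) = 2^k φ(2^k t)`. -/
def dil (φ : ℝ → ℂ) (k : ℤ) (t : ℝ) : ℂ := (((2 : ℝ) ^ k : ℝ) : ℂ) * φ ((2 : ℝ) ^ k * t)

/-- Fiber-wise convolution in the first variable. -/
def Px (φ : ℝ → ℂ) (f : ℝ × ℝ → ℂ) (z : ℝ × ℝ) : ℂ := ∫ t : ℝ, f (z.1 - t, z.2) * φ t

/-- Fiber-wise convolution in the second variable. -/
def Py (ψ : ℝ → ℂ) (g : ℝ × ℝ → ℂ) (z : ℝ × ℝ) : ℂ := ∫ t : ℝ, g (z.1, z.2 - t) * ψ t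

/-- The twisted paraproduct with coefficients `λ = (λ_k)_{k ∈ ℤ}`. -/
def TwPara (φ ψ : ℝ → ℂ) (lam : ℤ → ℂ) (f g : ℝ × ℝ → ℂ) (z : ℝ × ℝ) : ℂ :=
  ∑' k : ℤ, lam k * Px (dil φ k) f z * Py (dil ψ k) g z

/-- The Schwartz seminorm `‖φ‖_{α,β} = sup_t |t|^α |∂^β φ(t)|`. -/
def schSemi (φ : ℝ → ℂ) (α β : ℕ) : ℝ := ⨆ t : ℝ, |t| ^ α * ‖iteratedDeriv β φ t‖

/-- `max_{0 ≤ α,β ≤ 3} ‖φ‖_{α,β}`. -/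
def maxSchSemi3 (φ : ℝ → ℂ) : ℝ := ⨆ ab : Fin 4 × Fin 4, schSemi φ (ab.1 : ℕ) (ab.2 : ℕ)

/-- The mixed partial derivative `∂_{τ₁}^{β₁} ∂_{τ₂}^{β₂} F`. -/
def pd (β₁ β₂ : ℕ) (F : ℝ → ℝ → ℂ) (τ₁ τ₂ : ℝ) : ℂ :=
  iteratedDeriv β₁ (fun a => iteratedDeriv β₂ (F a) τ₂) τ₁

/-- The mixed partial derivative `∂_x^{α₁} ∂_y^{α₂} ∂_{τ₁}^{β₁} ∂_{τ₂}^{β₂} F`. -/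
def pd4 (α₁ α₂ β₁ β₂ : ℕ) (F : ℝ → ℝ → ℝ → ℝ → ℂ) (x y τ₁ τ₂ : ℝ) : ℂ :=
  iteratedDeriv α₁ (fun a =>
    iteratedDeriv α₂ (fun b =>
      iteratedDeriv β₁ (fun u => iteratedDeriv β₂ (fun v => F a b u v) τ₂) τ₁) y) x

/-- `∂_x^n F` for `F : ℝ² → ℂ` (derivative in the first variable). -/
def pdx (n : ℕ) (F : ℝ × ℝ → ℂ) (z : ℝ × ℝ) : ℂ := iteratedDeriv n (fun t => F (t, z.2)) z.1

/-- `∂_y^n F` for `F : ℝ² → ℂ` (derivative in the second variable). -/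
def pdy (n : ℕ) (F : ℝ × ℝ → ℂ) (z : ℝ × ℝ) : ℂ := iteratedDeriv n (fun t => F (z.1, t)) z.2

/-- `ϑ(τ) = θ(τ/2) - θ(τ)`. -/
def vartheta (θ : ℝ → ℝ) (τ : ℝ) : ℝ := θ (τ / 2) - θ τ

/-- The modulated dilate `f_ε(x,y) = e^{2πi(ξ⁰₁x + ξ⁰₂y)} Φ(εx, εy)`. -/
def fEps (ξ0 : ℝ × ℝ) (Φ : ℝ × ℝ → ℂ) (ε : ℝ) (z : ℝ × ℝ) : ℂ :=
  e2π (ξ0.1 * z.1 + ξ0.2 * z.2) * Φ (ε * z.1, ε * z.2)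

/-- `h_ε(x,y) = ε² e^{2πi(ζ⁰₁x + ζ⁰₂y)} Ψ(εx, εy)`. -/
def hEps (ζ0 : ℝ × ℝ) (Ψ : ℝ × ℝ → ℂ) (ε : ℝ) (z : ℝ × ℝ) : ℂ :=
  ((ε ^ 2 : ℝ) : ℂ) * e2π (ζ0.1 * z.1 + ζ0.2 * z.2) * Ψ (ε * z.1, ε * z.2)

section

open Finset

/-- Exponential sums over translated arithmetic progressions are uniformly bounded. -/
theorem exists_sum_two_rpow_abs_le {α γ : ℝ} (hα : 0 < α) (hγ : 0 < γ) :
    ∃ K : ℝ, 0 ≤ K ∧ ∀ (x : ℝ) (A : Finset ℤ), ∑ j ∈ A, (2 : ℝ) ^ (-(γ * |x - α * j|)) ≤ K := by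
  set ρ : ℝ := (2 : ℝ) ^ (-(γ * α)) with hρ
  have hρ0 : 0 < ρ := by positivity
  have hρ1 : ρ < 1 := Real.rpow_lt_one_of_one_lt_of_neg (by norm_num) (by nlinarith)
  have hs : Summable fun j : ℤ => ρ ^ j.natAbs := by
    refine Summable.of_nat_of_neg ?_ ?_ <;>
    simpa using summable_geometric_of_lt_one hρ0.le hρ1
  refine ⟨(2 : ℝ) ^ (γ * α) * ∑' j : ℤ, ρ ^ j.natAbs, by positivity, fun x A => ?_⟩
  set n : ℤ := ⌊x / α⌋
  have key : ∀ j : ℤ, (2 : ℝ) ^ (-(γ * |x - α * j|)) ≤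
      (2 : ℝ) ^ (γ * α) * ρ ^ (j - n).natAbs := by
    intro j
    rw [hρ, ← Real.rpow_natCast, ← Real.rpow_mul (by norm_num), ← Real.rpow_add (by norm_num)]
    refine Real.rpow_le_rpow_of_exponent_le (by norm_num) ?_
    have h1 : ((j - n).natAbs : ℝ) = |(j : ℝ) - n| := by
      rw [Nat.cast_natAbs]; push_cast; rfl
    rw [h1]
    have h2 : x - α * j = α * (x / α - j) := by field_simp
    rw [h2, abs_mul, abs_of_pos hα]
    have h3 : |(j : ℝ) - n| ≤ |x / α - j| + 1 := by
      have h4 := Int.floor_le (x / α)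
      have h5 := Int.lt_floor_add_one (x / α)
      have : |(j : ℝ) - n| ≤ |(j : ℝ) - x / α| + |x / α - n| := abs_sub_le _ _ _
      rw [abs_sub_comm (j : ℝ) (x / α)] at this
      have h6 : |x / α - n| ≤ 1 := by rw [abs_le]; constructor <;> linarith
      linarith
    have : 0 < γ * α := by positivity
    nlinarith
  calc _ ≤ ∑ j ∈ A, (2 : ℝ) ^ (γ * α) * ρ ^ (j - n).natAbs := sum_le_sum fun j _ => key j
    _ = (2 : ℝ) ^ (γ * α) * ∑ j ∈ A.image (fun j => j - n), ρ ^ j.natAbs := by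
        rw [mul_sum, sum_image (by intro a _ b _ h; simpa using h), ]
    _ ≤ _ := by
        gcongr
        exact hs.sum_le_tsum _ (fun _ _ => by positivity)

/-- The level-set decomposition of a finitely supported function. -/
theorem exists_dyadic_levels {X : Type*} [DecidableEq X] (B : Finset X) (f : X → ℂ)
    (hf : ∀ x, x ∉ B → f x = 0) :
    ∃ (A : Finset ℤ) (E : ℤ → Finset X), (∀ j, E j ⊆ B) ∧
      (∀ x, f x = ∑ j ∈ A, if x ∈ E j then f x else 0) ∧
      (∀ j, ∀ x ∈ E j, ‖f x‖ ≤ 2 * (2 : ℝ) ^ (j : ℝ)) ∧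
      ∀ a : ℝ, 0 < a → ∑ j ∈ A, (2 : ℝ) ^ ((j : ℝ) / a) * #(E j) ≤ ∑ x ∈ B, ‖f x‖ ^ (1 / a) := by
  classical
  set l : X → ℤ := fun x => Int.log 2 ‖f x‖
  set B' := B.filter fun x => f x ≠ 0
  refine ⟨B'.image l, fun j => B'.filter fun x => l x = j, ?_, ?_, ?_, ?_⟩
  · intro j x hx; simp [B'] at hx; exact hx.1.1
  · intro x
    by_cases hx : x ∈ B'
    · rw [sum_eq_single (l x)]
      · simp [hx]
      · intro b _ hb; simp [hx, hb.symm]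
      · intro h; exact absurd (mem_image_of_mem _ hx) h
    · have : f x = 0 := by
        by_contra h
        exact hx (by simp only [B', mem_filter]; exact ⟨by by_contra h'; exact h (hf x h'), h⟩)
      simp [this]
  · intro j x hx
    have h2 : l x = j := (mem_filter.1 hx).2
    have := Int.lt_zpow_succ_log_self (b := 2) (by norm_num) ‖f x‖
    rw [← h2, Real.rpow_intCast]
    push_cast at this
    rw [zpow_add₀ (by norm_num)] at this
    linarith
  · intro a ha
    have : ∀ j ∈ B'.image l, (2 : ℝ) ^ ((j : ℝ) / a) * #(B'.filter fun x => l x = j) ≤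
        ∑ x ∈ B'.filter (fun x => l x = j), ‖f x‖ ^ (1 / a) := by
      intro j _
      rw [mul_comm, ← nsmul_eq_mul]
      refine card_nsmul_le_sum _ _ _ fun x hx => ?_
      have h1 := mem_filter.1 hx
      have h2 : f x ≠ 0 := by have := h1.1; simp [B'] at this; exact this.2
      have h3 := Int.zpow_log_le_self (R := ℝ) (b := 2) (by norm_num) (norm_pos_iff.2 h2)
      have h4 : (2 : ℝ) ^ (j : ℝ) ≤ ‖f x‖ := by
        rw [Real.rpow_intCast, ← h1.2]; exact_mod_cast h3
      calc (2 : ℝ) ^ ((j : ℝ) / a) = ((2 : ℝ) ^ (j : ℝ)) ^ (1 / a) := by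
            rw [← Real.rpow_mul (by norm_num)]; ring_nf
        _ ≤ _ := Real.rpow_le_rpow (by positivity) h4 (by positivity)
    refine (sum_le_sum this).trans ?_
    rw [sum_fiberwise_of_maps_to (fun x hx => mem_image_of_mem _ hx)]
    exact sum_le_sum_of_subset_of_nonneg (filter_subset _ _) (fun _ _ _ => by positivity)

/-- Multilinear interpolation between restricted-type estimates on a finite set. -/
theorem exists_restricted_interpolation {ι : Type*} [Fintype ι] [DecidableEq ι] [Nontrivial ι]
    (a : ι → ℝ) (δ : ℝ) (hδ : 0 < δ) (ha : ∀ i, δ < a i) (hsum : ∑ i, a i = 1) :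
    ∃ K : ℝ, 0 ≤ K ∧ ∀ {X : Type} [DecidableEq X] (B : Finset X)
      (Λ : MultilinearMap ℂ (fun _ : ι => X → ℂ) ℂ) (C : ℝ), 0 ≤ C →
      (∀ m m' : ι, m ≠ m' → ∀ (E : ι → Finset X) (f : ι → X → ℂ), (∀ i, E i ⊆ B) →
        (∀ i x, ‖f i x‖ ≤ if x ∈ E i then 1 else 0) →
        ‖Λ f‖ ≤ C * ∏ i, (#(E i) : ℝ) ^
          (a i + (if i = m then δ else 0) - (if i = m' then δ else 0))) →
      ∀ f : ι → X → ℂ, (∀ i, ∀ x ∉ B, f i x = 0) →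
        ‖Λ f‖ ≤ K * C * ∏ i, (∑ x ∈ B, ‖f i x‖ ^ (1 / a i)) ^ a i := by
  have ha0 : ∀ i, 0 < a i := fun i => hδ.trans (ha i)
  obtain ⟨n, hn⟩ : ∃ n : ℝ, n = (Fintype.card ι : ℝ) := ⟨_, rfl⟩
  have hn0 : 0 < n := by rw [hn]; exact_mod_cast Fintype.card_pos
  have hγ : 0 < δ / n := by positivity
  choose Kc hKc0 hKc using fun i =>
    exists_sum_two_rpow_abs_le (α := 1 / a i) (γ := δ / n) (one_div_pos.2 (ha0 i)) hγ
  refine ⟨(∏ _i : ι, (2 : ℝ)) * (n * ∏ i, Kc i), by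
    have : 0 ≤ ∏ i, Kc i := prod_nonneg fun i _ => hKc0 i
    positivity, ?_⟩
  intro X _ B Λ C hC hΛ f hf
  set N : ι → ℝ := fun i => ∑ x ∈ B, ‖f i x‖ ^ (1 / a i) with hN
  have hNnn : ∀ i, 0 ≤ N i := fun i => sum_nonneg fun x _ => by positivity
  by_cases hz : ∃ i, N i = 0
  · obtain ⟨i, hi⟩ := hz
    have hfi : f i = 0 := by
      funext x
      by_cases hx : x ∈ B
      · have := (sum_eq_zero_iff_of_nonneg (fun x _ => by positivity)).1 hi x hx
        rw [Real.rpow_eq_zero (norm_nonneg _) (one_div_pos.2 (ha0 i)).ne'] at this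
        simpa using this
      · exact hf i x hx
    rw [Λ.map_coord_zero i hfi, norm_zero]
    have : 0 ≤ ∏ i, Kc i := prod_nonneg fun i _ => hKc0 i
    have : 0 ≤ ∏ i, N i ^ a i := prod_nonneg fun i _ => by have := hNnn i; positivity
    positivity
  push Not at hz
  have hNp : ∀ i, 0 < N i := fun i => lt_of_le_of_ne (hNnn i) (hz i).symm
  choose A E hEB hdec hbd hmass using fun i => exists_dyadic_levels B (f i) (hf i)
  set g : ι → ℤ → X → ℂ := fun i j x => if x ∈ E i j then f i x else 0 with hg
  have hfg : f = fun i => ∑ j ∈ A i, g i j := by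
    funext i x
    rw [hdec i x, Finset.sum_apply]
  have hexp : Λ f = ∑ J ∈ Fintype.piFinset A, Λ fun i => g i (J i) := by
    conv_lhs => rw [hfg]
    exact Λ.map_sum_finset g A
  clear hfg hdec
  obtain ⟨S, hS⟩ : ∃ S : ι → ℤ → ℝ,
    S = fun i (j : ℤ) => (2 : ℝ) ^ ((j : ℝ) / a i) * #(E i j) / N i := ⟨_, rfl⟩
  have hS0 : ∀ i j, 0 ≤ S i j := fun i j => by have := hNp i; rw [hS]; positivity
  have hS1 : ∀ i, ∑ j ∈ A i, S i j ≤ 1 := by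
    intro i
    rw [hS, ← sum_div, div_le_one (hNp i)]
    exact hmass i (a i) (ha0 i)
  obtain ⟨Y, hY⟩ : ∃ Y : ι → ℤ → ℝ, Y = fun i (j : ℤ) => (j : ℝ) / a i - Real.logb 2 (N i) := ⟨_, rfl⟩
  have h2Y : ∀ i (j : ℤ), (2 : ℝ) ^ ((j : ℝ) / a i) = (2 : ℝ) ^ Y i j * N i := by
    intro i j
    rw [hY]; dsimp only
    rw [Real.rpow_sub (by norm_num), Real.rpow_logb (by norm_num) (by norm_num) (hNp i),
      div_mul_cancel₀ _ (hNp i).ne']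
  have hE : ∀ i j, (#(E i j) : ℝ) = S i j / (2 : ℝ) ^ Y i j := by
    intro i j
    have := hNp i
    rw [hS]; dsimp only
    rw [h2Y]; field_simp
  clear hS
  have h2j : ∀ i (j : ℤ), (2 : ℝ) ^ (j : ℝ) = ((2 : ℝ) ^ Y i j) ^ a i * N i ^ a i := by
    intro i j
    rw [← Real.mul_rpow (by positivity) (hNp i).le, ← h2Y, ← Real.rpow_mul (by norm_num),
      div_mul_cancel₀ _ (ha0 i).ne']
  have hterm : ∀ J : ι → ℤ, ‖Λ fun i => g i (J i)‖ ≤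
      (∏ _i : ι, (2 : ℝ)) * C * (∏ i, N i ^ a i) *
        ∑ k, S k (J k) * ∏ i, (2 : ℝ) ^ (-(δ / n * |Y k (J k) - Y i (J i)|)) := by
    intro J
    obtain ⟨m, m', hmm, hmax, hmin⟩ : ∃ m m' : ι, m ≠ m' ∧ (∀ i, Y i (J i) ≤ Y m (J m)) ∧
        ∀ i, Y m' (J m') ≤ Y i (J i) := by
      obtain ⟨m, hm⟩ := Finite.exists_max fun i => Y i (J i)
      obtain ⟨m', hm'⟩ := Finite.exists_min fun i => Y i (J i)
      by_cases h : m = m'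
      · obtain ⟨k, hk⟩ := exists_ne m
        refine ⟨m, k, hk.symm, hm, fun i => ?_⟩
        subst h
        exact (hm k).trans (hm' i)
      · exact ⟨m, m', h, hm, hm'⟩
    set u : ι → X → ℂ := fun i x => ((1 / (2 * (2 : ℝ) ^ (J i : ℝ)) : ℝ) : ℂ) * g i (J i) x
    have hgu : (fun i => g i (J i)) = fun i => ((2 * (2 : ℝ) ^ (J i : ℝ) : ℝ) : ℂ) • u i := by
      funext i x
      simp only [u, Pi.smul_apply, smul_eq_mul]
      rw [← mul_assoc, ← Complex.ofReal_mul, mul_one_div_cancel (by positivity)]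
      simp
    have hu : ∀ i x, ‖u i x‖ ≤ if x ∈ E i (J i) then 1 else 0 := by
      intro i x
      simp only [u, g]
      split_ifs with hx
      · have := hbd i (J i) x hx
        rw [norm_mul, Complex.norm_real, Real.norm_of_nonneg (by positivity), one_div,
          inv_mul_le_iff₀ (by positivity), mul_one]
        exact this
      · simp
    have h1 := hΛ m m' hmm (fun i => E i (J i)) u (fun i => hEB i _) hu
    rw [hgu, Λ.map_smul_univ, norm_smul, norm_prod]
    obtain ⟨b, hb⟩ : ∃ b : ι → ℝ,
      b = fun i => a i + (if i = m then δ else 0) - (if i = m' then δ else 0) := ⟨_, rfl⟩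
    have h1 : ‖Λ u‖ ≤ C * ∏ i, (#(E i (J i)) : ℝ) ^ b i := by rw [hb]; exact h1
    have hb0 : ∀ i, 0 < b i := by
      intro i
      have := ha i
      simp only [hb]
      split_ifs <;> linarith
    have hbs : ∑ i, b i = 1 := by simp [hb, sum_add_distrib, sum_sub_distrib, hsum]
    have e1 : ∏ i, ‖((2 * (2 : ℝ) ^ (J i : ℝ) : ℝ) : ℂ)‖ =
        (∏ _i : ι, (2 : ℝ)) * ∏ i, (((2 : ℝ) ^ Y i (J i)) ^ a i * N i ^ a i) := by
      rw [← prod_mul_distrib]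
      refine prod_congr rfl fun i _ => ?_
      rw [Complex.norm_real, Real.norm_of_nonneg (by positivity), h2j i]
    have e2 : (∏ i, (((2 : ℝ) ^ Y i (J i)) ^ a i * N i ^ a i)) * ∏ i, (#(E i (J i)) : ℝ) ^ b i =
        (∏ i, N i ^ a i) * (∏ i, S i (J i) ^ b i) *
          (2 : ℝ) ^ (-(δ * (Y m (J m) - Y m' (J m')))) := by
      have e3 : (2 : ℝ) ^ (-(δ * (Y m (J m) - Y m' (J m')))) =
          ∏ i, (2 : ℝ) ^ (Y i (J i) * (a i - b i)) := by
        rw [← Real.rpow_sum_of_pos (by norm_num)]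
        congr 1
        have : ∀ i, Y i (J i) * (a i - b i) = (if i = m' then δ * Y i (J i) else 0) -
            (if i = m then δ * Y i (J i) else 0) := by
          intro i; simp only [hb]; split_ifs <;> ring
        rw [sum_congr rfl fun i _ => this i, sum_sub_distrib]
        simp; ring
      rw [e3, ← prod_mul_distrib, ← prod_mul_distrib, ← prod_mul_distrib]
      refine prod_congr rfl fun i _ => ?_
      rw [hE, Real.div_rpow (hS0 _ _) (by positivity), ← Real.rpow_mul (by norm_num),
        ← Real.rpow_mul (by norm_num), mul_sub, Real.rpow_sub two_pos (Y i (J i) * a i) (Y i (J i) * b i)]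
      ring
    have e4 : ∏ i, S i (J i) ^ b i ≤ ∑ k, S k (J k) := by
      refine (Real.geom_mean_le_arith_mean_weighted univ b (fun i => S i (J i))
        (fun i _ => (hb0 i).le) hbs (fun i _ => hS0 _ _)).trans (sum_le_sum fun i _ => ?_)
      have : b i ≤ 1 := hbs ▸ single_le_sum (f := b) (fun i _ => (hb0 i).le) (mem_univ i)
      exact mul_le_of_le_one_left (hS0 _ _) this
    have e5 : ∀ k, (2 : ℝ) ^ (-(δ * (Y m (J m) - Y m' (J m')))) ≤
        ∏ i, (2 : ℝ) ^ (-(δ / n * |Y k (J k) - Y i (J i)|)) := by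
      intro k
      rw [← Real.rpow_sum_of_pos (by norm_num)]
      refine Real.rpow_le_rpow_of_exponent_le (by norm_num) ?_
      rw [sum_neg_distrib, neg_le_neg_iff, ← mul_sum]
      have : ∑ i, |Y k (J k) - Y i (J i)| ≤ ∑ _i : ι, (Y m (J m) - Y m' (J m')) := by
        refine sum_le_sum fun i _ => ?_
        have := hmax i; have := hmin i; have := hmax k; have := hmin k
        rw [abs_le]; constructor <;> linarith
      rw [sum_const, card_univ, nsmul_eq_mul, ← hn] at this
      calc _ ≤ δ / n * (n * (Y m (J m) - Y m' (J m'))) := by gcongr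
        _ = _ := by field_simp
    have hP : 0 ≤ ∏ i, N i ^ a i := prod_nonneg fun i _ => by have := hNnn i; positivity
    calc _ ≤ ((∏ _i : ι, (2 : ℝ)) * ∏ i, (((2 : ℝ) ^ Y i (J i)) ^ a i * N i ^ a i)) *
          (C * ∏ i, (#(E i (J i)) : ℝ) ^ b i) := by
            rw [e1]
            refine mul_le_mul_of_nonneg_left h1 ?_
            rw [← e1]; positivity
      _ = (∏ _i : ι, (2 : ℝ)) * C * ((∏ i, (((2 : ℝ) ^ Y i (J i)) ^ a i * N i ^ a i)) *
          ∏ i, (#(E i (J i)) : ℝ) ^ b i) := by ring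
      _ = (∏ _i : ι, (2 : ℝ)) * C * ((∏ i, N i ^ a i) * ((∏ i, S i (J i) ^ b i) *
          (2 : ℝ) ^ (-(δ * (Y m (J m) - Y m' (J m')))))) := by rw [e2]; ring
      _ ≤ (∏ _i : ι, (2 : ℝ)) * C * ((∏ i, N i ^ a i) * ((∑ k, S k (J k)) *
          (2 : ℝ) ^ (-(δ * (Y m (J m) - Y m' (J m')))))) := by gcongr
      _ ≤ (∏ _i : ι, (2 : ℝ)) * C * ((∏ i, N i ^ a i) *
          ∑ k, S k (J k) * ∏ i, (2 : ℝ) ^ (-(δ / n * |Y k (J k) - Y i (J i)|))) := by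
            rw [sum_mul]
            gcongr with k _
            · exact hS0 _ _
            · exact e5 k
      _ = _ := by ring
  have hfinal : ∑ J ∈ Fintype.piFinset A, ∑ k, S k (J k) *
      ∏ i, (2 : ℝ) ^ (-(δ / n * |Y k (J k) - Y i (J i)|)) ≤ n * ∏ i, Kc i := by
    rw [sum_comm]
    calc _ ≤ ∑ _k : ι, ∏ i, Kc i := ?_
      _ = _ := by rw [sum_const, card_univ, nsmul_eq_mul, ← hn]
    refine sum_le_sum fun k _ => ?_
    calc _ ≤ ∑ J ∈ Fintype.piFinset A, ∑ j ∈ A k, S k j *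
          ∏ i, (2 : ℝ) ^ (-(δ / n * |Y k j - Y i (J i)|)) := by
            refine sum_le_sum fun J hJ => ?_
            refine single_le_sum (f := fun j => S k j *
              ∏ i, (2 : ℝ) ^ (-(δ / n * |Y k j - Y i (J i)|))) (fun j _ => ?_)
              (Fintype.mem_piFinset.1 hJ k)
            have := hS0 k j
            have : 0 ≤ ∏ i, (2 : ℝ) ^ (-(δ / n * |Y k j - Y i (J i)|)) :=
              prod_nonneg fun i _ => by positivity
            positivity
      _ = ∑ j ∈ A k, S k j * ∏ i, ∑ l ∈ A i, (2 : ℝ) ^ (-(δ / n * |Y k j - Y i l|)) := by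
            rw [sum_comm]
            refine sum_congr rfl fun j _ => ?_
            rw [← mul_sum, Finset.prod_univ_sum]
      _ ≤ ∑ j ∈ A k, S k j * ∏ i, Kc i := by
            gcongr with j _ i _
            · exact hS0 _ _
            · refine le_trans (le_of_eq ?_) (hKc i (Y k j + Real.logb 2 (N i)) (A i))
              refine sum_congr rfl fun l _ => ?_
              simp only [hY]
              congr 4
              ring
      _ ≤ _ := by
            rw [← sum_mul]
            exact mul_le_of_le_one_left (prod_nonneg fun i _ => hKc0 i) (hS1 k)
  rw [hexp]
  have hP : 0 ≤ ∏ i, N i ^ a i := prod_nonneg fun i _ => by have := hNnn i; positivity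
  calc _ ≤ ∑ J ∈ Fintype.piFinset A, ‖Λ fun i => g i (J i)‖ := norm_sum_le _ _
    _ ≤ ∑ J ∈ Fintype.piFinset A, (∏ _i : ι, (2 : ℝ)) * C * (∏ i, N i ^ a i) *
        ∑ k, S k (J k) * ∏ i, (2 : ℝ) ^ (-(δ / n * |Y k (J k) - Y i (J i)|)) :=
          sum_le_sum fun J _ => hterm J
    _ ≤ (∏ _i : ι, (2 : ℝ)) * C * (∏ i, N i ^ a i) * (n * ∏ i, Kc i) := by
          rw [← mul_sum]; gcongr
    _ = _ := by ring

/-- Sum over the four dyadic children of a dyadic square. -/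
def childSum (φ : ℕ → ℤ → ℤ → ℝ) (k : ℕ) (a b : ℤ) : ℝ :=
  φ k (2 * a) (2 * b) + φ k (2 * a) (2 * b + 1) + φ k (2 * a + 1) (2 * b) +
    φ k (2 * a + 1) (2 * b + 1)

theorem exists_mul_rpow_le_rpow_add {s : ℝ} (hs : 1 < s) :
    ∃ c : ℝ, 0 ≤ c ∧ ∀ v α : ℝ, 0 ≤ v → 0 < α →
      4 * s * α ^ (s - 1) * v ≤ v ^ s + c * α ^ s := by
  have hs1 : 0 < s - 1 := by linarith
  set R := (4 * s) ^ (1 / (s - 1)) with hR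
  have hR0 : 0 < R := by positivity
  have hRs : R ^ (s - 1) = 4 * s := by
    rw [hR, ← Real.rpow_mul (by positivity), one_div_mul_cancel hs1.ne', Real.rpow_one]
  refine ⟨4 * s * R, by positivity, fun v α hv hα => ?_⟩
  have hαs : α ^ s = α ^ (s - 1) * α := by
    rw [← Real.rpow_add_one hα.ne']; congr 1; ring
  rcases le_total v (R * α) with h | h
  · have : 4 * s * α ^ (s - 1) * v ≤ 4 * s * α ^ (s - 1) * (R * α) := by gcongr
    have h2 : 0 ≤ v ^ s := by positivity
    rw [hαs]; nlinarith
  · have hv0 : 0 < v := lt_of_lt_of_le (by positivity) h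
    have h1 : (R * α) ^ (s - 1) ≤ v ^ (s - 1) := by gcongr
    rw [Real.mul_rpow hR0.le hα.le, hRs] at h1
    have hvs : v ^ s = v ^ (s - 1) * v := by
      rw [← Real.rpow_add_one hv0.ne']; congr 1; ring
    have : 0 ≤ 4 * s * R * α ^ s := by positivity
    rw [hvs]; nlinarith

section tree
variable {p : Fin 3 → ℝ}

/-- The stopping-time Bellman induction on the dyadic tree, in its scaled additive form. -/
theorem exists_tree_bound_sum (hp : ∀ j, 2 < p j) (hsum : ∑ j, 1 / p j = 1) :
    ∃ C : ℝ, 0 ≤ C ∧ ∀ (W w : ℕ → ℤ → ℤ → ℝ) (m P : Fin 3 → ℕ → ℤ → ℤ → ℝ),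
      (∀ j k a b, 0 ≤ m j k a b) →
      (∀ j k a b, m j (k + 1) a b = childSum (m j) k a b) →
      (∀ j k a b, P j (k + 1) a b = childSum (P j) k a b) →
      (∀ a b, W 0 a b = 0) →
      (∀ k a b, W (k + 1) a b = w (k + 1) a b + childSum W k a b) →
      (∀ j (α : ℝ), 0 < α → ∀ k a b, p j / 2 * α ^ (p j / 2 - 1) * m j k a b ≤
        P j k a b + (p j / 2 - 1) * α ^ (p j / 2) * 4 ^ k) →
      (∀ j k a b, 0 ≤ P j k a b) →
      (∀ j k a b, m j k a b = 0 → W k a b = 0) →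
      (∀ α : Fin 3 → ℝ, (∀ j, 0 < α j) → ∃ bell : ℕ → ℤ → ℤ → ℝ, (∀ k a b, 0 ≤ bell k a b) ∧
        (∀ k a b, w (k + 1) a b + bell (k + 1) a b ≤ childSum bell k a b) ∧
        ∀ K : ℝ, 1 ≤ K → ∀ k a b, (∀ j, m j k a b ≤ K * α j * 4 ^ k) →
          bell k a b ≤ (K ^ 2 + K) * (∏ j, α j ^ (1 / 2 : ℝ)) * 4 ^ k) →
      ∀ t : Fin 3 → ℝ, (∀ j, 0 < t j) → ∏ j, t j ^ (1 / p j) = 1 →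
        ∀ k a b, W k a b ≤ C * ∑ j, t j * P j k a b := by
  have hs : ∀ j, 1 < p j / 2 := fun j => by have := hp j; linarith
  choose cs hcs0 hcs using fun j => exists_mul_rpow_le_rpow_add (hs j)
  set K : ℝ := 1 + 3 * ∑ j, cs j with hK
  have hcsum : 0 ≤ ∑ j, cs j := sum_nonneg fun j _ => hcs0 j
  have hK1 : 1 ≤ K := by linarith
  have hKc : ∀ j, 3 * cs j ≤ K := fun j => by
    have := single_le_sum (f := cs) (fun j _ => hcs0 j) (mem_univ j)
    linarith
  set C : ℝ := (4 * K) ^ 2 + 4 * K with hC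
  have hC0 : 0 < C := by positivity
  refine ⟨C * 4, by positivity, ?_⟩
  intro W w m P hm hmadd hPadd hW0 hWs htan hP hdeg hbell t ht htprod
  set Φ : ℕ → ℤ → ℤ → ℝ := fun k a b =>
    ∑ j, t j * (4 * P j k a b - 4 ^ k * (m j k a b / 4 ^ k) ^ (p j / 2)) with hΦ
  have hjensen : ∀ j k a b, (4 : ℝ) ^ k * (m j k a b / 4 ^ k) ^ (p j / 2) ≤ P j k a b := by
    intro j k a b
    rcases (hm j k a b).eq_or_lt with h | h
    · rw [← h, zero_div, Real.zero_rpow (by have := hs j; linarith), mul_zero]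
      exact hP j k a b
    · set v := m j k a b / 4 ^ k with hv
      have hv0 : 0 < v := by positivity
      have h1 := htan j v hv0 k a b
      have h2 : m j k a b = v * 4 ^ k := by rw [hv]; field_simp
      have h3 : v ^ (p j / 2) = v ^ (p j / 2 - 1) * v := by
        rw [← Real.rpow_add_one hv0.ne']; congr 1; ring
      rw [h2] at h1
      rw [h3] at h1 ⊢
      nlinarith
  suffices H : ∀ k a b, W k a b ≤ C * Φ k a b by
    intro k a b
    refine (H k a b).trans ?_
    rw [mul_assoc, mul_sum (a := (4 : ℝ))]
    refine mul_le_mul_of_nonneg_left (sum_le_sum fun j _ => ?_) hC0.le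
    have : (0 : ℝ) ≤ 4 ^ k * (m j k a b / 4 ^ k) ^ (p j / 2) := by
      have := hm j k a b; positivity
    have := ht j
    nlinarith
  intro k0
  induction k0 using Nat.strong_induction_on with
  | _ k0 ih =>
  intro a0 b0
  by_cases hz : ∃ j, m j k0 a0 b0 = 0
  · obtain ⟨j, hj⟩ := hz
    rw [hdeg j k0 a0 b0 hj]
    refine mul_nonneg hC0.le (sum_nonneg fun j _ => mul_nonneg (ht j).le ?_)
    have := hjensen j k0 a0 b0
    have := hP j k0 a0 b0
    linarith
  push Not at hz
  set α : Fin 3 → ℝ := fun j => m j k0 a0 b0 / 4 ^ k0 with hα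
  have hα0 : ∀ j, 0 < α j := fun j => div_pos ((hm j _ _ _).lt_of_ne (hz j).symm) (by positivity)
  obtain ⟨bell, hb0, hbstep, hbbd⟩ := hbell α hα0
  set Mα : ℝ := C * ∏ j, α j ^ (1 / 2 : ℝ) with hMα
  set Sα : ℝ := ∑ j, t j * α j ^ (p j / 2) with hSα
  have hMS : ∏ j, α j ^ (1 / 2 : ℝ) ≤ Sα := by
    have h1 : ∏ j, α j ^ (1 / 2 : ℝ) = ∏ j, (t j * α j ^ (p j / 2)) ^ (1 / p j) := by
      have h0 : ∏ j, α j ^ (1 / 2 : ℝ) = (∏ j, t j ^ (1 / p j)) * ∏ j, α j ^ (1 / 2 : ℝ) := by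
        rw [htprod, one_mul]
      rw [h0, ← prod_mul_distrib]
      refine prod_congr rfl fun j _ => ?_
      have := hp j
      rw [Real.mul_rpow (ht j).le (by have := hα0 j; positivity), ← Real.rpow_mul (hα0 j).le]
      congr 2
      field_simp
    rw [h1]
    refine (Real.geom_mean_le_arith_mean_weighted univ _ _
      (fun j _ => by have := hp j; positivity) hsum
      (fun j _ => by have := hα0 j; have := ht j; positivity)).trans (sum_le_sum fun j _ => ?_)
    refine mul_le_of_le_one_left (by have := hα0 j; have := ht j; positivity) ?_
    have := hp j
    rw [div_le_one (by linarith)]; linarith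
  set eα : ℝ := ∑ j, t j * (cs j * α j ^ (p j / 2)) with heα
  have he0 : 0 ≤ eα := sum_nonneg fun j _ => by
    have := hα0 j; have := ht j; have := hcs0 j; positivity
  have heS : 3 * eα ≤ K * Sα := by
    rw [heα, hSα, mul_sum, mul_sum]
    refine sum_le_sum fun j _ => ?_
    have h1 : 0 ≤ t j * α j ^ (p j / 2) := by have := hα0 j; have := ht j; positivity
    have := hKc j
    nlinarith
  set Lin : ℕ → ℤ → ℤ → ℝ := fun k a b =>
    (∑ j, t j * (4 * (P j k a b - p j / 2 * α j ^ (p j / 2 - 1) * m j k a b +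
      (p j / 2 - 1) * α j ^ (p j / 2) * 4 ^ k))) + eα * ∑ j, m j k a b / (K * α j) with hLin
  have hLinadd : ∀ k a b, Lin (k + 1) a b = childSum Lin k a b := by
    intro k a b
    simp only [hLin, childSum, hmadd, hPadd, Fin.sum_univ_three, pow_succ]
    ring
  have hLin0 : ∀ k a b, 0 ≤ Lin k a b := by
    intro k a b
    refine add_nonneg (sum_nonneg fun j _ => ?_) (mul_nonneg he0 (sum_nonneg fun j _ => ?_))
    · have := htan j (α j) (hα0 j) k a b
      have := ht j
      refine mul_nonneg this.le ?_
      linarith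
    · have := hα0 j; have := hm j k a b; positivity
  have hlast : ∀ k a b, (∃ j, K * α j * 4 ^ k < m j k a b) → Φ k a b ≤ Lin k a b := by
    rintro k a b ⟨i, hi⟩
    have h1 : (4 : ℝ) ^ k ≤ ∑ j, m j k a b / (K * α j) := by
      refine le_trans ?_ (single_le_sum (f := fun j => m j k a b / (K * α j)) (fun j _ => ?_)
        (mem_univ i))
      · have := hα0 i
        rw [le_div_iff₀ (by positivity)]; linarith
      · have := hα0 j; have := hm j k a b; positivity
    have h2 : Lin k a b ≥ ∑ j, (t j * (4 * (P j k a b - p j / 2 * α j ^ (p j / 2 - 1) * m j k a b +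
        (p j / 2 - 1) * α j ^ (p j / 2) * 4 ^ k)) + t j * (cs j * α j ^ (p j / 2)) * 4 ^ k) := by
      rw [sum_add_distrib, ← sum_mul]
      have := mul_le_mul_of_nonneg_left h1 he0
      simp only [hLin]
      linarith
    refine le_trans (sum_le_sum fun j _ => ?_) h2
    have h3 := hcs j (m j k a b / 4 ^ k) (α j) (by have := hm j k a b; positivity) (hα0 j)
    have h4 : (4 : ℝ) ^ k * (4 * (p j / 2) * α j ^ (p j / 2 - 1) * (m j k a b / 4 ^ k)) =
        4 * (p j / 2) * α j ^ (p j / 2 - 1) * m j k a b := by field_simp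
    have h5 := mul_le_mul_of_nonneg_left h3 (by positivity : (0 : ℝ) ≤ 4 ^ k)
    rw [h4] at h5
    have h6 : 0 ≤ (p j / 2 - 1) * α j ^ (p j / 2) * 4 ^ k := by
      have := hα0 j
      have : 0 < p j / 2 - 1 := by linarith [hs j]
      positivity
    have h7 := ht j
    rw [mul_assoc (t j), ← mul_add]
    refine mul_le_mul_of_nonneg_left ?_ h7.le
    linarith
  have inner : ∀ k a b, (k < k0 ∨ ∀ j, m j k a b ≤ K * α j * 4 ^ k) → k ≤ k0 →
      (∀ j, m j k a b ≤ 4 * K * α j * 4 ^ k) →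
      W k a b + bell k a b ≤ Mα * 4 ^ k + C * Lin k a b := by
    intro k
    induction k with
    | zero =>
      intro a b _ _ h4
      have h1 := hbbd (4 * K) (by linarith) 0 a b h4
      have h2 := mul_nonneg hC0.le (hLin0 0 a b)
      rw [hW0]
      linarith
    | succ k ihk =>
      intro a b hor hk h4
      by_cases hst : ∃ j, K * α j * 4 ^ (k + 1) < m j (k + 1) a b
      · have hlt : k + 1 < k0 := by
          rcases hor with h | h
          · exact h
          · obtain ⟨j, hj⟩ := hst
            exact absurd (h j) (not_le.2 hj)
        have h1 := hbbd (4 * K) (by linarith) (k + 1) a b h4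
        have h2 := ih (k + 1) hlt a b
        have h3 := mul_le_mul_of_nonneg_left (hlast _ a b hst) hC0.le
        linarith
      · push Not at hst
        have hch : ∀ a' b', (∀ j, m j k a' b' ≤ m j (k + 1) a b) →
            W k a' b' + bell k a' b' ≤ Mα * 4 ^ k + C * Lin k a' b' := by
          intro a' b' h
          refine ihk a' b' (Or.inl (by omega)) (by omega) fun j => ?_
          have := h j
          have := hst j
          rw [pow_succ] at this
          linarith
        have hnn := fun j a' b' => hm j k a' b'
        have hadd := fun j => hmadd j k a b
        simp only [childSum] at hadd
        have c1 := hch (2 * a) (2 * b) fun j => by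
          rw [hadd j]; linarith [hnn j (2 * a) (2 * b + 1), hnn j (2 * a + 1) (2 * b),
            hnn j (2 * a + 1) (2 * b + 1)]
        have c2 := hch (2 * a) (2 * b + 1) fun j => by
          rw [hadd j]; linarith [hnn j (2 * a) (2 * b), hnn j (2 * a + 1) (2 * b),
            hnn j (2 * a + 1) (2 * b + 1)]
        have c3 := hch (2 * a + 1) (2 * b) fun j => by
          rw [hadd j]; linarith [hnn j (2 * a) (2 * b + 1), hnn j (2 * a) (2 * b),
            hnn j (2 * a + 1) (2 * b + 1)]
        have c4 := hch (2 * a + 1) (2 * b + 1) fun j => by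
          rw [hadd j]; linarith [hnn j (2 * a) (2 * b + 1), hnn j (2 * a + 1) (2 * b),
            hnn j (2 * a) (2 * b)]
        have h1 := hbstep k a b
        have h2 := hLinadd k a b
        rw [hWs, h2, pow_succ]
        simp only [childSum] at h1 ⊢
        linarith
  have hmα : ∀ j, m j k0 a0 b0 = α j * 4 ^ k0 := fun j => by
    simp only [hα]; field_simp
  have h4K : ∀ j, m j k0 a0 b0 ≤ K * α j * 4 ^ k0 := fun j => by
    rw [hmα j]
    have := hα0 j
    gcongr
    nlinarith
  have htop := inner k0 a0 b0 (Or.inr h4K) le_rfl fun j => by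
    have := h4K j
    have : 0 ≤ K * α j * 4 ^ k0 := by have := hα0 j; positivity
    linarith
  have hb := hb0 k0 a0 b0
  have hLtop : Lin k0 a0 b0 = (∑ j, 4 * (t j * P j k0 a0 b0)) - 4 * Sα * 4 ^ k0 +
      3 * eα / K * 4 ^ k0 := by
    have e1 : ∑ j, m j k0 a0 b0 / (K * α j) = 3 / K * 4 ^ k0 := by
      have : ∀ j, m j k0 a0 b0 / (K * α j) = 4 ^ k0 / K := fun j => by
        rw [hmα j]; have := (hα0 j).ne'; field_simp
      rw [sum_congr rfl fun j _ => this j]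
      simp; ring
    simp only [hLin]
    rw [e1]
    have e2 : ∀ j, t j * (4 * (P j k0 a0 b0 - p j / 2 * α j ^ (p j / 2 - 1) * m j k0 a0 b0 +
        (p j / 2 - 1) * α j ^ (p j / 2) * 4 ^ k0)) = 4 * (t j * P j k0 a0 b0) -
          4 * 4 ^ k0 * (t j * α j ^ (p j / 2)) := by
      intro j
      have h3 : α j ^ (p j / 2) = α j ^ (p j / 2 - 1) * α j := by
        rw [← Real.rpow_add_one (hα0 j).ne']; congr 1; ring
      rw [hmα j, h3]; ring
    rw [sum_congr rfl fun j _ => e2 j, sum_sub_distrib, ← mul_sum (a := 4 * 4 ^ k0), ← hSα]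
    ring
  have hΦtop : Φ k0 a0 b0 = (∑ j, 4 * (t j * P j k0 a0 b0)) - Sα * 4 ^ k0 := by
    simp only [hΦ, hSα]
    rw [sum_mul, ← sum_sub_distrib]
    exact sum_congr rfl fun j _ => by ring
  have hS0 : 0 ≤ Sα := sum_nonneg fun j _ => by have := hα0 j; have := ht j; positivity
  have h1 : 3 * eα / K ≤ Sα := by rw [div_le_iff₀ (by linarith)]; linarith
  have h2 : Mα ≤ C * Sα := mul_le_mul_of_nonneg_left hMS hC0.le
  rw [hLtop] at htop
  rw [hΦtop]
  have h3 := mul_le_mul_of_nonneg_right h2 (by positivity : (0 : ℝ) ≤ 4 ^ k0)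
  have h5 : 0 ≤ C * (Sα * 4 ^ k0) := by positivity
  have h6 : C * (3 * eα / K * 4 ^ k0) ≤ C * (Sα * 4 ^ k0) := by gcongr
  linarith

end tree

/-- The multiplicative form of the dyadic tree estimate. -/
theorem exists_tree_bound_prod {p : Fin 3 → ℝ} (hp : ∀ j, 2 < p j) (hsum : ∑ j, 1 / p j = 1) :
    ∃ C : ℝ, 0 ≤ C ∧ ∀ (W w : ℕ → ℤ → ℤ → ℝ) (m P : Fin 3 → ℕ → ℤ → ℤ → ℝ),
      (∀ j k a b, 0 ≤ m j k a b) →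
      (∀ j k a b, m j (k + 1) a b = childSum (m j) k a b) →
      (∀ j k a b, P j (k + 1) a b = childSum (P j) k a b) →
      (∀ a b, W 0 a b = 0) →
      (∀ k a b, W (k + 1) a b = w (k + 1) a b + childSum W k a b) →
      (∀ j (α : ℝ), 0 < α → ∀ k a b, p j / 2 * α ^ (p j / 2 - 1) * m j k a b ≤
        P j k a b + (p j / 2 - 1) * α ^ (p j / 2) * 4 ^ k) →
      (∀ j k a b, 0 ≤ P j k a b) →
      (∀ j k a b, m j k a b = 0 → W k a b = 0) →
      (∀ j k a b, P j k a b = 0 → m j k a b = 0) →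
      (∀ α : Fin 3 → ℝ, (∀ j, 0 < α j) → ∃ bell : ℕ → ℤ → ℤ → ℝ, (∀ k a b, 0 ≤ bell k a b) ∧
        (∀ k a b, w (k + 1) a b + bell (k + 1) a b ≤ childSum bell k a b) ∧
        ∀ K : ℝ, 1 ≤ K → ∀ k a b, (∀ j, m j k a b ≤ K * α j * 4 ^ k) →
          bell k a b ≤ (K ^ 2 + K) * (∏ j, α j ^ (1 / 2 : ℝ)) * 4 ^ k) →
      ∀ k a b, W k a b ≤ C * ∏ j, P j k a b ^ (1 / p j) := by
  obtain ⟨C, hC, H⟩ := exists_tree_bound_sum hp hsum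
  refine ⟨C * 3, by positivity, ?_⟩
  intro W w m P hm hmadd hPadd hW0 hWs htan hP hdeg hdeg' hbell k a b
  by_cases hz : ∃ j, P j k a b = 0
  · obtain ⟨j, hj⟩ := hz
    rw [hdeg j k a b (hdeg' j k a b hj)]
    have : 0 ≤ ∏ j, P j k a b ^ (1 / p j) := prod_nonneg fun j _ => by
      have := hP j k a b; positivity
    positivity
  push Not at hz
  have hPp : ∀ j, 0 < P j k a b := fun j => (hP j k a b).lt_of_ne (hz j).symm
  obtain ⟨N, hN⟩ : ∃ N : ℝ, N = ∏ j, P j k a b ^ (1 / p j) := ⟨_, rfl⟩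
  have hN0 : 0 < N := by rw [hN]; exact prod_pos fun j _ => by have := hPp j; positivity
  have h1 := H W w m P hm hmadd hPadd hW0 hWs htan hP hdeg hbell (fun j => N / P j k a b)
    (fun j => div_pos hN0 (hPp j)) ?_ k a b
  · rw [← hN]
    have : ∑ j, N / P j k a b * P j k a b = 3 * N := by
      rw [sum_congr rfl fun j _ => div_mul_cancel₀ N (hz j)]; simp
    rw [this] at h1
    linarith
  · have : ∀ j, (N / P j k a b) ^ (1 / p j) = N ^ (1 / p j) / P j k a b ^ (1 / p j) :=
      fun j => Real.div_rpow hN0.le (hPp j).le _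
    rw [prod_congr rfl fun j _ => this j, prod_div_distrib, ← hN,
      ← Real.rpow_sum_of_pos hN0, hsum, Real.rpow_one, div_self hN0.ne']

/-- The dyadic interval `[a 2^k, (a+1) 2^k)` in `ℤ`. -/
def dyadicIco (k : ℕ) (a : ℤ) : Finset ℤ := Ico (a * 2 ^ k) ((a + 1) * 2 ^ k)

theorem mem_dyadicIco {k : ℕ} {a x : ℤ} : x ∈ dyadicIco k a ↔ x / 2 ^ k = a := by
  have h2 : (0 : ℤ) < 2 ^ k := by positivity
  rw [dyadicIco, Finset.mem_Ico, ← Int.le_ediv_iff_mul_le h2, ← Int.ediv_lt_iff_lt_mul h2]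
  omega

theorem card_dyadicIco (k : ℕ) (a : ℤ) : #(dyadicIco k a) = 2 ^ k := by
  rw [dyadicIco, Int.card_Ico]
  have : (a + 1) * 2 ^ k - a * 2 ^ k = ((2 ^ k : ℕ) : ℤ) := by push_cast; ring
  rw [this, Int.toNat_natCast]

theorem sum_dyadicIco_succ {M : Type*} [AddCommMonoid M] (φ : ℤ → M) (k : ℕ) (a : ℤ) :
    ∑ x ∈ dyadicIco (k + 1) a, φ x =
      ∑ x ∈ dyadicIco k (2 * a), φ x + ∑ x ∈ dyadicIco k (2 * a + 1), φ x := by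
  have e1 : dyadicIco (k + 1) a = Ico (2 * a * 2 ^ k) ((2 * a + 2) * 2 ^ k) := by
    rw [dyadicIco, pow_succ]; congr 1 <;> ring
  have e2 : dyadicIco k (2 * a + 1) = Ico ((2 * a + 1) * 2 ^ k) ((2 * a + 2) * 2 ^ k) := by
    rw [dyadicIco]; congr 1; ring
  have h2 : (0 : ℤ) < 2 ^ k := by positivity
  rw [e1, e2, dyadicIco, ← sum_union (Ico_disjoint_Ico_consecutive _ _ _),
    Ico_union_Ico_eq_Ico (by nlinarith) (by nlinarith)]

section bell
variable (h f : ℤ → ℤ → ℝ)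

/-- The quadratic energy `∑_{x ∈ I, x' ∈ I'} (∑_{y ∈ J} h(x,y) f(x',y))²`. -/
def pairEnergy (I I' J : Finset ℤ) : ℝ :=
  ∑ x ∈ I, ∑ x' ∈ I', (∑ y ∈ J, h x y * f x' y) ^ 2

theorem pairEnergy_nonneg (I I' J : Finset ℤ) : 0 ≤ pairEnergy h f I I' J :=
  sum_nonneg fun _ _ => sum_nonneg fun _ _ => sq_nonneg _

theorem pairEnergy_eq (I I' J : Finset ℤ) : pairEnergy h f I I' J =
    ∑ y ∈ J, ∑ y' ∈ J, (∑ x ∈ I, h x y * h x y') * ∑ x ∈ I', f x y * f x y' := by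
  have : ∀ x x', (∑ y ∈ J, h x y * f x' y) ^ 2 =
      ∑ y ∈ J, ∑ y' ∈ J, h x y * h x y' * (f x' y * f x' y') := by
    intro x x'
    rw [sq, sum_mul_sum]
    exact sum_congr rfl fun y _ => sum_congr rfl fun y' _ => by ring
  simp only [pairEnergy, this, sum_mul_sum]
  calc _ = ∑ x ∈ I, ∑ y ∈ J, ∑ x' ∈ I', ∑ y' ∈ J, h x y * h x y' * (f x' y * f x' y') :=
        sum_congr rfl fun x _ => sum_comm
    _ = ∑ y ∈ J, ∑ x ∈ I, ∑ x' ∈ I', ∑ y' ∈ J, h x y * h x y' * (f x' y * f x' y') := sum_comm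
    _ = _ := sum_congr rfl fun y _ => by
        calc _ = ∑ x ∈ I, ∑ y' ∈ J, ∑ x' ∈ I', h x y * h x y' * (f x' y * f x' y') :=
              sum_congr rfl fun x _ => sum_comm
          _ = _ := sum_comm

theorem neg_pairEnergy_alt_le {u : ℝ} (hu : 0 < u) (I₀ I₁ J : Finset ℤ) :
    -(pairEnergy h f I₀ I₀ J + pairEnergy h f I₁ I₁ J - pairEnergy h f I₀ I₁ J -
      pairEnergy h f I₁ I₀ J) ≤
    u / 2 * (pairEnergy f f I₀ I₀ J + pairEnergy f f I₁ I₁ J - pairEnergy f f I₀ I₁ J -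
      pairEnergy f f I₁ I₀ J) +
    u⁻¹ / 2 * (pairEnergy h h I₀ I₀ J + pairEnergy h h I₁ I₁ J - pairEnergy h h I₀ I₁ J -
      pairEnergy h h I₁ I₀ J) := by
  simp only [pairEnergy_eq, ← sum_add_distrib, ← sum_sub_distrib, mul_sum, ← sum_neg_distrib]
  refine sum_le_sum fun y _ => sum_le_sum fun y' _ => ?_
  simp only [← mul_sum]
  generalize ∑ x ∈ I₀, h x y * h x y' = H0
  generalize ∑ x ∈ I₁, h x y * h x y' = H1
  generalize ∑ x ∈ I₀, f x y * f x y' = F0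
  generalize ∑ x ∈ I₁, f x y * f x y' = F1
  have : 0 ≤ u / 2 * (F0 - F1) ^ 2 + u⁻¹ / 2 * (H0 - H1) ^ 2 + (H0 - H1) * (F0 - F1) := by
    have : u / 2 * (F0 - F1) ^ 2 + u⁻¹ / 2 * (H0 - H1) ^ 2 + (H0 - H1) * (F0 - F1) =
        u / 2 * ((F0 - F1) + u⁻¹ * (H0 - H1)) ^ 2 := by field_simp; ring
    rw [this]; positivity
  linarith

/-- The difference over the two vertical halves of the partial products. -/
def haarPair (k : ℕ) (b x a : ℤ) : ℝ :=
  ∑ y ∈ dyadicIco k (2 * b), h x y * f a y - ∑ y ∈ dyadicIco k (2 * b + 1), h x y * f a y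

/-- The energy over a dyadic square. -/
def squareEnergy (k : ℕ) (a b : ℤ) : ℝ :=
  pairEnergy h f (dyadicIco k a) (dyadicIco k a) (dyadicIco k b)

theorem four_childSum_squareEnergy (k : ℕ) (a b : ℤ) :
    4 * childSum (squareEnergy h f) k a b - squareEnergy h f (k + 1) a b =
      ∑ x ∈ dyadicIco (k + 1) a, ∑ x' ∈ dyadicIco (k + 1) a, haarPair h f k b x x' ^ 2 +
      2 * ∑ J ∈ {dyadicIco k (2 * b), dyadicIco k (2 * b + 1)},
        (pairEnergy h f (dyadicIco k (2 * a)) (dyadicIco k (2 * a)) J +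
        pairEnergy h f (dyadicIco k (2 * a + 1)) (dyadicIco k (2 * a + 1)) J -
        pairEnergy h f (dyadicIco k (2 * a)) (dyadicIco k (2 * a + 1)) J -
        pairEnergy h f (dyadicIco k (2 * a + 1)) (dyadicIco k (2 * a)) J) := by
  have hne : dyadicIco k (2 * b) ≠ dyadicIco k (2 * b + 1) := by
    intro h
    have : (2 * b) * 2 ^ k ∈ dyadicIco k (2 * b + 1) := by
      rw [← h, mem_dyadicIco, Int.mul_ediv_cancel _ (by positivity)]
    rw [mem_dyadicIco, Int.mul_ediv_cancel _ (by positivity)] at this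
    omega
  rw [sum_pair hne]
  have e1 : ∑ x ∈ dyadicIco (k + 1) a, ∑ x' ∈ dyadicIco (k + 1) a, haarPair h f k b x x' ^ 2 +
      squareEnergy h f (k + 1) a b =
      2 * (pairEnergy h f (dyadicIco (k + 1) a) (dyadicIco (k + 1) a) (dyadicIco k (2 * b)) +
        pairEnergy h f (dyadicIco (k + 1) a) (dyadicIco (k + 1) a) (dyadicIco k (2 * b + 1))) := by
    simp only [squareEnergy, pairEnergy, haarPair, sum_dyadicIco_succ _ k b, mul_sum,
      ← sum_add_distrib]
    exact sum_congr rfl fun x _ => sum_congr rfl fun x' _ => by ring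
  have e2 : ∀ J, pairEnergy h f (dyadicIco (k + 1) a) (dyadicIco (k + 1) a) J =
      pairEnergy h f (dyadicIco k (2 * a)) (dyadicIco k (2 * a)) J +
      pairEnergy h f (dyadicIco k (2 * a)) (dyadicIco k (2 * a + 1)) J +
      pairEnergy h f (dyadicIco k (2 * a + 1)) (dyadicIco k (2 * a)) J +
      pairEnergy h f (dyadicIco k (2 * a + 1)) (dyadicIco k (2 * a + 1)) J := by
    intro J
    simp only [pairEnergy, sum_dyadicIco_succ _ k a, sum_add_distrib]
    ring
  rw [e2, e2] at e1
  simp only [childSum]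
  rw [show squareEnergy h f (k + 1) a b = _ - _ from eq_sub_of_add_eq' e1]
  simp only [squareEnergy]
  ring

theorem squareEnergy_le (k : ℕ) (a b : ℤ) : squareEnergy h f k a b ≤
    (∑ x ∈ dyadicIco k a, ∑ y ∈ dyadicIco k b, h x y ^ 2) *
      ∑ x ∈ dyadicIco k a, ∑ y ∈ dyadicIco k b, f x y ^ 2 := by
  rw [squareEnergy, pairEnergy, sum_mul_sum]
  exact sum_le_sum fun x _ => sum_le_sum fun x' _ => sum_mul_sq_le_sq_mul_sq _ _ _

theorem squareEnergy_increment {u : ℝ} (hu : 0 < u) (k : ℕ) (a b : ℤ) :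
    ∑ x ∈ dyadicIco (k + 1) a, ∑ x' ∈ dyadicIco (k + 1) a, haarPair h f k b x x' ^ 2 +
      (squareEnergy h f (k + 1) a b + u / 2 * squareEnergy f f (k + 1) a b +
        u⁻¹ / 2 * squareEnergy h h (k + 1) a b) ≤
      4 * (childSum (squareEnergy h f) k a b + u / 2 * childSum (squareEnergy f f) k a b +
        u⁻¹ / 2 * childSum (squareEnergy h h) k a b) := by
  have h1 := four_childSum_squareEnergy h f k a b
  have h2 := four_childSum_squareEnergy f f k a b
  have h3 := four_childSum_squareEnergy h h k a b
  have key := sum_le_sum (s := {dyadicIco k (2 * b), dyadicIco k (2 * b + 1)}) fun J _ =>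
    neg_pairEnergy_alt_le h f hu (dyadicIco k (2 * a)) (dyadicIco k (2 * a + 1)) J
  rw [sum_neg_distrib] at key
  rw [sum_add_distrib, ← mul_sum, ← mul_sum] at key
  have h4 : 0 ≤ ∑ x ∈ dyadicIco (k + 1) a, ∑ x' ∈ dyadicIco (k + 1) a,
    haarPair f f k b x x' ^ 2 := sum_nonneg fun _ _ => sum_nonneg fun _ _ => sq_nonneg _
  have h5 : 0 ≤ ∑ x ∈ dyadicIco (k + 1) a, ∑ x' ∈ dyadicIco (k + 1) a,
    haarPair h h k b x x' ^ 2 := sum_nonneg fun _ _ => sum_nonneg fun _ _ => sq_nonneg _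
  have h6 : 0 < u⁻¹ := inv_pos.2 hu
  have h7 := congrArg (u / 2 * ·) h2
  have h8 := congrArg (u⁻¹ / 2 * ·) h3
  have h9 : 0 ≤ u / 2 * _ := mul_nonneg (by positivity) h4
  have h10 : 0 ≤ u⁻¹ / 2 * _ := mul_nonneg (by positivity) h5
  linarith

end bell

/-- The average over the dyadic interval of length `2^k` containing `x`. -/
def dyadicAvg {𝕜 : Type*} [Field 𝕜] (k : ℕ) (u : ℤ → 𝕜) (x : ℤ) : 𝕜 :=
  (2 ^ k)⁻¹ * ∑ t ∈ dyadicIco k (x / 2 ^ k), u t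

/-- The localized dyadic twisted paraproduct form at a single scale. -/
def dyadicForm {𝕜 : Type*} [Field 𝕜] (k : ℕ) (h f g : ℤ × ℤ → 𝕜) (I J : Finset ℤ) : 𝕜 :=
  ∑ x ∈ I, ∑ y ∈ J, h (x, y) * dyadicAvg (k + 1) (fun t => f (t, y)) x *
    (dyadicAvg k (fun t => g (x, t)) y - dyadicAvg (k + 1) (fun t => g (x, t)) y)

/-- Sum of a function over a dyadic square. -/
def squareSum (φ : ℤ × ℤ → ℝ) (k : ℕ) (a b : ℤ) : ℝ :=
  ∑ x ∈ dyadicIco k a, ∑ y ∈ dyadicIco k b, φ (x, y)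

theorem squareSum_succ (φ : ℤ × ℤ → ℝ) (k : ℕ) (a b : ℤ) :
    squareSum φ (k + 1) a b = childSum (squareSum φ) k a b := by
  simp only [squareSum, childSum, sum_dyadicIco_succ, sum_add_distrib]
  ring

theorem squareSum_nonneg {φ : ℤ × ℤ → ℝ} (hφ : ∀ z, 0 ≤ φ z) (k : ℕ) (a b : ℤ) :
    0 ≤ squareSum φ k a b := sum_nonneg fun _ _ => sum_nonneg fun _ _ => hφ _

theorem squareSum_eq_zero {φ : ℤ × ℤ → ℝ} (hφ : ∀ z, 0 ≤ φ z) {k : ℕ} {a b : ℤ} :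
    squareSum φ k a b = 0 ↔ ∀ x ∈ dyadicIco k a, ∀ y ∈ dyadicIco k b, φ (x, y) = 0 := by
  rw [squareSum, sum_eq_zero_iff_of_nonneg fun _ _ => sum_nonneg fun _ _ => hφ _]
  exact forall₂_congr fun x _ => sum_eq_zero_iff_of_nonneg fun _ _ => hφ _

/-- The difference of the integrals of `g(x, ·)` over the two halves of a dyadic interval. -/
def haarDiff (g : ℤ × ℤ → ℝ) (k : ℕ) (b x : ℤ) : ℝ :=
  ∑ y ∈ dyadicIco k (2 * b), g (x, y) - ∑ y ∈ dyadicIco k (2 * b + 1), g (x, y)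

theorem dyadicForm_square (k : ℕ) (h f g : ℤ × ℤ → ℝ) (a b : ℤ) :
    dyadicForm k h f g (dyadicIco (k + 1) a) (dyadicIco (k + 1) b) =
      (4 ^ (k + 1))⁻¹ * ∑ x ∈ dyadicIco (k + 1) a, ∑ x' ∈ dyadicIco (k + 1) a,
        haarPair (fun x y => h (x, y)) (fun x y => f (x, y)) k b x x' * haarDiff g k b x := by
  have hav : ∀ (n : ℕ) (c : ℤ) (u : ℤ → ℝ), ∀ x ∈ dyadicIco n c,
      dyadicAvg n u x = (2 ^ n)⁻¹ * ∑ x' ∈ dyadicIco n c, u x' := by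
    intro n c u x hx
    rw [dyadicAvg, mem_dyadicIco.1 hx]
  have hpar : ∀ c : ℤ, (c = 2 * b ∨ c = 2 * b + 1) → ∀ y ∈ dyadicIco k c,
      y ∈ dyadicIco (k + 1) b := by
    intro c hc y hy
    rw [mem_dyadicIco] at hy ⊢
    rw [pow_succ, ← Int.ediv_ediv_of_nonneg (by positivity), hy]
    omega
  rw [dyadicForm, mul_sum]
  refine sum_congr rfl fun x hx => ?_
  rw [sum_dyadicIco_succ, ← sum_mul]
  simp only [haarPair, sum_sub_distrib]
  rw [sum_comm, sum_comm (s := dyadicIco (k + 1) a) (t := dyadicIco k (2 * b + 1))]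
  have e4 : ((4 : ℝ) ^ (k + 1))⁻¹ = (2 ^ (k + 1))⁻¹ * (2 ^ (k + 1))⁻¹ := by
    rw [← mul_inv, ← mul_pow]; norm_num
  have e2 : ((2 : ℝ) ^ k)⁻¹ = 2 * (2 ^ (k + 1))⁻¹ := by rw [pow_succ]; field_simp
  have h0 : ∑ y ∈ dyadicIco k (2 * b), h (x, y) * dyadicAvg (k + 1) (fun x' => f (x', y)) x *
      (dyadicAvg k (fun y' => g (x, y')) y - dyadicAvg (k + 1) (fun y' => g (x, y')) y) =
      (4 ^ (k + 1))⁻¹ * ((∑ y ∈ dyadicIco k (2 * b), ∑ x' ∈ dyadicIco (k + 1) a,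
        h (x, y) * f (x', y)) * haarDiff g k b x) := by
    rw [sum_mul, mul_sum]
    refine sum_congr rfl fun y hy => ?_
    rw [hav _ _ _ x hx, hav _ _ _ y hy, hav _ _ _ y (hpar _ (Or.inl rfl) y hy), ← mul_sum,
      sum_dyadicIco_succ (fun y' => g (x, y')), haarDiff, e4, e2]
    ring
  have h1 : ∑ y ∈ dyadicIco k (2 * b + 1), h (x, y) *
      dyadicAvg (k + 1) (fun x' => f (x', y)) x *
      (dyadicAvg k (fun y' => g (x, y')) y - dyadicAvg (k + 1) (fun y' => g (x, y')) y) =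
      -((4 ^ (k + 1))⁻¹ * ((∑ y ∈ dyadicIco k (2 * b + 1), ∑ x' ∈ dyadicIco (k + 1) a,
        h (x, y) * f (x', y)) * haarDiff g k b x)) := by
    rw [sum_mul, mul_sum, ← sum_neg_distrib]
    refine sum_congr rfl fun y hy => ?_
    rw [hav _ _ _ x hx, hav _ _ _ y hy, hav _ _ _ y (hpar _ (Or.inr rfl) y hy), ← mul_sum,
      sum_dyadicIco_succ (fun y' => g (x, y')), haarDiff, e4, e2]
    ring
  rw [h0, h1]
  ring

/-- Accumulation of a quantity over all dyadic subsquares. -/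
def treeSum (w : ℕ → ℤ → ℤ → ℝ) : ℕ → ℤ → ℤ → ℝ
  | 0 => fun _ _ => 0
  | k + 1 => fun a b => w (k + 1) a b + (treeSum w k (2 * a) (2 * b) +
      treeSum w k (2 * a) (2 * b + 1) + treeSum w k (2 * a + 1) (2 * b) +
      treeSum w k (2 * a + 1) (2 * b + 1))

/-- The size of the single-scale form attached to the dyadic square of level `k`. -/
def cellWeight (h f g : ℤ × ℤ → ℝ) : ℕ → ℤ → ℤ → ℝ
  | 0 => fun _ _ => 0
  | k + 1 => fun a b => |dyadicForm k h f g (dyadicIco (k + 1) a) (dyadicIco (k + 1) b)|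

theorem cellWeight_succ_le (h f g : ℤ × ℤ → ℝ) {t : ℝ} (ht : 0 < t) (k : ℕ) (a b : ℤ) :
    cellWeight h f g (k + 1) a b ≤
      t⁻¹ / 2 * ((4 ^ (k + 1))⁻¹ * ∑ x ∈ dyadicIco (k + 1) a, ∑ x' ∈ dyadicIco (k + 1) a,
        haarPair (fun x y => h (x, y)) (fun x y => f (x, y)) k b x x' ^ 2) +
      t / 2 * ((2 ^ (k + 1))⁻¹ * ∑ x ∈ dyadicIco (k + 1) a, haarDiff g k b x ^ 2) := by
  have e : ((2 : ℝ) ^ (k + 1))⁻¹ * ∑ x ∈ dyadicIco (k + 1) a, haarDiff g k b x ^ 2 =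
      (4 ^ (k + 1))⁻¹ * ∑ x ∈ dyadicIco (k + 1) a, ∑ _x' ∈ dyadicIco (k + 1) a,
        haarDiff g k b x ^ 2 := by
    simp only [sum_const, card_dyadicIco, nsmul_eq_mul]
    rw [← mul_sum]
    have : ((4 : ℝ) ^ (k + 1))⁻¹ = (2 ^ (k + 1))⁻¹ * (2 ^ (k + 1))⁻¹ := by
      rw [← mul_inv, ← mul_pow]; norm_num
    rw [this]; push_cast; field_simp
  rw [e]
  change |dyadicForm k h f g (dyadicIco (k + 1) a) (dyadicIco (k + 1) b)| ≤ _
  rw [dyadicForm_square, abs_mul, abs_of_pos (by positivity)]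
  have : ∀ c d e : ℝ, t⁻¹ / 2 * (c * d) + t / 2 * (c * e) = c * (t⁻¹ / 2 * d + t / 2 * e) := by
    intros; ring
  rw [this]
  refine mul_le_mul_of_nonneg_left ?_ (by positivity)
  rw [mul_sum, mul_sum, ← sum_add_distrib]
  refine (abs_sum_le_sum_abs _ _).trans (sum_le_sum fun x _ => ?_)
  rw [mul_sum, mul_sum, ← sum_add_distrib]
  refine (abs_sum_le_sum_abs _ _).trans (sum_le_sum fun x' _ => ?_)
  generalize haarPair (fun x y => h (x, y)) (fun x y => f (x, y)) k b x x' = S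
  generalize haarDiff g k b x = D
  have h1 : t⁻¹ / 2 * S ^ 2 + t / 2 * D ^ 2 - S * D = t / 2 * (D - t⁻¹ * S) ^ 2 := by
    field_simp; ring
  have h2 : t⁻¹ / 2 * S ^ 2 + t / 2 * D ^ 2 + S * D = t / 2 * (D + t⁻¹ * S) ^ 2 := by
    field_simp; ring
  have h3 : 0 ≤ t / 2 * (D - t⁻¹ * S) ^ 2 := by positivity
  have h4 : 0 ≤ t / 2 * (D + t⁻¹ * S) ^ 2 := by positivity
  rw [abs_le]; constructor <;> linarith

/-- The Bellman potential of a dyadic square. -/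
def bellPot (h f g : ℤ × ℤ → ℝ) (u t : ℝ) (k : ℕ) (a b : ℤ) : ℝ :=
  t⁻¹ / 2 * ((4 ^ k)⁻¹ * (squareEnergy (fun x y => h (x, y)) (fun x y => f (x, y)) k a b +
    u / 2 * squareEnergy (fun x y => f (x, y)) (fun x y => f (x, y)) k a b +
    u⁻¹ / 2 * squareEnergy (fun x y => h (x, y)) (fun x y => h (x, y)) k a b)) +
  t / 2 * ((2 ^ k)⁻¹ * ∑ x ∈ dyadicIco k a, (∑ y ∈ dyadicIco k b, g (x, y)) ^ 2)

theorem bellPot_nonneg (h f g : ℤ × ℤ → ℝ) {u t : ℝ} (hu : 0 < u) (ht : 0 < t) (k : ℕ) (a b : ℤ) :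
    0 ≤ bellPot h f g u t k a b := by
  have h1 : ∀ h f : ℤ → ℤ → ℝ, 0 ≤ squareEnergy h f k a b := fun h f => pairEnergy_nonneg _ _ _ _ _
  have h2 : 0 ≤ ∑ x ∈ dyadicIco k a, (∑ y ∈ dyadicIco k b, g (x, y)) ^ 2 :=
    sum_nonneg fun _ _ => sq_nonneg _
  have := h1 (fun x y => h (x, y)) (fun x y => f (x, y))
  have := h1 (fun x y => f (x, y)) (fun x y => f (x, y))
  have := h1 (fun x y => h (x, y)) (fun x y => h (x, y))
  rw [bellPot]; positivity

theorem bellPot_step (h f g : ℤ × ℤ → ℝ) {u t : ℝ} (hu : 0 < u) (ht : 0 < t) (k : ℕ) (a b : ℤ) :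
    cellWeight h f g (k + 1) a b + bellPot h f g u t (k + 1) a b ≤
      childSum (bellPot h f g u t) k a b := by
  have h1 := cellWeight_succ_le h f g ht k a b
  have h2 := squareEnergy_increment (fun x y => h (x, y)) (fun x y => f (x, y)) hu k a b
  have h3 : ∑ x ∈ dyadicIco (k + 1) a, haarDiff g k b x ^ 2 +
      ∑ x ∈ dyadicIco (k + 1) a, (∑ y ∈ dyadicIco (k + 1) b, g (x, y)) ^ 2 =
      2 * childSum (fun k a b => ∑ x ∈ dyadicIco k a, (∑ y ∈ dyadicIco k b, g (x, y)) ^ 2)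
        k a b := by
    have : childSum (fun k a b => ∑ x ∈ dyadicIco k a, (∑ y ∈ dyadicIco k b, g (x, y)) ^ 2)
        k a b = ∑ x ∈ dyadicIco (k + 1) a, ((∑ y ∈ dyadicIco k (2 * b), g (x, y)) ^ 2 +
          (∑ y ∈ dyadicIco k (2 * b + 1), g (x, y)) ^ 2) := by
      simp only [childSum, sum_dyadicIco_succ _ k a, sum_add_distrib]; ring
    rw [this, ← sum_add_distrib, mul_sum]
    refine sum_congr rfl fun x _ => ?_
    rw [haarDiff, sum_dyadicIco_succ]; ring
  have h4 := mul_le_mul_of_nonneg_left h2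
    (by positivity : 0 ≤ t⁻¹ / 2 * ((4 : ℝ) ^ (k + 1))⁻¹)
  have h5 := congrArg (t / 2 * ((2 : ℝ) ^ (k + 1))⁻¹ * ·) h3
  have e4 : ((4 : ℝ) ^ (k + 1))⁻¹ = (4 ^ k)⁻¹ / 4 := by rw [pow_succ]; field_simp
  have e2 : ((2 : ℝ) ^ (k + 1))⁻¹ = (2 ^ k)⁻¹ / 2 := by rw [pow_succ]; field_simp
  rw [bellPot]
  simp only [childSum, bellPot] at h4 h5 ⊢
  rw [e4, e2] at h1
  rw [e4] at h4
  rw [e2] at h5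
  rw [e4, e2]
  generalize ((4 : ℝ) ^ k)⁻¹ = w4 at *
  generalize ((2 : ℝ) ^ k)⁻¹ = w2 at *
  ring_nf at h1 h4 h5 ⊢
  linarith

theorem bellPot_le (h f g : ℤ × ℤ → ℝ) {u t A : ℝ} (hu : 0 < u) (ht : 0 < t)
    (k : ℕ) (a b : ℤ) {α : Fin 3 → ℝ} (hα : ∀ j, 0 < α j)
    (hua : u = α 0 / α 1) (hta : t = (α 0 * α 1 / α 2) ^ (1 / 2 : ℝ))
    (h0 : squareSum (fun z => h z ^ 2) k a b ≤ A * α 0 * 4 ^ k)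
    (h1 : squareSum (fun z => f z ^ 2) k a b ≤ A * α 1 * 4 ^ k)
    (h2 : squareSum (fun z => g z ^ 2) k a b ≤ A * α 2 * 4 ^ k) :
    bellPot h f g u t k a b ≤ (A ^ 2 + A) * (∏ j, α j ^ (1 / 2 : ℝ)) * 4 ^ k := by
  obtain ⟨a0, e0⟩ : ∃ x, α 0 ^ (1 / 2 : ℝ) = x := ⟨_, rfl⟩
  obtain ⟨a1, e1⟩ : ∃ x, α 1 ^ (1 / 2 : ℝ) = x := ⟨_, rfl⟩
  obtain ⟨a2, e2⟩ : ∃ x, α 2 ^ (1 / 2 : ℝ) = x := ⟨_, rfl⟩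
  have p0 : 0 < a0 := by rw [← e0]; have := hα 0; positivity
  have p1 : 0 < a1 := by rw [← e1]; have := hα 1; positivity
  have p2 : 0 < a2 := by rw [← e2]; have := hα 2; positivity
  have sq : ∀ x : ℝ, 0 < x → x = (x ^ (1 / 2 : ℝ)) ^ 2 := by
    intro x hx
    rw [← Real.sqrt_eq_rpow, Real.sq_sqrt hx.le]
  have s0 : α 0 = a0 ^ 2 := e0 ▸ sq _ (hα 0)
  have s1 : α 1 = a1 ^ 2 := e1 ▸ sq _ (hα 1)
  have s2 : α 2 = a2 ^ 2 := e2 ▸ sq _ (hα 2)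
  have st : t = a0 * a1 / a2 := by
    rw [hta, Real.div_rpow (mul_nonneg (hα 0).le (hα 1).le) (hα 2).le,
      Real.mul_rpow (hα 0).le (hα 1).le, e0, e1, e2]
  have b0 : 0 ≤ squareSum (fun z => h z ^ 2) k a b := squareSum_nonneg (fun _ => sq_nonneg _) _ _ _
  have b1 : 0 ≤ squareSum (fun z => f z ^ 2) k a b := squareSum_nonneg (fun _ => sq_nonneg _) _ _ _
  have c1 : squareEnergy (fun x y => h (x, y)) (fun x y => f (x, y)) k a b ≤
      (A * α 0 * 4 ^ k) * (A * α 1 * 4 ^ k) :=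
    (squareEnergy_le _ _ k a b).trans (mul_le_mul h0 h1 b1 (b0.trans h0))
  have c2 : squareEnergy (fun x y => f (x, y)) (fun x y => f (x, y)) k a b ≤
      (A * α 1 * 4 ^ k) * (A * α 1 * 4 ^ k) :=
    (squareEnergy_le _ _ k a b).trans (mul_le_mul h1 h1 b1 (b1.trans h1))
  have c3 : squareEnergy (fun x y => h (x, y)) (fun x y => h (x, y)) k a b ≤
      (A * α 0 * 4 ^ k) * (A * α 0 * 4 ^ k) :=
    (squareEnergy_le _ _ k a b).trans (mul_le_mul h0 h0 b0 (b0.trans h0))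
  have c4 : ∑ x ∈ dyadicIco k a, (∑ y ∈ dyadicIco k b, g (x, y)) ^ 2 ≤
      2 ^ k * (A * α 2 * 4 ^ k) := by
    refine le_trans ?_ (mul_le_mul_of_nonneg_left h2 (by positivity))
    rw [squareSum, mul_sum]
    refine sum_le_sum fun x _ => ?_
    have := sq_sum_le_card_mul_sum_sq (s := dyadicIco k b) (f := fun y => g (x, y))
    rw [card_dyadicIco] at this
    exact_mod_cast this
  rw [bellPot]
  calc _ ≤ t⁻¹ / 2 * ((4 ^ k)⁻¹ * ((A * α 0 * 4 ^ k) * (A * α 1 * 4 ^ k) +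
        u / 2 * ((A * α 1 * 4 ^ k) * (A * α 1 * 4 ^ k)) +
        u⁻¹ / 2 * ((A * α 0 * 4 ^ k) * (A * α 0 * 4 ^ k)))) +
        t / 2 * ((2 ^ k)⁻¹ * (2 ^ k * (A * α 2 * 4 ^ k))) := by gcongr
    _ = (A ^ 2 + A / 2) * (a0 * a1 * a2) * 4 ^ k := by
        rw [st, hua, s0, s1, s2]; field_simp; ring
    _ ≤ _ := by
        rw [Fin.prod_univ_three, e0, e1, e2]
        have hA : 0 ≤ A := by
          have : 0 ≤ A * (α 0 * 4 ^ k) := by linarith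
          exact nonneg_of_mul_nonneg_left this (by have := hα 0; positivity)
        gcongr
        linarith

theorem cellWeight_eq_zero {h f g : ℤ × ℤ → ℝ} {k : ℕ} {a b : ℤ}
    (hz : squareSum (fun z => h z ^ 2) k a b = 0 ∨ squareSum (fun z => f z ^ 2) k a b = 0 ∨
      squareSum (fun z => g z ^ 2) k a b = 0) : cellWeight h f g k a b = 0 := by
  cases k with
  | zero => rfl
  | succ k =>
    change |dyadicForm k h f g (dyadicIco (k + 1) a) (dyadicIco (k + 1) b)| = 0
    rw [abs_eq_zero, dyadicForm_square]
    have key : ∀ φ : ℤ × ℤ → ℝ, squareSum (fun z => φ z ^ 2) (k + 1) a b = 0 →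
        ∀ x ∈ dyadicIco (k + 1) a, (∀ y ∈ dyadicIco k (2 * b), φ (x, y) = 0) ∧
          ∀ y ∈ dyadicIco k (2 * b + 1), φ (x, y) = 0 := by
      intro φ h0 x hx
      have h1 := fun y hy => pow_eq_zero_iff two_ne_zero |>.1
        ((squareSum_eq_zero (fun _ => sq_nonneg _)).1 h0 x hx y hy)
      have hpar : ∀ c : ℤ, (c = 2 * b ∨ c = 2 * b + 1) → ∀ y ∈ dyadicIco k c,
          y ∈ dyadicIco (k + 1) b := by
        intro c hc y hy
        rw [mem_dyadicIco] at hy ⊢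
        rw [pow_succ, ← Int.ediv_ediv_of_nonneg (by positivity), hy]
        omega
      exact ⟨fun y hy => h1 y (hpar _ (Or.inl rfl) y hy), fun y hy => h1 y (hpar _ (Or.inr rfl) y hy)⟩
    rw [sum_eq_zero fun x hx => sum_eq_zero fun x' hx' => ?_, mul_zero]
    rcases hz with hz | hz | hz
    · obtain ⟨k1, k2⟩ := key h hz x hx
      rw [haarPair, sum_eq_zero fun y hy => by rw [k1 y hy, zero_mul],
        sum_eq_zero fun y hy => by rw [k2 y hy, zero_mul]]
      simp
    · obtain ⟨k1, k2⟩ := key f hz x' hx'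
      rw [haarPair, sum_eq_zero fun y hy => by rw [k1 y hy, mul_zero],
        sum_eq_zero fun y hy => by rw [k2 y hy, mul_zero]]
      simp
    · obtain ⟨k1, k2⟩ := key g hz x hx
      rw [haarDiff, sum_eq_zero k1, sum_eq_zero k2]
      simp

theorem tangent_rpow {s α z : ℝ} (hs : 1 ≤ s) (hα : 0 < α) (hz : 0 ≤ z) :
    s * α ^ (s - 1) * z ≤ z ^ s + (s - 1) * α ^ s := by
  have h1 := one_add_mul_self_le_rpow_one_add (s := z / α - 1) (by
    have : 0 ≤ z / α := by positivity
    linarith) hs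
  rw [add_sub_cancel, Real.div_rpow hz hα.le, le_div_iff₀ (by positivity)] at h1
  have h3 : α ^ s = α ^ (s - 1) * α := by rw [← Real.rpow_add_one hα.ne']; congr 1; ring
  have h4 : (1 + s * (z / α - 1)) * α ^ s = s * α ^ (s - 1) * z - (s - 1) * α ^ s := by
    rw [h3]; field_simp; ring
  linarith

/-- The dyadic twisted paraproduct on a single dyadic square, local `L²` range. -/
theorem exists_treeSum_cellWeight_le {p : Fin 3 → ℝ} (hp : ∀ j, 2 < p j) (hsum : ∑ j, 1 / p j = 1) :
    ∃ C : ℝ, 0 ≤ C ∧ ∀ (F : Fin 3 → ℤ × ℤ → ℝ) (k : ℕ) (a b : ℤ),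
      treeSum (cellWeight (F 0) (F 1) (F 2)) k a b ≤
        C * ∏ j, squareSum (fun z => |F j z| ^ p j) k a b ^ (1 / p j) := by
  obtain ⟨C, hC, H⟩ := exists_tree_bound_prod hp hsum
  refine ⟨C, hC, fun F => ?_⟩
  have hm0 : ∀ j k a b, 0 ≤ squareSum (fun z => F j z ^ 2) k a b := fun j k a b =>
    squareSum_nonneg (fun _ => sq_nonneg _) k a b
  have hP0 : ∀ j k a b, 0 ≤ squareSum (fun z => |F j z| ^ p j) k a b := fun j k a b =>
    squareSum_nonneg (fun _ => by positivity) k a b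
  have hmadd : ∀ j k a b, squareSum (fun z => F j z ^ 2) (k + 1) a b =
      childSum (squareSum (fun z => F j z ^ 2)) k a b := fun j k a b => squareSum_succ _ k a b
  refine H (treeSum (cellWeight (F 0) (F 1) (F 2))) (cellWeight (F 0) (F 1) (F 2))
    (fun j => squareSum (fun z => F j z ^ 2)) (fun j => squareSum (fun z => |F j z| ^ p j))
    hm0 hmadd (fun j k a b => squareSum_succ _ k a b) (fun _ _ => rfl)
    (fun k a b => rfl) ?_ hP0 ?_ ?_ ?_
  · intro j α hα k a b
    have : (p j / 2 - 1) * α ^ (p j / 2) * 4 ^ k =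
        squareSum (fun _ => (p j / 2 - 1) * α ^ (p j / 2)) k a b := by
      have : (4 : ℝ) ^ k = 2 ^ k * 2 ^ k := by rw [← mul_pow]; norm_num
      simp only [squareSum, sum_const, card_dyadicIco, nsmul_eq_mul]
      rw [this]; push_cast; ring
    rw [this]
    simp only [squareSum, mul_sum, ← sum_add_distrib]
    refine sum_le_sum fun x _ => sum_le_sum fun y _ => ?_
    refine (tangent_rpow (by linarith [hp j]) hα (sq_nonneg _)).trans_eq ?_
    rw [← sq_abs, ← Real.rpow_natCast, ← Real.rpow_mul (abs_nonneg _)]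
    congr 2
    push_cast; ring
  · intro j k
    induction k with
    | zero => intro a b _; rfl
    | succ k ih =>
      intro a b h0
      have h1 := hmadd j k a b
      rw [h0] at h1
      simp only [childSum] at h1
      have n1 := hm0 j k (2 * a) (2 * b)
      have n2 := hm0 j k (2 * a) (2 * b + 1)
      have n3 := hm0 j k (2 * a + 1) (2 * b)
      have n4 := hm0 j k (2 * a + 1) (2 * b + 1)
      rw [treeSum]
      beta_reduce
      rw [ih _ _ (by linarith), ih _ _ (by linarith), ih _ _ (by linarith),
        ih _ _ (by linarith), cellWeight_eq_zero]
      · ring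
      · fin_cases j
        · exact Or.inl h0
        · exact Or.inr (Or.inl h0)
        · exact Or.inr (Or.inr h0)
  · intro j k a b h0
    rw [squareSum_eq_zero fun _ => by positivity] at h0
    rw [squareSum_eq_zero fun _ => sq_nonneg _]
    intro x hx y hy
    have := h0 x hx y hy
    rw [Real.rpow_eq_zero (abs_nonneg _) (by linarith [hp j]), abs_eq_zero] at this
    rw [this]; norm_num
  · intro α hα
    have hu : 0 < α 0 / α 1 := div_pos (hα 0) (hα 1)
    have ht : 0 < (α 0 * α 1 / α 2) ^ (1 / 2 : ℝ) := by
      have := hα 0; have := hα 1; have := hα 2; positivity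
    exact ⟨bellPot (F 0) (F 1) (F 2) _ _, fun k a b => bellPot_nonneg _ _ _ hu ht k a b,
      fun k a b => bellPot_step _ _ _ hu ht k a b,
      fun K _ k a b h => bellPot_le _ _ _ hu ht k a b hα rfl rfl (h 0) (h 1) (h 2)⟩

theorem sum_abs_dyadicForm_le (h f g : ℤ × ℤ → ℝ) (n : ℕ) : ∀ a b : ℤ,
    ∑ k ∈ range n, |dyadicForm k h f g (dyadicIco n a) (dyadicIco n b)| ≤
      treeSum (cellWeight h f g) n a b := by
  induction n with
  | zero => intro a b; exact le_of_eq rfl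
  | succ n ih =>
    intro a b
    have h1 : ∀ k, dyadicForm k h f g (dyadicIco (n + 1) a) (dyadicIco (n + 1) b) =
        childSum (fun n a b => dyadicForm k h f g (dyadicIco n a) (dyadicIco n b)) n a b := by
      intro k
      simp only [childSum, dyadicForm, sum_dyadicIco_succ, sum_add_distrib]
      ring
    rw [sum_range_succ, add_comm]
    change _ ≤ |dyadicForm n h f g (dyadicIco (n + 1) a) (dyadicIco (n + 1) b)| +
      childSum (treeSum (cellWeight h f g)) n a b
    refine add_le_add le_rfl ?_
    have h2 := add_le_add (add_le_add (add_le_add (ih (2 * a) (2 * b)) (ih (2 * a) (2 * b + 1)))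
      (ih (2 * a + 1) (2 * b))) (ih (2 * a + 1) (2 * b + 1))
    simp only [← sum_add_distrib] at h2
    refine le_trans (sum_le_sum fun k _ => ?_) h2
    rw [h1, childSum]
    refine (abs_add_le _ _).trans (add_le_add ((abs_add_le _ _).trans (add_le_add
      (abs_add_le _ _) le_rfl)) le_rfl)

section forms

variable {𝕜 : Type*} [Field 𝕜]

theorem dyadicAvg_add (k : ℕ) (u v : ℤ → 𝕜) (x : ℤ) :
    dyadicAvg k (fun x => u x + v x) x = dyadicAvg k u x + dyadicAvg k v x := by
  simp only [dyadicAvg, sum_add_distrib, mul_add]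

theorem dyadicAvg_mul (k : ℕ) (c : 𝕜) (u : ℤ → 𝕜) (x : ℤ) :
    dyadicAvg k (fun x => c * u x) x = c * dyadicAvg k u x := by
  simp only [dyadicAvg, ← mul_sum]; ring

/-- The interval `[-2 ^ n, 2 ^ n)`. -/
def dyadicBox (n : ℕ) : Finset ℤ := Ico (-2 ^ n) (2 ^ n)

/-- The dyadic twisted paraproduct with scales `0 ≤ k < n` on the box `[-2 ^ n, 2 ^ n)²`. -/
def twistedForm (n : ℕ) (h f g : ℤ × ℤ → 𝕜) : 𝕜 :=
  ∑ k ∈ range n, dyadicForm k h f g (dyadicBox n) (dyadicBox n)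

theorem twistedForm_add₀ (n : ℕ) (h h' f g : ℤ × ℤ → 𝕜) :
    twistedForm n (h + h') f g = twistedForm n h f g + twistedForm n h' f g := by
  simp only [twistedForm, dyadicForm, ← sum_add_distrib, Pi.add_apply, add_mul]

theorem twistedForm_add₁ (n : ℕ) (h f f' g : ℤ × ℤ → 𝕜) :
    twistedForm n h (f + f') g = twistedForm n h f g + twistedForm n h f' g := by
  simp only [twistedForm, dyadicForm, ← sum_add_distrib, Pi.add_apply, dyadicAvg_add]
  exact sum_congr rfl fun k _ => sum_congr rfl fun x _ => sum_congr rfl fun y _ => by ring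

theorem twistedForm_add₂ (n : ℕ) (h f g g' : ℤ × ℤ → 𝕜) :
    twistedForm n h f (g + g') = twistedForm n h f g + twistedForm n h f g' := by
  simp only [twistedForm, dyadicForm, ← sum_add_distrib, Pi.add_apply, dyadicAvg_add]
  exact sum_congr rfl fun k _ => sum_congr rfl fun x _ => sum_congr rfl fun y _ => by ring

theorem twistedForm_smul₀ (n : ℕ) (c : 𝕜) (h f g : ℤ × ℤ → 𝕜) :
    twistedForm n (c • h) f g = c * twistedForm n h f g := by
  simp only [twistedForm, dyadicForm, mul_sum, Pi.smul_apply, smul_eq_mul, mul_assoc]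

theorem twistedForm_smul₁ (n : ℕ) (c : 𝕜) (h f g : ℤ × ℤ → 𝕜) :
    twistedForm n h (c • f) g = c * twistedForm n h f g := by
  simp only [twistedForm, dyadicForm, mul_sum, Pi.smul_apply, smul_eq_mul, dyadicAvg_mul]
  exact sum_congr rfl fun k _ => sum_congr rfl fun x _ => sum_congr rfl fun y _ => by ring

theorem twistedForm_smul₂ (n : ℕ) (c : 𝕜) (h f g : ℤ × ℤ → 𝕜) :
    twistedForm n h f (c • g) = c * twistedForm n h f g := by
  simp only [twistedForm, dyadicForm, mul_sum, Pi.smul_apply, smul_eq_mul, dyadicAvg_mul]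
  exact sum_congr rfl fun k _ => sum_congr rfl fun x _ => sum_congr rfl fun y _ => by ring

end forms

/-- The multilinear map attached to a function of three arguments, linear in each. -/
def trilinearOf {X : Type*} (L : (X → ℂ) → (X → ℂ) → (X → ℂ) → ℂ)
    (ha : ∀ h h' f g, L (h + h') f g = L h f g + L h' f g)
    (hb : ∀ h f f' g, L h (f + f') g = L h f g + L h f' g)
    (hc : ∀ h f g g', L h f (g + g') = L h f g + L h f g')
    (ha' : ∀ (c : ℂ) h f g, L (c • h) f g = c * L h f g)
    (hb' : ∀ (c : ℂ) h f g, L h (c • f) g = c * L h f g)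
    (hc' : ∀ (c : ℂ) h f g, L h f (c • g) = c * L h f g) :
    MultilinearMap ℂ (fun _ : Fin 3 => X → ℂ) ℂ where
  toFun F := L (F 0) (F 1) (F 2)
  map_update_add' := by
    intro inst F i u v
    obtain rfl : inst = instDecidableEqFin 3 := Subsingleton.elim _ _
    fin_cases i
    · simpa [Function.update] using ha _ _ _ _
    · simpa [Function.update] using hb _ _ _ _
    · simpa [Function.update] using hc _ _ _ _
  map_update_smul' := by
    intro inst F i c v
    obtain rfl : inst = instDecidableEqFin 3 := Subsingleton.elim _ _
    fin_cases i
    · simpa [Function.update] using ha' _ _ _ _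
    · simpa [Function.update] using hb' _ _ _ _
    · simpa [Function.update] using hc' _ _ _ _

theorem sum_dyadicBox {M : Type*} [AddCommMonoid M] (n : ℕ) (u : ℤ → M) :
    ∑ x ∈ dyadicBox n, u x = ∑ x ∈ dyadicIco n (-1), u x + ∑ x ∈ dyadicIco n 0, u x := by
  have h0 : (0 : ℤ) < 2 ^ n := by positivity
  have : dyadicBox n = dyadicIco n (-1) ∪ dyadicIco n 0 := by
    ext x; simp only [dyadicBox, dyadicIco, mem_union, mem_Ico]; constructor <;> omega
  rw [this, sum_union]
  rw [disjoint_left]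
  intro x; simp only [dyadicIco, mem_Ico]; omega

/-- The dyadic twisted paraproduct in the local `L²` range, for real functions. -/
theorem exists_twistedForm_le_real {p : Fin 3 → ℝ} (hp : ∀ j, 2 < p j) (hsum : ∑ j, 1 / p j = 1) :
    ∃ C : ℝ, 0 ≤ C ∧ ∀ (n : ℕ) (F : Fin 3 → ℤ × ℤ → ℝ),
      |twistedForm n (F 0) (F 1) (F 2)| ≤
        C * ∏ j, (∑ z ∈ dyadicBox n ×ˢ dyadicBox n, |F j z| ^ p j) ^ (1 / p j) := by
  obtain ⟨C, hC, H⟩ := exists_treeSum_cellWeight_le hp hsum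
  refine ⟨4 * C, by positivity, fun n F => ?_⟩
  have hsub : ∀ a b, (a = -1 ∨ a = 0) → (b = -1 ∨ b = 0) →
      ∑ k ∈ range n, |dyadicForm k (F 0) (F 1) (F 2) (dyadicIco n a) (dyadicIco n b)| ≤
        C * ∏ j, (∑ z ∈ dyadicBox n ×ˢ dyadicBox n, |F j z| ^ p j) ^ (1 / p j) := by
    intro a b ha hb
    refine (sum_abs_dyadicForm_le _ _ _ n a b).trans ((H F n a b).trans ?_)
    refine mul_le_mul_of_nonneg_left (prod_le_prod (fun j _ => ?_) fun j _ => ?_) hC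
    · exact Real.rpow_nonneg (squareSum_nonneg (fun _ => by positivity) _ _ _) _
    · refine Real.rpow_le_rpow (squareSum_nonneg (fun _ => by positivity) _ _ _) ?_
        (by have := hp j; positivity)
      rw [squareSum, ← sum_product']
      refine sum_le_sum_of_subset_of_nonneg ?_ fun _ _ _ => by positivity
      have h0 : (0 : ℤ) < 2 ^ n := by positivity
      have : ∀ a : ℤ, (a = -1 ∨ a = 0) → dyadicIco n a ⊆ dyadicBox n := by
        intro a ha x
        simp only [dyadicIco, dyadicBox, mem_Ico]
        rcases ha with rfl | rfl <;> omega
      exact product_subset_product (this a ha) (this b hb)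
  have h1 : twistedForm n (F 0) (F 1) (F 2) =
      ∑ k ∈ range n, (dyadicForm k (F 0) (F 1) (F 2) (dyadicIco n (-1)) (dyadicIco n (-1)) +
        dyadicForm k (F 0) (F 1) (F 2) (dyadicIco n (-1)) (dyadicIco n 0) +
        dyadicForm k (F 0) (F 1) (F 2) (dyadicIco n 0) (dyadicIco n (-1)) +
        dyadicForm k (F 0) (F 1) (F 2) (dyadicIco n 0) (dyadicIco n 0)) := by
    rw [twistedForm]
    refine sum_congr rfl fun k _ => ?_
    simp only [dyadicForm, sum_dyadicBox, sum_add_distrib]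
    ring
  rw [h1]
  refine (abs_sum_le_sum_abs _ _).trans ?_
  have h2 := add_le_add (add_le_add (add_le_add (hsub (-1) (-1) (by simp) (by simp))
    (hsub (-1) 0 (by simp) (by simp))) (hsub 0 (-1) (by simp) (by simp)))
    (hsub 0 0 (by simp) (by simp))
  simp only [← sum_add_distrib] at h2
  refine le_trans (sum_le_sum fun k _ => ?_) (h2.trans_eq (by ring))
  refine (abs_add_le _ _).trans (add_le_add ((abs_add_le _ _).trans (add_le_add
      (abs_add_le _ _) le_rfl)) le_rfl)

/-- The twisted form as a multilinear map. -/
def twistedMap (n : ℕ) : MultilinearMap ℂ (fun _ : Fin 3 => ℤ × ℤ → ℂ) ℂ :=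
  trilinearOf (twistedForm n) (twistedForm_add₀ n) (twistedForm_add₁ n) (twistedForm_add₂ n)
    (twistedForm_smul₀ n) (twistedForm_smul₁ n) (twistedForm_smul₂ n)

theorem twistedMap_apply (n : ℕ) (F : Fin 3 → ℤ × ℤ → ℂ) :
    twistedMap n F = twistedForm n (F 0) (F 1) (F 2) := rfl

theorem twistedForm_ofReal (n : ℕ) (h f g : ℤ × ℤ → ℝ) :
    twistedForm n (fun z => (h z : ℂ)) (fun z => (f z : ℂ)) (fun z => (g z : ℂ)) =
      (twistedForm n h f g : ℝ) := by
  simp only [twistedForm, dyadicForm, dyadicAvg]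
  push_cast
  rfl

/-- The dyadic twisted paraproduct in the local `L²` range. -/
theorem exists_twistedMap_le {p : Fin 3 → ℝ} (hp : ∀ j, 2 < p j) (hsum : ∑ j, 1 / p j = 1) :
    ∃ C : ℝ, 0 ≤ C ∧ ∀ (n : ℕ) (F : Fin 3 → ℤ × ℤ → ℂ),
      ‖twistedMap n F‖ ≤
        C * ∏ j, (∑ z ∈ dyadicBox n ×ˢ dyadicBox n, ‖F j z‖ ^ p j) ^ (1 / p j) := by
  obtain ⟨C, hC, H⟩ := exists_twistedForm_le_real hp hsum
  refine ⟨8 * C, by positivity, fun n F => ?_⟩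
  let part : Fin 3 → Fin 2 → ℤ × ℤ → ℝ := fun j c z => if c = 0 then (F j z).re else (F j z).im
  let u : Fin 2 → ℂ := fun c => if c = 0 then 1 else Complex.I
  have hF : F = fun j => ∑ c, u c • fun z => (part j c z : ℂ) := by
    funext j z
    simp [u, part, Fin.sum_univ_two, mul_comm Complex.I]
  have hu : ∀ c, ‖u c‖ = 1 := by intro c; fin_cases c <;> simp [u]
  conv_lhs => rw [hF]
  rw [MultilinearMap.map_sum]
  refine (norm_sum_le _ _).trans ?_
  have hterm : ∀ r : Fin 3 → Fin 2,
      ‖twistedMap n fun j => u (r j) • fun z => (part j (r j) z : ℂ)‖ ≤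
        C * ∏ j, (∑ z ∈ dyadicBox n ×ˢ dyadicBox n, ‖F j z‖ ^ p j) ^ (1 / p j) := by
    intro r
    rw [MultilinearMap.map_smul_univ, norm_smul, norm_prod]
    simp only [hu, prod_const_one, one_mul]
    rw [twistedMap_apply, twistedForm_ofReal, Complex.norm_real, Real.norm_eq_abs]
    refine (H n fun j => part j (r j)).trans ?_
    refine mul_le_mul_of_nonneg_left (prod_le_prod (fun j _ => by positivity) fun j _ => ?_) hC
    have := hp j
    refine Real.rpow_le_rpow (by positivity) (sum_le_sum fun z _ => ?_) (by positivity)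
    refine Real.rpow_le_rpow (abs_nonneg _) ?_ (by linarith)
    simp only [part]
    split_ifs
    · exact Complex.abs_re_le_norm _
    · exact Complex.abs_im_le_norm _
  refine (sum_le_sum fun r _ => hterm r).trans_eq ?_
  simp only [sum_const, card_univ, nsmul_eq_mul, Fintype.card_pi, Fintype.card_fin]
  norm_num
  ring

/-- The dyadic interval of level `S.1` and position `S.2`. -/
abbrev dyadicIv (S : ℕ × ℤ) : Finset ℤ := dyadicIco S.1 S.2

theorem dyadicIco_succ_eq_union (k : ℕ) (a : ℤ) :
    dyadicIco (k + 1) a = dyadicIco k (2 * a) ∪ dyadicIco k (2 * a + 1) := by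
  have h0 : (0 : ℤ) < 2 ^ k := by positivity
  ext x; simp only [dyadicIco, mem_union, mem_Ico, pow_succ]
  constructor <;> intro <;> by_cases h : x < (2 * a + 1) * 2 ^ k <;> grind

theorem disjoint_dyadicIco {k : ℕ} {a b : ℤ} (hab : a ≠ b) :
    Disjoint (dyadicIco k a) (dyadicIco k b) := by
  rw [disjoint_left]
  intro x hx hy
  rw [mem_dyadicIco] at hx hy
  exact hab (hx.symm.trans hy)

/-- A stopping family for `w` at height `l`, selected inside a region `T`. -/
structure IsStopping (w : ℤ → ℝ) (l : ℝ) (T : Finset ℤ) (𝓢 : Finset (ℕ × ℤ)) : Prop where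
  subset : ∀ S ∈ 𝓢, dyadicIv S ⊆ T
  disj : (𝓢 : Set (ℕ × ℤ)).PairwiseDisjoint dyadicIv
  lt : ∀ S ∈ 𝓢, l * 2 ^ S.1 < ∑ x ∈ dyadicIv S, w x
  le : ∀ S ∈ 𝓢, ∑ x ∈ dyadicIv S, w x ≤ 2 * l * 2 ^ S.1
  off : ∀ x ∈ T, (∀ S ∈ 𝓢, x ∉ dyadicIv S) → w x ≤ l

theorem IsStopping.union {w : ℤ → ℝ} {l : ℝ} {T₁ T₂ : Finset ℤ} {𝓢₁ 𝓢₂ : Finset (ℕ × ℤ)}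
    (h₁ : IsStopping w l T₁ 𝓢₁) (h₂ : IsStopping w l T₂ 𝓢₂) (hT : Disjoint T₁ T₂) :
    IsStopping w l (T₁ ∪ T₂) (𝓢₁ ∪ 𝓢₂) where
  subset S hS := by
    rcases mem_union.1 hS with h | h
    · exact (h₁.subset S h).trans subset_union_left
    · exact (h₂.subset S h).trans subset_union_right
  disj := by
    intro S hS S' hS' hne
    rw [mem_coe, mem_union] at hS hS'
    rcases hS with h | h <;> rcases hS' with h' | h'
    · exact h₁.disj h h' hne
    · exact disjoint_of_subset_left (h₁.subset S h) (disjoint_of_subset_right (h₂.subset S' h') hT)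
    · exact disjoint_of_subset_left (h₂.subset S h)
        (disjoint_of_subset_right (h₁.subset S' h') hT.symm)
    · exact h₂.disj h h' hne
  lt S hS := (mem_union.1 hS).elim (h₁.lt S) (h₂.lt S)
  le S hS := (mem_union.1 hS).elim (h₁.le S) (h₂.le S)
  off x hx hn := by
    rcases mem_union.1 hx with h | h
    · exact h₁.off x h fun S hS => hn S (mem_union_left _ hS)
    · exact h₂.off x h fun S hS => hn S (mem_union_right _ hS)

theorem exists_isStopping {w : ℤ → ℝ} (hw : ∀ x, 0 ≤ w x) (l : ℝ) (N : ℕ) : ∀ a : ℤ,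
    ∑ x ∈ dyadicIco N a, w x ≤ l * 2 ^ N → ∃ 𝓢, IsStopping w l (dyadicIco N a) 𝓢 := by
  induction N with
  | zero =>
    intro a h
    refine ⟨∅, by simp, by simp, by simp, by simp, fun x hx _ => ?_⟩
    have := single_le_sum (fun x _ => hw x) hx
    simpa using this.trans h
  | succ N ih =>
    intro a h
    have key : ∀ b, (b = 2 * a ∨ b = 2 * a + 1) → ∃ 𝓢, IsStopping w l (dyadicIco N b) 𝓢 := by
      intro b hb
      by_cases hl : ∑ x ∈ dyadicIco N b, w x ≤ l * 2 ^ N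
      · exact ih b hl
      · refine ⟨{(N, b)}, by simp, by simp, by simpa using hl, ?_, ?_⟩
        · intro S hS
          rw [mem_singleton.1 hS]
          refine le_trans ?_ (h.trans_eq (by ring : l * 2 ^ (N + 1) = 2 * l * 2 ^ N))
          refine sum_le_sum_of_subset_of_nonneg ?_ fun _ _ _ => hw _
          rw [dyadicIco_succ_eq_union]
          rcases hb with rfl | rfl
          · exact subset_union_left
          · exact subset_union_right
        · intro x hx hn
          exact absurd hx (hn (N, b) (mem_singleton_self _))
    obtain ⟨𝓢₁, h₁⟩ := key _ (Or.inl rfl)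
    obtain ⟨𝓢₂, h₂⟩ := key _ (Or.inr rfl)
    rw [dyadicIco_succ_eq_union]
    exact ⟨_, h₁.union h₂ (disjoint_dyadicIco (by omega))⟩

theorem exists_isStopping_box {w : ℤ → ℝ} (hw : ∀ x, 0 ≤ w x) {l : ℝ} {N : ℕ}
    (h : ∑ x ∈ dyadicBox N, w x ≤ l * 2 ^ N) : ∃ 𝓢, IsStopping w l (dyadicBox N) 𝓢 := by
  have h' := h
  rw [sum_dyadicBox] at h'
  have n1 : 0 ≤ ∑ x ∈ dyadicIco N (-1), w x := sum_nonneg fun _ _ => hw _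
  have n2 : 0 ≤ ∑ x ∈ dyadicIco N 0, w x := sum_nonneg fun _ _ => hw _
  obtain ⟨𝓢₁, h₁⟩ := exists_isStopping hw l N (-1) (by linarith)
  obtain ⟨𝓢₂, h₂⟩ := exists_isStopping hw l N 0 (by linarith)
  have h0 : (0 : ℤ) < 2 ^ N := by positivity
  have : dyadicBox N = dyadicIco N (-1) ∪ dyadicIco N 0 := by
    ext x; simp only [dyadicBox, dyadicIco, mem_union, mem_Ico]; constructor <;> omega
  rw [this]
  exact ⟨_, h₁.union h₂ (disjoint_dyadicIco (by omega))⟩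

/-- The mean zero part of `f` on a dyadic interval. -/
def czBad (f : ℤ → ℂ) (S : ℕ × ℤ) (x : ℤ) : ℂ :=
  if x ∈ dyadicIv S then f x - dyadicAvg S.1 f x else 0

theorem czBad_of_notMem (f : ℤ → ℂ) {S : ℕ × ℤ} {x : ℤ} (hx : x ∉ dyadicIv S) :
    czBad f S x = 0 := if_neg hx

/-- The good part of the Calderón–Zygmund decomposition of `f`. -/
def czGood (f : ℤ → ℂ) (𝓢 : Finset (ℕ × ℤ)) (x : ℤ) : ℂ := f x - ∑ S ∈ 𝓢, czBad f S x

theorem dyadicAvg_of_mem {S : ℕ × ℤ} {x : ℤ} (hx : x ∈ dyadicIv S) (f : ℤ → ℂ) :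
    dyadicAvg S.1 f x = (2 ^ S.1)⁻¹ * ∑ x ∈ dyadicIv S, f x := by
  rw [dyadicAvg, mem_dyadicIco.1 hx]

theorem sum_czBad (f : ℤ → ℂ) {S : ℕ × ℤ} {I : Finset ℤ} (hI : dyadicIv S ⊆ I) :
    ∑ x ∈ I, czBad f S x = 0 := by
  rw [← sum_subset hI fun x _ hx => czBad_of_notMem f hx]
  rw [sum_congr rfl fun x hx => show czBad f S x = f x - (2 ^ S.1)⁻¹ * ∑ x ∈ dyadicIv S, f x by
    rw [czBad, if_pos hx, dyadicAvg_of_mem hx]]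
  rw [sum_sub_distrib, sum_const, card_dyadicIco, nsmul_eq_mul]
  push_cast
  field_simp
  ring

theorem norm_dyadicAvg_le {S : ℕ × ℤ} {x : ℤ} (hx : x ∈ dyadicIv S) (f : ℤ → ℂ) :
    ‖dyadicAvg S.1 f x‖ ≤ (2 ^ S.1)⁻¹ * ∑ x ∈ dyadicIv S, ‖f x‖ := by
  rw [dyadicAvg_of_mem hx, norm_mul]
  refine mul_le_mul (by simp) (norm_sum_le _ _) (norm_nonneg _) (by positivity)

theorem sum_norm_dyadicAvg_le (S : ℕ × ℤ) (f : ℤ → ℂ) :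
    ∑ x ∈ dyadicIv S, ‖dyadicAvg S.1 f x‖ ≤ ∑ x ∈ dyadicIv S, ‖f x‖ := by
  refine (sum_le_sum fun x hx => norm_dyadicAvg_le hx f).trans_eq ?_
  rw [sum_const, card_dyadicIco, nsmul_eq_mul]
  push_cast; field_simp

theorem sum_norm_czBad_le (f : ℤ → ℂ) (S : ℕ × ℤ) (I : Finset ℤ) :
    ∑ x ∈ I, ‖czBad f S x‖ ≤ 2 * ∑ x ∈ dyadicIv S, ‖f x‖ := by
  calc ∑ x ∈ I, ‖czBad f S x‖ ≤ ∑ x ∈ dyadicIv S, ‖czBad f S x‖ := by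
        rw [← sum_subset inter_subset_left (s₁ := I ∩ dyadicIv S)]
        · exact sum_le_sum_of_subset_of_nonneg inter_subset_right fun _ _ _ => norm_nonneg _
        · intro x hx hn
          rw [czBad, if_neg fun h => hn (mem_inter.2 ⟨hx, h⟩), norm_zero]
    _ ≤ ∑ x ∈ dyadicIv S, (‖f x‖ + ‖dyadicAvg S.1 f x‖) := by
        refine sum_le_sum fun x hx => ?_
        rw [czBad, if_pos hx]; exact norm_sub_le _ _
    _ ≤ _ := by
        rw [sum_add_distrib]; linarith [sum_norm_dyadicAvg_le S f]

section stopping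

variable {f : ℤ → ℂ} {l : ℝ} {T : Finset ℤ} {𝓢 : Finset (ℕ × ℤ)}

theorem czGood_of_mem (h𝓢 : IsStopping (fun x => ‖f x‖) l T 𝓢) {S : ℕ × ℤ} (hS : S ∈ 𝓢) {x : ℤ}
    (hx : x ∈ dyadicIv S) : czGood f 𝓢 x = dyadicAvg S.1 f x := by
  rw [czGood, sum_eq_single_of_mem S hS, czBad, if_pos hx]
  · ring
  · intro S' hS' hne
    exact if_neg fun h => disjoint_left.1 (h𝓢.disj hS' hS hne) h hx

theorem czGood_of_notMem {x : ℤ} (hx : ∀ S ∈ 𝓢, x ∉ dyadicIv S) : czGood f 𝓢 x = f x := by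
  rw [czGood, sum_eq_zero fun S hS => czBad_of_notMem f (hx S hS), sub_zero]

theorem norm_czGood_le (h𝓢 : IsStopping (fun x => ‖f x‖) l T 𝓢) (hl : 0 ≤ l) {x : ℤ} (hx : x ∈ T) :
    ‖czGood f 𝓢 x‖ ≤ 2 * l := by
  by_cases h : ∃ S ∈ 𝓢, x ∈ dyadicIv S
  · obtain ⟨S, hS, hxS⟩ := h
    rw [czGood_of_mem h𝓢 hS hxS]
    refine (norm_dyadicAvg_le hxS f).trans ?_
    rw [inv_mul_le_iff₀ (by positivity)]
    exact (h𝓢.le S hS).trans_eq (by ring)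
  · push Not at h
    rw [czGood_of_notMem h]
    linarith [h𝓢.off x hx h]

/-- The union of the intervals of a family. -/
def czUnion (𝓢 : Finset (ℕ × ℤ)) : Finset ℤ := 𝓢.biUnion dyadicIv

theorem sum_norm_czGood_le (h𝓢 : IsStopping (fun x => ‖f x‖) l T 𝓢) :
    ∑ x ∈ T, ‖czGood f 𝓢 x‖ ≤ ∑ x ∈ T, ‖f x‖ := by
  have hsub : czUnion 𝓢 ⊆ T := biUnion_subset.2 h𝓢.subset
  rw [← sum_sdiff hsub, ← sum_sdiff hsub]
  refine add_le_add (sum_le_sum fun x hx => le_of_eq ?_) ?_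
  · rw [czGood_of_notMem]
    intro S hS hxS
    exact (mem_sdiff.1 hx).2 (mem_biUnion.2 ⟨S, hS, hxS⟩)
  · rw [czUnion, sum_biUnion h𝓢.disj, sum_biUnion h𝓢.disj]
    refine sum_le_sum fun S hS => ?_
    rw [sum_congr rfl fun x hx => by rw [czGood_of_mem h𝓢 hS hx]]
    exact sum_norm_dyadicAvg_le S f

theorem sum_sum_stopping_le (h𝓢 : IsStopping (fun x => ‖f x‖) l T 𝓢) :
    ∑ S ∈ 𝓢, ∑ x ∈ dyadicIv S, ‖f x‖ ≤ ∑ x ∈ T, ‖f x‖ := by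
  rw [← sum_biUnion h𝓢.disj]
  exact sum_le_sum_of_subset_of_nonneg (biUnion_subset.2 h𝓢.subset) fun _ _ _ => norm_nonneg _

theorem mul_sum_pow_le (h𝓢 : IsStopping (fun x => ‖f x‖) l T 𝓢) :
    l * ∑ S ∈ 𝓢, (2 : ℝ) ^ S.1 ≤ ∑ x ∈ T, ‖f x‖ := by
  rw [mul_sum]
  exact (sum_le_sum fun S hS => (h𝓢.lt S hS).le).trans (sum_sum_stopping_le h𝓢)

theorem mul_card_czUnion_le (h𝓢 : IsStopping (fun x => ‖f x‖) l T 𝓢) (hl : 0 ≤ l) :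
    l * (czUnion 𝓢).card ≤ ∑ x ∈ T, ‖f x‖ := by
  refine le_trans (mul_le_mul_of_nonneg_left ?_ hl) (mul_sum_pow_le h𝓢)
  have := card_biUnion_le (s := 𝓢) (t := dyadicIv)
  calc ((czUnion 𝓢).card : ℝ) ≤ ∑ S ∈ 𝓢, (dyadicIv S).card := by exact_mod_cast this
    _ = _ := by simp [card_dyadicIco]

end stopping

theorem dyadicIco_subset_or_disjoint {k : ℕ} {a : ℤ} {S : ℕ × ℤ} :
    dyadicIv S ⊆ dyadicIco k a ∨ dyadicIco k a ⊆ dyadicIv S ∨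
      Disjoint (dyadicIv S) (dyadicIco k a) := by
  have key : ∀ (i j : ℕ) (b c : ℤ), i ≤ j → dyadicIco i b ⊆ dyadicIco j c ∨
      Disjoint (dyadicIco i b) (dyadicIco j c) := by
    intro i j b c hij
    by_cases h : b / 2 ^ (j - i) = c
    · left
      intro x hx
      rw [mem_dyadicIco] at hx ⊢
      rw [← h, ← hx, Int.ediv_ediv_of_nonneg (by positivity), ← pow_add]
      congr 2; omega
    · right
      rw [disjoint_left]
      intro x hx hx'
      rw [mem_dyadicIco] at hx hx'
      apply h
      rw [← hx, ← hx', Int.ediv_ediv_of_nonneg (by positivity), ← pow_add]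
      congr 2; omega
  rcases le_total S.1 k with h | h
  · exact (key _ _ S.2 a h).imp_right Or.inr
  · exact Or.inr ((key _ _ a S.2 h).imp_right fun h => h.symm)

/-- Averages over dyadic intervals reaching outside `S` annihilate the bad part on `S`. -/
theorem dyadicAvg_czBad (f : ℤ → ℂ) {S : ℕ × ℤ} {x : ℤ} (hx : x ∉ dyadicIv S) (k : ℕ) :
    dyadicAvg k (czBad f S) x = 0 := by
  have hmem : x ∈ dyadicIco k (x / 2 ^ k) := mem_dyadicIco.2 rfl
  rw [dyadicAvg]
  rcases dyadicIco_subset_or_disjoint (k := k) (a := x / 2 ^ k) (S := S) with h | h | h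
  · rw [sum_czBad f h, mul_zero]
  · exact absurd (h hmem) hx
  · rw [sum_eq_zero fun y hy => czBad_of_notMem f (disjoint_right.1 h hy), mul_zero]

/-- `f` is bounded by the indicator function of `E`. -/
def SubInd {X : Type*} [DecidableEq X] (E : Finset X) (f : X → ℂ) : Prop :=
  ∀ x, ‖f x‖ ≤ if x ∈ E then 1 else 0

section

variable {X : Type*} [DecidableEq X]

theorem SubInd.le_one {E : Finset X} {f : X → ℂ} (hf : SubInd E f) (x : X) : ‖f x‖ ≤ 1 :=
  (hf x).trans (by split_ifs <;> norm_num)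

theorem SubInd.eq_zero {E : Finset X} {f : X → ℂ} (hf : SubInd E f) {x : X} (hx : x ∉ E) :
    f x = 0 := by
  have := hf x
  rwa [if_neg hx, norm_le_zero_iff] at this

theorem SubInd.sum_rpow_le {E : Finset X} {f : X → ℂ} (hf : SubInd E f) {p : ℝ} (hp : 0 < p)
    (B : Finset X) : ∑ x ∈ B, ‖f x‖ ^ p ≤ (#E : ℝ) := by
  calc ∑ x ∈ B, ‖f x‖ ^ p ≤ ∑ x ∈ B, if x ∈ E then (1 : ℝ) else 0 := by
        refine sum_le_sum fun x _ => ?_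
        split_ifs with h
        · exact Real.rpow_le_one (norm_nonneg _) (hf.le_one x) hp.le
        · rw [hf.eq_zero h, norm_zero, Real.zero_rpow hp.ne']
    _ = #(B.filter (· ∈ E)) := by rw [sum_boole]
    _ ≤ _ := by
        exact_mod_cast card_le_card fun x hx => (mem_filter.1 hx).2

theorem SubInd.norm_le {E : Finset X} {f : X → ℂ} (hf : SubInd E f) {p : ℝ} (hp : 0 < p)
    (B : Finset X) : (∑ x ∈ B, ‖f x‖ ^ p) ^ (1 / p) ≤ (#E : ℝ) ^ (1 / p) :=
  Real.rpow_le_rpow (by positivity) (hf.sum_rpow_le hp B) (by positivity)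

/-- The restriction of `h` to `E`. -/
def cutOff (E : Finset X) (h : X → ℂ) (x : X) : ℂ := if x ∈ E then h x else 0

theorem SubInd.cutOff {E E' : Finset X} {f : X → ℂ} (hf : SubInd E f) :
    SubInd (E ∩ E') (cutOff E' f) := by
  intro x
  have := hf x
  by_cases h : x ∈ E' <;> by_cases h' : x ∈ E <;> simp_all [_root_.cutOff]

theorem norm_le_of_halving {L : (X → ℂ) → ℂ} (hL : ∀ h h', L (h + h') = L h + L h')
    {B : Finset X} {M n : ℝ} (hM : 0 ≤ M) (hn : 0 < n)
    (h1 : ∀ H ⊆ B, (#H : ℝ) ≤ n → ∀ h, SubInd H h → ‖L h‖ ≤ M)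
    (h2 : ∀ H ⊆ B, n < #H → ∃ H' ⊆ H, 2 * (#H' : ℝ) ≤ #H ∧ ∀ h, SubInd (H \ H') h → ‖L h‖ ≤ M) :
    ∀ H ⊆ B, n ≤ #H → ∀ h, SubInd H h → ‖L h‖ ≤ M * (2 + Real.logb 2 (#H / n)) := by
  have main : ∀ N : ℕ, ∀ H ⊆ B, #H = N → n ≤ #H → ∀ h, SubInd H h →
      ‖L h‖ ≤ M * (2 + Real.logb 2 (#H / n)) := by
    intro N
    induction N using Nat.strong_induction_on with
    | _ N ih =>
    intro H hH hN hnH h hh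
    have hHpos : (0 : ℝ) < #H := hn.trans_le hnH
    rcases hnH.eq_or_lt with he | hlt
    · refine (h1 H hH he.ge h hh).trans ?_
      rw [← he, div_self hn.ne', Real.logb_one]; linarith
    · obtain ⟨H', hs, hcard, hoff⟩ := h2 H hH hlt
      have hsplit : h = cutOff (H \ H') h + cutOff H' h := by
        funext x
        by_cases hx : x ∈ H' <;> by_cases hx' : x ∈ H <;>
          simp [cutOff, hx, hx', hh.eq_zero]
      have hA : SubInd (H \ H') (cutOff (H \ H') h) := by
        have := hh.cutOff (E' := H \ H')
        rwa [inter_eq_right.2 sdiff_subset] at this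
      have hB : SubInd H' (cutOff H' h) := by
        have := hh.cutOff (E' := H')
        rwa [inter_eq_right.2 hs] at this
      rw [hsplit, hL]
      refine (norm_add_le _ _).trans ?_
      have e1 := hoff _ hA
      have hl0 : 0 ≤ Real.logb 2 (#H / n) :=
        Real.logb_nonneg (by norm_num) (by rw [le_div_iff₀ hn]; linarith)
      rcases le_total (#H' : ℝ) n with hle | hle
      · have e2 := h1 H' (hs.trans hH) hle _ hB
        nlinarith
      · have e2 := ih #H' (by
          have : (#H' : ℝ) < #H := by linarith
          rw [← hN]; exact_mod_cast this) H' (hs.trans hH) rfl hle _ hB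
        have e3 : Real.logb 2 (#H' / n) ≤ Real.logb 2 (#H / n) - 1 := by
          have : Real.logb 2 (#H / n) - 1 = Real.logb 2 ((#H / n) / 2) := by
            rw [Real.logb_div (div_pos hHpos hn).ne' (by norm_num),
              Real.logb_self_eq_one (by norm_num)]
          rw [this]
          refine Real.logb_le_logb_of_le (by norm_num) (div_pos (hn.trans_le hle) hn) ?_
          rw [div_div, mul_comm n 2, ← div_div]
          exact div_le_div_of_nonneg_right (by linarith) hn.le
        have e4 := mul_le_mul_of_nonneg_left e3 hM
        linarith
  intro H hH hnH h hh
  exact main _ H hH rfl hnH h hh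

theorem two_add_logb_le {b : ℝ} (hb : 0 < b) {t : ℝ} (ht : 1 ≤ t) :
    2 + Real.logb 2 t ≤ (2 + 1 / (b * Real.log 2)) * t ^ b := by
  have h1 := Real.log_le_rpow_div (by linarith : 0 ≤ t) hb
  have h2 : 1 ≤ t ^ b := Real.one_le_rpow ht hb.le
  have h3 : 0 < Real.log 2 := Real.log_pos (by norm_num)
  have h4 : Real.logb 2 t ≤ t ^ b / b / Real.log 2 := by
    rw [Real.logb]; exact div_le_div_of_nonneg_right h1 h3.le
  have h5 : t ^ b / b / Real.log 2 = 1 / (b * Real.log 2) * t ^ b := by field_simp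
  rw [add_mul, ← h5]
  linarith

theorem exists_norm_le_of_halving {θ b : ℝ} (hb : 0 < b) : ∃ C : ℝ, 0 ≤ C ∧
    ∀ {L : (X → ℂ) → ℂ} (_ : ∀ h h', L (h + h') = L h + L h')
    {B : Finset X} {A n : ℝ} (_ : 0 ≤ A) (_ : 0 < n)
    (_ : ∀ H ⊆ B, (#H : ℝ) ≤ n → ∀ h, SubInd H h → ‖L h‖ ≤ A * n ^ θ)
    (_ : ∀ H ⊆ B, n < #H → ∃ H' ⊆ H, 2 * (#H' : ℝ) ≤ #H ∧
      ∀ h, SubInd (H \ H') h → ‖L h‖ ≤ A * n ^ θ),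
    ∀ H ⊆ B, n ≤ #H → ∀ h, SubInd H h → ‖L h‖ ≤ C * A * (n ^ (θ - b) * (#H : ℝ) ^ b) := by
  have h3 : 0 < Real.log 2 := Real.log_pos (by norm_num)
  refine ⟨2 + 1 / (b * Real.log 2), by positivity, ?_⟩
  intro L hL B A n hA hn h1 h2 H hH hnH h hh
  refine (norm_le_of_halving hL (by positivity) hn h1 h2 H hH hnH h hh).trans ?_
  refine (mul_le_mul_of_nonneg_left (two_add_logb_le hb (t := #H / n)
    (by rw [le_div_iff₀ hn]; linarith)) (by positivity)).trans_eq ?_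
  rw [Real.div_rpow (by positivity) hn.le, Real.rpow_sub hn]
  ring

end

theorem dyadicAvg_czGood (f : ℤ → ℂ) (𝓢 : Finset (ℕ × ℤ)) {x : ℤ} (hx : x ∉ czUnion 𝓢) (k : ℕ) :
    dyadicAvg k (czGood f 𝓢) x = dyadicAvg k f x := by
  have h1 : ∀ S ∈ 𝓢, dyadicAvg k (czBad f S) x = 0 := fun S hS =>
    dyadicAvg_czBad f (fun h => hx (mem_biUnion.2 ⟨S, hS, h⟩)) k
  have h2 : dyadicAvg k (czGood f 𝓢) x =
      dyadicAvg k f x - ∑ S ∈ 𝓢, dyadicAvg k (czBad f S) x := by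
    simp only [dyadicAvg, czGood, sum_sub_distrib, mul_sub, ← mul_sum]
    rw [sum_comm]
  rw [h2, sum_eq_zero h1, sub_zero]

/-- Calderón–Zygmund decomposition in the first variable. -/
theorem exists_column_cz {n : ℕ} {F : Finset (ℤ × ℤ)} {f : ℤ × ℤ → ℂ}
    (hFB : F ⊆ dyadicBox n ×ˢ dyadicBox n) (hf : SubInd F f) {l : ℝ} (hl : 0 < l) :
    ∃ (U : Finset (ℤ × ℤ)) (e : ℤ × ℤ → ℂ), l * #U ≤ #F ∧
      (∀ z ∈ dyadicBox n ×ˢ dyadicBox n, ‖e z‖ ≤ 2 * l) ∧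
      ∑ z ∈ dyadicBox n ×ˢ dyadicBox n, ‖e z‖ ≤ #F ∧
      ∀ x y, (x, y) ∈ dyadicBox n ×ˢ dyadicBox n → (x, y) ∉ U → ∀ k,
        dyadicAvg k (fun x => f (x, y)) x = dyadicAvg k (fun x => e (x, y)) x := by
  obtain ⟨N, hN⟩ : ∃ N : ℕ, (#F : ℝ) / l < 2 ^ N :=
    pow_unbounded_of_one_lt _ (by norm_num)
  have hcol : ∀ y, ∀ T : Finset ℤ, ∑ x ∈ T, ‖f (x, y)‖ ≤ #(F.filter (·.2 = y)) := by
    intro y T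
    calc ∑ x ∈ T, ‖f (x, y)‖ ≤ ∑ x ∈ T, if (x, y) ∈ F then (1 : ℝ) else 0 :=
          sum_le_sum fun x _ => hf _
      _ = #(T.filter fun x => (x, y) ∈ F) := by rw [sum_boole]
      _ ≤ _ := by
          have : #(T.filter fun x => (x, y) ∈ F) ≤ #(F.filter (·.2 = y)) :=
            card_le_card_of_injOn (fun x => (x, y)) (by
              intro x hx; simpa using (mem_filter.1 hx).2) (by intro x _ x' _ h; simpa using h)
          exact_mod_cast this
  have hcolsum : ∑ y ∈ dyadicBox n, (#(F.filter (·.2 = y)) : ℝ) ≤ #F := by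
    have := card_eq_sum_card_fiberwise (f := Prod.snd) (s := F) (t := dyadicBox n)
      fun z hz => (mem_product.1 (hFB hz)).2
    rw [this]; push_cast; rfl
  have hlast : ∀ y, ∃ 𝓢, IsStopping (fun x => ‖f (x, y)‖) l (dyadicBox (max N n)) 𝓢 := by
    intro y
    refine exists_isStopping_box (fun _ => norm_nonneg _) ?_
    have e1 : (#(F.filter (·.2 = y)) : ℝ) ≤ #F := by exact_mod_cast card_filter_le _ _
    have e2 : (2 : ℝ) ^ N ≤ 2 ^ (max N n) := pow_le_pow_right₀ (by norm_num) (le_max_left _ _)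
    rw [div_lt_iff₀ hl] at hN
    have := mul_le_mul_of_nonneg_left e2 hl.le
    linarith [hcol y (dyadicBox (max N n))]
  choose 𝓢 h𝓢 using hlast
  have hbox : dyadicBox n ⊆ dyadicBox (max N n) := by
    have : (2 : ℤ) ^ n ≤ 2 ^ (max N n) := pow_le_pow_right₀ (by norm_num) (le_max_right _ _)
    intro x; simp only [dyadicBox, mem_Ico]; omega
  refine ⟨(dyadicBox n ×ˢ dyadicBox n).filter fun z => z.1 ∈ czUnion (𝓢 z.2),
    fun z => czGood (fun x => f (x, z.2)) (𝓢 z.2) z.1, ?_, ?_, ?_, ?_⟩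
  · have e1 : #((dyadicBox n ×ˢ dyadicBox n).filter fun z => z.1 ∈ czUnion (𝓢 z.2)) ≤
        ∑ y ∈ dyadicBox n, #(czUnion (𝓢 y)) := by
      rw [card_eq_sum_card_fiberwise (f := Prod.snd) (t := dyadicBox n)]
      · refine sum_le_sum fun y _ => card_le_card_of_injOn Prod.fst ?_ ?_
        · intro z hz
          rw [mem_coe, mem_filter, mem_filter] at hz
          rw [← hz.2]; exact hz.1.2
        · intro z hz z' hz' he
          rw [mem_coe, mem_filter] at hz hz'
          exact Prod.ext he (hz.2.trans hz'.2.symm)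
      · intro z hz
        exact (mem_product.1 (mem_filter.1 hz).1).2
    have e3 : (#((dyadicBox n ×ˢ dyadicBox n).filter fun z => z.1 ∈ czUnion (𝓢 z.2)) : ℝ) ≤
        ∑ y ∈ dyadicBox n, (#(czUnion (𝓢 y)) : ℝ) := by exact_mod_cast e1
    refine (mul_le_mul_of_nonneg_left e3 hl.le).trans ?_
    rw [mul_sum]
    exact (sum_le_sum fun y _ => (mul_card_czUnion_le (h𝓢 y) hl.le).trans (hcol y _)).trans hcolsum
  · intro z hz
    exact norm_czGood_le (h𝓢 z.2) hl.le (hbox (mem_product.1 hz).1)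
  · rw [sum_product_right]
    refine (sum_le_sum fun y _ => ?_).trans hcolsum
    refine le_trans (sum_le_sum_of_subset_of_nonneg hbox fun _ _ _ => norm_nonneg _) ?_
    exact (sum_norm_czGood_le (h𝓢 y)).trans (hcol y _)
  · intro x y hxy hU k
    have hx : x ∉ czUnion (𝓢 y) := fun hx => hU (mem_filter.2 ⟨hxy, hx⟩)
    have := dyadicAvg_czGood (fun x => f (x, y)) (𝓢 y) hx k
    exact this.symm

theorem sum_rpow_le_of_le {X : Type*} {B : Finset X} {e : X → ℂ} {l m p : ℝ} (hp : 1 ≤ p)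
    (hl : 0 ≤ l) (h1 : ∀ z ∈ B, ‖e z‖ ≤ l) (h2 : ∑ z ∈ B, ‖e z‖ ≤ m) :
    ∑ z ∈ B, ‖e z‖ ^ p ≤ l ^ (p - 1) * m := by
  calc _ ≤ ∑ z ∈ B, l ^ (p - 1) * ‖e z‖ := by
        refine sum_le_sum fun z hz => ?_
        have hb := h1 z hz
        have : p = (p - 1) + 1 := by ring
        conv_lhs => rw [this, Real.rpow_add_one' (norm_nonneg _) (by linarith)]
        gcongr
    _ ≤ _ := by
        rw [← mul_sum]
        exact mul_le_mul_of_nonneg_left h2 (by positivity)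

theorem good_part_arith {θ F H : ℝ} (hθ0 : 0 < θ) (hθ : θ ≤ 1) (hF : 0 < F) (hFH : F ≤ H) :
    ((2 * (2 * F / H)) ^ (2 / θ - 1) * F) ^ (θ / 2) * H ^ (θ / 2) ≤ 4 * F ^ θ := by
  have hH : 0 < H := hF.trans_le hFH
  rw [Real.mul_rpow (by positivity) hF.le, ← Real.rpow_mul (by positivity)]
  have e1 : (2 / θ - 1) * (θ / 2) = 1 - θ / 2 := by field_simp
  have e2 : 2 * (2 * F / H) = 4 * (F / H) := by ring
  rw [e1, e2, Real.mul_rpow (by norm_num) (by positivity)]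
  have e3 : (4 : ℝ) ^ (1 - θ / 2) ≤ 4 := by
    calc (4 : ℝ) ^ (1 - θ / 2) ≤ 4 ^ (1 : ℝ) :=
          Real.rpow_le_rpow_of_exponent_le (by norm_num) (by linarith)
      _ = 4 := Real.rpow_one _
  have e4 : (F / H) ^ (1 - θ / 2) * F ^ (θ / 2) * H ^ (θ / 2) = F ^ θ * (F / H) ^ (1 - θ) := by
    have h1 : (F / H) ^ (1 - θ / 2) = (F / H) ^ (1 - θ) * (F / H) ^ (θ / 2) := by
      rw [← Real.rpow_add (by positivity)]; congr 1; ring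
    have h2 : F ^ θ = F ^ (θ / 2) * F ^ (θ / 2) := by
      rw [← Real.rpow_add hF]; congr 1; ring
    have h3 : (F / H) ^ (θ / 2) * H ^ (θ / 2) = F ^ (θ / 2) := by
      rw [← Real.mul_rpow (by positivity) hH.le, div_mul_cancel₀ _ hH.ne']
    rw [h1, h2]
    linear_combination (F / H) ^ (1 - θ) * F ^ (θ / 2) * h3
  have e5 : (F / H) ^ (1 - θ) ≤ 1 :=
    Real.rpow_le_one (by positivity) (by rw [div_le_one hH]; exact hFH) (by linarith)
  calc _ = (4 : ℝ) ^ (1 - θ / 2) * ((F / H) ^ (1 - θ / 2) * F ^ (θ / 2) * H ^ (θ / 2)) := by ring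
    _ ≤ 4 * (F ^ θ * 1) := by rw [e4]; gcongr
    _ = _ := by ring

theorem comparable_arith {θ a b F H : ℝ} (hb : 0 < b) (hba : b ≤ a) (hab : a + b = θ)
    (hF : 0 < F) (hH : 0 ≤ H) (hle : H ≤ F) : F ^ (θ / 2) * H ^ (θ / 2) ≤ F ^ a * H ^ b := by
  rcases hH.eq_or_lt with rfl | hH
  · rw [Real.zero_rpow (by linarith), Real.zero_rpow hb.ne', mul_zero, mul_zero]
  · have h1 : H ^ (θ / 2) = H ^ (a - θ / 2) * H ^ b := by
      rw [← Real.rpow_add hH]; congr 1; linarith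
    have h2 : F ^ a = F ^ (θ / 2) * F ^ (a - θ / 2) := by
      rw [← Real.rpow_add hF]; congr 1; ring
    have h3 : H ^ (a - θ / 2) ≤ F ^ (a - θ / 2) := Real.rpow_le_rpow hH.le hle (by linarith)
    rw [h1, h2, mul_assoc]
    gcongr

theorem exists_restricted_of_column {θ a b : ℝ} (hb : 0 < b) (hba : b ≤ a) (hab : a + b = θ)
    (hθ : θ ≤ 1) : ∃ C : ℝ, 0 ≤ C ∧
    ∀ (n : ℕ) (L : (ℤ × ℤ → ℂ) → (ℤ × ℤ → ℂ) → ℂ) (_ : ∀ f h h', L f (h + h') = L f h + L f h')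
      (A : ℝ) (_ : 0 ≤ A)
      (_ : ∀ f h, ‖L f h‖ ≤
        A * ((∑ z ∈ dyadicBox n ×ˢ dyadicBox n, ‖f z‖ ^ (2 / θ)) ^ (1 / (2 / θ)) *
          (∑ z ∈ dyadicBox n ×ˢ dyadicBox n, ‖h z‖ ^ (2 / θ)) ^ (1 / (2 / θ))))
      (_ : ∀ f e h, (∀ x y, h (x, y) ≠ 0 → ∀ k,
        dyadicAvg k (fun x => f (x, y)) x = dyadicAvg k (fun x => e (x, y)) x) → L f h = L e h)
      (F H : Finset (ℤ × ℤ)) (f h : ℤ × ℤ → ℂ) (_ : F ⊆ dyadicBox n ×ˢ dyadicBox n)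
      (_ : H ⊆ dyadicBox n ×ˢ dyadicBox n) (_ : SubInd F f) (_ : SubInd H h),
      ‖L f h‖ ≤ C * A * ((#F : ℝ) ^ a * (#H : ℝ) ^ b) := by
  obtain ⟨C, hC, halv⟩ := exists_norm_le_of_halving (X := ℤ × ℤ) (θ := θ) hb
  refine ⟨C * 4 + 1, by positivity, ?_⟩
  intro n L hL A hA hLB hcz F H f h hFB hHB hf hh
  have ha : 0 < a := hb.trans_le hba
  have hθ0 : 0 < θ := by linarith
  have hp : 0 < 2 / θ := by positivity
  have hp' : 1 / (2 / θ) = θ / 2 := by field_simp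
  rw [hp'] at hLB
  have hnorm : ∀ (F : Finset (ℤ × ℤ)) f, SubInd F f →
      (∑ z ∈ dyadicBox n ×ˢ dyadicBox n, ‖f z‖ ^ (2 / θ)) ^ (θ / 2) ≤ (#F : ℝ) ^ (θ / 2) := by
    intro F f hf
    have := hf.norm_le hp (dyadicBox n ×ˢ dyadicBox n)
    rwa [hp'] at this
  have hc : ∀ F : Finset (ℤ × ℤ), (0 : ℝ) ≤ #F := fun F => Nat.cast_nonneg _
  have base : ∀ H : Finset (ℤ × ℤ), ∀ h, SubInd H h →
      ‖L f h‖ ≤ A * ((#F : ℝ) ^ (θ / 2) * (#H : ℝ) ^ (θ / 2)) := by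
    intro H h hh
    exact (hLB f h).trans (mul_le_mul_of_nonneg_left (mul_le_mul (hnorm F f hf) (hnorm H h hh)
      (by positivity) (Real.rpow_nonneg (hc F) _)) hA)
  have hR : 0 ≤ A * ((#F : ℝ) ^ a * (#H : ℝ) ^ b) :=
    mul_nonneg hA (mul_nonneg (Real.rpow_nonneg (hc F) _) (Real.rpow_nonneg (hc H) _))
  have hR' : A * ((#F : ℝ) ^ a * (#H : ℝ) ^ b) ≤
      (C * 4 + 1) * A * ((#F : ℝ) ^ a * (#H : ℝ) ^ b) := by nlinarith
  rcases Nat.eq_zero_or_pos #F with hF0 | hFpos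
  · have h1 := base H h hh
    rw [hF0, Nat.cast_zero, Real.zero_rpow (by positivity), zero_mul, mul_zero] at h1
    exact h1.trans (hR.trans hR')
  have hFpos' : (0 : ℝ) < #F := by exact_mod_cast hFpos
  have hFθ : 0 ≤ (#F : ℝ) ^ θ := Real.rpow_nonneg (hc F) _
  rcases le_total (#H : ℝ) #F with hle | hle
  · exact (base H h hh).trans ((mul_le_mul_of_nonneg_left
      (comparable_arith hb hba hab hFpos' (hc H) hle) hA).trans hR')
  have h1 : ∀ H ⊆ dyadicBox n ×ˢ dyadicBox n, (#H : ℝ) ≤ #F → ∀ h, SubInd H h →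
      ‖L f h‖ ≤ 4 * A * (#F : ℝ) ^ θ := by
    intro H _ hHF h hh
    have e1 : (#F : ℝ) ^ θ = (#F : ℝ) ^ (θ / 2) * (#F : ℝ) ^ (θ / 2) := by
      rw [← Real.rpow_add hFpos']; congr 1; ring
    have e2 := Real.rpow_le_rpow (hc H) hHF (by positivity : 0 ≤ θ / 2)
    have e3 := mul_le_mul_of_nonneg_left e2 (Real.rpow_nonneg (hc F) (θ / 2))
    rw [← e1] at e3
    have e4 := mul_le_mul_of_nonneg_left e3 hA
    have e5 := mul_nonneg hA hFθ
    linarith [base H h hh]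
  have h2 : ∀ H ⊆ dyadicBox n ×ˢ dyadicBox n, (#F : ℝ) < #H → ∃ H' ⊆ H, 2 * (#H' : ℝ) ≤ #H ∧
      ∀ h, SubInd (H \ H') h → ‖L f h‖ ≤ 4 * A * (#F : ℝ) ^ θ := by
    intro H hHB hFH
    have hHpos : (0 : ℝ) < #H := hFpos'.trans hFH
    have hl : (0 : ℝ) < 2 * #F / #H := div_pos (by linarith) hHpos
    obtain ⟨U, e, hU, he1, he2, he3⟩ := exists_column_cz hFB hf hl
    refine ⟨H ∩ U, inter_subset_left, ?_, ?_⟩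
    · have e3 : (#(H ∩ U) : ℝ) ≤ #U := by exact_mod_cast card_le_card inter_subset_right
      rw [div_mul_eq_mul_div, div_le_iff₀ hHpos] at hU
      nlinarith
    · intro h hh
      rw [hcz f e h]
      · refine (hLB e h).trans ?_
        have hhn : (∑ z ∈ dyadicBox n ×ˢ dyadicBox n, ‖h z‖ ^ (2 / θ)) ^ (θ / 2) ≤
            (#H : ℝ) ^ (θ / 2) := by
          refine (hnorm _ h hh).trans ?_
          exact Real.rpow_le_rpow (hc _) (by exact_mod_cast card_le_card sdiff_subset)
            (by positivity)
        have hen := sum_rpow_le_of_le (p := 2 / θ) (by rw [le_div_iff₀ hθ0]; linarith)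
          (by linarith) he1 he2
        have hen' := Real.rpow_le_rpow (by positivity) hen (by positivity : 0 ≤ θ / 2)
        have e1 := mul_le_mul hen' hhn (by positivity) (Real.rpow_nonneg
          (mul_nonneg (Real.rpow_nonneg (by linarith) _) (hc F)) _)
        have e2 := e1.trans (good_part_arith hθ0 hθ hFpos' hFH.le)
        have e3 := mul_le_mul_of_nonneg_left e2 hA
        linarith
      · intro x y hxy k
        have hm : (x, y) ∈ H \ (H ∩ U) := by
          by_contra hn
          exact hxy (hh.eq_zero hn)
        rw [Finset.mem_sdiff, Finset.mem_inter] at hm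
        exact he3 x y (hHB hm.1) (fun hu => hm.2 ⟨hm.1, hu⟩) k
  have hfin := halv (L := L f) (hL f) (A := 4 * A) (by positivity) hFpos' h1 h2 H hHB hle h hh
  refine hfin.trans ?_
  have : θ - b = a := by linarith
  rw [this]
  nlinarith

theorem sum_swap_box (n : ℕ) (u : ℤ × ℤ → ℝ) :
    ∑ z ∈ dyadicBox n ×ˢ dyadicBox n, u z.swap = ∑ z ∈ dyadicBox n ×ˢ dyadicBox n, u z := by
  rw [sum_product, sum_product_right]
  rfl

theorem SubInd.swap {E : Finset (ℤ × ℤ)} {f : ℤ × ℤ → ℂ} (hf : SubInd E f) :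
    SubInd (E.map (Equiv.prodComm ℤ ℤ).toEmbedding) (fun z => f z.swap) := by
  intro z
  refine (hf z.swap).trans_eq ?_
  congr 1
  simp

theorem map_swap_subset {n : ℕ} {E : Finset (ℤ × ℤ)} (hE : E ⊆ dyadicBox n ×ˢ dyadicBox n) :
    E.map (Equiv.prodComm ℤ ℤ).toEmbedding ⊆ dyadicBox n ×ˢ dyadicBox n := by
  intro z hz
  rw [Finset.mem_map] at hz
  obtain ⟨w, hw, rfl⟩ := hz
  have := mem_product.1 (hE hw)
  exact mem_product.2 ⟨this.2, this.1⟩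

theorem twistedForm_congr_columns (n : ℕ) (h f e g : ℤ × ℤ → ℂ)
    (H : ∀ x y, h (x, y) ≠ 0 → ∀ k,
      dyadicAvg k (fun x => f (x, y)) x = dyadicAvg k (fun x => e (x, y)) x) :
    twistedForm n h f g = twistedForm n h e g := by
  unfold twistedForm dyadicForm
  refine sum_congr rfl fun k _ => sum_congr rfl fun x _ => sum_congr rfl fun y _ => ?_
  by_cases hz : h (x, y) = 0
  · simp only [hz, zero_mul]
  · rw [H x y hz]

theorem twistedForm_congr_rows (n : ℕ) (h f g e : ℤ × ℤ → ℂ)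
    (H : ∀ x y, h (x, y) ≠ 0 → ∀ k,
      dyadicAvg k (fun y => g (x, y)) y = dyadicAvg k (fun y => e (x, y)) y) :
    twistedForm n h f g = twistedForm n h f e := by
  unfold twistedForm dyadicForm
  refine sum_congr rfl fun k _ => sum_congr rfl fun x _ => sum_congr rfl fun y _ => ?_
  by_cases hz : h (x, y) = 0
  · simp only [hz, zero_mul]
  · rw [H x y hz, H x y hz]

theorem exists_restricted_twistedMap {b : Fin 3 → ℝ} (hb : ∀ j, 0 < b j) (h0 : b 0 < 1 / 2)
    (hsum : ∑ j, b j = 1) : ∃ C : ℝ, 0 ≤ C ∧ ∀ (n : ℕ) (E : Fin 3 → Finset (ℤ × ℤ))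
      (F : Fin 3 → ℤ × ℤ → ℂ), (∀ i, E i ⊆ dyadicBox n ×ˢ dyadicBox n) →
      (∀ i, SubInd (E i) (F i)) → ‖twistedMap n F‖ ≤ C * ∏ i, (#(E i) : ℝ) ^ b i := by
  have hb0 := hb 0
  have hb1 := hb 1
  have hb2 := hb 2
  rw [Fin.sum_univ_three] at hsum
  have hc : ∀ F : Finset (ℤ × ℤ), (0 : ℝ) ≤ #F := fun F => Nat.cast_nonneg _
  have strong : ∀ p : Fin 3 → ℝ, (∀ j, 2 < p j) → ∑ j, 1 / p j = 1 → ∃ C : ℝ, 0 ≤ C ∧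
      ∀ (n : ℕ) (h f g : ℤ × ℤ → ℂ), ‖twistedForm n h f g‖ ≤
        C * ((∑ z ∈ dyadicBox n ×ˢ dyadicBox n, ‖h z‖ ^ p 0) ^ (1 / p 0) *
          (∑ z ∈ dyadicBox n ×ˢ dyadicBox n, ‖f z‖ ^ p 1) ^ (1 / p 1) *
          (∑ z ∈ dyadicBox n ×ˢ dyadicBox n, ‖g z‖ ^ p 2) ^ (1 / p 2)) := by
    intro p hp hs
    obtain ⟨C, hC, H⟩ := exists_twistedMap_le hp hs
    refine ⟨C, hC, fun n h f g => ?_⟩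
    have := H n ![h, f, g]
    rw [twistedMap_apply, Fin.prod_univ_three] at this
    exact this
  rcases le_or_gt (1 / 2) (b 1) with h1 | h1
  · obtain ⟨θ, hθ⟩ : ∃ θ, θ = b 0 + b 1 := ⟨_, rfl⟩
    have hθ0 : 0 < θ := by linarith
    have hθ1 : θ < 1 := by linarith
    have e1 : 1 / (2 / θ) = θ / 2 := by field_simp
    obtain ⟨C₁, hC₁, H₁⟩ := strong ![2 / θ, 2 / θ, 1 / b 2] (by
      intro j
      fin_cases j
      · show 2 < 2 / θ
        rw [lt_div_iff₀ hθ0]; linarith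
      · show 2 < 2 / θ
        rw [lt_div_iff₀ hθ0]; linarith
      · show 2 < 1 / b 2
        rw [lt_div_iff₀ hb2]; linarith) (by
      rw [Fin.sum_univ_three]
      show 1 / (2 / θ) + 1 / (2 / θ) + 1 / (1 / b 2) = 1
      rw [e1, one_div_one_div]; linarith)
    obtain ⟨C₂, hC₂, H₂⟩ := exists_restricted_of_column (θ := θ) (a := b 1) (b := b 0) hb0
      (by linarith) (by linarith) hθ1.le
    refine ⟨C₂ * C₁, by positivity, fun n E F hE hF => ?_⟩
    have hg := (hF 2).norm_le (p := 1 / b 2) (by positivity) (dyadicBox n ×ˢ dyadicBox n)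
    have hA : 0 ≤ C₁ * (#(E 2) : ℝ) ^ b 2 := mul_nonneg hC₁ (Real.rpow_nonneg (hc _) _)
    have := H₂ n (fun f h => twistedForm n h f (F 2))
      (fun f h h' => twistedForm_add₀ n h h' f (F 2)) (C₁ * (#(E 2) : ℝ) ^ b 2) hA
      (by
        intro f h
        refine (H₁ n h f (F 2)).trans ?_
        rw [one_div_one_div] at hg
        have e2 : 1 / (![2 / θ, 2 / θ, 1 / b 2] : Fin 3 → ℝ) 2 = b 2 := one_div_one_div _
        rw [e2, mul_assoc C₁]
        refine mul_le_mul_of_nonneg_left ?_ hC₁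
        refine (mul_le_mul_of_nonneg_left hg (by positivity)).trans_eq ?_
        show _ = _
        simp only [Matrix.cons_val_zero, Matrix.cons_val_one]
        ring)
      (fun f e h H => twistedForm_congr_columns n h f e _ H)
      (E 1) (E 0) (F 1) (F 0) (hE 1) (hE 0) (hF 1) (hF 0)
    rw [twistedMap_apply, Fin.prod_univ_three]
    refine this.trans_eq ?_
    ring
  rcases le_or_gt (1 / 2) (b 2) with h2 | h2
  · obtain ⟨θ, hθ⟩ : ∃ θ, θ = b 0 + b 2 := ⟨_, rfl⟩
    have hθ0 : 0 < θ := by linarith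
    have hθ1 : θ < 1 := by linarith
    have e1 : 1 / (2 / θ) = θ / 2 := by field_simp
    obtain ⟨C₁, hC₁, H₁⟩ := strong ![2 / θ, 1 / b 1, 2 / θ] (by
      intro j
      fin_cases j
      · show 2 < 2 / θ
        rw [lt_div_iff₀ hθ0]; linarith
      · show 2 < 1 / b 1
        rw [lt_div_iff₀ hb1]; linarith
      · show 2 < 2 / θ
        rw [lt_div_iff₀ hθ0]; linarith) (by
      rw [Fin.sum_univ_three]
      show 1 / (2 / θ) + 1 / (1 / b 1) + 1 / (2 / θ) = 1
      rw [e1, one_div_one_div]; linarith)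
    obtain ⟨C₂, hC₂, H₂⟩ := exists_restricted_of_column (θ := θ) (a := b 2) (b := b 0) hb0
      (by linarith) (by linarith) hθ1.le
    refine ⟨C₂ * C₁, by positivity, fun n E F hE hF => ?_⟩
    have hg := (hF 1).norm_le (p := 1 / b 1) (by positivity) (dyadicBox n ×ˢ dyadicBox n)
    have hA : 0 ≤ C₁ * (#(E 1) : ℝ) ^ b 1 := mul_nonneg hC₁ (Real.rpow_nonneg (hc _) _)
    have := H₂ n (fun g h => twistedForm n (fun z => h z.swap) (F 1) (fun z => g z.swap))
      (fun g h h' => twistedForm_add₀ n (fun z => h z.swap) (fun z => h' z.swap) (F 1) _)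
      (C₁ * (#(E 1) : ℝ) ^ b 1) hA
      (by
        intro g h
        refine (H₁ n (fun z => h z.swap) (F 1) (fun z => g z.swap)).trans ?_
        rw [one_div_one_div] at hg
        have e2 : 1 / (![2 / θ, 1 / b 1, 2 / θ] : Fin 3 → ℝ) 1 = b 1 := one_div_one_div _
        rw [e2, mul_assoc C₁]
        refine mul_le_mul_of_nonneg_left ?_ hC₁
        refine (mul_le_mul_of_nonneg_right (mul_le_mul_of_nonneg_left hg (by positivity))
          (by positivity)).trans_eq ?_
        show _ = _
        rw [sum_swap_box n (fun z => ‖h z‖ ^ (![2 / θ, 1 / b 1, 2 / θ] : Fin 3 → ℝ) 0),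
          sum_swap_box n (fun z => ‖g z‖ ^ (![2 / θ, 1 / b 1, 2 / θ] : Fin 3 → ℝ) 2)]
        simp only [Matrix.cons_val_zero, Matrix.cons_val]
        ring)
      (fun g e h H => twistedForm_congr_rows n _ _ _ _ fun x y hxy k => H y x hxy k)
      (E 2 |>.map (Equiv.prodComm ℤ ℤ).toEmbedding) (E 0 |>.map (Equiv.prodComm ℤ ℤ).toEmbedding)
      (fun z => F 2 z.swap) (fun z => F 0 z.swap) (map_swap_subset (hE 2))
      (map_swap_subset (hE 0)) (hF 2).swap (hF 0).swap
    rw [twistedMap_apply, Fin.prod_univ_three]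
    rw [card_map, card_map] at this
    refine this.trans_eq ?_
    ring
  · obtain ⟨C₁, hC₁, H₁⟩ := exists_twistedMap_le (p := fun j => 1 / b j) (by
      intro j
      rw [lt_div_iff₀ (hb j)]
      fin_cases j
      · show 2 * b 0 < 1
        linarith
      · show 2 * b 1 < 1
        linarith
      · show 2 * b 2 < 1
        linarith) (by simp only [one_div_one_div, Fin.sum_univ_three]; exact hsum)
    refine ⟨C₁, hC₁, fun n E F hE hF => (H₁ n F).trans ?_⟩
    refine mul_le_mul_of_nonneg_left (prod_le_prod (fun j _ => by positivity) fun j _ => ?_) hC₁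
    have := (hF j).norm_le (p := 1 / b j) (one_div_pos.2 (hb j)) (dyadicBox n ×ˢ dyadicBox n)
    rwa [one_div_one_div] at this ⊢

/-- The dyadic twisted paraproduct in the full range of exponents. -/
theorem exists_twistedMap_le_full {a : Fin 3 → ℝ} (ha : ∀ j, 0 < a j) (h0 : a 0 < 1 / 2)
    (hsum : ∑ j, a j = 1) : ∃ C : ℝ, 0 ≤ C ∧ ∀ (n : ℕ) (F : Fin 3 → ℤ × ℤ → ℂ),
      (∀ i, ∀ z ∉ dyadicBox n ×ˢ dyadicBox n, F i z = 0) →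
      ‖twistedMap n F‖ ≤
        C * ∏ j, (∑ z ∈ dyadicBox n ×ˢ dyadicBox n, ‖F j z‖ ^ (1 / a j)) ^ a j := by
  obtain ⟨δ, hδ, hδa, hδ0⟩ : ∃ δ > 0, (∀ j, δ < a j) ∧ a 0 + δ < 1 / 2 := by
    obtain ⟨δ, hδ, hlt⟩ : ∃ δ > 0, δ < min (min (a 0) (min (a 1) (a 2))) (1 / 2 - a 0) :=
      exists_between (by
        rw [lt_min_iff, lt_min_iff, lt_min_iff]
        exact ⟨⟨ha 0, ha 1, ha 2⟩, by linarith⟩ : (0 : ℝ) < min (min (a 0) (min (a 1) (a 2))) (1 / 2 - a 0))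
    rw [lt_min_iff, lt_min_iff, lt_min_iff] at hlt
    refine ⟨δ, hδ, fun j => ?_, by linarith⟩
    fin_cases j
    exacts [hlt.1.1, hlt.1.2.1, hlt.1.2.2]
  obtain ⟨K, hK, H⟩ := exists_restricted_interpolation a δ hδ hδa hsum
  have hR : ∀ m m' : Fin 3, ∃ C : ℝ, 0 ≤ C ∧ (m ≠ m' → ∀ (n : ℕ) (E : Fin 3 → Finset (ℤ × ℤ))
      (F : Fin 3 → ℤ × ℤ → ℂ), (∀ i, E i ⊆ dyadicBox n ×ˢ dyadicBox n) →
      (∀ i, SubInd (E i) (F i)) → ‖twistedMap n F‖ ≤ C * ∏ i, (#(E i) : ℝ) ^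
        (a i + (if i = m then δ else 0) - (if i = m' then δ else 0))) := by
    intro m m'
    by_cases hm : m = m'
    · exact ⟨0, le_rfl, fun h => absurd hm h⟩
    · obtain ⟨C, hC, h⟩ := exists_restricted_twistedMap
        (b := fun i => a i + (if i = m then δ else 0) - (if i = m' then δ else 0)) (by
          intro j
          have := hδa j
          split_ifs <;> linarith) (by
          split_ifs <;> linarith) (by
          simp only [sum_sub_distrib, sum_add_distrib, sum_ite_eq', mem_univ, if_true, hsum]
          ring)
      exact ⟨C, hC, fun _ => h⟩
  choose C hC hCb using hR
  refine ⟨K * ∑ m, ∑ m', C m m', mul_nonneg hK (sum_nonneg fun _ _ => sum_nonneg fun _ _ => hC _ _),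
    fun n F hF => ?_⟩
  refine H (dyadicBox n ×ˢ dyadicBox n) (twistedMap n) (∑ m, ∑ m', C m m')
    (sum_nonneg fun _ _ => sum_nonneg fun _ _ => hC _ _) ?_ F hF
  intro m m' hm E f hE hf
  refine (hCb m m' hm n E f hE hf).trans (mul_le_mul_of_nonneg_right ?_
    (prod_nonneg fun i _ => Real.rpow_nonneg (Nat.cast_nonneg _) _))
  exact (single_le_sum (f := fun m' => C m m') (fun _ _ => hC _ _) (mem_univ m')).trans
    (single_le_sum (f := fun m => ∑ m', C m m') (fun _ _ => sum_nonneg fun _ _ => hC _ _)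
      (mem_univ m))

/-- The bilinear form on `B` of the convolution operator with kernel `k`. -/
def kerForm (k : ℤ → ℂ) (B : Finset ℤ) (h f : ℤ → ℂ) : ℂ :=
  ∑ x ∈ B, ∑ y ∈ B, h x * k (x - y) * f y

/-- A Calderón–Zygmund convolution kernel on the integers. -/
structure IsCZKernel (k : ℤ → ℂ) (A : ℝ) : Prop where
  nonneg : 0 ≤ A
  l2 : ∀ B h f, ‖kerForm k B h f‖ ≤
    A * ((∑ x ∈ B, ‖h x‖ ^ 2) ^ (1 / 2 : ℝ) * (∑ x ∈ B, ‖f x‖ ^ 2) ^ (1 / 2 : ℝ))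
  reg : ∀ i y : ℤ, 2 * |y| ≤ |i| → ‖k (i - y) - k i‖ * (i : ℝ) ^ 2 ≤ A * |(y : ℝ)|

theorem kerForm_neg (k : ℤ → ℂ) (B : Finset ℤ) (h f : ℤ → ℂ) :
    kerForm (fun i => k (-i)) B f h = kerForm k B h f := by
  rw [kerForm, kerForm, sum_comm]
  refine sum_congr rfl fun x _ => sum_congr rfl fun y _ => ?_
  rw [neg_sub]; ring

theorem IsCZKernel.neg {k : ℤ → ℂ} {A : ℝ} (hk : IsCZKernel k A) :
    IsCZKernel (fun i => k (-i)) A where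
  nonneg := hk.nonneg
  l2 B h f := by
    rw [kerForm_neg, mul_comm (_ ^ _)]
    exact hk.l2 B f h
  reg i y hy := by
    have := hk.reg (-i) (-y) (by simpa using hy)
    push_cast at this
    rw [neg_sq, abs_neg] at this
    rwa [neg_sub, show y - i = -i - -y by ring]

theorem kerForm_add_left (k : ℤ → ℂ) (B : Finset ℤ) (h h' f : ℤ → ℂ) :
    kerForm k B (h + h') f = kerForm k B h f + kerForm k B h' f := by
  simp only [kerForm, ← sum_add_distrib, Pi.add_apply, add_mul]

theorem sum_inv_sq_le_of_pos {X : Finset ℤ} {L : ℕ} (hL : 0 < L) (hX : ∀ i ∈ X, 2 * (L : ℤ) ≤ i) :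
    ∑ i ∈ X, ((i : ℝ) ^ 2)⁻¹ ≤ 1 / L := by
  obtain ⟨M, hM⟩ := X.bddAbove
  have hmap : ∑ i ∈ X, ((i : ℝ) ^ 2)⁻¹ ≤ ∑ j ∈ Ioc (2 * L - 1) (max M.toNat (2 * L)),
      ((j : ℝ) ^ 2)⁻¹ := by
    have e : ∑ i ∈ X, ((i : ℝ) ^ 2)⁻¹ = ∑ j ∈ X.image Int.toNat, ((j : ℝ) ^ 2)⁻¹ := by
      rw [sum_image]
      · refine sum_congr rfl fun i hi => ?_
        have h0 : 0 ≤ i := by have := hX i hi; omega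
        have : ((i.toNat : ℤ) : ℝ) = i := by rw [Int.toNat_of_nonneg h0]
        rw [← this]; push_cast; rfl
      · intro i hi j hj hij
        have h1 := hX i hi
        have h2 := hX j hj
        omega
    rw [e]
    refine sum_le_sum_of_subset_of_nonneg ?_ fun _ _ _ => by positivity
    intro j hj
    obtain ⟨i, hi, rfl⟩ := mem_image.1 hj
    have h1 := hX i hi
    have h2 : i ≤ M := hM hi
    rw [mem_Ioc]
    constructor
    · omega
    · exact (by omega : i.toNat ≤ M.toNat).trans (le_max_left _ _)
  refine hmap.trans ((sum_Ioc_inv_sq_le_sub (α := ℝ) (by omega) (by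
    have := le_max_right M.toNat (2 * L); omega)).trans ?_)
  have h1 : (L : ℝ) ≤ ((2 * L - 1 : ℕ) : ℝ) := by exact_mod_cast (by omega : L ≤ 2 * L - 1)
  have h2 : (0 : ℝ) < L := by exact_mod_cast hL
  have h3 : ((2 * L - 1 : ℕ) : ℝ)⁻¹ ≤ 1 / L := by
    rw [one_div]; exact inv_anti₀ h2 h1
  have h4 : (0 : ℝ) ≤ ((max M.toNat (2 * L) : ℕ) : ℝ)⁻¹ := by positivity
  linarith

theorem sum_inv_sq_le {X : Finset ℤ} {L : ℕ} (hL : 0 < L) (hX : ∀ i ∈ X, 2 * (L : ℤ) ≤ |i|) :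
    ∑ i ∈ X, ((i : ℝ) ^ 2)⁻¹ ≤ 2 / L := by
  rw [← sum_filter_add_sum_filter_not X (fun i => 0 ≤ i)]
  have h1 := sum_inv_sq_le_of_pos (X := X.filter (fun i => 0 ≤ i)) hL (by
    intro i hi
    rw [mem_filter] at hi
    rw [← abs_of_nonneg hi.2]; exact hX i hi.1)
  have h2 := sum_inv_sq_le_of_pos (X := (X.filter (fun i => ¬ 0 ≤ i)).image (fun i => -i)) hL (by
    intro i hi
    obtain ⟨j, hj, rfl⟩ := mem_image.1 hi
    rw [mem_filter] at hj
    have := hX j hj.1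
    rwa [abs_of_neg (by omega)] at this)
  rw [sum_image (fun i _ j _ hij => by simpa using hij)] at h2
  push_cast at h2
  simp only [neg_sq] at h2
  calc _ ≤ 1 / (L : ℝ) + 1 / L := add_le_add h1 h2
    _ = 2 / L := by ring

/-- The points at distance less than two lengths from the left end of a dyadic interval. -/
def dyadicStar (S : ℕ × ℤ) : Finset ℤ := Ioo (S.2 * 2 ^ S.1 - 2 * 2 ^ S.1) (S.2 * 2 ^ S.1 + 2 * 2 ^ S.1)

theorem card_dyadicStar_le (S : ℕ × ℤ) : #(dyadicStar S) ≤ 4 * 2 ^ S.1 := by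
  rw [dyadicStar, Int.card_Ioo]
  have h : (0 : ℤ) < 2 ^ S.1 := by positivity
  have : ((4 * 2 ^ S.1 : ℕ) : ℤ) = 4 * 2 ^ S.1 := by push_cast; rfl
  omega

theorem IsCZKernel.sum_bad_le {k : ℤ → ℂ} {A : ℝ} (hk : IsCZKernel k A) (f : ℤ → ℂ) {S : ℕ × ℤ}
    {B : Finset ℤ} (hS : dyadicIv S ⊆ B) {X : Finset ℤ} (hX : ∀ x ∈ X, x ∉ dyadicStar S) :
    ∑ x ∈ X, ‖∑ y ∈ B, k (x - y) * czBad f S y‖ ≤ 4 * A * ∑ y ∈ dyadicIv S, ‖f y‖ := by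
  have hA := hk.nonneg
  set y₀ : ℤ := S.2 * 2 ^ S.1 with hy₀
  have h2 : (0 : ℤ) < 2 ^ S.1 := by positivity
  have hX' : ∀ x ∈ X, 2 * 2 ^ S.1 ≤ |x - y₀| := by
    intro x hx
    have := hX x hx
    rw [dyadicStar, mem_Ioo, ← hy₀] at this
    rw [le_abs]
    by_contra hcon
    push Not at hcon
    exact this ⟨by linarith, by linarith⟩
  have h1 : ∀ x ∈ X, ‖∑ y ∈ B, k (x - y) * czBad f S y‖ ≤
      A * 2 ^ S.1 * (∑ y ∈ B, ‖czBad f S y‖) * (((x - y₀ : ℤ) : ℝ) ^ 2)⁻¹ := by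
    intro x hx
    have e : ∑ y ∈ B, k (x - y) * czBad f S y =
        ∑ y ∈ B, (k (x - y₀ - (y - y₀)) - k (x - y₀)) * czBad f S y := by
      simp only [sub_mul, sum_sub_distrib, ← mul_sum, sum_czBad f hS, mul_zero, sub_zero]
      refine sum_congr rfl fun y _ => ?_
      congr 2; ring
    have hpos : (0 : ℝ) < ((x - y₀ : ℤ) : ℝ) ^ 2 := by
      have h3 := hX' x hx
      have : x - y₀ ≠ 0 := by
        intro h0; rw [h0, abs_zero] at h3; linarith
      have : ((x - y₀ : ℤ) : ℝ) ≠ 0 := by exact_mod_cast this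
      positivity
    rw [e, ← div_eq_mul_inv, le_div_iff₀ hpos, mul_sum]
    refine (mul_le_mul_of_nonneg_right (norm_sum_le _ _) hpos.le).trans ?_
    rw [sum_mul]
    refine sum_le_sum fun y _ => ?_
    by_cases hy : y ∈ dyadicIv S
    · have hy1 : 0 ≤ y - y₀ ∧ y - y₀ < 2 ^ S.1 := by
        rw [dyadicIv, dyadicIco, mem_Ico] at hy
        constructor
        · linarith [hy.1]
        · have : (S.2 + 1) * 2 ^ S.1 = y₀ + 2 ^ S.1 := by rw [hy₀]; ring
          linarith [hy.2]
      have hyabs : |y - y₀| ≤ 2 ^ S.1 := by rw [abs_of_nonneg hy1.1]; exact hy1.2.le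
      have := hk.reg (x - y₀) (y - y₀) (by linarith [hX' x hx])
      have hyR : |((y - y₀ : ℤ) : ℝ)| ≤ 2 ^ S.1 := by exact_mod_cast hyabs
      rw [norm_mul]
      calc _ = (‖k (x - y₀ - (y - y₀)) - k (x - y₀)‖ * ((x - y₀ : ℤ) : ℝ) ^ 2) *
            ‖czBad f S y‖ := by ring
        _ ≤ _ := mul_le_mul_of_nonneg_right (this.trans (mul_le_mul_of_nonneg_left hyR hA))
          (norm_nonneg _)
    · simp [czBad_of_notMem f hy]
  refine (sum_le_sum h1).trans ?_
  rw [← mul_sum]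
  have h4 : ∑ x ∈ X, (((x - y₀ : ℤ) : ℝ) ^ 2)⁻¹ ≤ 2 / 2 ^ S.1 := by
    have := sum_inv_sq_le (X := X.image (fun x => x - y₀)) (L := 2 ^ S.1) (by positivity) (by
      intro i hi
      obtain ⟨x, hx, rfl⟩ := mem_image.1 hi
      push_cast
      exact hX' x hx)
    rw [sum_image (fun i _ j _ hij => by simpa using hij)] at this
    push_cast at this ⊢
    exact this
  have h5 := sum_norm_czBad_le f S B
  have h6 : (0 : ℝ) < 2 ^ S.1 := by positivity
  calc _ ≤ A * 2 ^ S.1 * (2 * ∑ x ∈ dyadicIv S, ‖f x‖) * (2 / 2 ^ S.1) := by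
        refine mul_le_mul (mul_le_mul_of_nonneg_left h5 (by positivity)) h4
          (sum_nonneg fun _ _ => by positivity) (by positivity)
    _ = _ := by field_simp; ring

theorem exists_restricted_kerForm_of_le {b : ℝ} (hb : 0 < b) (hb2 : b ≤ 1 / 2) :
    ∃ C : ℝ, 0 ≤ C ∧ ∀ (k : ℤ → ℂ) (A : ℝ), IsCZKernel k A → ∀ (n : ℕ) (F H : Finset ℤ)
      (f h : ℤ → ℂ), F ⊆ dyadicBox n → H ⊆ dyadicBox n → SubInd F f → SubInd H h →
      ‖kerForm k (dyadicBox n) h f‖ ≤ C * A * ((#F : ℝ) ^ (1 - b) * (#H : ℝ) ^ b) := by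
  obtain ⟨C, hC, halv⟩ := exists_norm_le_of_halving (X := ℤ) (θ := 1) hb
  refine ⟨C * 8 + 1, by positivity, ?_⟩
  intro k A hk n F H f h hFB hHB hf hh
  have hA := hk.nonneg
  have hc : ∀ F : Finset ℤ, (0 : ℝ) ≤ #F := fun F => Nat.cast_nonneg _
  have hsq : ∀ (F : Finset ℤ) f, SubInd F f → ∑ x ∈ dyadicBox n, ‖f x‖ ^ 2 ≤ (#F : ℝ) := by
    intro F f hf
    have := hf.sum_rpow_le (p := 2) (by norm_num) (dyadicBox n)
    simpa only [Real.rpow_two] using this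
  have hnorm : ∀ (F : Finset ℤ) f, SubInd F f →
      (∑ x ∈ dyadicBox n, ‖f x‖ ^ 2) ^ (1 / 2 : ℝ) ≤ (#F : ℝ) ^ (1 / 2 : ℝ) := by
    intro F f hf
    exact Real.rpow_le_rpow (sum_nonneg fun _ _ => by positivity) (hsq F f hf) (by norm_num)
  have base : ∀ H : Finset ℤ, ∀ h, SubInd H h →
      ‖kerForm k (dyadicBox n) h f‖ ≤ A * ((#F : ℝ) ^ (1 / 2 : ℝ) * (#H : ℝ) ^ (1 / 2 : ℝ)) := by
    intro H h hh
    refine (hk.l2 _ h f).trans (mul_le_mul_of_nonneg_left ?_ hA)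
    rw [mul_comm]
    exact mul_le_mul (hnorm F f hf) (hnorm H h hh)
      (Real.rpow_nonneg (sum_nonneg fun _ _ => by positivity) _) (Real.rpow_nonneg (hc F) _)
  have hR : 0 ≤ A * ((#F : ℝ) ^ (1 - b) * (#H : ℝ) ^ b) :=
    mul_nonneg hA (mul_nonneg (Real.rpow_nonneg (hc F) _) (Real.rpow_nonneg (hc H) _))
  have hR' : A * ((#F : ℝ) ^ (1 - b) * (#H : ℝ) ^ b) ≤
      (C * 8 + 1) * A * ((#F : ℝ) ^ (1 - b) * (#H : ℝ) ^ b) := by nlinarith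
  rcases Nat.eq_zero_or_pos #F with hF0 | hFpos
  · have h1 := base H h hh
    rw [hF0, Nat.cast_zero, Real.zero_rpow (by positivity), zero_mul, mul_zero] at h1
    exact h1.trans (hR.trans hR')
  have hFpos' : (0 : ℝ) < #F := by exact_mod_cast hFpos
  rcases le_total (#H : ℝ) #F with hle | hle
  · exact (base H h hh).trans ((mul_le_mul_of_nonneg_left
      (comparable_arith (θ := 1) hb (by linarith) (by ring) hFpos' (hc H) hle) hA).trans hR')
  have h1 : ∀ H ⊆ dyadicBox n, (#H : ℝ) ≤ #F → ∀ h, SubInd H h →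
      ‖kerForm k (dyadicBox n) h f‖ ≤ 8 * A * (#F : ℝ) ^ (1 : ℝ) := by
    intro H _ hHF h hh
    have e1 : (#F : ℝ) ^ (1 : ℝ) = (#F : ℝ) ^ (1 / 2 : ℝ) * (#F : ℝ) ^ (1 / 2 : ℝ) := by
      rw [← Real.rpow_add hFpos']; norm_num
    have e2 := Real.rpow_le_rpow (hc H) hHF (by norm_num : (0 : ℝ) ≤ 1 / 2)
    have e3 := mul_le_mul_of_nonneg_left e2 (Real.rpow_nonneg (hc F) (1 / 2))
    rw [← e1] at e3
    have e4 := mul_le_mul_of_nonneg_left e3 hA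
    have e5 := mul_nonneg hA (Real.rpow_nonneg (hc F) 1)
    linarith [base H h hh]
  have h2 : ∀ H ⊆ dyadicBox n, (#F : ℝ) < #H → ∃ H' ⊆ H, 2 * (#H' : ℝ) ≤ #H ∧
      ∀ h, SubInd (H \ H') h → ‖kerForm k (dyadicBox n) h f‖ ≤ 8 * A * (#F : ℝ) ^ (1 : ℝ) := by
    intro H hHB hFH
    have hHpos : (0 : ℝ) < #H := hFpos'.trans hFH
    set l : ℝ := 8 * #F / #H with hl_def
    have hl : 0 < l := div_pos (by linarith) hHpos
    have hf1 : ∑ x ∈ dyadicBox n, ‖f x‖ ≤ #F := by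
      have := hf.sum_rpow_le (p := 1) one_pos (dyadicBox n)
      simpa only [Real.rpow_one] using this
    have hHn : (#H : ℝ) ≤ 2 * 2 ^ n := by
      have h3 := card_le_card hHB
      have h4 : #(dyadicBox n) = 2 * 2 ^ n := by
        rw [dyadicBox, Int.card_Ico]
        have : (2 : ℤ) ^ n - -2 ^ n = ((2 * 2 ^ n : ℕ) : ℤ) := by push_cast; ring
        rw [this, Int.toNat_natCast]
      rw [h4] at h3
      exact_mod_cast h3
    obtain ⟨𝓢, h𝓢⟩ := exists_isStopping_box (w := fun x => ‖f x‖) (fun _ => norm_nonneg _)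
      (l := l) (N := n) (by
        refine hf1.trans ?_
        rw [hl_def, div_mul_eq_mul_div, le_div_iff₀ hHpos]
        nlinarith)
    set U := 𝓢.biUnion dyadicStar
    refine ⟨H ∩ U, inter_subset_left, ?_, ?_⟩
    · have e1 : (#U : ℝ) ≤ 4 * ∑ S ∈ 𝓢, (2 : ℝ) ^ S.1 := by
        have h5 : #U ≤ ∑ S ∈ 𝓢, 4 * 2 ^ S.1 :=
          card_biUnion_le.trans (sum_le_sum fun S _ => card_dyadicStar_le S)
        rw [mul_sum]
        exact_mod_cast h5
      have e2 := (mul_sum_pow_le h𝓢).trans hf1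
      have e3 : (#(H ∩ U) : ℝ) ≤ #U := by exact_mod_cast card_le_card inter_subset_right
      rw [hl_def, div_mul_eq_mul_div, div_le_iff₀ hHpos] at e2
      have e4 : 8 * ∑ S ∈ 𝓢, (2 : ℝ) ^ S.1 ≤ #H := by
        have : (#F : ℝ) * (8 * ∑ S ∈ 𝓢, (2 : ℝ) ^ S.1) ≤ #F * #H := by linarith
        exact le_of_mul_le_mul_left this hFpos'
      linarith
    · intro h hh
      have hsplit : kerForm k (dyadicBox n) h f = kerForm k (dyadicBox n) h (czGood f 𝓢) +
          ∑ S ∈ 𝓢, ∑ x ∈ dyadicBox n, h x * ∑ y ∈ dyadicBox n, k (x - y) * czBad f S y := by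
        rw [sum_comm]
        simp only [kerForm, czGood]
        rw [← sum_add_distrib]
        refine sum_congr rfl fun x _ => ?_
        rw [← mul_sum, sum_comm, mul_sum, ← sum_add_distrib]
        refine sum_congr rfl fun y _ => ?_
        rw [← mul_sum]
        ring
      have hgood : ‖kerForm k (dyadicBox n) h (czGood f 𝓢)‖ ≤ 4 * A * #F := by
        refine (hk.l2 _ _ _).trans ?_
        have g1 : ∑ x ∈ dyadicBox n, ‖czGood f 𝓢 x‖ ^ 2 ≤ 2 * l * #F := by
          calc _ ≤ ∑ x ∈ dyadicBox n, 2 * l * ‖czGood f 𝓢 x‖ := by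
                refine sum_le_sum fun x hx => ?_
                rw [sq]
                exact mul_le_mul_of_nonneg_right (norm_czGood_le h𝓢 hl.le hx) (norm_nonneg _)
            _ ≤ _ := by
                rw [← mul_sum]
                exact mul_le_mul_of_nonneg_left ((sum_norm_czGood_le h𝓢).trans hf1)
                  (by linarith)
        have g2 : ∑ x ∈ dyadicBox n, ‖h x‖ ^ 2 ≤ (#H : ℝ) :=
          (hsq _ h hh).trans (by exact_mod_cast card_le_card sdiff_subset)
        have g3 : (#H : ℝ) * (2 * l * #F) = (4 * #F) ^ 2 := by
          rw [hl_def]; field_simp; ring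
        rw [← Real.mul_rpow (sum_nonneg fun _ _ => by positivity)
          (sum_nonneg fun _ _ => by positivity), mul_comm 4 A, mul_assoc]
        refine mul_le_mul_of_nonneg_left ?_ hA
        rw [← Real.sqrt_eq_rpow]
        refine Real.sqrt_le_iff.2 ⟨by linarith, ?_⟩
        rw [← g3]
        exact mul_le_mul g2 g1 (sum_nonneg fun _ _ => by positivity) hHpos.le
      have hbad : ‖∑ S ∈ 𝓢, ∑ x ∈ dyadicBox n,
          h x * ∑ y ∈ dyadicBox n, k (x - y) * czBad f S y‖ ≤ 4 * A * #F := by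
        refine (norm_sum_le _ _).trans ?_
        have g1 : ∀ S ∈ 𝓢, ‖∑ x ∈ dyadicBox n,
            h x * ∑ y ∈ dyadicBox n, k (x - y) * czBad f S y‖ ≤
            4 * A * ∑ y ∈ dyadicIv S, ‖f y‖ := by
          intro S hS
          have hsub : H \ (H ∩ U) ⊆ dyadicBox n := sdiff_subset.trans hHB
          rw [← sum_subset hsub fun x _ hx => by rw [hh.eq_zero hx, zero_mul]]
          refine (norm_sum_le _ _).trans ((sum_le_sum fun x _ => ?_).trans
            (hk.sum_bad_le f (h𝓢.subset S hS) (X := H \ (H ∩ U)) ?_))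
          · rw [norm_mul]
            exact mul_le_of_le_one_left (norm_nonneg _) (hh.le_one x)
          · intro x hx hxS
            rw [Finset.mem_sdiff, Finset.mem_inter] at hx
            exact hx.2 ⟨hx.1, mem_biUnion.2 ⟨S, hS, hxS⟩⟩
        refine (sum_le_sum g1).trans ?_
        rw [← mul_sum]
        exact mul_le_mul_of_nonneg_left ((sum_sum_stopping_le h𝓢).trans hf1) (by linarith)
      rw [hsplit, Real.rpow_one]
      exact (norm_add_le _ _).trans (by linarith)
  have hfin := halv (L := fun h => kerForm k (dyadicBox n) h f)
    (fun h h' => kerForm_add_left k _ h h' f) (A := 8 * A) (by positivity) hFpos' h1 h2 H hHB hle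
    h hh
  refine hfin.trans ?_
  nlinarith

/-- Restricted type estimates for Calderón–Zygmund kernels on the integers. -/
theorem exists_restricted_kerForm {b : ℝ} (hb : 0 < b) (hb1 : b < 1) :
    ∃ C : ℝ, 0 ≤ C ∧ ∀ (k : ℤ → ℂ) (A : ℝ), IsCZKernel k A → ∀ (n : ℕ) (F H : Finset ℤ)
      (f h : ℤ → ℂ), F ⊆ dyadicBox n → H ⊆ dyadicBox n → SubInd F f → SubInd H h →
      ‖kerForm k (dyadicBox n) h f‖ ≤ C * A * ((#F : ℝ) ^ (1 - b) * (#H : ℝ) ^ b) := by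
  rcases le_total b (1 / 2) with h | h
  · exact exists_restricted_kerForm_of_le hb h
  · obtain ⟨C, hC, H⟩ := exists_restricted_kerForm_of_le (b := 1 - b) (by linarith) (by linarith)
    refine ⟨C, hC, fun k A hk n F G f g hF hG hf hg => ?_⟩
    have := H _ A hk.neg n G F g f hG hF hg hf
    rwa [kerForm_neg, sub_sub_cancel, mul_comm (_ ^ _)] at this

/-- The kernel form as a multilinear map. -/
def kerMap (k : ℤ → ℂ) (B : Finset ℤ) : MultilinearMap ℂ (fun _ : Fin 2 => ℤ → ℂ) ℂ where
  toFun F := kerForm k B (F 0) (F 1)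
  map_update_add' := by
    intro inst F i u v
    obtain rfl : inst = instDecidableEqFin 2 := Subsingleton.elim _ _
    fin_cases i
    · simp [Function.update, kerForm, add_mul, sum_add_distrib]
    · simp [Function.update, kerForm, mul_add, sum_add_distrib]
  map_update_smul' := by
    intro inst F i c v
    obtain rfl : inst = instDecidableEqFin 2 := Subsingleton.elim _ _
    fin_cases i
    · simp [Function.update, kerForm, mul_sum, mul_assoc]
    · simp [Function.update, kerForm, mul_sum, mul_left_comm]

theorem kerMap_apply (k : ℤ → ℂ) (B : Finset ℤ) (F : Fin 2 → ℤ → ℂ) :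
    kerMap k B F = kerForm k B (F 0) (F 1) := rfl

/-- Calderón–Zygmund kernels on the integers are bounded on `ℓ^p`. -/
theorem exists_kerMap_le {a : Fin 2 → ℝ} (ha : ∀ j, 0 < a j) (hsum : ∑ j, a j = 1) :
    ∃ C : ℝ, 0 ≤ C ∧ ∀ (k : ℤ → ℂ) (A : ℝ), IsCZKernel k A → ∀ (n : ℕ) (F : Fin 2 → ℤ → ℂ),
      (∀ i, ∀ z ∉ dyadicBox n, F i z = 0) →
      ‖kerMap k (dyadicBox n) F‖ ≤
        C * A * ∏ j, (∑ z ∈ dyadicBox n, ‖F j z‖ ^ (1 / a j)) ^ a j := by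
  have hs : a 0 + a 1 = 1 := by simpa [Fin.sum_univ_two] using hsum
  obtain ⟨δ, hδ, hδa⟩ : ∃ δ > 0, ∀ j, δ < a j := by
    obtain ⟨δ, hδ, hlt⟩ : ∃ δ > 0, δ < min (a 0) (a 1) :=
      exists_between (lt_min (ha 0) (ha 1))
    rw [lt_min_iff] at hlt
    refine ⟨δ, hδ, fun j => ?_⟩
    fin_cases j
    exacts [hlt.1, hlt.2]
  obtain ⟨K, hK, H⟩ := exists_restricted_interpolation a δ hδ hδa hsum
  have h0 := hδa 0
  have h1 := hδa 1
  obtain ⟨C₁, hC₁, H₁⟩ := exists_restricted_kerForm (b := a 0 + δ) (by linarith) (by linarith)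
  obtain ⟨C₂, hC₂, H₂⟩ := exists_restricted_kerForm (b := a 0 - δ) (by linarith) (by linarith)
  refine ⟨K * (C₁ + C₂), by positivity, fun k A hk n F hF => ?_⟩
  have hA := hk.nonneg
  rw [mul_assoc K]
  refine H (dyadicBox n) (kerMap k (dyadicBox n)) ((C₁ + C₂) * A) (by positivity) ?_ F hF
  intro m m' hm E f hE hf
  have h₁ := H₁ k A hk n (E 1) (E 0) (f 1) (f 0) (hE 1) (hE 0) (hf 1) (hf 0)
  have h₂ := H₂ k A hk n (E 1) (E 0) (f 1) (f 0) (hE 1) (hE 0) (hf 1) (hf 0)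
  have hp : ∀ x y : ℝ, 0 ≤ (#(E 1) : ℝ) ^ x * (#(E 0) : ℝ) ^ y := fun x y =>
    mul_nonneg (Real.rpow_nonneg (Nat.cast_nonneg _) _) (Real.rpow_nonneg (Nat.cast_nonneg _) _)
  rw [kerMap_apply, Fin.prod_univ_two, mul_comm (_ ^ _)]
  fin_cases m <;> fin_cases m'
  · exact absurd rfl hm
  · simp only [Fin.zero_eta, Fin.mk_one, if_true, zero_ne_one, one_ne_zero, if_false]
    rw [show a 1 + 0 - δ = 1 - (a 0 + δ) by linarith, show a 0 + δ - 0 = a 0 + δ by ring]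
    exact h₁.trans (mul_le_mul_of_nonneg_right (mul_le_mul_of_nonneg_right (by linarith) hA)
      (hp _ _))
  · simp only [Fin.zero_eta, Fin.mk_one, if_true, zero_ne_one, one_ne_zero, if_false]
    rw [show a 1 + δ - 0 = 1 - (a 0 - δ) by linarith, show a 0 + 0 - δ = a 0 - δ by ring]
    exact h₂.trans (mul_le_mul_of_nonneg_right (mul_le_mul_of_nonneg_right (by linarith) hA)
      (hp _ _))
  · exact absurd rfl hm

end

section

open scoped FourierTransform SchwartzMap
open SchwartzMap (derivCLM compCLMOfContinuousLinearEquiv smulLeftCLM)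

lemma norm_e2π (t : ℝ) : ‖e2π t‖ = 1 := by
  unfold e2π
  rw [show 2 * (Real.pi : ℂ) * Complex.I * (t : ℂ) = ((2 * Real.pi * t : ℝ) : ℂ) * Complex.I by
    push_cast; ring]
  exact Complex.norm_exp_ofReal_mul_I _

lemma e2π_add (s t : ℝ) : e2π (s + t) = e2π s * e2π t := by
  unfold e2π
  rw [← Complex.exp_add]
  push_cast
  ring_nf

@[simp] lemma e2π_zero : e2π 0 = 1 := by simp [e2π]

@[fun_prop] lemma continuous_e2π : Continuous e2π := by unfold e2π; fun_prop

/-- The two-dimensional Fourier transform on Schwartz functions. -/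
def ftS (f : 𝓢(ℝ × ℝ, ℂ)) : 𝓢(ℝ × ℝ, ℂ) :=
  compCLMOfContinuousLinearEquiv ℂ Complex.equivRealProdCLM.symm
    (𝓕 (compCLMOfContinuousLinearEquiv ℂ Complex.equivRealProdCLM f))

/-- The two-dimensional inverse Fourier transform on Schwartz functions. -/
def iftS (f : 𝓢(ℝ × ℝ, ℂ)) : 𝓢(ℝ × ℝ, ℂ) :=
  compCLMOfContinuousLinearEquiv ℂ Complex.equivRealProdCLM.symm
    (𝓕⁻ (compCLMOfContinuousLinearEquiv ℂ Complex.equivRealProdCLM f))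

lemma ftS_iftS (f : 𝓢(ℝ × ℝ, ℂ)) : ftS (iftS f) = f := by
  unfold ftS iftS
  have h : ∀ g : SchwartzMap ℂ ℂ, compCLMOfContinuousLinearEquiv ℂ
      Complex.equivRealProdCLM (compCLMOfContinuousLinearEquiv ℂ
      Complex.equivRealProdCLM.symm g) = g := by
    intro g; ext x; exact congrArg g (Complex.equivRealProdCLM.symm_apply_apply x)
  rw [h, FourierTransform.fourier_fourierInv_eq]
  ext x; simp

lemma iftS_ftS (f : 𝓢(ℝ × ℝ, ℂ)) : iftS (ftS f) = f := by
  unfold ftS iftS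
  have h : ∀ g : SchwartzMap ℂ ℂ, compCLMOfContinuousLinearEquiv ℂ
      Complex.equivRealProdCLM (compCLMOfContinuousLinearEquiv ℂ
      Complex.equivRealProdCLM.symm g) = g := by
    intro g; ext x; exact congrArg g (Complex.equivRealProdCLM.symm_apply_apply x)
  rw [h, FourierTransform.fourierInv_fourier_eq]
  ext x; simp

lemma ftS_apply (f : 𝓢(ℝ × ℝ, ℂ)) (ζ : ℝ × ℝ) : ftS f ζ = FT2 f ζ := by
  simp only [ftS, FT2, SchwartzMap.compCLMOfContinuousLinearEquiv_apply, Function.comp_apply,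
    SchwartzMap.fourier_coe]
  rw [Real.fourier_eq', ← Complex.volume_preserving_equiv_real_prod.integral_comp
    Complex.measurableEquivRealProd.measurableEmbedding]
  refine integral_congr_ae (.of_forall fun v => ?_)
  simp only [Function.comp_apply, smul_eq_mul, e2π]
  rw [mul_comm]
  congr 2
  simp [Complex.inner, Complex.measurableEquivRealProd_apply]
  ring

lemma iftS_apply (f : 𝓢(ℝ × ℝ, ℂ)) (z : ℝ × ℝ) :
    iftS f z = ∫ ζ : ℝ × ℝ, f ζ * e2π (z.1 * ζ.1 + z.2 * ζ.2) := by
  simp only [iftS, SchwartzMap.compCLMOfContinuousLinearEquiv_apply, Function.comp_apply,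
    SchwartzMap.fourierInv_coe]
  rw [Real.fourierInv_eq', ← Complex.volume_preserving_equiv_real_prod.integral_comp
    Complex.measurableEquivRealProd.measurableEmbedding]
  refine integral_congr_ae (.of_forall fun v => ?_)
  simp only [Function.comp_apply, smul_eq_mul, e2π]
  rw [mul_comm]
  congr 2
  simp [Complex.inner, Complex.measurableEquivRealProd_apply]
  ring

lemma SchwartzMap.eq_integral_ftS (f : 𝓢(ℝ × ℝ, ℂ)) (z : ℝ × ℝ) :
    f z = ∫ ζ : ℝ × ℝ, ftS f ζ * e2π (z.1 * ζ.1 + z.2 * ζ.2) := by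
  rw [← iftS_apply, iftS_ftS]

lemma SchwartzMap.exists_norm_le (f : 𝓢(ℝ × ℝ, ℂ)) : ∃ C, ∀ z, ‖f z‖ ≤ C :=
  ⟨_, fun z => f.norm_le_seminorm ℝ z⟩

/-- The Fourier multiplier with symbol `a`. -/
def fmul (a : ℝ × ℝ → ℂ) (f : 𝓢(ℝ × ℝ, ℂ)) : 𝓢(ℝ × ℝ, ℂ) :=
  iftS (smulLeftCLM ℂ a (ftS f))

lemma ftS_fmul {a : ℝ × ℝ → ℂ} (ha : a.HasTemperateGrowth) (f : 𝓢(ℝ × ℝ, ℂ))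
    (ζ : ℝ × ℝ) : ftS (fmul a f) ζ = a ζ * ftS f ζ := by
  rw [fmul, ftS_iftS, SchwartzMap.smulLeftCLM_apply_apply ha, smul_eq_mul]

/-- The `L^p` norm of a Schwartz function as a real number. -/
def nrm (p : ℝ) (f : 𝓢(ℝ × ℝ, ℂ)) : ℝ := (∫ z, ‖f z‖ ^ p) ^ (1 / p)

lemma nrm_nonneg (p : ℝ) (f : 𝓢(ℝ × ℝ, ℂ)) : 0 ≤ nrm p f := by
  unfold nrm; positivity

lemma LpNorm_schwartz {p : ℝ} (hp : 0 < p) (f : 𝓢(ℝ × ℝ, ℂ)) :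
    LpNorm p f = ENNReal.ofReal (nrm p f) := by
  have hm : MemLp f (ENNReal.ofReal p) volume := f.memLp _
  unfold LpNorm nrm
  rw [hm.eLpNorm_eq_integral_rpow_norm (by simpa using hp) ENNReal.ofReal_ne_top,
    ENNReal.toReal_ofReal hp.le, one_div]

/-- The integrand `f̂(ξ) ĝ(η) ĥ(-ξ-η)`. -/
def triFT (f g h : 𝓢(ℝ × ℝ, ℂ)) (w : (ℝ × ℝ) × (ℝ × ℝ)) : ℂ :=
  ftS f w.1 * ftS g w.2 * ftS h (-(w.1 + w.2))

lemma integrable_triFT (f g h : 𝓢(ℝ × ℝ, ℂ)) : Integrable (triFT f g h) := by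
  obtain ⟨C, hC⟩ := (ftS h).exists_norm_le
  refine ((ftS f).integrable.mul_prod (ftS g).integrable).mul_bdd (c := C) ?_ ?_
  · exact Continuous.aestronglyMeasurable (by fun_prop)
  · exact Eventually.of_forall fun w => hC _

/-- The trilinear form with symbol `M`. -/
def trilin (M : (ℝ × ℝ) × (ℝ × ℝ) → ℂ) (f g h : 𝓢(ℝ × ℝ, ℂ)) : ℂ :=
  ∫ w, M w * triFT f g h w

/-- The trilinear form with symbol `M` is bounded by `A` on `L^p × L^q × L^r`. -/
def SymBdd (p q r : ℝ) (M : (ℝ × ℝ) × (ℝ × ℝ) → ℂ) (A : ℝ) : Prop :=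
  ∀ f g h, ‖trilin M f g h‖ ≤ A * (nrm p f * nrm q g * nrm r h)

/-- The multiplier with symbol `a` is bounded by `A` on `L^p`. -/
def MulBdd (p : ℝ) (a : ℝ × ℝ → ℂ) (A : ℝ) : Prop :=
  ∀ f, nrm p (fmul a f) ≤ A * nrm p f

section

lemma integrable_mul_triFT {M : (ℝ × ℝ) × (ℝ × ℝ) → ℂ} {K : ℝ}
    (hM : AEStronglyMeasurable M) (hK : ∀ w, ‖M w‖ ≤ K) (f g h : 𝓢(ℝ × ℝ, ℂ)) :
    Integrable (fun w => M w * triFT f g h w) :=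
  (integrable_triFT f g h).bdd_mul hM (.of_forall hK)

lemma trilin_shift (f g h : 𝓢(ℝ × ℝ, ℂ)) (x₁ x₂ x₀ : ℝ × ℝ) :
    ∫ z, f (z + x₁) * g (z + x₂) * h (z + x₀) =
      trilin (fun w => e2π (x₁.1 * w.1.1 + x₁.2 * w.1.2) * e2π (x₂.1 * w.2.1 + x₂.2 * w.2.2) *
        e2π (-(x₀.1 * (w.1.1 + w.2.1) + x₀.2 * (w.1.2 + w.2.2)))) f g h := by
  have h1 : ∀ z : ℝ × ℝ, f (z + x₁) * g (z + x₂) * h (z + x₀) =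
      ∫ w : (ℝ × ℝ) × (ℝ × ℝ), ftS f w.1 * e2π ((z + x₁).1 * w.1.1 + (z + x₁).2 * w.1.2) *
        (ftS g w.2 * e2π ((z + x₂).1 * w.2.1 + (z + x₂).2 * w.2.2)) * h (z + x₀) := by
    intro z
    rw [integral_mul_const, Measure.volume_eq_prod, integral_prod_mul
      (fun ξ : ℝ × ℝ => ftS f ξ * e2π ((z + x₁).1 * ξ.1 + (z + x₁).2 * ξ.2))
      (fun η : ℝ × ℝ => ftS g η * e2π ((z + x₂).1 * η.1 + (z + x₂).2 * η.2)),
      ← f.eq_integral_ftS, ← g.eq_integral_ftS]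
  simp_rw [h1]
  rw [integral_integral_swap]
  · unfold trilin
    refine integral_congr_ae (.of_forall fun w => ?_)
    change ∫ z : ℝ × ℝ, _ = _
    have h2 : ftS h (-(w.1 + w.2)) = ∫ z : ℝ × ℝ, h (z + x₀) *
        e2π ((z + x₀).1 * (w.1.1 + w.2.1) + (z + x₀).2 * (w.1.2 + w.2.2)) := by
      rw [ftS_apply, FT2, integral_add_right_eq_self (fun z : ℝ × ℝ => h z *
        e2π (z.1 * (w.1.1 + w.2.1) + z.2 * (w.1.2 + w.2.2)))]
      refine integral_congr_ae (.of_forall fun z => ?_)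
      simp only [Prod.fst_neg, Prod.snd_neg, Prod.fst_add, Prod.snd_add]
      ring_nf
    simp only [triFT]
    rw [h2, ← integral_const_mul, ← integral_const_mul]
    refine integral_congr_ae (.of_forall fun z => ?_)
    simp only [Prod.fst_add, Prod.snd_add]
    have e1 : e2π ((z.1 + x₁.1) * w.1.1 + (z.2 + x₁.2) * w.1.2) *
        e2π ((z.1 + x₂.1) * w.2.1 + (z.2 + x₂.2) * w.2.2) =
        e2π (x₁.1 * w.1.1 + x₁.2 * w.1.2) * e2π (x₂.1 * w.2.1 + x₂.2 * w.2.2) *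
        e2π (-(x₀.1 * (w.1.1 + w.2.1) + x₀.2 * (w.1.2 + w.2.2))) *
        e2π ((z.1 + x₀.1) * (w.1.1 + w.2.1) + (z.2 + x₀.2) * (w.1.2 + w.2.2)) := by
      simp only [← e2π_add]; ring_nf
    linear_combination ftS f w.1 * ftS g w.2 * h (z + x₀) * e1
  · have hi : Integrable (fun p : (ℝ × ℝ) × ((ℝ × ℝ) × (ℝ × ℝ)) =>
        h (p.1 + x₀) * (ftS f p.2.1 * ftS g p.2.2)) :=
      (h.integrable.comp_add_right x₀).mul_prod ((ftS f).integrable.mul_prod (ftS g).integrable)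
    refine hi.mono (Continuous.aestronglyMeasurable ?_) (.of_forall fun p => ?_)
    · simp only [Prod.fst_add, Prod.snd_add]
      fun_prop
    · simp only [Function.uncurry, norm_mul, norm_e2π]
      exact le_of_eq (by ring)

lemma trilin_mul {a b c : ℝ × ℝ → ℂ} (ha : a.HasTemperateGrowth) (hb : b.HasTemperateGrowth)
    (hc : c.HasTemperateGrowth) (M : (ℝ × ℝ) × (ℝ × ℝ) → ℂ) (f g h : 𝓢(ℝ × ℝ, ℂ)) :
    trilin M (fmul a f) (fmul b g) (fmul c h) =
      trilin (fun w => M w * (a w.1 * b w.2 * c (-(w.1 + w.2)))) f g h := by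
  unfold trilin triFT
  simp only [ftS_fmul ha, ftS_fmul hb, ftS_fmul hc]
  exact integral_congr_ae (.of_forall fun w => by ring)

variable {p q r : ℝ}

lemma SymBdd.mono {M : (ℝ × ℝ) × (ℝ × ℝ) → ℂ} {A B : ℝ} (hM : SymBdd p q r M A) (h : A ≤ B) :
    SymBdd p q r M B := fun f g k =>
  (hM f g k).trans (mul_le_mul_of_nonneg_right h
    (mul_nonneg (mul_nonneg (nrm_nonneg _ _) (nrm_nonneg _ _)) (nrm_nonneg _ _)))

lemma SymBdd.mul {a b c : ℝ × ℝ → ℂ} (ha : a.HasTemperateGrowth) (hb : b.HasTemperateGrowth)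
    (hc : c.HasTemperateGrowth) {M : (ℝ × ℝ) × (ℝ × ℝ) → ℂ} {A A₁ A₂ A₃ : ℝ} (hA : 0 ≤ A)
    (hA₁ : 0 ≤ A₁) (hA₂ : 0 ≤ A₂)
    (hM : SymBdd p q r M A) (h₁ : MulBdd p a A₁) (h₂ : MulBdd q b A₂) (h₃ : MulBdd r c A₃) :
    SymBdd p q r (fun w => M w * (a w.1 * b w.2 * c (-(w.1 + w.2)))) (A * (A₁ * A₂ * A₃)) := by
  intro f g h
  rw [← trilin_mul ha hb hc]
  refine (hM _ _ _).trans ?_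
  rw [mul_assoc A]
  refine mul_le_mul_of_nonneg_left ?_ hA
  calc _ ≤ (A₁ * nrm p f) * (A₂ * nrm q g) * (A₃ * nrm r h) := by
        have := nrm_nonneg p f
        have := nrm_nonneg q g
        have := nrm_nonneg r h
        have := nrm_nonneg q (fmul b g)
        have := nrm_nonneg r (fmul c h)
        gcongr
        · exact h₁ f
        · exact h₂ g
        · exact h₃ h
    _ = _ := by ring

lemma SymBdd.sum {ι : Type*} (s : Finset ι) {M : ι → (ℝ × ℝ) × (ℝ × ℝ) → ℂ} {A K : ι → ℝ}
    (hm : ∀ i ∈ s, AEStronglyMeasurable (M i)) (hK : ∀ i ∈ s, ∀ w, ‖M i w‖ ≤ K i)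
    (h : ∀ i ∈ s, SymBdd p q r (M i) (A i)) :
    SymBdd p q r (fun w => ∑ i ∈ s, M i w) (∑ i ∈ s, A i) := by
  intro f g k
  have : trilin (fun w => ∑ i ∈ s, M i w) f g k = ∑ i ∈ s, trilin (M i) f g k := by
    unfold trilin
    rw [← integral_finsetSum _ fun i hi => integrable_mul_triFT (hm i hi) (hK i hi) f g k]
    simp_rw [Finset.sum_mul]
  rw [this, Finset.sum_mul]
  exact (norm_sum_le _ _).trans (Finset.sum_le_sum fun i hi => h i hi f g k)

lemma SymBdd.const_mul {M : (ℝ × ℝ) × (ℝ × ℝ) → ℂ} {A : ℝ} (h : SymBdd p q r M A) (c : ℂ) :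
    SymBdd p q r (fun w => c * M w) (‖c‖ * A) := by
  intro f g k
  have : trilin (fun w => c * M w) f g k = c * trilin M f g k := by
    unfold trilin
    rw [← integral_const_mul]
    simp_rw [mul_assoc]
  rw [this, norm_mul, mul_assoc]
  exact mul_le_mul_of_nonneg_left (h f g k) (norm_nonneg _)

lemma SymBdd.integral {X : Type*} [MeasurableSpace X] {μ : Measure X} [SFinite μ]
    {M : X → (ℝ × ℝ) × (ℝ × ℝ) → ℂ} {A K : X → ℝ}
    (hm : AEStronglyMeasurable (Function.uncurry M) (μ.prod volume))
    (hK : ∀ x w, ‖M x w‖ ≤ K x) (hKi : Integrable K μ) (hA : Integrable A μ)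
    (h : ∀ x, SymBdd p q r (M x) (A x)) :
    SymBdd p q r (fun w => ∫ x, M x w ∂μ) (∫ x, A x ∂μ) := by
  intro f g k
  have : trilin (fun w => ∫ x, M x w ∂μ) f g k = ∫ x, trilin (M x) f g k ∂μ := by
    unfold trilin
    rw [integral_integral_swap]
    · simp_rw [integral_mul_const]
    · refine (hKi.mul_prod (integrable_triFT f g k).norm).mono'
        (hm.mul ((integrable_triFT f g k).aestronglyMeasurable.comp_snd))
        (.of_forall fun z => ?_)
      simp only [Function.uncurry, norm_mul]
      exact mul_le_mul_of_nonneg_right (hK _ _) (norm_nonneg _)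
  rw [this, ← integral_mul_const]
  exact norm_integral_le_of_norm_le (hA.mul_const _) (.of_forall fun x => h x f g k)

lemma SymBdd.tendsto {ι : Type*} {l : Filter ι} [l.NeBot] [l.IsCountablyGenerated]
    {M : ι → (ℝ × ℝ) × (ℝ × ℝ) → ℂ} {M' : (ℝ × ℝ) × (ℝ × ℝ) → ℂ} {A K : ℝ}
    (hm : ∀ᶠ i in l, AEStronglyMeasurable (M i)) (hK : ∀ᶠ i in l, ∀ w, ‖M i w‖ ≤ K)
    (h : ∀ᶠ i in l, SymBdd p q r (M i) A)
    (hl : ∀ᵐ w, Tendsto (fun i => M i w) l (𝓝 (M' w))) : SymBdd p q r M' A := by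
  intro f g k
  have : Tendsto (fun i => trilin (M i) f g k) l (𝓝 (trilin M' f g k)) := by
    refine tendsto_integral_filter_of_dominated_convergence
      (fun w => K * ‖triFT f g k w‖) ?_ ?_ ((integrable_triFT f g k).norm.const_mul K) ?_
    · filter_upwards [hm] with i hi
      exact hi.mul (integrable_triFT f g k).aestronglyMeasurable
    · filter_upwards [hK] with i hi
      refine Eventually.of_forall fun w => ?_
      rw [norm_mul]
      exact mul_le_mul_of_nonneg_right (hi w) (norm_nonneg _)
    · filter_upwards [hl] with w hw
      exact hw.mul_const _
  exact le_of_tendsto this.norm (h.mono fun i hi => hi f g k)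

lemma contDiff_e2π {n : WithTop ℕ∞} : ContDiff ℝ n e2π := by
  unfold e2π
  exact (contDiff_const.mul Complex.ofRealCLM.contDiff).cexp

lemma hasDerivAt_e2π (t : ℝ) : HasDerivAt e2π (2 * Real.pi * Complex.I * e2π t) t := by
  have h := ((Complex.ofRealCLM.hasDerivAt (x := t)).const_mul
    (2 * (Real.pi : ℂ) * Complex.I)).cexp
  refine h.congr_deriv ?_
  simp [e2π]
  ring

lemma iteratedDeriv_e2π (n : ℕ) :
    iteratedDeriv n e2π = fun t => (2 * Real.pi * Complex.I) ^ n * e2π t := by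
  induction n with
  | zero => ext; simp
  | succ n ih =>
    rw [iteratedDeriv_succ, ih]
    ext t
    rw [((hasDerivAt_e2π t).const_mul _).deriv]
    ring

lemma hasTemperateGrowth_e2π_real : e2π.HasTemperateGrowth := by
  refine ⟨contDiff_e2π, fun n => ⟨0, (2 * Real.pi) ^ n, fun x => ?_⟩⟩
  rw [norm_iteratedFDeriv_eq_norm_iteratedDeriv, iteratedDeriv_e2π]
  simp [norm_e2π, abs_of_pos Real.pi_pos]

lemma hasTemperateGrowth_e2π_linear (L : ℝ × ℝ →L[ℝ] ℝ) :
    (fun ζ => e2π (L ζ)).HasTemperateGrowth :=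
  hasTemperateGrowth_e2π_real.comp L.hasTemperateGrowth

lemma hasTemperateGrowth_e2π (u : ℝ × ℝ) :
    (fun ζ : ℝ × ℝ => e2π (u.1 * ζ.1 + u.2 * ζ.2)).HasTemperateGrowth := by
  simpa using hasTemperateGrowth_e2π_linear
    (u.1 • ContinuousLinearMap.fst ℝ ℝ ℝ + u.2 • ContinuousLinearMap.snd ℝ ℝ ℝ)

lemma fmul_e2π_apply (u : ℝ × ℝ) (f : 𝓢(ℝ × ℝ, ℂ)) (z : ℝ × ℝ) :
    fmul (fun ζ : ℝ × ℝ => e2π (u.1 * ζ.1 + u.2 * ζ.2)) f z = f (z + u) := by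
  rw [SchwartzMap.eq_integral_ftS, f.eq_integral_ftS]
  simp_rw [ftS_fmul (hasTemperateGrowth_e2π u)]
  refine integral_congr_ae (.of_forall fun ζ => ?_)
  simp only [Prod.fst_add, Prod.snd_add]
  rw [show (z.1 + u.1) * ζ.1 + (z.2 + u.2) * ζ.2 =
    (u.1 * ζ.1 + u.2 * ζ.2) + (z.1 * ζ.1 + z.2 * ζ.2) by ring,
    e2π_add (u.1 * ζ.1 + u.2 * ζ.2)]
  ring

lemma mulBdd_e2π (p : ℝ) (u : ℝ × ℝ) :
    MulBdd p (fun ζ : ℝ × ℝ => e2π (u.1 * ζ.1 + u.2 * ζ.2)) 1 := by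
  intro f
  unfold nrm
  simp_rw [fmul_e2π_apply]
  rw [integral_add_right_eq_self (fun z => ‖f z‖ ^ p), one_mul]

end

lemma multilinear_expand {ι X : Type*} [Fintype ι] [DecidableEq ι] [DecidableEq X]
    (Λ : MultilinearMap ℂ (fun _ : ι => X → ℂ) ℂ) (B : Finset X) (F : ι → X → ℂ) :
    Λ (fun i x => if x ∈ B then F i x else 0) =
      ∑ x ∈ Fintype.piFinset fun _ : ι => B,
        (∏ i, F i (x i)) * Λ (fun i => Pi.single (x i) 1) := by
  have h : (fun i x => if x ∈ B then F i x else 0) =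
      fun i => ∑ y ∈ B, F i y • (Pi.single y (1 : ℂ) : X → ℂ) := by
    ext i x
    simp only [Finset.sum_apply, Pi.smul_apply, Pi.single_apply, smul_eq_mul, mul_ite, mul_one,
      mul_zero, Finset.sum_ite_eq]
  rw [h, Λ.map_sum_finset]
  refine Finset.sum_congr rfl fun x _ => ?_
  rw [Λ.map_smul_univ, smul_eq_mul]

lemma integral_prod_rpow_le {X ι : Type*} [MeasurableSpace X] {μ : Measure X} [Fintype ι]
    (u : ι → X → ℝ) (a : ι → ℝ) (ha : ∀ i, 0 ≤ a i) (hsum : ∑ i, a i = 1)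
    (h0 : ∀ i x, 0 ≤ u i x) (hu : ∀ i, Integrable (u i) μ) :
    Integrable (fun x => ∏ i, u i x ^ a i) μ ∧
    ∫ x, ∏ i, u i x ^ a i ∂μ ≤ ∏ i, (∫ x, u i x ∂μ) ^ a i := by
  have hm : AEStronglyMeasurable (fun x => ∏ i, u i x ^ a i) μ :=
    Finset.aestronglyMeasurable_fun_prod _
      fun i _ => ((hu i).aestronglyMeasurable.aemeasurable.pow_const _).aestronglyMeasurable
  have h1 : ∫⁻ x, ENNReal.ofReal (∏ i, u i x ^ a i) ∂μ ≤
      ENNReal.ofReal (∏ i, (∫ x, u i x ∂μ) ^ a i) := by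
    have h2 := ENNReal.lintegral_prod_norm_pow_le (μ := μ) Finset.univ
      (f := fun i x => ENNReal.ofReal (u i x)) (p := a)
      (fun i _ => (hu i).aestronglyMeasurable.aemeasurable.ennreal_ofReal) hsum
      (fun i _ => ha i)
    have h3 : ∀ x, ENNReal.ofReal (∏ i, u i x ^ a i) = ∏ i, ENNReal.ofReal (u i x) ^ a i := by
      intro x
      rw [ENNReal.ofReal_prod_of_nonneg fun i _ => Real.rpow_nonneg (h0 i x) _]
      exact Finset.prod_congr rfl fun i _ =>
        (ENNReal.ofReal_rpow_of_nonneg (h0 i x) (ha i)).symm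
    simp_rw [h3]
    refine h2.trans (le_of_eq ?_)
    rw [ENNReal.ofReal_prod_of_nonneg fun i _ => Real.rpow_nonneg (integral_nonneg (h0 i)) _]
    refine Finset.prod_congr rfl fun i _ => ?_
    rw [← ENNReal.ofReal_rpow_of_nonneg (integral_nonneg (h0 i)) (ha i),
      ofReal_integral_eq_lintegral_ofReal (hu i) (.of_forall (h0 i))]
  have h4 : ∀ x, 0 ≤ ∏ i, u i x ^ a i := fun x =>
    Finset.prod_nonneg fun i _ => Real.rpow_nonneg (h0 i x) _
  refine ⟨⟨hm, ?_⟩, ?_⟩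
  · rw [hasFiniteIntegral_iff_ofReal (.of_forall h4)]
    exact h1.trans_lt ENNReal.ofReal_lt_top
  · rw [integral_eq_lintegral_of_nonneg_ae (.of_forall h4) hm]
    exact ENNReal.toReal_le_of_le_ofReal
      (Finset.prod_nonneg fun i _ => Real.rpow_nonneg (integral_nonneg (h0 i)) _) h1

lemma integrable_norm_rpow (f : 𝓢(ℝ × ℝ, ℂ)) {p : ℝ} (hp : 0 < p) :
    Integrable (fun z => ‖f z‖ ^ p) := by
  have := (f.memLp (ENNReal.ofReal p) volume).integrable_norm_rpow (by simpa using hp)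
    ENNReal.ofReal_ne_top
  rwa [ENNReal.toReal_ofReal hp.le] at this

lemma integral_multilinear_le {ι X : Type*} [Fintype ι] [DecidableEq ι] [DecidableEq X]
    (Λ : MultilinearMap ℂ (fun _ : ι => X → ℂ) ℂ) (B : Finset X) (hB : B.Nonempty)
    (a : ι → ℝ) (ha : ∀ i, 0 < a i)
    (hsum : ∑ i, a i = 1) {C : ℝ} (hC : 0 ≤ C)
    (hΛ : ∀ F, (∀ i, ∀ x ∉ B, F i x = 0) →
      ‖Λ F‖ ≤ C * ∏ i, (∑ x ∈ B, ‖F i x‖ ^ (1 / a i)) ^ a i)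
    (pos : X → ℝ × ℝ) (f : ι → 𝓢(ℝ × ℝ, ℂ)) (c : ι → X → ℂ) (hc : ∀ i x, ‖c i x‖ ≤ 1) :
    ‖∫ z, Λ (fun i x => if x ∈ B then c i x * f i (z + pos x) else 0)‖ ≤
      C * (B.card * ∏ i, nrm (1 / a i) (f i)) := by
  have hi : ∀ i, Integrable (fun z => ∑ x ∈ B, ‖f i (z + pos x)‖ ^ (1 / a i)) := fun i =>
    integrable_finsetSum _ fun x _ =>
      (integrable_norm_rpow (f i) (by have := ha i; positivity)).comp_add_right (pos x)
  have hval : ∀ i, ∫ z, ∑ x ∈ B, ‖f i (z + pos x)‖ ^ (1 / a i) =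
      B.card * ∫ z, ‖f i z‖ ^ (1 / a i) := by
    intro i
    rw [integral_finsetSum _ fun x _ =>
      (integrable_norm_rpow (f i) (by have := ha i; positivity)).comp_add_right (pos x)]
    simp_rw [integral_add_right_eq_self (fun z => ‖f i z‖ ^ (1 / a i))]
    simp
  obtain ⟨h1, h2⟩ := integral_prod_rpow_le (μ := volume)
    (fun i z => ∑ x ∈ B, ‖f i (z + pos x)‖ ^ (1 / a i)) a (fun i => (ha i).le) hsum
    (fun i z => Finset.sum_nonneg fun x _ => by positivity) hi
  refine (norm_integral_le_of_norm_le (h1.const_mul C) (.of_forall fun z => ?_)).trans ?_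
  · refine (hΛ _ fun i x hx => by simp [hx]).trans (mul_le_mul_of_nonneg_left ?_ hC)
    refine Finset.prod_le_prod (fun i _ => by positivity) fun i _ => ?_
    refine Real.rpow_le_rpow (Finset.sum_nonneg fun x _ => by positivity) ?_ (ha i).le
    refine Finset.sum_le_sum fun x hx => ?_
    refine Real.rpow_le_rpow (norm_nonneg _) ?_ (by have := ha i; positivity)
    rw [if_pos hx, norm_mul]
    exact mul_le_of_le_one_left (norm_nonneg _) (hc i x)
  · rw [integral_const_mul]
    refine mul_le_mul_of_nonneg_left (h2.trans (le_of_eq ?_)) hC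
    simp_rw [hval]
    have hn : (0 : ℝ) ≤ B.card := Nat.cast_nonneg _
    have hp : (0 : ℝ) < B.card := by exact_mod_cast hB.card_pos
    rw [Finset.prod_congr rfl fun i _ => Real.mul_rpow (z := a i) hn
      (integral_nonneg fun z => by positivity : 0 ≤ ∫ z, ‖f i z‖ ^ (1 / a i)),
      Finset.prod_mul_distrib, ← Real.rpow_sum_of_pos hp, hsum, Real.rpow_one]
    simp [nrm]

/-- The symbol of a discrete trilinear form sampled along `pos`. -/
def discSymbol {X : Type*} [DecidableEq X] (Λ : MultilinearMap ℂ (fun _ : Fin 3 => X → ℂ) ℂ)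
    (B : Finset X) (pos : X → ℝ × ℝ) (w : (ℝ × ℝ) × (ℝ × ℝ)) : ℂ :=
  Λ (fun i x => if x ∈ B then
    (![fun x => e2π (-((pos x).1 * (w.1.1 + w.2.1) + (pos x).2 * (w.1.2 + w.2.2))),
      fun x => e2π ((pos x).1 * w.1.1 + (pos x).2 * w.1.2),
      fun x => e2π ((pos x).1 * w.2.1 + (pos x).2 * w.2.2)] : Fin 3 → X → ℂ) i x else 0)

lemma integrable_tri (f g h : 𝓢(ℝ × ℝ, ℂ)) (x₀ x₁ x₂ : ℝ × ℝ) :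
    Integrable (fun z => h (z + x₀) * f (z + x₁) * g (z + x₂)) := by
  obtain ⟨C, hC⟩ := f.exists_norm_le
  obtain ⟨C', hC'⟩ := g.exists_norm_le
  exact ((h.integrable.comp_add_right x₀).mul_bdd (c := C)
    (Continuous.aestronglyMeasurable (by fun_prop)) (.of_forall fun z => hC _)).mul_bdd
    (c := C') (Continuous.aestronglyMeasurable (by fun_prop)) (.of_forall fun z => hC' _)

lemma integral_eq_trilin_discSymbol {X : Type*} [DecidableEq X]
    (Λ : MultilinearMap ℂ (fun _ : Fin 3 => X → ℂ) ℂ) (B : Finset X) (pos : X → ℝ × ℝ)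
    (f g h : 𝓢(ℝ × ℝ, ℂ)) :
    ∫ z, Λ (fun i x => if x ∈ B then
      (1 : ℂ) * (![h, f, g] : Fin 3 → 𝓢(ℝ × ℝ, ℂ)) i (z + pos x) else 0) =
      trilin (discSymbol Λ B pos) f g h := by
  simp_rw [multilinear_expand Λ B (fun i x => (1 : ℂ) * _)]
  unfold trilin discSymbol
  simp_rw [multilinear_expand Λ B, Finset.sum_mul]
  rw [integral_finsetSum, integral_finsetSum]
  · refine Finset.sum_congr rfl fun x _ => ?_
    simp only [Fin.prod_univ_three, one_mul, Matrix.cons_val_zero, Matrix.cons_val_one,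
      Matrix.cons_val]
    rw [integral_mul_const]
    have h1 := trilin_shift f g h (pos (x 1)) (pos (x 2)) (pos (x 0))
    unfold trilin at h1
    rw [show (fun z => h (z + pos (x 0)) * f (z + pos (x 1)) * g (z + pos (x 2))) =
      fun z => f (z + pos (x 1)) * g (z + pos (x 2)) * h (z + pos (x 0)) by ext; ring, h1,
      ← integral_mul_const]
    exact integral_congr_ae (.of_forall fun w => by ring)
  · intro x _
    have h1 := integrable_mul_triFT (M := fun w => (∏ i,
      (![fun x => e2π (-((pos x).1 * (w.1.1 + w.2.1) + (pos x).2 * (w.1.2 + w.2.2))),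
      fun x => e2π ((pos x).1 * w.1.1 + (pos x).2 * w.1.2),
      fun x => e2π ((pos x).1 * w.2.1 + (pos x).2 * w.2.2)] : Fin 3 → X → ℂ) i (x i)) *
        Λ (fun i => Pi.single (x i) 1)) (K := ‖Λ (fun i => Pi.single (x i) 1)‖) ?_ ?_ f g h
    · exact h1
    · refine Continuous.aestronglyMeasurable ?_
      simp only [Fin.prod_univ_three, Matrix.cons_val_zero, Matrix.cons_val_one, Matrix.cons_val]
      fun_prop
    · intro w
      simp [Fin.prod_univ_three, norm_e2π]
  · intro x _
    simp only [Fin.prod_univ_three, one_mul, Matrix.cons_val_zero, Matrix.cons_val_one,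
      Matrix.cons_val]
    exact (integrable_tri f g h _ _ _).mul_const _

lemma symBdd_discSymbol {X : Type*} [DecidableEq X]
    (Λ : MultilinearMap ℂ (fun _ : Fin 3 => X → ℂ) ℂ) (B : Finset X) (hB : B.Nonempty)
    (a : Fin 3 → ℝ) (ha : ∀ i, 0 < a i) (hsum : ∑ i, a i = 1) {C : ℝ} (hC : 0 ≤ C)
    (hΛ : ∀ F, (∀ i, ∀ x ∉ B, F i x = 0) →
      ‖Λ F‖ ≤ C * ∏ i, (∑ x ∈ B, ‖F i x‖ ^ (1 / a i)) ^ a i) (pos : X → ℝ × ℝ) :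
    SymBdd (1 / a 1) (1 / a 2) (1 / a 0) (discSymbol Λ B pos) (C * B.card) := by
  intro f g h
  rw [← integral_eq_trilin_discSymbol]
  refine (integral_multilinear_le Λ B hB a ha hsum hC hΛ pos ![h, f, g] (fun _ _ => 1)
    (by simp)).trans (le_of_eq ?_)
  simp only [Fin.prod_univ_three, Matrix.cons_val_zero, Matrix.cons_val_one, Matrix.cons_val]
  ring

/-- The average of the character `e2π (a θ)` over `0 ≤ a < 2 ^ k`. -/
def charAvg (k : ℕ) (θ : ℝ) : ℂ := (2 ^ k)⁻¹ * ∑ a ∈ Finset.range (2 ^ k), e2π (a * θ)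

lemma sum_dyadicIco_e2π (k : ℕ) (a : ℤ) (θ : ℝ) :
    ∑ x ∈ dyadicIco k a, e2π (x * θ) = 2 ^ k * (e2π (a * 2 ^ k * θ) * charAvg k θ) := by
  have h : dyadicIco k a = (Finset.range (2 ^ k)).image fun j : ℕ => a * 2 ^ k + (j : ℤ) := by
    ext x
    rw [dyadicIco, Finset.mem_Ico, Finset.mem_image]
    constructor
    · intro hx
      refine ⟨(x - a * 2 ^ k).toNat, ?_, ?_⟩
      · rw [Finset.mem_range]
        have : x - a * 2 ^ k < ((2 ^ k : ℕ) : ℤ) := by push_cast; linarith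
        omega
      · rw [Int.toNat_of_nonneg (by linarith)]; ring
    · rintro ⟨j, hj, rfl⟩
      rw [Finset.mem_range] at hj
      have : (j : ℤ) < 2 ^ k := by exact_mod_cast hj
      constructor <;> linarith
  rw [h, Finset.sum_image (fun i _ j _ hij => by simpa using hij), charAvg]
  have h2 : (2 : ℂ) ^ k ≠ 0 := pow_ne_zero _ two_ne_zero
  rw [mul_left_comm (e2π _), ← mul_assoc, mul_inv_cancel₀ h2, one_mul, Finset.mul_sum]
  refine Finset.sum_congr rfl fun j _ => ?_
  rw [← e2π_add]
  congr 1; push_cast; ring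

lemma sum_e2π_mul_dyadicAvg {k : ℕ} {θ : ℝ} {N : ℕ} (hN : k ≤ N) : ∀ a : ℤ,
    ∑ x ∈ dyadicIco N a, e2π (-(x * θ)) * dyadicAvg k (fun x : ℤ => e2π (x * θ)) x =
      2 ^ N * (charAvg k θ * charAvg k (-θ)) := by
  induction N, hN using Nat.le_induction with
  | base =>
    intro a
    have h1 : ∀ x ∈ dyadicIco k a, e2π (-(x * θ)) * dyadicAvg k (fun x : ℤ => e2π (x * θ)) x =
        e2π (x * -θ) * (e2π (a * 2 ^ k * θ) * charAvg k θ) := by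
      intro x hx
      rw [mem_dyadicIco] at hx
      rw [dyadicAvg, hx, sum_dyadicIco_e2π, inv_mul_cancel_left₀ (pow_ne_zero _ two_ne_zero), mul_neg]
    rw [Finset.sum_congr rfl h1, ← Finset.sum_mul, sum_dyadicIco_e2π]
    have h2 : e2π (a * 2 ^ k * -θ) * e2π (a * 2 ^ k * θ) = 1 := by
      rw [← e2π_add, ← e2π_zero]; congr 1; ring
    linear_combination 2 ^ k * charAvg k θ * charAvg k (-θ) * h2
  | succ N hN ih =>
    intro a
    rw [sum_dyadicIco_succ, ih, ih]
    ring

lemma dyadicIco_subset_dyadicBox {k n : ℕ} (hk : k ≤ n) {x : ℤ} (hx : x ∈ dyadicBox n) :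
    dyadicIco k (x / 2 ^ k) ⊆ dyadicBox n := by
  intro y hy
  rw [dyadicBox, Finset.mem_Ico] at *
  rw [mem_dyadicIco] at hy
  have h1 : (0 : ℤ) < 2 ^ k := by positivity
  have h2 : (2 : ℤ) ^ n = 2 ^ (n - k) * 2 ^ k := by rw [← pow_add]; congr 1; omega
  have h3 : -2 ^ (n - k) ≤ x / 2 ^ k := by
    rw [Int.le_ediv_iff_mul_le h1]; linarith [hx.1]
  have h4 : x / 2 ^ k < 2 ^ (n - k) := by
    rw [Int.ediv_lt_iff_lt_mul h1]; linarith [hx.2]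
  rw [← hy] at h3 h4
  rw [Int.le_ediv_iff_mul_le h1] at h3
  rw [Int.ediv_lt_iff_lt_mul h1] at h4
  constructor <;> linarith

lemma sum_dyadicBox_e2π_mul_dyadicAvg {k n : ℕ} (hk : k ≤ n) (θ : ℝ) :
    ∑ x ∈ dyadicBox n, e2π (-(x * θ)) * dyadicAvg k (fun x : ℤ => e2π (x * θ)) x =
      2 ^ (n + 1) * (charAvg k θ * charAvg k (-θ)) := by
  rw [sum_dyadicBox, sum_e2π_mul_dyadicAvg hk, sum_e2π_mul_dyadicAvg hk]
  ring

lemma dyadicAvg_congr {k : ℕ} {u v : ℤ → ℂ} {x : ℤ}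
    (h : ∀ y ∈ dyadicIco k (x / 2 ^ k), u y = v y) : dyadicAvg k u x = dyadicAvg k v x := by
  rw [dyadicAvg, dyadicAvg, Finset.sum_congr rfl h]

/-- The Fourier symbol of the dyadic twisted paraproduct. -/
def dyadicSymbol (n : ℕ) (θ₁ θ₂ : ℝ) : ℂ :=
  ∑ k ∈ Finset.range n, charAvg (k + 1) θ₁ * charAvg (k + 1) (-θ₁) *
    (charAvg k θ₂ * charAvg k (-θ₂) - charAvg (k + 1) θ₂ * charAvg (k + 1) (-θ₂))

lemma discSymbol_twistedMap (n : ℕ) (ε₁ ε₂ : ℝ) (w : (ℝ × ℝ) × (ℝ × ℝ)) :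
    discSymbol (twistedMap n) (dyadicBox n ×ˢ dyadicBox n)
      (fun z : ℤ × ℤ => (ε₁ * z.1, ε₂ * z.2)) w =
      2 ^ (n + 1) * 2 ^ (n + 1) * dyadicSymbol n (ε₁ * w.1.1) (ε₂ * w.2.2) := by
  rw [discSymbol, twistedMap_apply, twistedForm, dyadicSymbol, Finset.mul_sum]
  refine Finset.sum_congr rfl fun k hk => ?_
  rw [Finset.mem_range] at hk
  have e1 := sum_dyadicBox_e2π_mul_dyadicAvg (show k + 1 ≤ n by omega) (ε₁ * w.1.1)
  have e2 := sum_dyadicBox_e2π_mul_dyadicAvg (show k + 1 ≤ n by omega) (ε₂ * w.2.2)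
  have e3 := sum_dyadicBox_e2π_mul_dyadicAvg (show k ≤ n by omega) (ε₂ * w.2.2)
  have e4 : ∀ A B D : ℂ, (2 : ℂ) ^ (n + 1) * 2 ^ (n + 1) * (A * (B - D)) =
    (2 ^ (n + 1) * A) * (2 ^ (n + 1) * B - 2 ^ (n + 1) * D) := by intros; ring
  rw [e4, ← e1, ← e2, ← e3, ← Finset.sum_sub_distrib, Finset.sum_mul_sum, dyadicForm]
  refine Finset.sum_congr rfl fun x hx => Finset.sum_congr rfl fun y hy => ?_
  simp only [Finset.mem_product, hx, hy, true_and, and_true, if_true, and_self,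
    Matrix.cons_val_zero, Matrix.cons_val_one, Matrix.cons_val]
  have f1 : dyadicAvg (k + 1) (fun x' : ℤ => if x' ∈ dyadicBox n then
      e2π (ε₁ * x' * w.1.1 + ε₂ * y * w.1.2) else 0) x =
      e2π (ε₂ * y * w.1.2) * dyadicAvg (k + 1) (fun x : ℤ => e2π (x * (ε₁ * w.1.1))) x := by
    rw [← dyadicAvg_mul]
    refine dyadicAvg_congr fun x' hx' => ?_
    rw [if_pos (dyadicIco_subset_dyadicBox (by omega) hx hx'), ← e2π_add]
    congr 1; ring
  have f2 : ∀ j ≤ n, dyadicAvg j (fun y' : ℤ => if y' ∈ dyadicBox n then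
      e2π (ε₁ * x * w.2.1 + ε₂ * y' * w.2.2) else 0) y =
      e2π (ε₁ * x * w.2.1) * dyadicAvg j (fun y : ℤ => e2π (y * (ε₂ * w.2.2))) y := by
    intro j hj
    rw [← dyadicAvg_mul]
    refine dyadicAvg_congr fun x' hx' => ?_
    rw [if_pos (dyadicIco_subset_dyadicBox hj hy hx'), ← e2π_add]
    congr 1; ring
  rw [f1, f2 _ (by omega), f2 _ (by omega)]
  have f3 : e2π (-(ε₁ * x * (w.1.1 + w.2.1) + ε₂ * y * (w.1.2 + w.2.2))) *
      (e2π (ε₂ * y * w.1.2) * e2π (ε₁ * x * w.2.1)) =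
      e2π (-(x * (ε₁ * w.1.1))) * e2π (-(y * (ε₂ * w.2.2))) := by
    rw [← e2π_add, ← e2π_add, ← e2π_add]; congr 1; ring
  linear_combination (dyadicAvg (k + 1) (fun x : ℤ => e2π (x * (ε₁ * w.1.1))) x *
    (dyadicAvg k (fun y : ℤ => e2π (y * (ε₂ * w.2.2))) y -
      dyadicAvg (k + 1) (fun y : ℤ => e2π (y * (ε₂ * w.2.2))) y)) * f3

lemma card_dyadicBox (n : ℕ) : (dyadicBox n).card = 2 ^ (n + 1) := by
  rw [dyadicBox, Int.card_Ico]
  have : (2 : ℤ) ^ n - -2 ^ n = ((2 ^ (n + 1) : ℕ) : ℤ) := by push_cast; ring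
  rw [this, Int.toNat_natCast]

/-- The symbols of the dyadic twisted paraproducts are uniformly bounded, at every scale. -/
theorem exists_symBdd_dyadicSymbol {a : Fin 3 → ℝ} (ha : ∀ j, 0 < a j) (h0 : a 0 < 1 / 2)
    (hsum : ∑ j, a j = 1) : ∃ C : ℝ, 0 ≤ C ∧ ∀ (n : ℕ) (ε₁ ε₂ : ℝ),
      SymBdd (1 / a 1) (1 / a 2) (1 / a 0)
        (fun w => dyadicSymbol n (ε₁ * w.1.1) (ε₂ * w.2.2)) C := by
  obtain ⟨C, hC, h⟩ := exists_twistedMap_le_full ha h0 hsum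
  refine ⟨C, hC, fun n ε₁ ε₂ => ?_⟩
  have hne : (dyadicBox n ×ˢ dyadicBox n).Nonempty := by
    rw [← Finset.card_pos, Finset.card_product, card_dyadicBox]; positivity
  have h1 := (symBdd_discSymbol (twistedMap n) (dyadicBox n ×ˢ dyadicBox n) hne a ha hsum hC
    (h n) (fun z : ℤ × ℤ => (ε₁ * z.1, ε₂ * z.2))).const_mul
    (((2 : ℂ) ^ (n + 1) * 2 ^ (n + 1))⁻¹)
  simp only [discSymbol_twistedMap] at h1
  have h2 : (2 : ℂ) ^ (n + 1) * 2 ^ (n + 1) ≠ 0 :=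
    mul_ne_zero (pow_ne_zero _ two_ne_zero) (pow_ne_zero _ two_ne_zero)
  simp only [inv_mul_cancel_left₀ h2] at h1
  refine h1.mono (le_of_eq ?_)
  rw [Finset.card_product, card_dyadicBox, norm_inv, norm_mul, norm_pow, Complex.norm_ofNat]
  push_cast
  field_simp

section

variable {p q r : ℝ}

/-- Modulated symbols satisfy the same bounds. -/
lemma SymBdd.mul_e2π {M : (ℝ × ℝ) × (ℝ × ℝ) → ℂ} {A : ℝ} (hA : 0 ≤ A) (hM : SymBdd p q r M A)
    (u v : ℝ × ℝ) : SymBdd p q r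
      (fun w => M w * e2π (u.1 * w.1.1 + u.2 * w.1.2 + (v.1 * w.2.1 + v.2 * w.2.2))) A := by
  have h := hM.mul (hasTemperateGrowth_e2π u) (hasTemperateGrowth_e2π v)
    (hasTemperateGrowth_e2π (0 : ℝ × ℝ)) hA zero_le_one zero_le_one
    (mulBdd_e2π p u) (mulBdd_e2π q v) (mulBdd_e2π r 0)
  simp only [mul_one, Prod.fst_zero, Prod.snd_zero, zero_mul, add_zero, e2π_zero, ← e2π_add] at h
  exact h

/-- The average of `e2π (t x)` over `t ∈ [0, 1]`. -/
def expAvg (x : ℝ) : ℂ := ∫ t in (0 : ℝ)..1, e2π (t * x)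

@[fun_prop] lemma continuous_expAvg : Continuous expAvg := by
  unfold expAvg
  refine intervalIntegral.continuous_parametric_intervalIntegral_of_continuous' ?_ 0 1
  fun_prop

lemma norm_expAvg_le (x : ℝ) : ‖expAvg x‖ ≤ 1 := by
  have := intervalIntegral.norm_integral_le_of_norm_le_const (a := 0) (b := 1)
    (f := fun t => e2π (t * x)) (C := 1) (fun t _ => (norm_e2π _).le)
  simpa [expAvg] using this

lemma SymBdd.mul_expAvg {M : (ℝ × ℝ) × (ℝ × ℝ) → ℂ} {A K : ℝ} (hA : 0 ≤ A)
    (hM : SymBdd p q r M A) (hc : Continuous M) (hK : ∀ w, ‖M w‖ ≤ K) (u v : ℝ × ℝ) :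
    SymBdd p q r
      (fun w => M w * expAvg (u.1 * w.1.1 + u.2 * w.1.2 + (v.1 * w.2.1 + v.2 * w.2.2))) A := by
  have h := SymBdd.integral (p := p) (q := q) (r := r) (μ := volume.restrict (Set.Ioc (0 : ℝ) 1))
    (M := fun t w => M w * e2π (t * (u.1 * w.1.1 + u.2 * w.1.2 + (v.1 * w.2.1 + v.2 * w.2.2))))
    (A := fun _ => A) (K := fun _ => K) ?_ ?_ ?_ ?_ ?_
  · simp only [integral_const, smul_eq_mul] at h
    simpa [expAvg, intervalIntegral.integral_of_le, integral_const_mul] using h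
  · refine Continuous.aestronglyMeasurable ?_
    unfold Function.uncurry
    fun_prop
  · intro t w
    rw [norm_mul, norm_e2π, mul_one]
    exact hK w
  · exact integrable_const _
  · exact integrable_const _
  · intro t
    have := hM.mul_e2π hA (t * u.1, t * u.2) (t * v.1, t * v.2)
    convert this using 5
    ring

lemma expAvg_mul (x : ℝ) : expAvg x * (2 * Real.pi * Complex.I * x) = e2π x - 1 := by
  have h : ∀ t ∈ Set.uIcc (0 : ℝ) 1, HasDerivAt (fun t => e2π (t * x))
      (e2π (t * x) * (2 * Real.pi * Complex.I * x)) t := by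
    intro t _
    have := (hasDerivAt_e2π (t * x)).scomp t ((hasDerivAt_id t).mul_const x)
    rw [one_mul, Complex.real_smul] at this
    exact this.congr_deriv (by ring)
  have := intervalIntegral.integral_eq_sub_of_hasDerivAt h
    (Continuous.intervalIntegrable (by fun_prop) _ _)
  rw [intervalIntegral.integral_mul_const] at this
  rw [expAvg, this]; simp

lemma charAvg_mul_expAvg (k : ℕ) (θ : ℝ) : charAvg k θ * expAvg θ = expAvg (2 ^ k * θ) := by
  have h1 : ∀ a : ℕ, e2π (a * θ) * expAvg θ = ∫ t in (a : ℝ)..(a + 1 : ℕ), e2π (t * θ) := by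
    intro a
    rw [expAvg, ← intervalIntegral.integral_const_mul]
    have := intervalIntegral.integral_comp_add_right (a := 0) (b := 1)
      (fun t => e2π (t * θ)) (a : ℝ)
    rw [zero_add] at this
    rw [show ((a + 1 : ℕ) : ℝ) = 1 + a by push_cast; ring, ← this]
    congr 1; ext t
    rw [← e2π_add]; congr 1; ring
  have h2 : (2 : ℝ) ^ k ≠ 0 := by positivity
  rw [charAvg, mul_assoc, Finset.sum_mul, Finset.sum_congr rfl fun a _ => h1 a,
    intervalIntegral.sum_integral_adjacent_intervals (a := fun a : ℕ => (a : ℝ))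
    (fun a _ => Continuous.intervalIntegrable (by fun_prop) _ _), expAvg]
  have := intervalIntegral.integral_comp_mul_right (a := 0) (b := 1)
    (fun t => e2π (t * θ)) h2
  simp only [mul_assoc] at this
  rw [this]
  simp

/-- The Fejér type kernel `|∫₀¹ e2π (t x) dt|²`. -/
def fejer (x : ℝ) : ℂ := expAvg x * expAvg (-x)

@[fun_prop] lemma continuous_fejer : Continuous fejer := by unfold fejer; fun_prop

lemma norm_fejer_le (x : ℝ) : ‖fejer x‖ ≤ 1 := by
  rw [fejer, norm_mul]
  exact mul_le_one₀ (norm_expAvg_le _) (norm_nonneg _) (norm_expAvg_le _)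

lemma fejer_mul (x : ℝ) : fejer x * (4 * Real.pi ^ 2 * x ^ 2) = 2 - e2π x - e2π (-x) := by
  have h1 := expAvg_mul x
  have h2 := expAvg_mul (-x)
  have h3 : e2π x * e2π (-x) = 1 := by rw [← e2π_add]; simp
  push_cast at h2
  have h4 : fejer x * (4 * Real.pi ^ 2 * x ^ 2) =
      (expAvg x * (2 * Real.pi * Complex.I * x)) *
      (expAvg (-x) * (2 * Real.pi * Complex.I * -x)) := by
    rw [fejer]
    linear_combination (4 * Real.pi ^ 2 * x ^ 2 * expAvg x * expAvg (-x)) * Complex.I_sq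
  rw [h4, h1, h2]
  linear_combination h3

lemma charAvg_mul_fejer (k : ℕ) (θ : ℝ) :
    charAvg k θ * charAvg k (-θ) * fejer θ = fejer (2 ^ k * θ) := by
  have h1 := charAvg_mul_expAvg k θ
  have h2 := charAvg_mul_expAvg k (-θ)
  rw [mul_neg] at h2
  rw [fejer, fejer, ← h1, ← h2]; ring

@[fun_prop] lemma continuous_charAvg (k : ℕ) : Continuous (charAvg k) := by
  unfold charAvg; fun_prop

lemma norm_charAvg_le (k : ℕ) (θ : ℝ) : ‖charAvg k θ‖ ≤ 1 := by
  rw [charAvg, norm_mul, norm_inv, norm_pow, Complex.norm_ofNat]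
  refine (mul_le_mul_of_nonneg_left (norm_sum_le _ _) (by positivity)).trans (le_of_eq ?_)
  simp [norm_e2π]

lemma norm_dyadicSymbol_le (n : ℕ) (θ₁ θ₂ : ℝ) : ‖dyadicSymbol n θ₁ θ₂‖ ≤ n * 2 := by
  have h : ∀ k θ, ‖charAvg k θ * charAvg k (-θ)‖ ≤ 1 := fun k θ => by
    rw [norm_mul]
    exact mul_le_one₀ (norm_charAvg_le _ _) (norm_nonneg _) (norm_charAvg_le _ _)
  refine (norm_sum_le_of_le (f := fun k => _) (n := fun _ => (2 : ℝ)) _ fun k _ => ?_).trans_eq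
    (by simp)
  rw [norm_mul]
  calc _ ≤ 1 * (1 + 1 : ℝ) := mul_le_mul (h _ _)
        ((norm_sub_le _ _).trans (add_le_add (h _ _) (h _ _))) (norm_nonneg _) zero_le_one
    _ = 2 := by norm_num

theorem exists_symBdd_fejer {a : Fin 3 → ℝ} (ha : ∀ j, 0 < a j) (h0 : a 0 < 1 / 2)
    (hsum : ∑ j, a j = 1) : ∃ C : ℝ, 0 ≤ C ∧ ∀ (n : ℕ) (ε₁ ε₂ : ℝ),
      SymBdd (1 / a 1) (1 / a 2) (1 / a 0)
        (fun w => ∑ k ∈ Finset.range n, fejer (2 ^ (k + 1) * (ε₁ * w.1.1)) *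
          (fejer (2 ^ k * (ε₂ * w.2.2)) - fejer (2 ^ (k + 1) * (ε₂ * w.2.2)))) C := by
  obtain ⟨C, hC, h⟩ := exists_symBdd_dyadicSymbol ha h0 hsum
  refine ⟨C, hC, fun n ε₁ ε₂ => ?_⟩
  have hs : Continuous fun w : (ℝ × ℝ) × (ℝ × ℝ) =>
      dyadicSymbol n (ε₁ * w.1.1) (ε₂ * w.2.2) := by
    unfold dyadicSymbol; fun_prop
  have hle : ∀ {z : ℂ} {x : ℝ}, ‖z‖ ≤ n * 2 → ‖z * expAvg x‖ ≤ n * 2 := by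
    intro z x hz
    rw [norm_mul]
    exact (mul_le_of_le_one_right (norm_nonneg _) (norm_expAvg_le _)).trans hz
  have b0 := fun w : (ℝ × ℝ) × (ℝ × ℝ) => norm_dyadicSymbol_le n (ε₁ * w.1.1) (ε₂ * w.2.2)
  have h1 := (h n ε₁ ε₂).mul_expAvg hC hs b0 (ε₁, 0) 0
  have h2 := h1.mul_expAvg hC (by fun_prop) (fun w => hle (b0 w)) (-ε₁, 0) 0
  have h3 := h2.mul_expAvg hC (by fun_prop) (fun w => hle (hle (b0 w))) 0 (0, ε₂)
  have h4 := h3.mul_expAvg hC (by fun_prop) (fun w => hle (hle (hle (b0 w)))) 0 (0, -ε₂)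
  convert h4 using 1
  ext w
  simp only [Prod.fst_zero, Prod.snd_zero, zero_mul, add_zero, zero_add, dyadicSymbol]
  rw [show ∀ A B D E F : ℂ, A * B * D * E * F = A * (B * D * (E * F)) by intros; ring,
    Finset.sum_mul]
  refine Finset.sum_congr rfl fun k _ => ?_
  rw [neg_mul, neg_mul, ← fejer, ← fejer, ← charAvg_mul_fejer, ← charAvg_mul_fejer,
    ← charAvg_mul_fejer]
  ring

end

section

variable {p q r : ℝ}

/-- The weight representing `φ` as a superposition of dilated Fejér kernels. -/
def fejerWeight (φ : 𝓢(ℝ, ℂ)) (a : ℝ) : ℂ :=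
  (a ^ 2 / 2 : ℝ) * derivCLM ℂ ℂ (derivCLM ℂ ℂ (𝓕⁻ φ)) a

@[fun_prop] lemma continuous_fejerWeight (φ : 𝓢(ℝ, ℂ)) : Continuous (fejerWeight φ) := by
  unfold fejerWeight; fun_prop

lemma integrable_fejerWeight (φ : 𝓢(ℝ, ℂ)) : Integrable (fejerWeight φ) := by
  have h := ((derivCLM ℂ ℂ (derivCLM ℂ ℂ (𝓕⁻ φ))).integrable_pow_mul
    (μ := volume) 2).const_mul (1 / 2)
  refine h.mono (by fun_prop) (.of_forall fun a => le_of_eq ?_)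
  rw [fejerWeight, norm_mul, Complex.norm_real, Real.norm_of_nonneg (by positivity),
    Real.norm_of_nonneg (by positivity), Real.norm_eq_abs, sq_abs]
  ring

lemma integral_deriv_deriv_mul_e2π (φ : 𝓢(ℝ, ℂ)) (ξ : ℝ) :
    ∫ a, derivCLM ℂ ℂ (derivCLM ℂ ℂ (𝓕⁻ φ)) a * e2π (-(a * ξ)) =
      -(4 * Real.pi ^ 2 * ξ ^ 2) * φ ξ := by
  set ψ := 𝓕⁻ φ with hψ
  have h1 : ∀ f : 𝓢(ℝ, ℂ), ∀ x, 𝓕 (derivCLM ℂ ℂ f : ℝ → ℂ) x =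
      (2 * Real.pi * Complex.I * x) * 𝓕 (f : ℝ → ℂ) x := by
    intro f x
    have : (derivCLM ℂ ℂ f : ℝ → ℂ) = deriv f := by
      ext y; simp
    rw [this, Real.fourier_deriv f.integrable f.differentiable]
    · simp [smul_eq_mul]
    · rw [← this]; exact (derivCLM ℂ ℂ f).integrable
  have h2 := h1 (derivCLM ℂ ℂ ψ) ξ
  rw [h1 ψ ξ, ← SchwartzMap.fourier_coe ψ, hψ, FourierTransform.fourier_fourierInv_eq] at h2
  rw [Real.fourier_eq'] at h2
  have h3 : ∀ a : ℝ, e2π (-(a * ξ)) = Complex.exp (↑(-2 * Real.pi * inner ℝ a ξ) * Complex.I) := by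
    intro a
    rw [e2π]; congr 1
    simp; ring
  simp only [h3]
  simp only [smul_eq_mul] at h2
  rw [show (fun a => derivCLM ℂ ℂ (derivCLM ℂ ℂ ψ) a *
    Complex.exp (↑(-2 * Real.pi * inner ℝ a ξ) * Complex.I)) = fun a =>
    Complex.exp (↑(-2 * Real.pi * inner ℝ a ξ) * Complex.I) *
      derivCLM ℂ ℂ (derivCLM ℂ ℂ ψ) a by ext; ring, hψ, h2]
  linear_combination (4 * Real.pi ^ 2 * ξ ^ 2 * φ ξ) * Complex.I_sq

lemma integral_fejerWeight (φ : 𝓢(ℝ, ℂ)) (hφ : ∀ x, φ (-x) = φ x) {ξ : ℝ} (hξ : ξ ≠ 0) :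
    ∫ a, fejerWeight φ a * fejer (a * ξ) = φ ξ := by
  set F := derivCLM ℂ ℂ (derivCLM ℂ ℂ (𝓕⁻ φ)) with hF
  have hπ : (Real.pi : ℂ) ≠ 0 := by exact_mod_cast Real.pi_ne_zero
  have hξ' : (ξ : ℂ) ≠ 0 := by exact_mod_cast hξ
  have h1 : ∀ a, fejerWeight φ a * fejer (a * ξ) = (8 * Real.pi ^ 2 * ξ ^ 2 : ℂ)⁻¹ *
      (2 * (F a * e2π (-(a * 0))) - F a * e2π (-(a * -ξ)) - F a * e2π (-(a * ξ))) := by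
    intro a
    have := fejer_mul (a * ξ)
    rw [fejerWeight, ← hF, mul_zero, neg_zero, e2π_zero, mul_neg, neg_neg,
      eq_inv_mul_iff_mul_eq₀ (by simp [hπ, hξ'])]
    push_cast at this ⊢
    linear_combination (F a) * this
  have hi : ∀ x, Integrable fun a => F a * e2π (-(a * x)) := fun x =>
    F.integrable.mul_bdd (c := 1) (Continuous.aestronglyMeasurable (by fun_prop))
      (.of_forall fun a => (norm_e2π _).le)
  simp only [h1]
  have hi2 : Integrable fun a => 2 * (F a * e2π (-(a * 0))) - F a * e2π (-(a * -ξ)) :=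
    ((hi 0).const_mul 2).sub (hi _)
  rw [integral_const_mul, integral_sub hi2 (hi _), integral_sub ((hi 0).const_mul 2) (hi _), integral_const_mul, hF,
    integral_deriv_deriv_mul_e2π, integral_deriv_deriv_mul_e2π, integral_deriv_deriv_mul_e2π,
    hφ]
  push_cast
  field_simp
  ring

lemma SymBdd.congr_ae {M M' : (ℝ × ℝ) × (ℝ × ℝ) → ℂ} {A : ℝ} (h : SymBdd p q r M A)
    (hM : M =ᵐ[volume] M') : SymBdd p q r M' A := by
  intro f g k
  have : trilin M' f g k = trilin M f g k :=
    integral_congr_ae (hM.mono fun w hw => by simp only [hw])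
  rw [this]
  exact h f g k

lemma ae_fst_fst_ne_zero : ∀ᵐ w : (ℝ × ℝ) × (ℝ × ℝ), w.1.1 ≠ 0 := by
  have h1 : ∀ᵐ x : ℝ, x ≠ 0 := by simp [ae_iff]
  exact Measure.quasiMeasurePreserving_fst.ae (Measure.quasiMeasurePreserving_fst.ae h1)

lemma ae_snd_snd_ne_zero : ∀ᵐ w : (ℝ × ℝ) × (ℝ × ℝ), w.2.2 ≠ 0 := by
  have h1 : ∀ᵐ x : ℝ, x ≠ 0 := by simp [ae_iff]
  exact Measure.quasiMeasurePreserving_snd.ae (Measure.quasiMeasurePreserving_snd.ae h1)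

/-- The smooth twisted paraproduct with consecutive scales. -/
theorem exists_symBdd_smooth {a : Fin 3 → ℝ} (ha : ∀ j, 0 < a j) (h0 : a 0 < 1 / 2)
    (hsum : ∑ j, a j = 1) (φ : 𝓢(ℝ, ℂ)) (hφ : ∀ x, φ (-x) = φ x) :
    ∃ C : ℝ, 0 ≤ C ∧ ∀ (n : ℕ) (ε₁ ε₂ : ℝ), ε₁ ≠ 0 → ε₂ ≠ 0 →
      SymBdd (1 / a 1) (1 / a 2) (1 / a 0)
        (fun w => ∑ k ∈ Finset.range n, φ (2 ^ (k + 1) * (ε₁ * w.1.1)) *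
          (φ (2 ^ k * (ε₂ * w.2.2)) - φ (2 ^ (k + 1) * (ε₂ * w.2.2)))) C := by
  obtain ⟨C, hC, h⟩ := exists_symBdd_fejer ha h0 hsum
  set W := fejerWeight φ
  have hW : Integrable W := integrable_fejerWeight φ
  refine ⟨∫ x, ‖W x‖ * ∫ y, ‖W y‖ * C, integral_nonneg fun _ => mul_nonneg (norm_nonneg _)
    (integral_nonneg fun _ => mul_nonneg (norm_nonneg _) hC), fun n ε₁ ε₂ hε₁ hε₂ => ?_⟩
  let R : ℝ → ℝ → (ℝ × ℝ) × (ℝ × ℝ) → ℂ := fun x y w =>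
    ∑ k ∈ Finset.range n, fejer (2 ^ (k + 1) * (x * ε₁ * w.1.1)) *
          (fejer (2 ^ k * (y * ε₂ * w.2.2)) - fejer (2 ^ (k + 1) * (y * ε₂ * w.2.2)))
  have hR : ∀ x y w, ‖R x y w‖ ≤ n * 2 := by
    intro x y w
    refine (norm_sum_le_of_le (f := fun k => _) (n := fun _ => (2 : ℝ)) _ fun k _ => ?_).trans_eq
      (by simp)
    rw [norm_mul]
    calc _ ≤ 1 * (1 + 1 : ℝ) := mul_le_mul (norm_fejer_le _) ((norm_sub_le _ _).trans
          (add_le_add (norm_fejer_le _) (norm_fejer_le _))) (norm_nonneg _) zero_le_one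
      _ = 2 := by norm_num
  have hRc : Continuous fun z : ℝ × ℝ × ((ℝ × ℝ) × (ℝ × ℝ)) => R z.1 z.2.1 z.2.2 := by
    fun_prop
  have hWc : Continuous W := continuous_fejerWeight φ
  have hy : ∀ x, SymBdd (1 / a 1) (1 / a 2) (1 / a 0) (fun w => ∫ y, W y * R x y w)
      (∫ y, ‖W y‖ * C) := by
    intro x
    refine SymBdd.integral (K := fun y => ‖W y‖ * (n * 2)) ?_ ?_ (hW.norm.mul_const _)
      (hW.norm.mul_const _) ?_
    · refine Continuous.aestronglyMeasurable ?_
      have := hRc.comp (show Continuous fun z : ℝ × ((ℝ × ℝ) × (ℝ × ℝ)) => (x, z.1, z.2) by fun_prop)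
      exact (hWc.comp continuous_fst).mul this
    · intro y w
      rw [norm_mul]
      exact mul_le_mul_of_nonneg_left (hR x y w) (norm_nonneg _)
    · intro y
      exact (h n (x * ε₁) (y * ε₂)).const_mul (W y)
  have hRy : Continuous fun z : ℝ × ((ℝ × ℝ) × (ℝ × ℝ)) => ∫ y, W y * R z.1 y z.2 := by
    refine continuous_of_dominated (bound := fun y => ‖W y‖ * (n * 2)) ?_ ?_ (hW.norm.mul_const _) ?_
    · intro z
      refine Continuous.aestronglyMeasurable ?_
      have := hRc.comp (show Continuous fun y : ℝ => (z.1, y, z.2) by fun_prop)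
      exact hWc.mul this
    · intro z
      refine Eventually.of_forall fun y => ?_
      rw [norm_mul]
      exact mul_le_mul_of_nonneg_left (hR _ y _) (norm_nonneg _)
    · refine Eventually.of_forall fun y => ?_
      have := hRc.comp (show Continuous fun z : ℝ × ((ℝ × ℝ) × (ℝ × ℝ)) => (z.1, y, z.2) by fun_prop)
      exact continuous_const.mul this
  have hB : ∀ x w, ‖∫ y, W y * R x y w‖ ≤ ∫ y, ‖W y‖ * (n * 2) := by
    intro x w
    refine norm_integral_le_of_norm_le (hW.norm.mul_const _) (.of_forall fun y => ?_)
    rw [norm_mul]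
    exact mul_le_mul_of_nonneg_left (hR _ y _) (norm_nonneg _)
  have hx : SymBdd (1 / a 1) (1 / a 2) (1 / a 0) (fun w => ∫ x, W x * ∫ y, W y * R x y w)
      (∫ x, ‖W x‖ * ∫ y, ‖W y‖ * C) := by
    refine SymBdd.integral (K := fun x => ‖W x‖ * ∫ y, ‖W y‖ * (n * 2)) ?_ ?_
      (hW.norm.mul_const _) (hW.norm.mul_const _) ?_
    · exact ((hWc.comp continuous_fst).mul hRy).aestronglyMeasurable
    · intro x w
      rw [norm_mul]
      exact mul_le_mul_of_nonneg_left (hB x w) (norm_nonneg _)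
    · intro x
      exact (hy x).const_mul (W x)
  refine hx.congr_ae ?_
  filter_upwards [ae_fst_fst_ne_zero, ae_snd_snd_ne_zero] with w h1 h2
  have hf : ∀ c : ℝ, Integrable fun y => W y * fejer (y * c) := fun c =>
    hW.mul_bdd (c := 1) (Continuous.aestronglyMeasurable (by fun_prop))
      (.of_forall fun _ => norm_fejer_le _)
  have hφi : ∀ c : ℝ, c ≠ 0 → ∫ y, W y * fejer (y * c) = φ c :=
    fun c hc => integral_fejerWeight φ hφ hc
  have e1 : ∀ x, ∫ y, W y * R x y w = ∑ k ∈ Finset.range n,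
      fejer (x * (2 ^ (k + 1) * (ε₁ * w.1.1))) *
        (φ (2 ^ k * (ε₂ * w.2.2)) - φ (2 ^ (k + 1) * (ε₂ * w.2.2))) := by
    intro x
    have : ∀ y, W y * R x y w = ∑ k ∈ Finset.range n, fejer (x * (2 ^ (k + 1) * (ε₁ * w.1.1))) *
        (W y * fejer (y * (2 ^ k * (ε₂ * w.2.2))) -
          W y * fejer (y * (2 ^ (k + 1) * (ε₂ * w.2.2)))) := by
      intro y
      rw [Finset.mul_sum]
      refine Finset.sum_congr rfl fun k _ => ?_
      rw [show y * (2 ^ k * (ε₂ * w.2.2)) = 2 ^ k * (y * ε₂ * w.2.2) by ring,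
        show y * (2 ^ (k + 1) * (ε₂ * w.2.2)) = 2 ^ (k + 1) * (y * ε₂ * w.2.2) by ring,
        show x * (2 ^ (k + 1) * (ε₁ * w.1.1)) = 2 ^ (k + 1) * (x * ε₁ * w.1.1) by ring]
      ring
    simp only [this]
    have hs : ∀ c d : ℝ, Integrable fun y => W y * fejer (y * c) - W y * fejer (y * d) :=
      fun c d => (hf c).sub (hf d)
    rw [integral_finsetSum _ fun k _ => (hs _ _).const_mul _]
    refine Finset.sum_congr rfl fun k _ => ?_
    rw [integral_const_mul, integral_sub (hf _) (hf _), hφi _ (by positivity),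
      hφi _ (by positivity)]
  simp only [e1, Finset.mul_sum, ← mul_assoc]
  rw [integral_finsetSum _ fun k _ => by
    simpa only [mul_assoc] using (hf (2 ^ (k + 1) * (ε₁ * w.1.1))).mul_const _]
  refine Finset.sum_congr rfl fun k _ => ?_
  rw [integral_mul_const]
  have := hφi (2 ^ (k + 1) * (ε₁ * w.1.1)) (by positivity)
  simp only [mul_assoc] at this ⊢
  rw [this]

end

lemma e2π_int (n : ℤ) : e2π n = 1 := by
  rw [e2π, Complex.exp_eq_one_iff]
  exact ⟨n, by push_cast; ring⟩

/-- The inverse Fourier transform on the line. -/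
def invF (G : 𝓢(ℝ, ℂ)) : 𝓢(ℝ, ℂ) := 𝓕⁻ G

lemma fourierInv_real (G : 𝓢(ℝ, ℂ)) (x : ℝ) :
    invF G x = ∫ θ, G θ * e2π (x * θ) := by
  rw [invF, SchwartzMap.fourierInv_coe, Real.fourierInv_eq']
  refine integral_congr_ae (.of_forall fun v => ?_)
  simp only [smul_eq_mul, e2π]
  rw [mul_comm]
  congr 2
  simp
  ring

lemma fourier_real (G : 𝓢(ℝ, ℂ)) (x : ℝ) :
    (𝓕 G) x = ∫ θ, G θ * e2π (-(x * θ)) := by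
  rw [SchwartzMap.fourier_coe, Real.fourier_eq']
  refine integral_congr_ae (.of_forall fun v => ?_)
  simp only [smul_eq_mul, e2π]
  rw [mul_comm]
  congr 2
  simp
  ring

lemma integral_e2π_int (n : ℤ) :
    ∫ θ in (-1 / 2 : ℝ)..1 / 2, e2π (n * θ) = if n = 0 then 1 else 0 := by
  split_ifs with h
  · simp only [h, Int.cast_zero, zero_mul, e2π_zero, intervalIntegral.integral_const]
    norm_num
  · have hn : (2 * Real.pi * Complex.I * n : ℂ) ≠ 0 := by
      have : (n : ℂ) ≠ 0 := by exact_mod_cast h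
      have := Real.pi_ne_zero
      simp_all
    have hd : ∀ θ : ℝ, HasDerivAt (fun θ : ℝ => e2π (n * θ) / (2 * Real.pi * Complex.I * n))
        (e2π (n * θ)) θ := by
      intro θ
      have h1 := ((hasDerivAt_e2π (n * θ)).scomp θ ((hasDerivAt_id θ).const_mul (n : ℝ))).div_const
        (2 * Real.pi * Complex.I * n : ℂ)
      refine h1.congr_deriv ?_
      simp only [mul_one, Complex.real_smul, Complex.ofReal_intCast]
      rw [div_eq_iff hn]
      ring
    rw [intervalIntegral.integral_eq_sub_of_hasDerivAt (fun θ _ => hd θ)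
      ((by fun_prop : Continuous fun θ : ℝ => e2π (n * θ)).intervalIntegrable _ _)]
    have : e2π (n * (1 / 2)) = e2π (n * (-1 / 2)) := by
      rw [show (n : ℝ) * (1 / 2) = n * (-1 / 2) + n by ring, e2π_add, e2π_int, mul_one]
    rw [this, sub_self]

lemma conj_e2π (t : ℝ) : (starRingEnd ℂ) (e2π t) = e2π (-t) := by
  simp only [e2π, ← Complex.exp_conj]
  congr 1
  simp [Complex.conj_ofNat]

lemma integral_norm_sq_trig (B : Finset ℤ) (h : ℤ → ℂ) :
    ∫ θ in (-1 / 2 : ℝ)..1 / 2, ‖∑ x ∈ B, h x * e2π (x * θ)‖ ^ 2 = ∑ x ∈ B, ‖h x‖ ^ 2 := by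
  have key : ((∫ θ in (-1 / 2 : ℝ)..1 / 2, ‖∑ x ∈ B, h x * e2π (x * θ)‖ ^ 2 : ℝ) : ℂ) =
      ((∑ x ∈ B, ‖h x‖ ^ 2 : ℝ) : ℂ) := by
    rw [← intervalIntegral.integral_ofReal]
    have e : ∀ θ : ℝ, ((‖∑ x ∈ B, h x * e2π (x * θ)‖ ^ 2 : ℝ) : ℂ) =
        ∑ x ∈ B, ∑ y ∈ B, h x * (starRingEnd ℂ) (h y) * e2π ((x - y : ℤ) * θ) := by
      intro θ
      rw [Complex.ofReal_pow, ← Complex.mul_conj', map_sum, Finset.sum_mul_sum]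
      refine Finset.sum_congr rfl fun x _ => Finset.sum_congr rfl fun y _ => ?_
      rw [map_mul, conj_e2π, Int.cast_sub, show ((x : ℝ) - y) * θ = x * θ + -(y * θ) by ring,
        e2π_add]
      ring
    simp_rw [e]
    rw [intervalIntegral.integral_finsetSum
      (fun x _ => (Continuous.intervalIntegrable (by fun_prop) _ _))]
    rw [Complex.ofReal_sum]
    refine Finset.sum_congr rfl fun x hx => ?_
    rw [intervalIntegral.integral_finsetSum
      (fun y _ => (Continuous.intervalIntegrable (by fun_prop) _ _))]
    simp_rw [intervalIntegral.integral_const_mul, integral_e2π_int]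
    rw [Finset.sum_eq_single x]
    · simp [Complex.mul_conj']
    · intro y _ hy
      simp [sub_eq_zero, hy.symm]
    · exact fun h => absurd hx h
  exact_mod_cast key

lemma norm_kerForm_fourierInv_le (G : 𝓢(ℝ, ℂ)) {A : ℝ} (hG : ∀ θ, 1 / 4 < |θ| → G θ = 0)
    (hA : ∀ θ, ‖G θ‖ ≤ A) (B : Finset ℤ) (h f : ℤ → ℂ) :
    ‖kerForm (fun i : ℤ => invF G i) B h f‖ ≤
      A * ((∑ x ∈ B, ‖h x‖ ^ 2) ^ (1 / 2 : ℝ) * (∑ x ∈ B, ‖f x‖ ^ 2) ^ (1 / 2 : ℝ)) := by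
  have hA0 : 0 ≤ A := (norm_nonneg _).trans (hA 0)
  set H : ℝ → ℂ := fun θ => ∑ x ∈ B, h x * e2π (x * θ) with hH
  set F : ℝ → ℂ := fun θ => ∑ y ∈ B, f y * e2π (-(y * θ)) with hF
  have hHc : Continuous H := by fun_prop
  have hFc : Continuous F := by fun_prop
  have e : kerForm (fun i : ℤ => invF G i) B h f = ∫ θ in (-1 / 2 : ℝ)..1 / 2, G θ * (H θ * F θ) := by
    rw [intervalIntegral.integral_of_le (by norm_num),
      setIntegral_eq_integral_of_forall_compl_eq_zero]
    · have e1 : ∀ θ, G θ * (H θ * F θ) = ∑ x ∈ B, ∑ y ∈ B,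
          h x * (G θ * e2π ((x - y : ℤ) * θ)) * f y := by
        intro θ
        rw [hH, hF, Finset.sum_mul_sum, Finset.mul_sum]
        refine Finset.sum_congr rfl fun x _ => ?_
        rw [Finset.mul_sum]
        refine Finset.sum_congr rfl fun y _ => ?_
        rw [Int.cast_sub, show ((x : ℝ) - y) * θ = x * θ + -(y * θ) by ring, e2π_add]
        ring
      have hi : ∀ x y : ℤ, Integrable fun θ => h x * (G θ * e2π ((x - y : ℤ) * θ)) * f y := by
        intro x y
        refine ((G.integrable.mul_bdd (c := 1) (by
          exact Continuous.aestronglyMeasurable (by fun_prop))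
          (.of_forall fun θ => (norm_e2π _).le)).const_mul _).mul_const _
      simp_rw [e1]
      rw [integral_finsetSum _ fun x _ => integrable_finsetSum _ fun y _ => hi x y]
      refine Finset.sum_congr rfl fun x _ => ?_
      rw [integral_finsetSum _ fun y _ => hi x y]
      refine Finset.sum_congr rfl fun y _ => ?_
      rw [integral_mul_const, integral_const_mul, ← fourierInv_real]
    · intro θ hθ
      rw [hG θ, zero_mul]
      by_contra hc
      push Not at hc
      rw [abs_le] at hc
      exact hθ ⟨by linarith, by linarith⟩
  rw [e]
  have hHs : ∫ θ in (-1 / 2 : ℝ)..1 / 2, ‖H θ‖ ^ 2 = ∑ x ∈ B, ‖h x‖ ^ 2 :=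
    integral_norm_sq_trig B h
  have hFs : ∫ θ in (-1 / 2 : ℝ)..1 / 2, ‖F θ‖ ^ 2 = ∑ x ∈ B, ‖f x‖ ^ 2 := by
    have h1 := integral_norm_sq_trig B (fun x => (starRingEnd ℂ) (f x))
    simp only [RCLike.norm_conj] at h1
    rw [← h1]
    refine intervalIntegral.integral_congr fun θ _ => ?_
    rw [← RCLike.norm_conj, hF, map_sum]
    simp only [map_mul, conj_e2π, neg_neg]
  have hle : (-1 / 2 : ℝ) ≤ 1 / 2 := by norm_num
  have hmem : ∀ u : ℝ → ℂ, Continuous u → MemLp (fun θ => ‖u θ‖) (ENNReal.ofReal 2)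
      (volume.restrict (Set.Ioc (-1 / 2 : ℝ) (1 / 2))) := by
    intro u hu
    have h1 : MemLp (fun θ => ‖u θ‖) ⊤ (volume.restrict (Set.Ioc (-1 / 2 : ℝ) (1 / 2))) := by
      obtain ⟨K, hK⟩ := isCompact_Icc.exists_bound_of_continuousOn
        (s := Set.Icc (-1 / 2 : ℝ) (1 / 2)) hu.norm.continuousOn
      exact memLp_top_of_bound hu.norm.aestronglyMeasurable K
        ((ae_restrict_mem measurableSet_Ioc).mono fun θ hθ => hK θ ⟨hθ.1.le, hθ.2⟩)
    exact h1.mono_exponent le_top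
  have hCS := integral_mul_le_Lp_mul_Lq_of_nonneg Real.HolderConjugate.two_two
    (μ := volume.restrict (Set.Ioc (-1 / 2 : ℝ) (1 / 2)))
    (f := fun θ => ‖H θ‖) (g := fun θ => ‖F θ‖)
    (.of_forall fun _ => norm_nonneg _) (.of_forall fun _ => norm_nonneg _)
    (hmem H hHc) (hmem F hFc)
  simp only [Real.rpow_two] at hCS
  rw [← intervalIntegral.integral_of_le hle, ← intervalIntegral.integral_of_le hle,
    ← intervalIntegral.integral_of_le hle, hHs, hFs] at hCS
  calc ‖∫ θ in (-1 / 2 : ℝ)..1 / 2, G θ * (H θ * F θ)‖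
      ≤ ∫ θ in (-1 / 2 : ℝ)..1 / 2, A * (‖H θ‖ * ‖F θ‖) := by
        refine intervalIntegral.norm_integral_le_of_norm_le hle
          (.of_forall fun θ _ => ?_) (Continuous.intervalIntegrable (by fun_prop) _ _)
        rw [norm_mul, norm_mul]
        exact mul_le_mul_of_nonneg_right (hA θ) (by positivity)
    _ ≤ _ := by
        rw [intervalIntegral.integral_const_mul]
        exact mul_le_mul_of_nonneg_left hCS hA0

/-- The kernel of a periodic multiplier satisfying a Hörmander condition. -/
lemma isCZKernel_fourierInv (G : 𝓢(ℝ, ℂ)) {A : ℝ} (hG : ∀ θ, 1 / 4 < |θ| → G θ = 0)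
    (hA : ∀ θ, ‖G θ‖ ≤ A) (hd : ∀ x, ‖deriv (invF G) x‖ * x ^ 2 ≤ A) :
    IsCZKernel (fun i : ℤ => invF G i) (4 * A) where
  nonneg := by have := (norm_nonneg _).trans (hA 0); positivity
  l2 B h f := by
    have hA0 : 0 ≤ A := (norm_nonneg _).trans (hA 0)
    exact (norm_kerForm_fourierInv_le G hG hA B h f).trans
      (mul_le_mul_of_nonneg_right (by linarith) (by positivity))
  reg i y hy := by
    have hA0 : 0 ≤ A := (norm_nonneg _).trans (hA 0)
    rcases eq_or_ne i 0 with rfl | hi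
    · simp only [Int.cast_zero, ne_eq, OfNat.ofNat_ne_zero, not_false_eq_true, zero_pow, mul_zero]
      positivity
    have hi2 : 0 < (i : ℝ) ^ 2 := by positivity
    have hy' : 2 * |(y : ℝ)| ≤ |(i : ℝ)| := by exact_mod_cast hy
    have h1 := Convex.norm_image_sub_le_of_norm_deriv_le (𝕜 := ℝ) (f := invF G)
      (s := Metric.closedBall (i : ℝ) |(y : ℝ)|) (C := 4 * A / (i : ℝ) ^ 2)
      (fun x _ => (invF G).differentiableAt) (fun x hx => by
        rw [le_div_iff₀ hi2]
        rw [Metric.mem_closedBall, Real.dist_eq] at hx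
        have h2 : |(i : ℝ)| ≤ 2 * |x| := by
          have := abs_sub_abs_le_abs_sub (i : ℝ) x
          rw [abs_sub_comm] at this
          linarith
        have h3 : (i : ℝ) ^ 2 ≤ 4 * x ^ 2 := by
          rw [← sq_abs (i : ℝ), ← sq_abs x]
          nlinarith [abs_nonneg (i : ℝ)]
        nlinarith [hd x, norm_nonneg (deriv (invF G) x)])
      (convex_closedBall _ _) (x := (i : ℝ)) (y := ((i - y : ℤ) : ℝ))
      (Metric.mem_closedBall_self (abs_nonneg _)) (by
        rw [Metric.mem_closedBall, Real.dist_eq]; push_cast; rw [sub_sub_cancel_left, abs_neg])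
    have h4 : ‖((i - y : ℤ) : ℝ) - i‖ = |(y : ℝ)| := by
      push_cast; rw [sub_sub_cancel_left, norm_neg, Real.norm_eq_abs]
    rw [h4] at h1
    calc _ ≤ 4 * A / (i : ℝ) ^ 2 * |(y : ℝ)| * (i : ℝ) ^ 2 :=
          mul_le_mul_of_nonneg_right h1 hi2.le
      _ = _ := by field_simp

lemma exists_sum_min_le : ∃ K : ℝ, 0 ≤ K ∧ ∀ (y : ℝ), 0 < y → ∀ S : Finset ℤ,
    ∑ k ∈ S, min (2 ^ k * y) (2 ^ k * y)⁻¹ ≤ K := by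
  obtain ⟨K, hK, H⟩ := exists_sum_two_rpow_abs_le (α := 1) (γ := 1) one_pos one_pos
  refine ⟨K, hK, fun y hy S => le_trans (Finset.sum_le_sum fun k _ => ?_)
    (H (-Real.logb 2 y) S)⟩
  have e : (2 : ℝ) ^ k * y = 2 ^ ((k : ℝ) + Real.logb 2 y) := by
    rw [Real.rpow_add two_pos, Real.rpow_intCast, Real.rpow_logb two_pos (by norm_num) hy]
  rw [e, ← Real.rpow_neg zero_le_two, one_mul, one_mul,
    show |-Real.logb 2 y - k| = |k + Real.logb 2 y| by rw [← abs_neg]; ring_nf]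
  rcases abs_cases ((k : ℝ) + Real.logb 2 y) with ⟨h, _⟩ | ⟨h, _⟩ <;> rw [h]
  · exact min_le_right _ _
  · rw [neg_neg]; exact min_le_left _ _

lemma SchwartzMap.exists_decay (f : 𝓢(ℝ, ℂ)) (n : ℕ) :
    ∃ A : ℝ, 0 ≤ A ∧ ∀ x, ‖f x‖ * (1 + |x|) ^ n ≤ A := by
  obtain ⟨A, hA⟩ := f.decay n 0
  obtain ⟨B, hB⟩ := f.decay 0 0
  refine ⟨2 ^ n * (A + B), ?_, fun x => ?_⟩
  · have h1 := (by positivity : (0 : ℝ) ≤ ‖(0 : ℝ)‖ ^ n * ‖iteratedFDeriv ℝ 0 f 0‖).trans (hA.2 0)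
    have h2 := (by positivity : (0 : ℝ) ≤ ‖(0 : ℝ)‖ ^ 0 * ‖iteratedFDeriv ℝ 0 f 0‖).trans (hB.2 0)
    positivity
  · have h1 := hA.2 x
    have h2 := hB.2 x
    simp only [norm_iteratedFDeriv_zero, pow_zero, one_mul, Real.norm_eq_abs] at h1 h2
    have h3 : (1 + |x|) ^ n ≤ 2 ^ n * (|x| ^ n + 1) := by
      rcases le_total |x| 1 with h | h
      · calc (1 + |x|) ^ n ≤ 2 ^ n := pow_le_pow_left₀ (by positivity) (by linarith) n
          _ ≤ _ := le_mul_of_one_le_right (by positivity)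
            (le_add_of_nonneg_left (by positivity))
      · calc (1 + |x|) ^ n ≤ (2 * |x|) ^ n := pow_le_pow_left₀ (by positivity) (by linarith) n
          _ = 2 ^ n * |x| ^ n := mul_pow _ _ _
          _ ≤ _ := mul_le_mul_of_nonneg_left (by linarith) (by positivity)
    calc ‖f x‖ * (1 + |x|) ^ n ≤ ‖f x‖ * (2 ^ n * (|x| ^ n + 1)) :=
          mul_le_mul_of_nonneg_left h3 (norm_nonneg _)
      _ = 2 ^ n * (|x| ^ n * ‖f x‖ + ‖f x‖) := by ring
      _ ≤ _ := mul_le_mul_of_nonneg_left (by linarith) (by positivity)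

/-- A lacunary sum of modulated dilates of a profile `ψ`. -/
def lacSum (ψ : 𝓢(ℝ, ℂ)) (S : Finset ℤ) (c : ℤ → ℂ) (u t : ℝ) : ℂ :=
  ∑ k ∈ S, c k * (ψ (2 ^ k * t) * e2π (u * (2 ^ k * t)))

lemma exists_lacSum_le (ψ : 𝓢(ℝ, ℂ)) (hψ : ψ 0 = 0) : ∃ C : ℝ, 0 ≤ C ∧
    ∀ (S : Finset ℤ) (c : ℤ → ℂ) (u : ℝ), (∀ k, ‖c k‖ ≤ 1) → ∀ t, ‖lacSum ψ S c u t‖ ≤ C := by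
  obtain ⟨K, hK, H⟩ := exists_sum_min_le
  obtain ⟨A, hA, hA'⟩ := ψ.exists_decay 1
  obtain ⟨B, hB, hB'⟩ := (derivCLM ℂ ℂ ψ).exists_decay 0
  have hmin : ∀ t : ℝ, t ≠ 0 → ‖ψ t‖ ≤ (A + B) * min |t| |t|⁻¹ := by
    intro t ht
    have ht' : 0 < |t| := abs_pos.2 ht
    have h1 : ‖ψ t‖ ≤ B * |t| := by
      have h := Convex.norm_image_sub_le_of_norm_deriv_le (𝕜 := ℝ) (f := ψ) (s := Set.univ)
        (C := B) (fun x _ => ψ.differentiableAt)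
        (fun x _ => by
          have := hB' x
          rw [pow_zero, mul_one] at this
          exact this) convex_univ
        (Set.mem_univ 0) (Set.mem_univ t)
      rwa [hψ, sub_zero, sub_zero, Real.norm_eq_abs] at h
    have h2 : ‖ψ t‖ ≤ A * |t|⁻¹ := by
      rw [← div_eq_mul_inv, le_div_iff₀ ht']
      have := hA' t
      nlinarith [norm_nonneg (ψ t)]
    rcases min_cases |t| |t|⁻¹ with ⟨h, _⟩ | ⟨h, _⟩ <;> rw [h]
    · exact h1.trans (mul_le_mul_of_nonneg_right (by linarith) ht'.le)
    · exact h2.trans (mul_le_mul_of_nonneg_right (by linarith) (by positivity))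
  refine ⟨(A + B) * K, by positivity, fun S c u hc t => ?_⟩
  rcases eq_or_ne t 0 with rfl | ht
  · simp only [lacSum, mul_zero, hψ, zero_mul, Finset.sum_const_zero, norm_zero]
    positivity
  calc ‖lacSum ψ S c u t‖ ≤ ∑ k ∈ S, (A + B) * min (2 ^ k * |t|) (2 ^ k * |t|)⁻¹ := by
        refine (norm_sum_le _ _).trans (Finset.sum_le_sum fun k _ => ?_)
        rw [norm_mul, norm_mul, norm_e2π, mul_one]
        have h2 : (0 : ℝ) < 2 ^ k := by positivity
        have h1 := hmin (2 ^ k * t) (by positivity)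
        rw [abs_mul, abs_of_pos h2] at h1
        exact (mul_le_of_le_one_left (norm_nonneg _) (hc k)).trans h1
    _ ≤ _ := by
        rw [← Finset.mul_sum]
        exact mul_le_mul_of_nonneg_left (H _ (abs_pos.2 ht) S) (by positivity)

lemma hasDerivAt_schwartz (f : 𝓢(ℝ, ℂ)) (x : ℝ) :
    HasDerivAt f (derivCLM ℂ ℂ f x) x := f.differentiableAt.hasDerivAt

lemma invF_lacSum {ψ G : 𝓢(ℝ, ℂ)} {S : Finset ℤ} {c : ℤ → ℂ} {u ε : ℝ} (hε : 0 < ε)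
    (hG : ∀ θ, G θ = lacSum ψ S c u (θ / ε)) (x : ℝ) :
    invF G x = ∑ k ∈ S, c k * ((ε / 2 ^ k : ℝ) * invF ψ (ε / 2 ^ k * x + u)) := by
  rw [fourierInv_real]
  simp_rw [hG, lacSum, Finset.sum_mul]
  have e : ∀ (k : ℤ) (θ : ℝ), c k * (ψ (2 ^ k * (θ / ε)) * e2π (u * (2 ^ k * (θ / ε)))) *
      e2π (x * θ) = c k * (fun t => ψ t * e2π ((ε / 2 ^ k * x + u) * t)) (2 ^ k / ε * θ) := by
    intro k θ
    have h2 : (2 : ℝ) ^ k ≠ 0 := by positivity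
    have h1 : (ε / 2 ^ k * x + u) * (2 ^ k / ε * θ) = u * (2 ^ k * (θ / ε)) + x * θ := by
      field_simp
      ring
    beta_reduce
    rw [h1, e2π_add, show 2 ^ k / ε * θ = 2 ^ k * (θ / ε) by ring]
    ring
  have hi : ∀ y : ℝ, Integrable fun t => ψ t * e2π (y * t) := fun y =>
    ψ.integrable.mul_bdd (c := 1) (Continuous.aestronglyMeasurable (by fun_prop))
      (.of_forall fun θ => (norm_e2π _).le)
  simp_rw [e]
  rw [integral_finsetSum]
  · refine Finset.sum_congr rfl fun k _ => ?_
    have h2 : (0 : ℝ) < 2 ^ k := by positivity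
    rw [integral_const_mul, Measure.integral_comp_mul_left
      (fun t => ψ t * e2π ((ε / 2 ^ k * x + u) * t)), fourierInv_real, inv_div,
      abs_of_pos (by positivity), Complex.real_smul]
  · intro k _
    exact ((hi _).comp_mul_left' (by positivity)).const_mul _

lemma exists_deriv_invF_le (ψ : 𝓢(ℝ, ℂ)) : ∃ C : ℝ, 0 ≤ C ∧
    ∀ (S : Finset ℤ) (c : ℤ → ℂ) (u ε : ℝ) (G : 𝓢(ℝ, ℂ)), (∀ k, ‖c k‖ ≤ 1) → 0 < ε →
      (∀ θ, G θ = lacSum ψ S c u (θ / ε)) →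
      ∀ x, ‖deriv (invF G) x‖ * x ^ 2 ≤ C * (1 + |u|) ^ 4 := by
  obtain ⟨K, hK, H⟩ := exists_sum_min_le
  set η' := derivCLM ℂ ℂ (invF ψ) with hη
  obtain ⟨A, hA, hA'⟩ := η'.exists_decay 4
  refine ⟨A * K, by positivity, fun S c u ε G hc hε hG x => ?_⟩
  have hd : HasDerivAt (invF G) (∑ k ∈ S, c k * ((ε / 2 ^ k : ℝ) *
      ((ε / 2 ^ k : ℝ) * η' (ε / 2 ^ k * x + u)))) x := by
    have h1 : (invF G : ℝ → ℂ) = fun x => ∑ k ∈ S, c k * ((ε / 2 ^ k : ℝ) *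
        invF ψ (ε / 2 ^ k * x + u)) := funext (invF_lacSum hε hG)
    rw [h1]
    refine HasDerivAt.fun_sum fun k _ => ((HasDerivAt.const_mul _ ?_).const_mul _)
    have h2 := (hasDerivAt_schwartz (invF ψ) (ε / 2 ^ k * x + u)).scomp x
      (((hasDerivAt_id x).const_mul (ε / 2 ^ k)).add_const u)
    refine h2.congr_deriv ?_
    rw [mul_one, Complex.real_smul]
  rw [hd.deriv]
  rcases eq_or_ne x 0 with rfl | hx
  · simp only [ne_eq, OfNat.ofNat_ne_zero, not_false_eq_true, zero_pow, mul_zero]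
    positivity
  have hx' : 0 < |x| := abs_pos.2 hx
  have hterm : ∀ k, ‖c k * ((ε / 2 ^ k : ℝ) * ((ε / 2 ^ k : ℝ) * η' (ε / 2 ^ k * x + u)))‖ * x ^ 2
      ≤ (A * (1 + |u|) ^ 4) * min (2 ^ k * (ε * |x|)⁻¹) (2 ^ k * (ε * |x|)⁻¹)⁻¹ := by
    intro k
    have h2 : (0 : ℝ) < 2 ^ k := by positivity
    set r := ε / 2 ^ k * |x| with hr
    have hr0 : 0 < r := by positivity
    have er : 2 ^ k * (ε * |x|)⁻¹ = r⁻¹ := by rw [hr]; field_simp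
    rw [er, inv_inv]
    have hη1 : ‖η' (ε / 2 ^ k * x + u)‖ * (1 + r) ^ 4 ≤ A * (1 + |u|) ^ 4 := by
      have h3 : 1 + r ≤ (1 + |ε / 2 ^ k * x + u|) * (1 + |u|) := by
        have h5 : r = |ε / 2 ^ k * x| := by rw [hr, abs_mul, abs_of_pos (div_pos hε h2)]
        have h4 := abs_sub_abs_le_abs_sub (ε / 2 ^ k * x) (-u)
        rw [abs_neg, sub_neg_eq_add, ← h5] at h4
        nlinarith [abs_nonneg u, abs_nonneg (ε / 2 ^ k * x + u),
          mul_nonneg (abs_nonneg u) (abs_nonneg (ε / 2 ^ k * x + u))]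
      calc _ ≤ ‖η' (ε / 2 ^ k * x + u)‖ * ((1 + |ε / 2 ^ k * x + u|) * (1 + |u|)) ^ 4 :=
            mul_le_mul_of_nonneg_left (pow_le_pow_left₀ (by positivity) h3 4) (norm_nonneg _)
        _ = (‖η' (ε / 2 ^ k * x + u)‖ * (1 + |ε / 2 ^ k * x + u|) ^ 4) * (1 + |u|) ^ 4 := by ring
        _ ≤ _ := mul_le_mul_of_nonneg_right (hA' _) (by positivity)
    have hle : r ^ 2 ≤ (1 + r) ^ 4 * min r⁻¹ r := by
      rcases min_cases r⁻¹ r with ⟨h, _⟩ | ⟨h, _⟩ <;> rw [h]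
      · rw [← div_eq_mul_inv, le_div_iff₀ hr0]
        calc r ^ 2 * r = r ^ 3 := by ring
          _ ≤ _ := by nlinarith [pow_pos hr0 2, pow_pos hr0 3, pow_pos hr0 4]
      · nlinarith [pow_pos hr0 2, pow_pos hr0 3, pow_pos hr0 4, pow_pos hr0 5]
    rw [norm_mul, norm_mul, norm_mul, Complex.norm_real, Real.norm_eq_abs,
      abs_of_pos (div_pos hε h2)]
    have hm0 : 0 ≤ min r⁻¹ r := le_min (by positivity) hr0.le
    calc ‖c k‖ * (ε / 2 ^ k * (ε / 2 ^ k * ‖η' (ε / 2 ^ k * x + u)‖)) * x ^ 2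
        = ‖c k‖ * (‖η' (ε / 2 ^ k * x + u)‖ * r ^ 2) := by rw [hr, mul_pow, sq_abs]; ring
      _ ≤ 1 * (‖η' (ε / 2 ^ k * x + u)‖ * r ^ 2) :=
          mul_le_mul_of_nonneg_right (hc k) (by positivity)
      _ ≤ ‖η' (ε / 2 ^ k * x + u)‖ * ((1 + r) ^ 4 * min r⁻¹ r) := by
          rw [one_mul]; exact mul_le_mul_of_nonneg_left hle (norm_nonneg _)
      _ ≤ _ := by
          rw [← mul_assoc]; exact mul_le_mul_of_nonneg_right hη1 hm0
  calc _ ≤ (∑ k ∈ S, ‖c k * ((ε / 2 ^ k : ℝ) * ((ε / 2 ^ k : ℝ) *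
        η' (ε / 2 ^ k * x + u)))‖) * x ^ 2 :=
        mul_le_mul_of_nonneg_right (norm_sum_le _ _) (by positivity)
    _ ≤ ∑ k ∈ S, (A * (1 + |u|) ^ 4) * min (2 ^ k * (ε * |x|)⁻¹) (2 ^ k * (ε * |x|)⁻¹)⁻¹ := by
        rw [Finset.sum_mul]
        exact Finset.sum_le_sum fun k _ => hterm k
    _ ≤ (A * (1 + |u|) ^ 4) * K := by
        rw [← Finset.mul_sum]
        exact mul_le_mul_of_nonneg_left (H _ (by positivity) S) (by positivity)
    _ = _ := by ring

/-- Periodized lacunary sums have Calderón–Zygmund kernels, uniformly. -/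
theorem exists_isCZKernel_lacSum (ψ : 𝓢(ℝ, ℂ)) (hψ : ψ 0 = 0) (hψc : HasCompactSupport ψ) :
    ∃ C : ℝ, 0 ≤ C ∧ ∀ (S : Finset ℤ) (c : ℤ → ℂ) (u : ℝ), (∀ k, ‖c k‖ ≤ 1) →
      (∀ t, ‖lacSum ψ S c u t‖ ≤ C) ∧ ∃ ε₀ > 0, ∀ ε, 0 < ε → ε ≤ ε₀ →
        ∃ G : 𝓢(ℝ, ℂ), (∀ θ, G θ = lacSum ψ S c u (θ / ε)) ∧
          (∀ θ, 1 / 4 < |θ| → G θ = 0) ∧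
          IsCZKernel (fun i : ℤ => invF G i) (C * (1 + |u|) ^ 4) := by
  obtain ⟨C₁, hC₁, H₁⟩ := exists_lacSum_le ψ hψ
  obtain ⟨C₂, hC₂, H₂⟩ := exists_deriv_invF_le ψ
  obtain ⟨R, hR⟩ := hψc.isCompact.isBounded.subset_closedBall 0
  have hψR : ∀ t, R < |t| → ψ t = 0 := by
    intro t ht
    by_contra hne
    have := hR (subset_tsupport _ hne)
    rw [Metric.mem_closedBall, Real.dist_eq, sub_zero] at this
    linarith
  refine ⟨4 * (C₁ + C₂), by positivity, fun S c u hc => ⟨fun t => (H₁ S c u hc t).trans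
    (by linarith), ?_⟩⟩
  set T := 1 + ∑ k ∈ S, |R| / 2 ^ k with hT
  have hT0 : 0 < T := by positivity
  have hlac : ∀ t, T < |t| → lacSum ψ S c u t = 0 := by
    intro t ht
    refine Finset.sum_eq_zero fun k hk => ?_
    have h2 : (0 : ℝ) < 2 ^ k := by positivity
    rw [hψR, zero_mul, mul_zero]
    have h3 : |R| / 2 ^ k ≤ ∑ k ∈ S, |R| / 2 ^ k :=
      Finset.single_le_sum (f := fun k : ℤ => |R| / 2 ^ k) (fun _ _ => by positivity) hk
    rw [abs_mul, abs_of_pos h2]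
    have h4 : |R| / 2 ^ k < |t| := by linarith
    rw [div_lt_iff₀ h2] at h4
    linarith [le_abs_self R]
  refine ⟨1 / (4 * T), by positivity, fun ε hε hεT => ?_⟩
  have hz : ∀ θ, 1 / 4 < |θ| → lacSum ψ S c u (θ / ε) = 0 := by
    intro θ hθ
    refine hlac _ ?_
    rw [abs_div, abs_of_pos hε, lt_div_iff₀ hε]
    rw [le_div_iff₀ (by positivity)] at hεT
    linarith
  have hcs : HasCompactSupport fun θ => lacSum ψ S c u (θ / ε) := by
    refine HasCompactSupport.intro (isCompact_closedBall (0 : ℝ) (1 / 4)) fun θ hθ => hz θ ?_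
    rwa [Metric.mem_closedBall, Real.dist_eq, sub_zero, not_le] at hθ
  have hsm : ContDiff ℝ (⊤ : ℕ∞) fun θ => lacSum ψ S c u (θ / ε) := by
    unfold lacSum
    refine ContDiff.sum fun k _ => contDiff_const.mul (ContDiff.mul ?_ ?_)
    · exact (ψ.smooth _).comp (contDiff_const.mul (contDiff_id.div_const _))
    · exact contDiff_e2π.comp (contDiff_const.mul (contDiff_const.mul (contDiff_id.div_const _)))
  have hGv : ∀ θ, hcs.toSchwartzMap hsm θ = lacSum ψ S c u (θ / ε) := fun θ => rfl
  refine ⟨hcs.toSchwartzMap hsm, hGv, fun θ hθ => (hGv θ).trans (hz θ hθ), ?_⟩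
  have h1u : (1 : ℝ) ≤ (1 + |u|) ^ 4 := one_le_pow₀ (by linarith [abs_nonneg u])
  rw [mul_assoc]
  refine isCZKernel_fourierInv _ (fun θ hθ => (hGv θ).trans (hz θ hθ)) (fun θ => ?_) fun x => ?_
  · rw [hGv]
    exact (H₁ S c u hc _).trans (by nlinarith)
  · exact (H₂ S c u ε _ hc hε hGv x).trans
      (mul_le_mul_of_nonneg_right (by linarith) (by positivity))

/-- Duality: the `L^p` norm is detected by pairings with Schwartz functions. -/
lemma integral_rpow_le_of_forall_schwartz {p q A : ℝ} (hpq : p.HolderConjugate q) (hA : 0 ≤ A)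
    {u : ℝ × ℝ → ℂ} (hu : MemLp u (ENNReal.ofReal p))
    (H : ∀ h : 𝓢(ℝ × ℝ, ℂ), ‖∫ z, u z * h z‖ ≤ A * nrm q h) :
    (∫ z, ‖u z‖ ^ p) ^ (1 / p) ≤ A := by
  have hp0 := hpq.pos
  have hp1 := hpq.lt
  have hq0 := hpq.symm.pos
  have hq1 := hpq.symm.lt
  set N := (∫ z, ‖u z‖ ^ p) ^ (1 / p) with hN
  have hI0 : 0 ≤ ∫ z, ‖u z‖ ^ p := by positivity
  have hNp : N ^ p = ∫ z, ‖u z‖ ^ p := by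
    rw [hN, ← Real.rpow_mul hI0, one_div_mul_cancel hp0.ne', Real.rpow_one]
  have hN0 : 0 ≤ N := by positivity
  have hqp : (p - 1) * q = p := by have := hpq.sub_one_mul_conj; linarith
  have hup : Integrable fun z => ‖u z‖ ^ p := by
    have := hu.integrable_norm_rpow (by simpa using hp0) ENNReal.ofReal_ne_top
    rwa [ENNReal.toReal_ofReal hp0.le] at this
  set v : ℝ × ℝ → ℂ := fun z => (starRingEnd ℂ) (u z) * ((‖u z‖ ^ (p - 2) : ℝ) : ℂ) with hv
  have hvn : ∀ z, ‖v z‖ = ‖u z‖ ^ (p - 1) := by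
    intro z
    rw [hv]
    simp only [norm_mul, RCLike.norm_conj, Complex.norm_real, Real.norm_eq_abs]
    rw [abs_of_nonneg (Real.rpow_nonneg (norm_nonneg _) _)]
    rcases (norm_nonneg (u z)).eq_or_lt with h | h
    · rw [← h, zero_mul, Real.zero_rpow (by linarith)]
    · rw [← Real.rpow_one_add' h.le (by linarith)]; ring_nf
  have hvm : AEStronglyMeasurable v := by
    have h1 := hu.1
    exact (Complex.continuous_conj.comp_aestronglyMeasurable h1).mul
      (Complex.continuous_ofReal.comp_aestronglyMeasurable
        (h1.norm.aemeasurable.pow_const _).aestronglyMeasurable)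
  have hvq : ∀ z, ‖v z‖ ^ q = ‖u z‖ ^ p := by
    intro z
    rw [hvn, ← Real.rpow_mul (norm_nonneg _), hqp]
  have hvL : MemLp v (ENNReal.ofReal q) := by
    rw [← integrable_norm_rpow_iff hvm (by simpa using hq0) ENNReal.ofReal_ne_top,
      ENNReal.toReal_ofReal hq0.le]
    simp_rw [hvq]
    exact hup
  have hvnorm : (∫ z, ‖v z‖ ^ q) ^ (1 / q) = N ^ (p - 1) := by
    simp_rw [hvq]
    rw [← hNp, ← Real.rpow_mul hN0, mul_one_div]
    congr 1
    rw [div_eq_iff hq0.ne', hqp]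
  have hval : ∀ {w : ℝ × ℝ → ℂ}, MemLp w (ENNReal.ofReal q) →
      eLpNorm w (ENNReal.ofReal q) volume = ENNReal.ofReal ((∫ z, ‖w z‖ ^ q) ^ (1 / q)) := by
    intro w hw
    rw [hw.eLpNorm_eq_integral_rpow_norm (by simpa using hq0) ENNReal.ofReal_ne_top,
      ENNReal.toReal_ofReal hq0.le, one_div]
  have huv : ∀ z, u z * v z = ((‖u z‖ ^ p : ℝ) : ℂ) := by
    intro z
    rw [hv]
    beta_reduce
    rw [← mul_assoc, Complex.mul_conj', ← Complex.ofReal_pow, ← Complex.ofReal_mul]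
    congr 1
    rcases (norm_nonneg (u z)).eq_or_lt with h | h
    · rw [← h, Real.zero_rpow hp0.ne']; simp
    · rw [← Real.rpow_natCast, ← Real.rpow_add h]; norm_num
  have hmul : ∀ {w : ℝ × ℝ → ℂ}, MemLp w (ENNReal.ofReal q) → Integrable fun z => u z * w z := by
    intro w hw
    have : ENNReal.HolderConjugate (ENNReal.ofReal p) (ENNReal.ofReal q) := hpq.ennrealOfReal
    exact hu.integrable_mul hw
  have key : ∀ δ > 0, N ^ p ≤ N * δ + |A| * (N ^ (p - 1) + δ) := by
    intro δ hδ
    obtain ⟨g, hg₁, hg₂, hg₃⟩ := hvL.exist_eLpNorm_sub_le ENNReal.ofReal_ne_top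
      (by rw [ENNReal.one_le_ofReal]; exact hq1.le) hδ
    set h := hg₁.toSchwartzMap hg₂ with hh
    have hhg : ∀ z, h z = g z := fun z => rfl
    have hhL : MemLp h (ENNReal.ofReal q) := h.memLp _
    have hd : MemLp (fun z => v z - h z) (ENNReal.ofReal q) := hvL.sub hhL
    have hd' : (∫ z, ‖v z - h z‖ ^ q) ^ (1 / q) ≤ δ := by
      have h1 := hval hd
      have h2 : eLpNorm (fun z => v z - h z) (ENNReal.ofReal q) volume ≤ ENNReal.ofReal δ := hg₃
      rw [h1] at h2
      exact (ENNReal.ofReal_le_ofReal_iff hδ.le).1 h2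
    have hn : nrm q h ≤ N ^ (p - 1) + δ := by
      have e1 := hval hhL
      have e2 : eLpNorm h (ENNReal.ofReal q) volume ≤ eLpNorm v (ENNReal.ofReal q) volume +
          eLpNorm (fun z => v z - h z) (ENNReal.ofReal q) volume := by
        have h3 : (h : ℝ × ℝ → ℂ) = v - fun z => v z - h z := by ext z; simp
        have h4 := eLpNorm_sub_le hvL.1 hd.1 (p := ENNReal.ofReal q)
          (by rw [ENNReal.one_le_ofReal]; exact hq1.le)
        rwa [← h3] at h4
      rw [e1, hval hvL, hval hd, hvnorm, ← ENNReal.ofReal_add (by positivity) (by positivity),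
        ENNReal.ofReal_le_ofReal_iff (by positivity)] at e2
      exact e2.trans (by linarith)
    have e3 : ((N ^ p : ℝ) : ℂ) = (∫ z, u z * (v z - h z)) + ∫ z, u z * h z := by
      have h4 : ∀ z, u z * v z = u z * (v z - h z) + u z * h z := fun z => by ring
      have h5 : ∫ z, u z * v z = (∫ z, u z * (v z - h z)) + ∫ z, u z * h z := by
        simp_rw [h4]
        exact integral_add (hmul hd) (hmul hhL)
      rw [← h5]
      simp_rw [huv]
      rw [integral_complex_ofReal, hNp]
    have e4 : ‖∫ z, u z * (v z - h z)‖ ≤ N * δ := by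
      refine (norm_integral_le_integral_norm _).trans ?_
      simp_rw [norm_mul]
      exact (integral_mul_norm_le_Lp_mul_Lq hpq hu hd).trans
        (mul_le_mul_of_nonneg_left hd' hN0)
    have e5 : ‖∫ z, u z * h z‖ ≤ |A| * (N ^ (p - 1) + δ) :=
      (H h).trans ((mul_le_mul_of_nonneg_right (le_abs_self A) (nrm_nonneg _ _)).trans
        (mul_le_mul_of_nonneg_left hn (abs_nonneg _)))
    calc N ^ p = ‖((N ^ p : ℝ) : ℂ)‖ := by
          rw [Complex.norm_real, Real.norm_of_nonneg (by positivity)]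
      _ ≤ _ := by rw [e3]; exact (norm_add_le _ _).trans (add_le_add e4 e5)
  have hlim : N ^ p ≤ |A| * N ^ (p - 1) := by
    refine le_of_forall_pos_le_add fun e he => ?_
    have h1 := key (e / (N + |A| + 1)) (by positivity)
    have h2 : (N + |A|) * (e / (N + |A| + 1)) ≤ e := by
      rw [← mul_div_assoc, div_le_iff₀ (by positivity)]
      nlinarith
    nlinarith
  have hAN : N ≤ |A| := by
    rcases hN0.eq_or_lt with h | h
    · rw [← h]; positivity
    · have h1 : N ^ p = N * N ^ (p - 1) := by
        rw [← Real.rpow_one_add' h.le (by linarith)]; ring_nf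
      rw [h1] at hlim
      exact le_of_mul_le_mul_right hlim (by positivity)
  rwa [abs_of_nonneg hA] at hAN

/-- The bilinear form with symbol `a`. -/
def bilin (a : ℝ × ℝ → ℂ) (f h : 𝓢(ℝ × ℝ, ℂ)) : ℂ :=
  ∫ ζ, a ζ * (ftS f ζ * ftS h (-ζ))

lemma integrable_pair (f h : 𝓢(ℝ × ℝ, ℂ)) :
    Integrable fun ζ : ℝ × ℝ => ftS f ζ * ftS h (-ζ) := by
  obtain ⟨C, hC⟩ := (ftS h).exists_norm_le
  exact (ftS f).integrable.mul_bdd (c := C) (Continuous.aestronglyMeasurable (by fun_prop))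
    (.of_forall fun w => hC _)

lemma integrable_mul_pair {a : ℝ × ℝ → ℂ} {K : ℝ} (ha : AEStronglyMeasurable a)
    (hK : ∀ ζ, ‖a ζ‖ ≤ K) (f h : 𝓢(ℝ × ℝ, ℂ)) :
    Integrable fun ζ : ℝ × ℝ => a ζ * (ftS f ζ * ftS h (-ζ)) :=
  (integrable_pair f h).bdd_mul ha (.of_forall hK)

lemma bilin_one (f h : 𝓢(ℝ × ℝ, ℂ)) :
    ∫ z, f z * h z = ∫ ζ, ftS f ζ * ftS h (-ζ) := by
  have h1 : ∀ z, f z * h z = ∫ ζ : ℝ × ℝ, ftS f ζ * e2π (z.1 * ζ.1 + z.2 * ζ.2) * h z := by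
    intro z
    rw [integral_mul_const, ← f.eq_integral_ftS]
  simp_rw [h1]
  rw [integral_integral_swap]
  · refine integral_congr_ae (.of_forall fun ζ => ?_)
    beta_reduce
    rw [ftS_apply h, FT2, ← integral_const_mul]
    refine integral_congr_ae (.of_forall fun z => ?_)
    simp only [Prod.fst_neg, Prod.snd_neg]
    rw [show -(z.1 * -ζ.1 + z.2 * -ζ.2) = z.1 * ζ.1 + z.2 * ζ.2 by ring]
    ring
  · have h2 : Integrable fun w : (ℝ × ℝ) × (ℝ × ℝ) => h w.1 * ftS f w.2 :=
      h.integrable.mul_prod (ftS f).integrable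
    have h3 := h2.mul_bdd (c := 1) (g := fun w : (ℝ × ℝ) × (ℝ × ℝ) =>
      e2π (w.1.1 * w.2.1 + w.1.2 * w.2.2)) (Continuous.aestronglyMeasurable (by fun_prop))
      (.of_forall fun _ => (norm_e2π _).le)
    refine h3.congr (.of_forall fun w => ?_)
    simp only [Function.uncurry]
    ring

lemma integral_fmul_mul {a : ℝ × ℝ → ℂ} (ha : a.HasTemperateGrowth)
    (f h : 𝓢(ℝ × ℝ, ℂ)) : ∫ z, fmul a f z * h z = bilin a f h := by
  rw [bilin_one, bilin]
  simp_rw [ftS_fmul ha, mul_assoc]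

lemma integral_shift_mul_shift (f h : 𝓢(ℝ × ℝ, ℂ)) (x y : ℝ × ℝ) :
    ∫ z, f (z + x) * h (z + y) =
      bilin (fun ζ => e2π ((x - y).1 * ζ.1 + (x - y).2 * ζ.2)) f h := by
  rw [← integral_fmul_mul (hasTemperateGrowth_e2π _)]
  simp_rw [fmul_e2π_apply]
  rw [← integral_add_right_eq_self (fun z => f (z + (x - y)) * h z) y]
  refine integral_congr_ae (.of_forall fun z => ?_)
  beta_reduce
  rw [show z + y + (x - y) = z + x by abel]

lemma mulBdd_of_bilin {p q A : ℝ} (hpq : p.HolderConjugate q) (hA : 0 ≤ A) {a : ℝ × ℝ → ℂ}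
    (ha : a.HasTemperateGrowth) (H : ∀ f h, ‖bilin a f h‖ ≤ A * (nrm p f * nrm q h)) :
    MulBdd p a A := by
  intro f
  refine integral_rpow_le_of_forall_schwartz hpq (mul_nonneg hA (nrm_nonneg _ _))
    ((fmul a f).memLp _) fun h => ?_
  rw [integral_fmul_mul ha, mul_assoc]
  exact H f h

lemma tendsto_bilin {a : ℕ → ℝ × ℝ → ℂ} {b : ℝ × ℝ → ℂ} {K : ℝ}
    (ha : ∀ n, AEStronglyMeasurable (a n)) (hK : ∀ n ζ, ‖a n ζ‖ ≤ K)
    (hlim : ∀ ζ, Tendsto (fun n => a n ζ) atTop (𝓝 (b ζ))) (f h : 𝓢(ℝ × ℝ, ℂ)) :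
    Tendsto (fun n => bilin (a n) f h) atTop (𝓝 (bilin b f h)) := by
  refine tendsto_integral_of_dominated_convergence (fun ζ => K * ‖ftS f ζ * ftS h (-ζ)‖)
    (fun n => (ha n).mul (integrable_pair f h).1) ((integrable_pair f h).norm.const_mul K)
    (fun n => Eventually.of_forall fun ζ => ?_) (.of_forall fun ζ => ?_)
  · rw [norm_mul]
    exact mul_le_mul_of_nonneg_right (hK n ζ) (norm_nonneg _)
  · exact (hlim ζ).mul_const _

lemma sum_sum_sub_eq_tsum (B : Finset ℤ) {g : ℤ → ℂ} :
    ∑ x ∈ B, ∑ y ∈ B, g (x - y) =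
      ∑' i, ((B.filter fun x => x - i ∈ B).card : ℂ) * g i := by
  have h1 : ∀ x : ℤ, HasSum (fun i => if x - i ∈ B then g i else 0) (∑ y ∈ B, g (x - y)) := by
    intro x
    have h2 : HasSum (fun j => if j ∈ B then g (x - j) else 0) (∑ y ∈ B, g (x - y)) := by
      rw [Finset.sum_congr rfl fun j (hj : j ∈ B) => (if_pos hj : (if j ∈ B then g (x - j) else 0) =
        g (x - j)).symm]
      exact hasSum_sum_of_ne_finset_zero fun j hj => if_neg hj
    have h4 := (Equiv.subLeft x).hasSum_iff.2 h2
    refine h4.congr_fun fun i => ?_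
    simp
  rw [← (hasSum_sum fun x (_ : x ∈ B) => h1 x).tsum_eq]
  refine tsum_congr fun i => ?_
  rw [← Finset.sum_filter, Finset.sum_const, nsmul_eq_mul]

lemma le_card_filter_dyadicBox (n : ℕ) (i : ℤ) :
    (2 : ℝ) ^ (n + 1) - |(i : ℝ)| ≤ ((dyadicBox n).filter fun x => x - i ∈ dyadicBox n).card := by
  have h1 : Finset.Ico (max (-2 ^ n : ℤ) (-2 ^ n + i)) (min (2 ^ n : ℤ) (2 ^ n + i)) ⊆
      (dyadicBox n).filter fun x => x - i ∈ dyadicBox n := by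
    intro x hx
    simp only [Finset.mem_Ico, max_le_iff, lt_min_iff, Finset.mem_filter, dyadicBox] at hx ⊢
    omega
  have h2 := Finset.card_le_card h1
  rw [Int.card_Ico] at h2
  have h3 : (2 : ℤ) ^ (n + 1) - |i| ≤
      (((dyadicBox n).filter fun x => x - i ∈ dyadicBox n).card : ℤ) := by
    rw [pow_succ]
    refine le_trans ?_ ((Int.self_le_toNat _).trans (Int.ofNat_le.2 h2))
    rcases abs_cases i with ⟨h, _⟩ | ⟨h, _⟩ <;> rw [h]
    · rw [max_eq_right (by linarith), min_eq_left (by linarith)]; linarith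
    · rw [max_eq_left (by linarith), min_eq_right (by linarith)]; linarith
  exact_mod_cast h3

lemma tendsto_sum_sum_sub {g : ℤ → ℂ} (hg : Summable fun i => ‖g i‖) :
    Tendsto (fun n : ℕ => ((2 : ℂ) ^ (n + 1))⁻¹ * ∑ x ∈ dyadicBox n, ∑ y ∈ dyadicBox n, g (x - y))
      atTop (𝓝 (∑' i, g i)) := by
  simp_rw [sum_sum_sub_eq_tsum, ← tsum_mul_left, ← mul_assoc]
  refine tendsto_tsum_of_dominated_convergence hg (fun i => ?_)
    (.of_forall fun n i => ?_)
  · have h1 : Tendsto (fun n : ℕ => ((2 : ℝ) ^ (n + 1))⁻¹ *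
        (((dyadicBox n).filter fun x => x - i ∈ dyadicBox n).card : ℝ)) atTop (𝓝 1) := by
      have h2 : Tendsto (fun n : ℕ => 1 - |(i : ℝ)| * ((2 : ℝ) ^ (n + 1))⁻¹) atTop (𝓝 1) := by
        have h3 : Tendsto (fun n : ℕ => ((2 : ℝ) ^ (n + 1))⁻¹) atTop (𝓝 0) :=
          tendsto_inv_atTop_zero.comp ((tendsto_pow_atTop_atTop_of_one_lt one_lt_two).comp
            (tendsto_add_atTop_nat 1))
        simpa using (h3.const_mul |(i : ℝ)|).const_sub 1
      refine tendsto_of_tendsto_of_tendsto_of_le_of_le h2 tendsto_const_nhds (fun n => ?_)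
        fun n => ?_
      · have h4 := le_card_filter_dyadicBox n i
        have h5 : (0 : ℝ) < 2 ^ (n + 1) := by positivity
        beta_reduce
        rw [inv_mul_eq_div, le_div_iff₀ h5, sub_mul, mul_assoc, inv_mul_cancel₀ h5.ne']
        linarith
      · beta_reduce
        rw [inv_mul_le_one₀ (by positivity)]
        have h4 := Finset.card_filter_le (dyadicBox n) fun x => x - i ∈ dyadicBox n
        rw [card_dyadicBox] at h4
        exact_mod_cast h4
    have h6 := (Complex.continuous_ofReal.tendsto 1).comp h1
    have h7 := h6.mul_const (g i)
    rw [Complex.ofReal_one, one_mul] at h7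
    refine h7.congr fun n => ?_
    simp
  · rw [norm_mul]
    refine mul_le_of_le_one_left (norm_nonneg _) ?_
    rw [norm_mul, norm_inv, norm_pow, Complex.norm_natCast, Complex.norm_ofNat,
      inv_mul_le_one₀ (by positivity)]
    have h4 := Finset.card_filter_le (dyadicBox n) fun x => x - i ∈ dyadicBox n
    rw [card_dyadicBox] at h4
    exact_mod_cast h4

lemma summable_invF (G : 𝓢(ℝ, ℂ)) : Summable fun i : ℤ => ‖invF G i‖ := by
  obtain ⟨A, hA, h⟩ := (invF G).exists_decay 2
  have hs : Summable fun i : ℤ => A * (1 / ((i : ℝ)) ^ 2) + if i = 0 then ‖invF G 0‖ else 0 := by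
    refine ((Real.summable_one_div_int_pow.2 one_lt_two).mul_left A).add ?_
    exact summable_of_ne_finset_zero (s := {0}) fun i hi => if_neg (by simpa using hi)
  refine hs.of_nonneg_of_le (fun _ => norm_nonneg _) fun i => ?_
  rcases eq_or_ne i 0 with rfl | hi
  · simp
  · rw [if_neg hi, add_zero, mul_one_div, le_div_iff₀ (by positivity)]
    refine le_trans (mul_le_mul_of_nonneg_left ?_ (norm_nonneg _)) (h i)
    rw [← sq_abs]
    exact pow_le_pow_left₀ (abs_nonneg _) (by linarith) 2

/-- The Fourier series of the periodization of `G`. -/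
lemma tsum_invF_mul_e2π (G : 𝓢(ℝ, ℂ)) (hG : ∀ θ, 1 / 4 < |θ| → G θ = 0) (θ : ℝ) :
    ∑' i : ℤ, invF G i * e2π (-(i * θ)) = G (θ - round θ) := by
  set t := θ - round θ with ht
  have h := SchwartzMap.tsum_eq_tsum_fourier G t
  have hr : |t| ≤ 1 / 2 := abs_sub_round θ
  rw [tsum_eq_single 0, Int.cast_zero, add_zero] at h
  · rw [h, ← (Equiv.neg ℤ).tsum_eq]
    refine tsum_congr fun n => ?_
    have e1 : invF G ((-n : ℤ) : ℝ) = (𝓕 G) (n : ℝ) := by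
      rw [fourierInv_real, fourier_real]
      push_cast
      simp only [neg_mul]
    have e2 : (fourier n (t : UnitAddCircle) : ℂ) = e2π (n * t) := by
      rw [fourier_coe_apply, e2π]
      congr 1
      push_cast
      ring
    have e3 : e2π (-(((-n : ℤ) : ℝ) * θ)) = e2π (n * t) := by
      have h1 := e2π_int (n * round θ)
      rw [ht, show -(((-n : ℤ) : ℝ) * θ) = n * (θ - round θ) + ((n * round θ : ℤ) : ℝ) by
        push_cast; ring, e2π_add, h1, mul_one]
    rw [Equiv.neg_apply, e1, e2, e3]
  · intro n hn
    refine hG _ ?_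
    have h1 : (1 : ℝ) ≤ |(n : ℝ)| := by exact_mod_cast Int.one_le_abs hn
    have h2 := abs_sub_abs_le_abs_sub (n : ℝ) (-t)
    rw [abs_neg, sub_neg_eq_add, add_comm (n : ℝ)] at h2
    linarith

lemma hasTemperateGrowth_lacSum (ψ : 𝓢(ℝ, ℂ)) (S : Finset ℤ) (c : ℤ → ℂ) (u : ℝ) :
    (lacSum ψ S c u).HasTemperateGrowth := by
  have h : ∀ a : ℝ, (fun t : ℝ => a * t).HasTemperateGrowth := fun a =>
    (ContinuousLinearMap.hasTemperateGrowth (a • ContinuousLinearMap.id ℝ ℝ))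
  unfold lacSum
  refine Function.HasTemperateGrowth.sum fun k _ => ?_
  refine (Function.HasTemperateGrowth.const _).mul (Function.HasTemperateGrowth.mul ?_ ?_)
  · exact ψ.hasTemperateGrowth.comp (h _)
  · exact hasTemperateGrowth_e2π_real.comp ((h u).comp (h _))

lemma hasTemperateGrowth_affine (α : ℝ × ℝ) (γ : ℝ) :
    (fun ζ : ℝ × ℝ => α.1 * ζ.1 + α.2 * ζ.2 + γ).HasTemperateGrowth := by
  refine Function.HasTemperateGrowth.add ?_ (Function.HasTemperateGrowth.const γ)
  exact ContinuousLinearMap.hasTemperateGrowth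
    (α.1 • ContinuousLinearMap.fst ℝ ℝ ℝ + α.2 • ContinuousLinearMap.snd ℝ ℝ ℝ)

lemma norm_bilin_kerMap_le {a : Fin 2 → ℝ} (ha : ∀ j, 0 < a j) (hsum : ∑ j, a j = 1) {k : ℤ → ℂ}
    {C : ℝ} (hC : 0 ≤ C) {n : ℕ}
    (hk : ∀ F : Fin 2 → ℤ → ℂ, (∀ i, ∀ z ∉ dyadicBox n, F i z = 0) →
      ‖kerMap k (dyadicBox n) F‖ ≤ C * ∏ j, (∑ z ∈ dyadicBox n, ‖F j z‖ ^ (1 / a j)) ^ a j)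
    (α : ℝ × ℝ) (γ : ℝ) (f h : 𝓢(ℝ × ℝ, ℂ)) :
    ‖bilin (fun ζ => ((2 : ℂ) ^ (n + 1))⁻¹ * ∑ x ∈ dyadicBox n, ∑ y ∈ dyadicBox n,
      k (x - y) * e2π (-((x - y : ℤ) * (α.1 * ζ.1 + α.2 * ζ.2 + γ)))) f h‖ ≤
      C * (nrm (1 / a 1) f * nrm (1 / a 0) h) := by
  set B := dyadicBox n
  have hB : B.Nonempty := Finset.card_pos.1 (by rw [card_dyadicBox]; positivity)
  have h1 := integral_multilinear_le (kerMap k B) B hB a ha hsum hC hk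
    (fun x : ℤ => (x * α.1, x * α.2)) ![h, f]
    (fun i x => (![e2π (-(x * γ)), e2π (x * γ)] : Fin 2 → ℂ) i) (by
      intro i x
      fin_cases i <;> simp [norm_e2π])
  have e : ∫ z, kerMap k B (fun i x => if x ∈ B then
      (![e2π (-(x * γ)), e2π (x * γ)] : Fin 2 → ℂ) i *
        (![h, f] : Fin 2 → 𝓢(ℝ × ℝ, ℂ)) i (z + (x * α.1, x * α.2)) else 0) =
      bilin (fun ζ => ∑ x ∈ B, ∑ y ∈ B,
        k (x - y) * e2π (-((x - y : ℤ) * (α.1 * ζ.1 + α.2 * ζ.2 + γ)))) f h := by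
    have e1 : ∀ z, kerMap k B (fun i x => if x ∈ B then
        (![e2π (-(x * γ)), e2π (x * γ)] : Fin 2 → ℂ) i *
          (![h, f] : Fin 2 → 𝓢(ℝ × ℝ, ℂ)) i (z + (x * α.1, x * α.2)) else 0) =
        ∑ x ∈ B, ∑ y ∈ B, (k (x - y) * e2π (-(x * γ)) * e2π (y * γ)) *
          (f (z + (y * α.1, y * α.2)) * h (z + (x * α.1, x * α.2))) := by
      intro z
      rw [kerMap_apply, kerForm]
      refine Finset.sum_congr rfl fun x hx => Finset.sum_congr rfl fun y hy => ?_
      simp only [hx, hy, if_true, Matrix.cons_val_zero, Matrix.cons_val_one]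
      ring
    have hi : ∀ x y : ℤ, Integrable fun z => (k (x - y) * e2π (-(x * γ)) * e2π (y * γ)) *
        (f (z + (y * α.1, y * α.2)) * h (z + (x * α.1, x * α.2))) := by
      intro x y
      obtain ⟨K, hK⟩ := h.exists_norm_le
      exact ((f.integrable.comp_add_right _).mul_bdd (c := K)
        (Continuous.aestronglyMeasurable (by fun_prop))
        (.of_forall fun w => hK _)).const_mul _
    simp_rw [e1]
    rw [integral_finsetSum _ fun x _ => integrable_finsetSum _ fun y _ => hi x y]
    have hi2 : ∀ x y : ℤ, Integrable fun ζ : ℝ × ℝ => k (x - y) *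
        e2π (-((x - y : ℤ) * (α.1 * ζ.1 + α.2 * ζ.2 + γ))) * (ftS f ζ * ftS h (-ζ)) := by
      intro x y
      refine integrable_mul_pair (K := ‖k (x - y)‖)
        (Continuous.aestronglyMeasurable (by fun_prop)) (fun ζ => ?_) f h
      rw [norm_mul, norm_e2π, mul_one]
    unfold bilin
    simp_rw [Finset.sum_mul]
    rw [integral_finsetSum _ fun x _ => integrable_finsetSum _ fun y _ => hi2 x y]
    refine Finset.sum_congr rfl fun x _ => ?_
    rw [integral_finsetSum _ fun y _ => hi x y, integral_finsetSum _ fun y _ => hi2 x y]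
    refine Finset.sum_congr rfl fun y _ => ?_
    rw [integral_const_mul, integral_shift_mul_shift, bilin, ← integral_const_mul]
    refine integral_congr_ae (.of_forall fun ζ => ?_)
    have e2 : e2π (-((x - y : ℤ) * (α.1 * ζ.1 + α.2 * ζ.2 + γ))) = e2π (-(x * γ)) * e2π (y * γ) *
        e2π ((y * α.1 - x * α.1) * ζ.1 + (y * α.2 - x * α.2) * ζ.2) := by
      rw [← e2π_add, ← e2π_add]
      push_cast
      ring_nf
    simp only [Prod.fst_sub, Prod.snd_sub]
    rw [e2]
    ring
  rw [e, Fin.prod_univ_two, card_dyadicBox] at h1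
  simp only [Matrix.cons_val_zero, Matrix.cons_val_one] at h1
  have e3 : bilin (fun ζ => ((2 : ℂ) ^ (n + 1))⁻¹ * ∑ x ∈ B, ∑ y ∈ B,
      k (x - y) * e2π (-((x - y : ℤ) * (α.1 * ζ.1 + α.2 * ζ.2 + γ)))) f h =
      ((2 : ℂ) ^ (n + 1))⁻¹ * bilin (fun ζ => ∑ x ∈ B, ∑ y ∈ B,
      k (x - y) * e2π (-((x - y : ℤ) * (α.1 * ζ.1 + α.2 * ζ.2 + γ)))) f h := by
    unfold bilin
    simp_rw [mul_assoc]
    rw [integral_const_mul]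
  rw [e3, norm_mul, norm_inv, norm_pow, Complex.norm_ofNat, inv_mul_le_iff₀ (by positivity)]
  refine h1.trans (le_of_eq ?_)
  push_cast
  ring

lemma norm_average_sum_sub_le {g : ℤ → ℂ} (hg : Summable fun i => ‖g i‖) (n : ℕ) :
    ‖((2 : ℂ) ^ (n + 1))⁻¹ * ∑ x ∈ dyadicBox n, ∑ y ∈ dyadicBox n, g (x - y)‖ ≤ ∑' i, ‖g i‖ := by
  rw [norm_mul, norm_inv, norm_pow, Complex.norm_ofNat, inv_mul_le_iff₀ (by positivity)]
  have h1 : ∀ x ∈ dyadicBox n, ‖∑ y ∈ dyadicBox n, g (x - y)‖ ≤ ∑' i, ‖g i‖ := by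
    intro x _
    have hs : Summable fun y : ℤ => ‖g (x - y)‖ := (Equiv.subLeft x).summable_iff.2 hg
    calc ‖∑ y ∈ dyadicBox n, g (x - y)‖ ≤ ∑ y ∈ dyadicBox n, ‖g (x - y)‖ := norm_sum_le _ _
      _ ≤ ∑' y, ‖g (x - y)‖ := hs.sum_le_tsum _ fun _ _ => norm_nonneg _
      _ = ∑' i, ‖g i‖ := (Equiv.subLeft x).tsum_eq fun i => ‖g i‖
  calc ‖∑ x ∈ dyadicBox n, ∑ y ∈ dyadicBox n, g (x - y)‖ ≤ ∑ x ∈ dyadicBox n, ∑' i, ‖g i‖ :=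
        norm_sum_le_of_le _ h1
    _ = 2 ^ (n + 1) * ∑' i, ‖g i‖ := by
        rw [Finset.sum_const, card_dyadicBox, nsmul_eq_mul]; push_cast; rfl

set_option maxHeartbeats 1000000 in
/-- The one-dimensional multiplier theorem for lacunary sums, along lines. -/
theorem exists_mulBdd_lacSum {p : ℝ} (hp : 1 < p) (ψ : 𝓢(ℝ, ℂ)) (hψ : ψ 0 = 0)
    (hψc : HasCompactSupport ψ) : ∃ C : ℝ, 0 ≤ C ∧ ∀ (S : Finset ℤ) (c : ℤ → ℂ) (u : ℝ),
      (∀ k, ‖c k‖ ≤ 1) → ∀ (α : ℝ × ℝ) (γ : ℝ),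
      MulBdd p (fun ζ => lacSum ψ S c u (α.1 * ζ.1 + α.2 * ζ.2 + γ)) (C * (1 + |u|) ^ 4) := by
  have hpq := Real.HolderConjugate.conjExponent hp
  set q := p.conjExponent with hq
  have hp0 := hpq.pos
  have hq0 := hpq.symm.pos
  let a : Fin 2 → ℝ := ![1 / q, 1 / p]
  have ha : ∀ j, 0 < a j := by intro j; fin_cases j <;> simp [a] <;> positivity
  have hsum : ∑ j, a j = 1 := by
    have := hpq.inv_add_inv_eq_one
    simp only [Fin.sum_univ_two, a, Matrix.cons_val_zero, Matrix.cons_val_one, one_div]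
    linarith
  have ha0 : 1 / a 0 = q := by simp [a]
  have ha1 : 1 / a 1 = p := by simp [a]
  obtain ⟨C₁, hC₁, H₁⟩ := exists_kerMap_le ha hsum
  obtain ⟨C₂, hC₂, H₂⟩ := exists_isCZKernel_lacSum ψ hψ hψc
  refine ⟨C₁ * C₂, by positivity, fun S c u hc α γ => ?_⟩
  obtain ⟨hb, ε₀, hε₀, H⟩ := H₂ S c u hc
  refine mulBdd_of_bilin hpq (by positivity)
    ((hasTemperateGrowth_lacSum ψ S c u).comp (hasTemperateGrowth_affine α γ)) fun f h => ?_
  set t : ℝ × ℝ → ℝ := fun ζ => α.1 * ζ.1 + α.2 * ζ.2 + γ with ht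
  have htc : Continuous t := by fun_prop
  have hstep : ∀ ε, 0 < ε → ε ≤ ε₀ → ∃ a : ℝ × ℝ → ℂ, AEStronglyMeasurable a ∧
      (∀ ζ, ‖a ζ‖ ≤ C₂) ∧ (∀ ζ, ε * |t ζ| < 1 / 2 → a ζ = lacSum ψ S c u (t ζ)) ∧
      ‖bilin a f h‖ ≤ C₁ * (C₂ * (1 + |u|) ^ 4) * (nrm p f * nrm q h) := by
    intro ε hε hε1
    obtain ⟨G, hG, hG0, hk⟩ := H ε hε hε1
    have hA := hk.nonneg
    have hbn : ∀ n : ℕ, ∀ ζ, ‖((2 : ℂ) ^ (n + 1))⁻¹ * ∑ x ∈ dyadicBox n, ∑ y ∈ dyadicBox n,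
        invF G (x - y : ℤ) * e2π (-((x - y : ℤ) * (ε * t ζ)))‖ ≤ ∑' i : ℤ, ‖invF G i‖ := by
      intro n ζ
      have hs : Summable fun i : ℤ => ‖invF G i * e2π (-(i * (ε * t ζ)))‖ := by
        simp only [norm_mul, norm_e2π, mul_one]
        exact summable_invF G
      have h1 := norm_average_sum_sub_le hs n
      simp only [norm_mul _ (e2π _), norm_e2π, mul_one] at h1
      exact h1
    have hlim : ∀ ζ, Tendsto (fun n : ℕ => ((2 : ℂ) ^ (n + 1))⁻¹ * ∑ x ∈ dyadicBox n,
        ∑ y ∈ dyadicBox n, invF G (x - y : ℤ) * e2π (-((x - y : ℤ) * (ε * t ζ)))) atTop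
        (𝓝 (G (ε * t ζ - round (ε * t ζ)))) := by
      intro ζ
      rw [← tsum_invF_mul_e2π G hG0]
      refine tendsto_sum_sum_sub (g := fun i : ℤ => invF G i * e2π (-(i * (ε * t ζ)))) ?_
      simp only [norm_mul, norm_e2π, mul_one]
      exact summable_invF G
    have hmeas : ∀ n : ℕ, AEStronglyMeasurable fun ζ => ((2 : ℂ) ^ (n + 1))⁻¹ *
        ∑ x ∈ dyadicBox n, ∑ y ∈ dyadicBox n,
        invF G (x - y : ℤ) * e2π (-((x - y : ℤ) * (ε * t ζ))) := fun n =>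
      Continuous.aestronglyMeasurable (by fun_prop)
    refine ⟨fun ζ => G (ε * t ζ - round (ε * t ζ)),
      aestronglyMeasurable_of_tendsto_ae atTop hmeas (.of_forall hlim),
      fun ζ => ?_, fun ζ hζ => ?_, ?_⟩
    · beta_reduce; rw [hG]; exact hb _
    · have : round (ε * t ζ) = 0 := by
        rw [round_eq_zero_iff]
        rw [← abs_of_pos hε, ← abs_mul, abs_lt] at hζ
        exact ⟨by linarith, by linarith⟩
      beta_reduce
      rw [this, Int.cast_zero, sub_zero, hG, mul_div_cancel_left₀ _ hε.ne']
    · refine le_of_tendsto (tendsto_bilin hmeas hbn hlim f h).norm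
        (.of_forall fun n => ?_)
      have h1 := norm_bilin_kerMap_le ha hsum (mul_nonneg hC₁ hA) (H₁ _ _ hk n) (ε • α) (ε * γ) f h
      rw [ha0, ha1] at h1
      have e : ∀ ζ : ℝ × ℝ, (ε • α).1 * ζ.1 + (ε • α).2 * ζ.2 + ε * γ = ε * t ζ := by
        intro ζ
        simp only [ht, Prod.smul_fst, Prod.smul_snd, smul_eq_mul]
        ring
      simp only [e] at h1
      exact h1
  choose! a' ha₁ ha₂ ha₃ ha₄ using hstep
  have hpos : ∀ n : ℕ, 0 < ε₀ / (n + 1) := fun n => by positivity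
  have hle : ∀ n : ℕ, ε₀ / (n + 1) ≤ ε₀ := fun n => div_le_self hε₀.le (by simp)
  have hl := tendsto_bilin (fun n : ℕ => ha₁ _ (hpos n) (hle n))
    (fun n : ℕ => ha₂ _ (hpos n) (hle n)) (b := fun ζ => lacSum ψ S c u (t ζ)) (fun ζ => ?_) f h
  · rw [mul_assoc C₁]
    exact le_of_tendsto hl.norm (.of_forall fun n => ha₄ _ (hpos n) (hle n))
  · refine tendsto_const_nhds.congr' ?_
    have h1 : Tendsto (fun n : ℕ => ε₀ / ((n : ℝ) + 1) * |t ζ|) atTop (𝓝 0) := by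
      have h2 := (tendsto_one_div_add_atTop_nhds_zero_nat (𝕜 := ℝ)).const_mul (ε₀ * |t ζ|)
      rw [mul_zero] at h2
      refine h2.congr fun n => ?_
      ring
    filter_upwards [h1.eventually (gt_mem_nhds (by norm_num : (0 : ℝ) < 1 / 2))] with n hn
    exact (ha₃ _ (hpos n) (hle n) ζ hn).symm

section

variable {p q r : ℝ}

lemma exists_signs_norm_sum_diag_le (J : Finset ℤ) (Φ : ℤ → ℤ → ℂ) : ∀ c : ℂ,
    ∃ ε : ℤ → ℂ, (∀ k, ε k = 1 ∨ ε k = -1) ∧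
      ‖c + ∑ j ∈ J, Φ j j‖ ≤ ‖c + ∑ j ∈ J, ∑ k ∈ J, ε j * ε k * Φ j k‖ := by
  induction J using Finset.induction_on with
  | empty => exact fun c => ⟨fun _ => 1, fun _ => Or.inl rfl, by simp⟩
  | insert a s ha ih =>
    intro c
    obtain ⟨ε, hε, h⟩ := ih (c + Φ a a)
    set Z := c + Φ a a + ∑ j ∈ s, ∑ k ∈ s, ε j * ε k * Φ j k with hZ
    set W := ∑ k ∈ s, ε k * (Φ a k + Φ k a) with hW
    have key : ∀ σ : ℂ, σ = 1 ∨ σ = -1 → c + ∑ j ∈ insert a s, ∑ k ∈ insert a s,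
        Function.update ε a σ j * Function.update ε a σ k * Φ j k = Z + σ * W := by
      intro σ hσ
      have hσ2 : σ * σ = 1 := by rcases hσ with h | h <;> simp [h]
      have hu : ∀ j ∈ s, Function.update ε a σ j = ε j := fun j hj =>
        Function.update_of_ne (ne_of_mem_of_not_mem hj ha) _ _
      rw [Finset.sum_insert ha, Finset.sum_insert ha]
      simp only [Function.update_self]
      have e1 : ∑ k ∈ s, σ * Function.update ε a σ k * Φ a k = σ * ∑ k ∈ s, ε k * Φ a k := by
        rw [Finset.mul_sum]
        exact Finset.sum_congr rfl fun k hk => by rw [hu k hk]; ring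
      have e2 : ∑ j ∈ s, ∑ k ∈ insert a s, Function.update ε a σ j * Function.update ε a σ k *
          Φ j k = σ * ∑ k ∈ s, ε k * Φ k a + ∑ j ∈ s, ∑ k ∈ s, ε j * ε k * Φ j k := by
        rw [Finset.mul_sum, ← Finset.sum_add_distrib]
        refine Finset.sum_congr rfl fun j hj => ?_
        rw [Finset.sum_insert ha, Function.update_self, hu j hj]
        congr 1
        · ring
        · exact Finset.sum_congr rfl fun k hk => by rw [hu k hk]
      rw [e1, e2, hσ2, hZ, hW]
      simp only [mul_add, Finset.sum_add_distrib]
      ring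
    have hcase : ∃ σ : ℂ, (σ = 1 ∨ σ = -1) ∧ ‖Z‖ ≤ ‖Z + σ * W‖ := by
      by_contra! hn
      have h1 := hn 1 (Or.inl rfl)
      have h2 := hn (-1) (Or.inr rfl)
      have h3 := norm_add_le (Z + 1 * W) (Z + -1 * W)
      have h4 : Z + 1 * W + (Z + -1 * W) = 2 * Z := by ring
      rw [h4, norm_mul, Complex.norm_ofNat] at h3
      linarith
    obtain ⟨σ, hσ, hle⟩ := hcase
    refine ⟨Function.update ε a σ, fun k => ?_, ?_⟩
    · by_cases hk : k = a
      · subst hk; simpa using hσ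
      · rw [Function.update_of_ne hk]; exact hε k
    · rw [key σ hσ, Finset.sum_insert ha, ← add_assoc]
      exact h.trans hle

lemma SymBdd.of_signs (J : Finset ℤ) {M : (ℝ × ℝ) × (ℝ × ℝ) → ℂ}
    {a b : ℤ → (ℝ × ℝ) × (ℝ × ℝ) → ℂ} {A K Ka Kb : ℝ} (hM : AEStronglyMeasurable M)
    (ha : ∀ j, AEStronglyMeasurable (a j)) (hb : ∀ j, AEStronglyMeasurable (b j))
    (hMK : ∀ w, ‖M w‖ ≤ K) (haK : ∀ j w, ‖a j w‖ ≤ Ka) (hbK : ∀ j w, ‖b j w‖ ≤ Kb)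
    (h : ∀ ε : ℤ → ℂ, (∀ k, ε k = 1 ∨ ε k = -1) → SymBdd p q r
      (fun w => M w * ((∑ j ∈ J, ε j * a j w) * ∑ j ∈ J, ε j * b j w)) A) :
    SymBdd p q r (fun w => M w * ∑ j ∈ J, a j w * b j w) A := by
  intro f g k
  have hK0 : 0 ≤ K := (norm_nonneg _).trans (hMK 0)
  have hKa : 0 ≤ Ka := (norm_nonneg _).trans (haK 0 0)
  have hi : ∀ i j, Integrable fun w => M w * (a i w * b j w) * triFT f g k w := fun i j =>
    integrable_mul_triFT (K := K * (Ka * Kb)) (hM.mul ((ha i).mul (hb j))) (fun w => by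
      simp only [Pi.mul_apply, norm_mul]
      exact mul_le_mul (hMK w) (mul_le_mul (haK i w) (hbK j w) (norm_nonneg _) hKa)
        (by positivity) hK0) f g k
  set Φ : ℤ → ℤ → ℂ := fun i j => trilin (fun w => M w * (a i w * b j w)) f g k with hΦ
  obtain ⟨ε, hε, hle⟩ := exists_signs_norm_sum_diag_le J Φ 0
  rw [zero_add, zero_add] at hle
  have e1 : trilin (fun w => M w * ∑ j ∈ J, a j w * b j w) f g k = ∑ j ∈ J, Φ j j := by
    simp only [hΦ, trilin, Finset.mul_sum, Finset.sum_mul]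
    rw [integral_finsetSum _ fun j _ => hi j j]
  have e2 : trilin (fun w => M w * ((∑ j ∈ J, ε j * a j w) * ∑ j ∈ J, ε j * b j w)) f g k =
      ∑ i ∈ J, ∑ j ∈ J, ε i * ε j * Φ i j := by
    have e3 : ∀ w, M w * ((∑ j ∈ J, ε j * a j w) * ∑ j ∈ J, ε j * b j w) * triFT f g k w =
        ∑ i ∈ J, ∑ j ∈ J, ε i * ε j * (M w * (a i w * b j w) * triFT f g k w) := by
      intro w
      rw [Finset.sum_mul_sum, Finset.mul_sum, Finset.sum_mul]
      refine Finset.sum_congr rfl fun i _ => ?_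
      rw [Finset.mul_sum, Finset.sum_mul]
      exact Finset.sum_congr rfl fun j _ => by ring
    simp only [hΦ, trilin, e3]
    rw [integral_finsetSum _ fun i _ => integrable_finsetSum _ fun j _ => (hi i j).const_mul _]
    refine Finset.sum_congr rfl fun i _ => ?_
    rw [integral_finsetSum _ fun j _ => (hi i j).const_mul _]
    exact Finset.sum_congr rfl fun j _ => integral_const_mul _ _
  rw [e1]
  refine hle.trans ?_
  rw [← e2]
  exact h ε hε f g k

lemma symBdd_one {a : Fin 3 → ℝ} (ha : ∀ j, 0 < a j) (hsum : ∑ j, a j = 1) :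
    SymBdd (1 / a 1) (1 / a 2) (1 / a 0) (fun _ => 1) 1 := by
  intro f g h
  have e := trilin_shift f g h 0 0 0
  simp only [Prod.fst_zero, Prod.snd_zero, add_zero, zero_mul, neg_zero, e2π_zero, mul_one] at e
  rw [← e]
  obtain ⟨h1, h2⟩ := integral_prod_rpow_le (μ := volume)
    (fun i z => ‖(![h, f, g] : Fin 3 → 𝓢(ℝ × ℝ, ℂ)) i z‖ ^ (1 / a i)) a
    (fun i => (ha i).le) hsum (fun i z => by positivity)
    fun i => integrable_norm_rpow _ (by have := ha i; positivity)
  refine (norm_integral_le_of_norm_le h1 (.of_forall fun z => le_of_eq ?_)).trans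
    (h2.trans (le_of_eq ?_))
  · have e1 : ∀ i, (‖(![h, f, g] : Fin 3 → 𝓢(ℝ × ℝ, ℂ)) i z‖ ^ (1 / a i)) ^ a i =
        ‖(![h, f, g] : Fin 3 → 𝓢(ℝ × ℝ, ℂ)) i z‖ := by
      intro i
      rw [← Real.rpow_mul (norm_nonneg _), one_div_mul_cancel (ha i).ne', Real.rpow_one]
    simp only [e1, Fin.prod_univ_three, norm_mul]
    simp only [Matrix.cons_val_zero, Matrix.cons_val_one, Matrix.cons_val_two, Matrix.tail_cons,
      Matrix.head_cons]
    ring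
  · simp only [Fin.prod_univ_three, nrm, one_div_one_div]
    simp only [Matrix.cons_val_zero, Matrix.cons_val_one, Matrix.cons_val_two, Matrix.tail_cons,
      Matrix.head_cons]
    ring

lemma mulBdd_one (p : ℝ) : MulBdd p (fun _ => 1) 1 := by
  have := mulBdd_e2π p 0
  simpa using this

/-- Paraproduct-type symbols with both profiles vanishing at the origin are bounded. -/
theorem exists_symBdd_annular {a : Fin 3 → ℝ} (ha : ∀ j, 0 < a j) (hsum : ∑ j, a j = 1)
    (ψ₁ ψ₂ : 𝓢(ℝ, ℂ)) (h₁ : ψ₁ 0 = 0) (h₁c : HasCompactSupport ψ₁) (h₂ : ψ₂ 0 = 0)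
    (h₂c : HasCompactSupport ψ₂) : ∃ C : ℝ, 0 ≤ C ∧ ∀ (J : Finset ℤ) (c : ℤ → ℂ) (u v ρ₁ ρ₂ : ℝ),
      (∀ k, ‖c k‖ ≤ 1) → SymBdd (1 / a 1) (1 / a 2) (1 / a 0) (fun w => ∑ j ∈ J,
        (c j * (ψ₁ (2 ^ j * (ρ₁ * w.1.1)) * e2π (u * (2 ^ j * (ρ₁ * w.1.1))))) *
        (ψ₂ (2 ^ j * (ρ₂ * w.2.2)) * e2π (v * (2 ^ j * (ρ₂ * w.2.2)))))
        (C * ((1 + |u|) ^ 4 * (1 + |v|) ^ 4)) := by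
  have hlt : ∀ i, i ≠ 0 → 1 < 1 / a i := by
    intro i hi
    rw [Fin.sum_univ_three] at hsum
    have h0 := ha 0
    have h1 := ha 1
    have h2 := ha 2
    rw [lt_div_iff₀ (ha i)]
    fin_cases i <;> simp at hi ⊢ <;> linarith
  obtain ⟨C₁, hC₁, H₁⟩ := exists_mulBdd_lacSum (hlt 1 (by decide)) ψ₁ h₁ h₁c
  obtain ⟨C₂, hC₂, H₂⟩ := exists_mulBdd_lacSum (hlt 2 (by decide)) ψ₂ h₂ h₂c
  obtain ⟨K₁, hK₁⟩ : ∃ K, ∀ x, ‖ψ₁ x‖ ≤ K := ⟨_, fun z => ψ₁.norm_le_seminorm ℝ z⟩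
  obtain ⟨K₂, hK₂⟩ : ∃ K, ∀ x, ‖ψ₂ x‖ ≤ K := ⟨_, fun z => ψ₂.norm_le_seminorm ℝ z⟩
  refine ⟨C₁ * C₂, by positivity, fun J c u v ρ₁ ρ₂ hc => ?_⟩
  have hmain := SymBdd.of_signs (p := 1 / a 1) (q := 1 / a 2) (r := 1 / a 0) J
    (M := fun _ => 1) (K := 1) (Ka := K₁) (Kb := K₂)
    (A := C₁ * C₂ * ((1 + |u|) ^ 4 * (1 + |v|) ^ 4))
    (a := fun j w => c j * (ψ₁ (2 ^ j * (ρ₁ * w.1.1)) * e2π (u * (2 ^ j * (ρ₁ * w.1.1)))))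
    (b := fun j w => ψ₂ (2 ^ j * (ρ₂ * w.2.2)) * e2π (v * (2 ^ j * (ρ₂ * w.2.2))))
    (Continuous.aestronglyMeasurable (by fun_prop))
    (fun j => Continuous.aestronglyMeasurable (by fun_prop))
    (fun j => Continuous.aestronglyMeasurable (by fun_prop)) (fun w => by simp)
    (fun j w => by
      rw [norm_mul, norm_mul, norm_e2π, mul_one]
      refine (mul_le_mul (hc j) (hK₁ _) (norm_nonneg _) zero_le_one).trans (one_mul _).le)
    (fun j w => by rw [norm_mul, norm_e2π, mul_one]; exact hK₂ _) fun ε hε => ?_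
  · simpa only [one_mul] using hmain
  have hε1 : ∀ k, ‖ε k‖ = 1 := fun k => by rcases hε k with h | h <;> simp [h]
  have hm₁ := H₁ J (fun k => ε k * c k) u (fun k => by rw [norm_mul, hε1, one_mul]; exact hc k)
    (ρ₁, 0) 0
  have hm₂ := H₂ J ε v (fun k => (hε1 k).le) (0, ρ₂) 0
  have h := (symBdd_one ha hsum).mul
    ((hasTemperateGrowth_lacSum ψ₁ J _ u).comp (hasTemperateGrowth_affine (ρ₁, 0) 0))
    ((hasTemperateGrowth_lacSum ψ₂ J _ v).comp (hasTemperateGrowth_affine (0, ρ₂) 0))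
    (Function.HasTemperateGrowth.const 1) zero_le_one (by positivity) (by positivity)
    hm₁ hm₂ (mulBdd_one _)
  convert h using 1
  · ext w
    simp only [Function.comp_apply, lacSum, zero_mul, add_zero, zero_add, mul_one, one_mul]
    congr 1
    exact Finset.sum_congr rfl fun j _ => by ring
  · ring

end

/-- A smooth even bump function, equal to `1` on `[-1, 1]` and supported in `[-2, 2]`. -/
def bumpφ : 𝓢(ℝ, ℂ) :=
  let b : ContDiffBump (0 : ℝ) := ⟨1, 2, one_pos, one_lt_two⟩
  HasCompactSupport.toSchwartzMap (f := fun t => ((b t : ℝ) : ℂ))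
    (b.hasCompactSupport.comp_left Complex.ofReal_zero)
    (Complex.ofRealCLM.contDiff.comp b.contDiff)

lemma bumpφ_one {t : ℝ} (ht : |t| ≤ 1) : bumpφ t = 1 := by
  let b : ContDiffBump (0 : ℝ) := ⟨1, 2, one_pos, one_lt_two⟩
  change ((b t : ℝ) : ℂ) = 1
  rw [b.one_of_mem_closedBall (by simpa using ht)]
  simp

lemma bumpφ_zero {t : ℝ} (ht : 2 ≤ |t|) : bumpφ t = 0 := by
  let b : ContDiffBump (0 : ℝ) := ⟨1, 2, one_pos, one_lt_two⟩
  change ((b t : ℝ) : ℂ) = 0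
  rw [b.zero_of_le_dist (by simpa using ht)]
  simp

lemma bumpφ_neg (t : ℝ) : bumpφ (-t) = bumpφ t := by
  let b : ContDiffBump (0 : ℝ) := ⟨1, 2, one_pos, one_lt_two⟩
  change ((b (-t) : ℝ) : ℂ) = ((b t : ℝ) : ℂ)
  rw [b.neg]

/-- Dilation of a Schwartz function by `b ≠ 0` (junk value `0` at `b = 0`). -/
def dilS (b : ℝ) (f : 𝓢(ℝ, ℂ)) : 𝓢(ℝ, ℂ) :=
  if hb : b ≠ 0 then compCLMOfContinuousLinearEquiv ℂ
    (ContinuousLinearEquiv.unitsEquivAut ℝ (Units.mk0 b hb)) f else 0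

lemma dilS_apply {b : ℝ} (hb : b ≠ 0) (f : 𝓢(ℝ, ℂ)) (t : ℝ) : dilS b f t = f (b * t) := by
  rw [dilS, dif_pos hb]
  simp [mul_comm]

/-- The Littlewood–Paley profile `φ(t) - φ(2t)`. -/
def lpσ : 𝓢(ℝ, ℂ) := bumpφ - dilS 2 bumpφ

lemma lpσ_apply (t : ℝ) : lpσ t = bumpφ t - bumpφ (2 * t) := by
  simp [lpσ, dilS_apply two_ne_zero]

lemma lpσ_ne_zero {t : ℝ} (h : lpσ t ≠ 0) : 1 / 2 < |t| ∧ |t| < 2 := by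
  rw [lpσ_apply] at h
  constructor
  · by_contra! hn
    refine h ?_
    rw [bumpφ_one (by linarith), bumpφ_one (by rw [abs_mul, abs_two]; linarith), sub_self]
  · by_contra! hn
    refine h ?_
    rw [bumpφ_zero hn, bumpφ_zero (by rw [abs_mul, abs_two]; linarith), sub_self]

lemma sum_Icc_lpσ (m n : ℕ) (t : ℝ) :
    ∑ l ∈ Finset.Icc (-m : ℤ) n, lpσ (2 ^ l * t) =
      bumpφ (2 ^ (-m : ℤ) * t) - bumpφ (2 ^ (n + 1 : ℤ) * t) := by
  have h2 : (2 : ℝ) ≠ 0 := two_ne_zero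
  have e : ∀ l : ℤ, lpσ (2 ^ l * t) = bumpφ (2 ^ l * t) - bumpφ (2 ^ (l + 1) * t) := by
    intro l
    rw [lpσ_apply, zpow_add_one₀ h2]
    congr 2
    ring
  induction n with
  | zero =>
    induction m with
    | zero => simp [e]
    | succ m ih =>
      have : Finset.Icc (-((m + 1 : ℕ) : ℤ)) (0 : ℕ) =
          insert (-((m + 1 : ℕ) : ℤ)) (Finset.Icc (-m : ℤ) (0 : ℕ)) := by
        ext x; simp only [Finset.mem_Icc, Finset.mem_insert]; push_cast; omega
      rw [this, Finset.sum_insert (by simp), ih, e]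
      have h3 : -((m + 1 : ℕ) : ℤ) + 1 = -(m : ℤ) := by push_cast; ring
      rw [h3]; ring
  | succ n ih =>
    have : Finset.Icc (-m : ℤ) ((n + 1 : ℕ) : ℤ) =
        insert (((n + 1 : ℕ) : ℤ)) (Finset.Icc (-m : ℤ) (n : ℕ)) := by
      ext x; simp only [Finset.mem_Icc, Finset.mem_insert]; push_cast; omega
    rw [this, Finset.sum_insert (by simp), ih, e]
    push_cast; ring

lemma sum_Icc_lpσ_eq_one {m : ℕ} {t : ℝ} (h₁ : 2 ^ (-m : ℤ) ≤ |t|) (h₂ : |t| ≤ 2 ^ (m : ℤ)) :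
    ∑ l ∈ Finset.Icc (-m : ℤ) m, lpσ (2 ^ l * t) = 1 := by
  have h2 : (0 : ℝ) < 2 := two_pos
  rw [sum_Icc_lpσ, bumpφ_one, bumpφ_zero, sub_zero]
  · rw [abs_mul, abs_of_pos (by positivity), zpow_add_one₀ h2.ne']
    have := mul_le_mul_of_nonneg_left h₁ (by positivity : (0 : ℝ) ≤ 2 ^ (m : ℤ))
    rw [← zpow_add₀ h2.ne', add_neg_cancel, zpow_zero] at this
    linarith
  · rw [abs_mul, abs_of_pos (by positivity)]
    have := mul_le_mul_of_nonneg_left h₂ (by positivity : (0 : ℝ) ≤ 2 ^ (-m : ℤ))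
    rwa [← zpow_add₀ h2.ne', neg_add_cancel, zpow_zero] at this

section

variable {p q r : ℝ}

/-- Measurable bounded symbols. -/
def IsTame (M : (ℝ × ℝ) × (ℝ × ℝ) → ℂ) : Prop :=
  AEStronglyMeasurable M ∧ ∃ K, ∀ w, ‖M w‖ ≤ K

lemma isTame_const (c : ℂ) : IsTame fun _ => c :=
  ⟨aestronglyMeasurable_const, ‖c‖, fun _ => le_rfl⟩

lemma IsTame.mul {M N : (ℝ × ℝ) × (ℝ × ℝ) → ℂ} (hM : IsTame M) (hN : IsTame N) :
    IsTame fun w => M w * N w := by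
  obtain ⟨hM, K, hK⟩ := hM
  obtain ⟨hN, K', hK'⟩ := hN
  refine ⟨hM.mul hN, K * K', fun w => ?_⟩
  rw [norm_mul]
  exact mul_le_mul (hK w) (hK' w) (norm_nonneg _) ((norm_nonneg _).trans (hK w))

lemma IsTame.add {M N : (ℝ × ℝ) × (ℝ × ℝ) → ℂ} (hM : IsTame M) (hN : IsTame N) :
    IsTame fun w => M w + N w := by
  obtain ⟨hM, K, hK⟩ := hM
  obtain ⟨hN, K', hK'⟩ := hN
  exact ⟨hM.add hN, K + K', fun w => norm_add_le_of_le (hK w) (hK' w)⟩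

lemma IsTame.sum {ι : Type*} (s : Finset ι) {M : ι → (ℝ × ℝ) × (ℝ × ℝ) → ℂ}
    (h : ∀ i, IsTame (M i)) : IsTame fun w => ∑ i ∈ s, M i w := by
  choose h K hK using h
  exact ⟨Finset.aestronglyMeasurable_fun_sum s fun i _ => h i, ∑ i ∈ s, K i,
    fun w => norm_sum_le_of_le _ fun i _ => hK i w⟩

lemma isTame_schwartz (f : 𝓢(ℝ, ℂ)) {t : (ℝ × ℝ) × (ℝ × ℝ) → ℝ} (ht : Continuous t) :
    IsTame fun w => f (t w) :=
  ⟨(f.continuous.comp ht).aestronglyMeasurable, _, fun w => f.norm_le_seminorm ℝ (t w)⟩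

lemma isTame_e2π {t : (ℝ × ℝ) × (ℝ × ℝ) → ℝ} (ht : Continuous t) : IsTame fun w => e2π (t w) :=
  ⟨(continuous_e2π.comp ht).aestronglyMeasurable, 1, fun _ => (norm_e2π _).le⟩

lemma SymBdd.sum_of_isTame {ι : Type*} (s : Finset ι) {M : ι → (ℝ × ℝ) × (ℝ × ℝ) → ℂ} {A : ι → ℝ}
    (hM : ∀ i, IsTame (M i)) (h : ∀ i ∈ s, SymBdd p q r (M i) (A i)) :
    SymBdd p q r (fun w => ∑ i ∈ s, M i w) (∑ i ∈ s, A i) := by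
  choose hm K hK using hM
  exact SymBdd.sum s (fun i _ => hm i) (fun i _ => hK i) h

lemma SymBdd.add {M N : (ℝ × ℝ) × (ℝ × ℝ) → ℂ} {A B : ℝ} (hM : IsTame M) (hN : IsTame N)
    (h₁ : SymBdd p q r M A) (h₂ : SymBdd p q r N B) :
    SymBdd p q r (fun w => M w + N w) (A + B) := by
  have h := SymBdd.sum_of_isTame (p := p) (q := q) (r := r) Finset.univ (M := ![M, N])
    (A := ![A, B]) (fun i => by fin_cases i <;> assumption)
    (fun i _ => by fin_cases i <;> assumption)
  simpa only [Fin.sum_univ_two, Matrix.cons_val_zero, Matrix.cons_val_one] using h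

/-- The product of two Schwartz functions of one variable. -/
def mulS (f g : 𝓢(ℝ, ℂ)) : 𝓢(ℝ, ℂ) := smulLeftCLM ℂ f g

lemma mulS_apply (f g : 𝓢(ℝ, ℂ)) (t : ℝ) : mulS f g t = f t * g t := by
  rw [mulS, SchwartzMap.smulLeftCLM_apply_apply f.hasTemperateGrowth, smul_eq_mul]

/-- The profile `ψ` is supported in the annulus `2^{-m} ≤ |t| ≤ 2^m`. -/
def IsAnnular (m : ℕ) (ψ : 𝓢(ℝ, ℂ)) : Prop :=
  ∀ t, ψ t ≠ 0 → 2 ^ (-m : ℤ) ≤ |t| ∧ |t| ≤ 2 ^ (m : ℤ)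

lemma IsAnnular.zero {m : ℕ} {ψ : 𝓢(ℝ, ℂ)} (h : IsAnnular m ψ) : ψ 0 = 0 := by
  by_contra hn
  have := (h 0 hn).1
  rw [abs_zero] at this
  exact absurd this (not_le.2 (by positivity))

lemma IsAnnular.hasCompactSupport {m : ℕ} {ψ : 𝓢(ℝ, ℂ)} (h : IsAnnular m ψ) :
    HasCompactSupport ψ :=
  HasCompactSupport.intro (isCompact_closedBall (0 : ℝ) (2 ^ (m : ℤ))) fun t ht => by
    simp only [Metric.mem_closedBall, dist_zero_right, Real.norm_eq_abs] at ht
    by_contra hn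
    exact ht (h t hn).2

lemma isAnnular_mulS {m : ℕ} {ψ : 𝓢(ℝ, ℂ)} (h : IsAnnular m ψ) (f : 𝓢(ℝ, ℂ)) :
    IsAnnular m (mulS f ψ) := fun t ht => h t fun h0 => ht (by rw [mulS_apply, h0, mul_zero])

lemma isAnnular_lpσ : IsAnnular 1 lpσ := fun t ht => by
  have := lpσ_ne_zero ht
  norm_num
  constructor <;> linarith

lemma sum_lpσ_mul_annular {m : ℕ} {ψ : 𝓢(ℝ, ℂ)} (h : IsAnnular m ψ) (t : ℝ) :
    ∑ l ∈ Finset.Icc (-m : ℤ) m, lpσ (2 ^ l * t) * ψ t = ψ t := by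
  rw [← Finset.sum_mul]
  by_cases h0 : ψ t = 0
  · simp [h0]
  · rw [sum_Icc_lpσ_eq_one (h t h0).1 (h t h0).2, one_mul]

lemma lpσ_mul_annular_eq_zero {m : ℕ} {ψ : 𝓢(ℝ, ℂ)} (h : IsAnnular m ψ) {l : ℤ}
    (hl : l ∉ Finset.Icc (-m : ℤ) m) (t : ℝ) : lpσ (2 ^ l * t) * ψ t = 0 := by
  by_contra hn
  obtain ⟨h1, h2⟩ := lpσ_ne_zero (left_ne_zero_of_mul hn)
  obtain ⟨h3, h4⟩ := h t (right_ne_zero_of_mul hn)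
  rw [abs_mul, abs_of_pos (by positivity)] at h1 h2
  refine hl (Finset.mem_Icc.2 ⟨?_, ?_⟩)
  · have h5 : (2 : ℝ) ^ (-1 : ℤ) < 2 ^ (l + m) := by
      rw [zpow_add₀ two_ne_zero]
      have := mul_le_mul_of_nonneg_left h4 (by positivity : (0 : ℝ) ≤ 2 ^ l)
      norm_num at h1 this ⊢
      linarith
    have := (zpow_lt_zpow_iff_right₀ (one_lt_two : (1 : ℝ) < 2)).1 h5
    omega
  · have h5 : (2 : ℝ) ^ (l + -m) < 2 ^ (1 : ℤ) := by
      rw [zpow_add₀ two_ne_zero]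
      have := mul_le_mul_of_nonneg_left h3 (by positivity : (0 : ℝ) ≤ 2 ^ l)
      rw [zpow_one]
      linarith
    have := (zpow_lt_zpow_iff_right₀ (one_lt_two : (1 : ℝ) < 2)).1 h5
    omega

lemma sum_range_bumpφ_lpσ_mul {m L : ℕ} {ψ : 𝓢(ℝ, ℂ)} (h : IsAnnular m ψ) {j : ℤ}
    (hj₁ : -L ≤ j - m) (hj₂ : j + m < L) (x y : ℝ) :
    (∑ k ∈ Finset.range (2 * L), bumpφ (2 ^ (k + 1) * (2 ^ (-L : ℤ) * x)) *
      lpσ (2 ^ k * (2 ^ (-L : ℤ) * y))) * ψ (2 ^ j * y) =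
    ∑ l ∈ Finset.Icc (-m : ℤ) m, bumpφ (2 ^ (l + 1) * (2 ^ j * x)) *
      (lpσ (2 ^ l * (2 ^ j * y)) * ψ (2 ^ j * y)) := by
  have h20 : (2 : ℝ) ≠ 0 := two_ne_zero
  set F : ℤ → ℂ := fun l => bumpφ (2 ^ (l + 1) * (2 ^ j * x)) *
    (lpσ (2 ^ l * (2 ^ j * y)) * ψ (2 ^ j * y)) with hF
  have e1 : ∀ k ∈ Finset.range (2 * L), bumpφ (2 ^ (k + 1) * (2 ^ (-L : ℤ) * x)) *
      lpσ (2 ^ k * (2 ^ (-L : ℤ) * y)) * ψ (2 ^ j * y) = F ((k : ℤ) - (L + j)) := by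
    intro k _
    simp only [hF]
    rw [mul_assoc]
    have e : ∀ z : ℝ, (2 : ℝ) ^ ((k : ℤ) - (L + j)) * (2 ^ j * z) = 2 ^ k * (2 ^ (-L : ℤ) * z) := by
      intro z
      rw [← mul_assoc, ← mul_assoc, ← zpow_add₀ h20, ← zpow_natCast, ← zpow_add₀ h20]
      congr 2
      ring
    have e' : ∀ z : ℝ, (2 : ℝ) ^ ((k : ℤ) - (L + j) + 1) * (2 ^ j * z) =
        2 ^ (k + 1) * (2 ^ (-L : ℤ) * z) := by
      intro z
      rw [← mul_assoc, ← mul_assoc, ← zpow_add₀ h20, ← zpow_natCast, ← zpow_add₀ h20]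
      congr 2
      push_cast
      ring
    rw [e, e']
  rw [Finset.sum_mul, Finset.sum_congr rfl e1]
  symm
  refine Finset.sum_of_injOn (fun l => (l + L + j).toNat) ?_ ?_ ?_ ?_
  · intro x hx y hy hxy
    simp only [Finset.coe_Icc, Set.mem_Icc] at hx hy
    simp only at hxy
    omega
  · intro x hx
    simp only [Finset.coe_Icc, Set.mem_Icc, Finset.coe_range, Set.mem_Iio] at hx ⊢
    omega
  · intro k hk hk2
    simp only [hF]
    rw [lpσ_mul_annular_eq_zero h, mul_zero]
    intro hl
    refine hk2 ⟨(k : ℤ) - (L + j), hl, ?_⟩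
    simp only
    omega
  · intro l hl
    simp only [Finset.mem_Icc] at hl
    rw [show (((l + L + j).toNat : ℕ) : ℤ) - (L + j) = l by omega]

theorem exists_symBdd_bump {a : Fin 3 → ℝ} (ha : ∀ j, 0 < a j) (h0 : a 0 < 1 / 2)
    (hsum : ∑ j, a j = 1) {m : ℕ} {ψ : 𝓢(ℝ, ℂ)} (hψ : IsAnnular m ψ) :
    ∃ C : ℝ, 0 ≤ C ∧ ∀ (J : Finset ℤ) (c : ℤ → ℂ) (v ρ₁ ρ₂ : ℝ), ρ₁ ≠ 0 → ρ₂ ≠ 0 →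
      (∀ k, ‖c k‖ ≤ 1) → SymBdd (1 / a 1) (1 / a 2) (1 / a 0) (fun w => ∑ j ∈ J,
        (c j * bumpφ (2 ^ j * (ρ₁ * w.1.1))) *
        (ψ (2 ^ j * (ρ₂ * w.2.2)) * e2π (v * (2 ^ j * (ρ₂ * w.2.2)))))
        (C * (1 + |v|) ^ 4) := by
  have h2lt : 1 < 1 / a 2 := by
    rw [Fin.sum_univ_three] at hsum
    have h0 := ha 0
    have h1 := ha 1
    have h2 := ha 2
    rw [lt_div_iff₀ (ha 2)]
    linarith
  obtain ⟨C₁, hC₁, H₁⟩ := exists_symBdd_smooth ha h0 hsum bumpφ bumpφ_neg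
  obtain ⟨C₂, hC₂, H₂⟩ := exists_mulBdd_lacSum h2lt ψ hψ.zero hψ.hasCompactSupport
  set Φ : ℤ → 𝓢(ℝ, ℂ) := fun l => dilS (2 ^ (l + 1)) bumpφ - bumpφ with hΦ
  have hΦa : ∀ l t, Φ l t = bumpφ (2 ^ (l + 1) * t) - bumpφ t := fun l t => by
    simp [hΦ, dilS_apply (zpow_ne_zero (l + 1) (two_ne_zero : (2 : ℝ) ≠ 0))]
  set Ψ : ℤ → 𝓢(ℝ, ℂ) := fun l => mulS (dilS (2 ^ l) lpσ) ψ with hΨ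
  have hΨa : ∀ l t, Ψ l t = lpσ (2 ^ l * t) * ψ t := fun l t => by
    simp [hΨ, mulS_apply, dilS_apply (zpow_ne_zero l (two_ne_zero : (2 : ℝ) ≠ 0))]
  have hΦ0 : ∀ l, Φ l 0 = 0 := fun l => by rw [hΦa]; simp
  have hΦc : ∀ l, HasCompactSupport (Φ l) := fun l => by
    refine HasCompactSupport.intro (isCompact_closedBall (0 : ℝ) (max 2 (2 / 2 ^ (l + 1)))) ?_
    intro t ht
    simp only [Metric.mem_closedBall, dist_zero_right, Real.norm_eq_abs, not_le, max_lt_iff] at ht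
    have h1 := ht.2
    rw [div_lt_iff₀ (by positivity)] at h1
    rw [hΦa, bumpφ_zero ht.1.le, bumpφ_zero, sub_self]
    rw [abs_mul, abs_of_pos (by positivity), mul_comm]
    exact h1.le
  choose C₃ hC₃ H₃ using fun l => exists_symBdd_annular ha hsum (Φ l) (Ψ l) (hΦ0 l) (hΦc l)
    (isAnnular_mulS hψ _).zero (isAnnular_mulS hψ _).hasCompactSupport
  refine ⟨C₁ * C₂ + ∑ l ∈ Finset.Icc (-m : ℤ) m, C₃ l,
    add_nonneg (by positivity) (Finset.sum_nonneg fun l _ => hC₃ l),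
    fun J c v ρ₁ ρ₂ hρ₁ hρ₂ hc => ?_⟩
  obtain ⟨L, hL⟩ : ∃ L : ℕ, ∀ j ∈ J, -(L : ℤ) ≤ j - m ∧ j + m < L := by
    refine ⟨(∑ j ∈ J, j.natAbs) + m + 1, fun j hj => ?_⟩
    have : j.natAbs ≤ ∑ j ∈ J, j.natAbs :=
      Finset.single_le_sum (f := fun j : ℤ => j.natAbs) (fun _ _ => Nat.zero_le _) hj
    generalize ∑ j ∈ J, j.natAbs = N at this ⊢
    omega
  have hB := H₁ (2 * L) (2 ^ (-L : ℤ) * ρ₁) (2 ^ (-L : ℤ) * ρ₂)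
    (mul_ne_zero (by positivity) hρ₁) (mul_ne_zero (by positivity) hρ₂)
  have hσ : ∀ (k : ℕ) (y : ℝ), bumpφ (2 ^ k * y) - bumpφ (2 ^ (k + 1) * y) = lpσ (2 ^ k * y) := by
    intro k y
    rw [lpσ_apply, pow_succ']
    congr 2
    ring
  simp only [hσ] at hB
  have hm₂ := H₂ J c v hc (0, ρ₂) 0
  have hBΨ := hB.mul (Function.HasTemperateGrowth.const 1)
    ((hasTemperateGrowth_lacSum ψ J c v).comp (hasTemperateGrowth_affine (0, ρ₂) 0))
    (Function.HasTemperateGrowth.const 1) hC₁ zero_le_one (by positivity)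
    (mulBdd_one _) hm₂ (mulBdd_one _)
  have hG := SymBdd.sum_of_isTame (Finset.Icc (-m : ℤ) m)
    (fun l => ?_) (fun l _ => H₃ l J c 0 v ρ₁ ρ₂ hc)
  swap
  · refine IsTame.sum _ fun j => ((isTame_const _).mul ((isTame_schwartz _ ?_).mul
      (isTame_e2π ?_))).mul ((isTame_schwartz _ ?_).mul (isTame_e2π ?_)) <;> fun_prop
  have hall := SymBdd.add ?_ ?_ hBΨ (hG.const_mul (-1))
  · refine SymBdd.mono (A := C₁ * (1 * (C₂ * (1 + |v|) ^ 4) * 1) + ‖(-1 : ℂ)‖ *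
        ∑ l ∈ Finset.Icc (-m : ℤ) m, C₃ l * ((1 + |(0 : ℝ)|) ^ 4 * (1 + |v|) ^ 4)) ?_ (le_of_eq ?_)
    · convert hall using 1
      ext w
      simp only [Function.comp_apply, lacSum, zero_mul, add_zero, zero_add, mul_one, one_mul,
        e2π_zero]
      set X := w.1.1
      set Y := w.2.2
      rw [Finset.mul_sum, Finset.sum_comm, neg_one_mul, ← sub_eq_add_neg,
        ← Finset.sum_sub_distrib]
      refine Finset.sum_congr rfl fun j hj => ?_
      have h1 := sum_range_bumpφ_lpσ_mul hψ (hL j hj).1 (hL j hj).2 (ρ₁ * X) (ρ₂ * Y)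
      have h2 := sum_lpσ_mul_annular hψ (2 ^ j * (ρ₂ * Y))
      have h3 : ∀ S E : ℂ, S * (c j * (ψ (2 ^ j * (ρ₂ * Y)) * E)) =
          c j * E * (S * ψ (2 ^ j * (ρ₂ * Y))) := fun S E => by ring
      have e : ∀ z : ℝ, 2 ^ (-L : ℤ) * ρ₁ * z = 2 ^ (-L : ℤ) * (ρ₁ * z) := fun z => by ring
      have e' : ∀ z : ℝ, 2 ^ (-L : ℤ) * ρ₂ * z = 2 ^ (-L : ℤ) * (ρ₂ * z) := fun z => by ring
      rw [h3]
      simp only [e, e']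
      rw [h1, Finset.mul_sum, ← Finset.sum_sub_distrib]
      nth_rewrite 1 [← h2]
      rw [Finset.sum_mul, Finset.mul_sum]
      refine Finset.sum_congr rfl fun l _ => ?_
      rw [hΦa, hΨa]
      ring
    · rw [← Finset.sum_mul]
      simp
      ring
  · simp only [Function.comp_apply, lacSum]
    refine IsTame.mul (IsTame.sum _ fun k => (isTame_schwartz _ ?_).mul
      (isTame_schwartz (lpσ) ?_)) (((isTame_const 1).mul (IsTame.sum _ fun j =>
        (isTame_const _).mul ((isTame_schwartz _ ?_).mul (isTame_e2π ?_)))).mul (isTame_const 1)) <;>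
      fun_prop
  · refine (isTame_const _).mul (IsTame.sum _ fun l => IsTame.sum _ fun j =>
      ((isTame_const _).mul ((isTame_schwartz _ ?_).mul
      (isTame_e2π ?_))).mul ((isTame_schwartz _ ?_).mul (isTame_e2π ?_))) <;> fun_prop

end

lemma two_pi_I_mul_expAvg (a : ℝ) : 2 * Real.pi * Complex.I * a * expAvg a = e2π a - 1 := by
  have h : ∀ x ∈ Set.uIcc (0 : ℝ) 1, HasDerivAt (fun x : ℝ => e2π (x * a))
      (2 * Real.pi * Complex.I * a * e2π (x * a)) x := by
    intro x _
    have := (hasDerivAt_e2π (x * a)).scomp x ((hasDerivAt_id x).mul_const a)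
    refine this.congr_deriv ?_
    simp
    ring
  have h2 := intervalIntegral.integral_eq_sub_of_hasDerivAt h
    (Continuous.intervalIntegrable (by fun_prop) _ _)
  rw [intervalIntegral.integral_const_mul] at h2
  simpa [expAvg] using h2

/-- The profile `tσ(t)`. -/
def lpκ : 𝓢(ℝ, ℂ) := smulLeftCLM ℂ (fun t : ℝ => (t : ℂ)) lpσ

lemma lpκ_apply (t : ℝ) : lpκ t = t * lpσ t := by
  rw [lpκ, SchwartzMap.smulLeftCLM_apply_apply Function.Complex.hasTemperateGrowth_ofReal, smul_eq_mul]

lemma isAnnular_lpκ : IsAnnular 1 lpκ := fun t ht =>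
  isAnnular_lpσ t fun h0 => ht (by rw [lpκ_apply, h0, mul_zero])

theorem exists_symBdd_bump_sub_one {a : Fin 3 → ℝ} (ha : ∀ j, 0 < a j)
    (hsum : ∑ j, a j = 1) {m : ℕ} {ψ : 𝓢(ℝ, ℂ)} (hψ : IsAnnular m ψ) :
    ∃ C : ℝ, 0 ≤ C ∧ ∀ (J : Finset ℤ) (c : ℤ → ℂ) (u v ρ₁ ρ₂ : ℝ),
      (∀ k, ‖c k‖ ≤ 1) → SymBdd (1 / a 1) (1 / a 2) (1 / a 0) (fun w => ∑ j ∈ J,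
        (c j * (bumpφ (2 ^ j * (ρ₁ * w.1.1)) * (e2π (u * (2 ^ j * (ρ₁ * w.1.1))) - 1))) *
        (ψ (2 ^ j * (ρ₂ * w.2.2)) * e2π (v * (2 ^ j * (ρ₂ * w.2.2)))))
        (C * ((1 + |u|) ^ 5 * (1 + |v|) ^ 4)) := by
  obtain ⟨C, hC, H⟩ := exists_symBdd_annular ha hsum lpκ ψ isAnnular_lpκ.zero
    isAnnular_lpκ.hasCompactSupport hψ.zero hψ.hasCompactSupport
  obtain ⟨Kψ, hKψ⟩ : ∃ K, ∀ x, ‖ψ x‖ ≤ K := ⟨_, fun z => ψ.norm_le_seminorm ℝ z⟩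
  obtain ⟨Kκ, hKκ⟩ : ∃ K, ∀ x, ‖lpκ x‖ ≤ K := ⟨_, fun z => lpκ.norm_le_seminorm ℝ z⟩
  obtain ⟨Kφ, hKφ⟩ : ∃ K, ∀ x, ‖bumpφ x‖ ≤ K := ⟨_, fun z => bumpφ.norm_le_seminorm ℝ z⟩
  have hKκ0 := (norm_nonneg _).trans (hKκ 0)
  have hKψ0 := (norm_nonneg _).trans (hKψ 0)
  have hKφ0 := (norm_nonneg _).trans (hKφ 0)
  refine ⟨2 * (2 * Real.pi * C), by positivity, fun J c u v ρ₁ ρ₂ hc => ?_⟩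
  set D := C * ((1 + |u|) ^ 4 * (1 + |v|) ^ 4) with hD
  set T : ℤ → (ℝ × ℝ) × (ℝ × ℝ) → ℝ := fun j w => 2 ^ j * (ρ₁ * w.1.1) with hT
  set S : ℤ → (ℝ × ℝ) × (ℝ × ℝ) → ℂ := fun j w =>
    ψ (2 ^ j * (ρ₂ * w.2.2)) * e2π (v * (2 ^ j * (ρ₂ * w.2.2))) with hS
  have hSK : ∀ j w, ‖S j w‖ ≤ Kψ := fun j w => by
    simp only [hS, norm_mul, norm_e2π, mul_one]; exact hKψ _
  have hSt : ∀ j, IsTame (S j) := fun j => by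
    refine (isTame_schwartz _ ?_).mul (isTame_e2π ?_) <;> fun_prop
  have hTc : ∀ j, Continuous (T j) := fun j => by simp only [hT]; fun_prop
  have hSc : ∀ j, Continuous (S j) := fun j => by simp only [hS]; fun_prop
  have hl : ∀ l : ℕ, SymBdd (1 / a 1) (1 / a 2) (1 / a 0) (fun w => ∑ j ∈ J,
      (c j * (lpσ (2 ^ (l : ℤ) * T j w) * (e2π (u * T j w) - 1))) * S j w)
      (2 * Real.pi * |u| * (1 / 2) ^ l * D) := by
    intro l
    have h1 : ∀ x : ℝ, SymBdd (1 / a 1) (1 / a 2) (1 / a 0) (fun w => ∑ j ∈ J,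
        (c j * (lpκ (2 ^ (l : ℤ) * T j w) * e2π (x * (u * T j w)))) * S j w)
        (C * ((1 + |x * u|) ^ 4 * (1 + |v|) ^ 4)) := by
      intro x
      refine SymBdd.mono (A := C * ((1 + |x * u / 2 ^ l|) ^ 4 * (1 + |v|) ^ 4)) ?_ ?_
      · convert H J c (x * u / 2 ^ l) v (2 ^ l * ρ₁) ρ₂ hc using 1
        ext w
        refine Finset.sum_congr rfl fun j _ => ?_
        have e : (2 : ℝ) ^ j * (2 ^ l * ρ₁ * w.1.1) = 2 ^ (l : ℤ) * T j w := by
          rw [zpow_natCast]; simp only [hT]; ring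
        rw [e]
        have e2 : x * u / 2 ^ l * (2 ^ (l : ℤ) * T j w) = x * (u * T j w) := by
          rw [zpow_natCast]; field_simp
        rw [e2]
      · have : |x * u / 2 ^ l| ≤ |x * u| := by
          rw [abs_div]
          refine div_le_self (abs_nonneg _) ?_
          rw [abs_of_pos (by positivity)]
          exact one_le_pow₀ one_le_two
        gcongr
    have h2 := SymBdd.integral (p := 1 / a 1) (q := 1 / a 2) (r := 1 / a 0)
      (μ := volume.restrict (Set.Ioc (0 : ℝ) 1)) (M := fun (x : ℝ) w => ∑ j ∈ J,
        (c j * (lpκ (2 ^ (l : ℤ) * T j w) * e2π (x * (u * T j w)))) * S j w)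
      (K := fun _ => ∑ j ∈ J, 1 * Kκ * Kψ)
      (A := fun x => C * ((1 + |x * u|) ^ 4 * (1 + |v|) ^ 4)) ?_ ?_ ?_ ?_ h1
    · refine SymBdd.mono (A := ‖(2 * Real.pi * Complex.I * u * (1 / 2) ^ l : ℂ)‖ *
        ∫ x in Set.Ioc (0 : ℝ) 1, C * ((1 + |x * u|) ^ 4 * (1 + |v|) ^ 4)) ?_ ?_
      · convert h2.const_mul (2 * Real.pi * Complex.I * u * (1 / 2) ^ l : ℂ) using 1
        ext w
        rw [integral_finsetSum _ fun j _ =>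
          (Continuous.integrableOn_Ioc (by fun_prop) : IntegrableOn _ _ _), Finset.mul_sum]
        refine Finset.sum_congr rfl fun j _ => ?_
        rw [integral_mul_const, integral_const_mul, integral_const_mul]
        have e := two_pi_I_mul_expAvg (u * T j w)
        rw [expAvg, intervalIntegral.integral_of_le zero_le_one] at e
        rw [← e, lpκ_apply, zpow_natCast]
        push_cast
        have : (1 / 2 : ℂ) ^ l * 2 ^ l = 1 := by rw [← mul_pow]; norm_num
        linear_combination (-(2 * Real.pi * Complex.I * u * c j * T j w *
          lpσ (2 ^ l * T j w) * (∫ x in Set.Ioc (0 : ℝ) 1, e2π (x * (u * T j w))) * S j w)) * this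
      · have e : ‖(2 * Real.pi * Complex.I * u * (1 / 2) ^ l : ℂ)‖ =
            2 * Real.pi * |u| * (1 / 2) ^ l := by
          simp [abs_of_pos Real.pi_pos]
        rw [e]
        refine mul_le_mul_of_nonneg_left ?_ (by positivity)
        have e2 : D = ∫ x in Set.Ioc (0 : ℝ) 1, D := by simp
        rw [e2]
        refine setIntegral_mono_on (Continuous.integrableOn_Ioc (by fun_prop))
          (Continuous.integrableOn_Ioc (by fun_prop)) measurableSet_Ioc fun x hx => ?_
        have : |x * u| ≤ |u| := by
          rw [abs_mul, abs_of_pos hx.1]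
          exact mul_le_of_le_one_left (abs_nonneg _) hx.2
        rw [hD]
        gcongr
    · refine Continuous.aestronglyMeasurable ?_
      unfold Function.uncurry
      fun_prop
    · intro x w
      refine norm_sum_le_of_le _ fun j _ => ?_
      rw [norm_mul, norm_mul, norm_mul, norm_e2π, mul_one]
      exact mul_le_mul (mul_le_mul (hc j) (hKκ _) (norm_nonneg _) zero_le_one) (hSK j w)
        (norm_nonneg _) (by positivity)
    · exact integrable_const _
    · exact Continuous.integrableOn_Ioc (by fun_prop)
  have hN : ∀ N : ℕ, SymBdd (1 / a 1) (1 / a 2) (1 / a 0) (fun w => ∑ j ∈ J,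
      (c j * ((bumpφ (T j w) - bumpφ (2 ^ (N + 1 : ℤ) * T j w)) * (e2π (u * T j w) - 1))) * S j w)
      (2 * (2 * Real.pi * C) * ((1 + |u|) ^ 5 * (1 + |v|) ^ 4)) := by
    intro N
    have h3 := SymBdd.sum_of_isTame (Finset.range (N + 1)) (fun l => ?_) (fun l _ => hl l)
    · refine SymBdd.mono (A := ∑ l ∈ Finset.range (N + 1), 2 * Real.pi * |u| * (1 / 2) ^ l * D)
        ?_ ?_
      · convert h3 using 1
        ext w
        rw [Finset.sum_comm]
        refine Finset.sum_congr rfl fun j _ => ?_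
        have e := sum_Icc_lpσ 0 N (T j w)
        simp only [Nat.cast_zero, neg_zero, zpow_zero, one_mul] at e
        rw [← e, Finset.sum_mul, Finset.mul_sum, Finset.sum_mul]
        refine Finset.sum_nbij' Int.toNat (fun n : ℕ => (n : ℤ)) ?_ ?_ ?_ ?_ ?_
        · intro l hl; simp only [Finset.mem_Icc, Finset.mem_range] at hl ⊢; omega
        · intro l hl; simp only [Finset.mem_Icc, Finset.mem_range] at hl ⊢; omega
        · intro l hl; simp only [Finset.mem_Icc] at hl; omega
        · intro l hl; simp
        · intro l hl
          simp only [Finset.mem_Icc] at hl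
          rw [Int.toNat_of_nonneg hl.1]
      · rw [← Finset.sum_mul, ← Finset.mul_sum]
        have h4 : ∑ l ∈ Finset.range (N + 1), (1 / 2 : ℝ) ^ l ≤ 2 := by
          rw [geom_sum_eq (by norm_num)]
          have : (0 : ℝ) < (1 / 2) ^ (N + 1) := by positivity
          rw [div_le_iff_of_neg (by norm_num)]
          linarith
        calc (2 * Real.pi * |u| * ∑ l ∈ Finset.range (N + 1), (1 / 2 : ℝ) ^ l) * D
            ≤ (2 * Real.pi * (1 + |u|) * 2) * D := by
              have : 0 ≤ D := by positivity
              gcongr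
              linarith
          _ = _ := by rw [hD]; ring
    · refine IsTame.sum _ fun j => ((isTame_const _).mul ((isTame_schwartz _ ?_).mul ?_)).mul
        (hSt j)
      · fun_prop
      · simp only [sub_eq_add_neg]
        exact (isTame_e2π (by fun_prop)).add (isTame_const _)
  have hle : ∀ j w, ‖e2π (u * T j w) - 1‖ ≤ 2 := fun j w => by
    refine (norm_sub_le _ _).trans ?_
    rw [norm_e2π, norm_one]; norm_num
  refine SymBdd.tendsto (l := atTop) (K := ∑ j ∈ J, 1 * ((Kφ + Kφ) * 2) * Kψ)
    (.of_forall fun N => Continuous.aestronglyMeasurable (by fun_prop))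
    (.of_forall fun N w => ?_) (.of_forall hN) (.of_forall fun w => ?_)
  · refine norm_sum_le_of_le _ fun j _ => ?_
    rw [norm_mul, norm_mul, norm_mul]
    exact mul_le_mul (mul_le_mul (hc j) (mul_le_mul (norm_sub_le_of_le (hKφ _) (hKφ _)) (hle j w)
      (norm_nonneg _) (by positivity)) (by positivity) zero_le_one) (hSK j w)
      (norm_nonneg _) (by positivity)
  · refine tendsto_finsetSum _ fun j _ => (Tendsto.const_mul _ ?_).mul_const _
    by_cases h0 : T j w = 0
    · simp only [hT] at h0
      simp [hT, h0]
    · refine tendsto_const_nhds.congr' ?_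
      have h5 : Tendsto (fun N : ℕ => (2 : ℝ) ^ N * |T j w|) atTop atTop :=
        (tendsto_pow_atTop_atTop_of_one_lt one_lt_two).atTop_mul_const (abs_pos.2 h0)
      filter_upwards [h5.eventually_ge_atTop 2] with N hN
      rw [bumpφ_zero (t := 2 ^ (N + 1 : ℤ) * T j w), sub_zero]
      rw [abs_mul, abs_of_pos (by positivity), zpow_add_one₀ two_ne_zero, zpow_natCast]
      have := abs_nonneg (T j w)
      nlinarith [pow_pos (two_pos : (0 : ℝ) < 2) N]

theorem exists_symBdd_bump_mod {a : Fin 3 → ℝ} (ha : ∀ j, 0 < a j) (h0 : a 0 < 1 / 2)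
    (hsum : ∑ j, a j = 1) {m : ℕ} {ψ : 𝓢(ℝ, ℂ)} (hψ : IsAnnular m ψ) :
    ∃ C : ℝ, 0 ≤ C ∧ ∀ (J : Finset ℤ) (c : ℤ → ℂ) (u v ρ₁ ρ₂ : ℝ), ρ₁ ≠ 0 → ρ₂ ≠ 0 →
      (∀ k, ‖c k‖ ≤ 1) → SymBdd (1 / a 1) (1 / a 2) (1 / a 0) (fun w => ∑ j ∈ J,
        (c j * (bumpφ (2 ^ j * (ρ₁ * w.1.1)) * e2π (u * (2 ^ j * (ρ₁ * w.1.1))))) *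
        (ψ (2 ^ j * (ρ₂ * w.2.2)) * e2π (v * (2 ^ j * (ρ₂ * w.2.2)))))
        (C * ((1 + |u|) ^ 5 * (1 + |v|) ^ 4)) := by
  obtain ⟨C₁, hC₁, H₁⟩ := exists_symBdd_bump ha h0 hsum hψ
  obtain ⟨C₂, hC₂, H₂⟩ := exists_symBdd_bump_sub_one ha hsum hψ
  refine ⟨C₁ + C₂, by positivity, fun J c u v ρ₁ ρ₂ hρ₁ hρ₂ hc => ?_⟩
  have h := SymBdd.add ?_ ?_ (H₁ J c v ρ₁ ρ₂ hρ₁ hρ₂ hc) (H₂ J c u v ρ₁ ρ₂ hc)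
  · refine SymBdd.mono (A := C₁ * (1 + |v|) ^ 4 + C₂ * ((1 + |u|) ^ 5 * (1 + |v|) ^ 4)) ?_ ?_
    · convert h using 1
      ext w
      rw [← Finset.sum_add_distrib]
      exact Finset.sum_congr rfl fun j _ => by ring
    · have h1 : (1 : ℝ) ≤ (1 + |u|) ^ 5 := one_le_pow₀ (by linarith [abs_nonneg u])
      have h2 : C₁ * (1 + |v|) ^ 4 ≤ C₁ * ((1 + |u|) ^ 5 * (1 + |v|) ^ 4) :=
        mul_le_mul_of_nonneg_left (le_mul_of_one_le_left (by positivity) h1) hC₁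
      linarith
  · refine IsTame.sum _ fun j => ((isTame_const _).mul (isTame_schwartz _ ?_)).mul
      ((isTame_schwartz _ ?_).mul (isTame_e2π ?_)) <;> fun_prop
  · refine IsTame.sum _ fun j => ((isTame_const _).mul ((isTame_schwartz _ ?_).mul ?_)).mul
      ((isTame_schwartz _ ?_).mul (isTame_e2π ?_))
    · fun_prop
    · simp only [sub_eq_add_neg]
      exact (isTame_e2π (by fun_prop)).add (isTame_const _)
    · fun_prop
    · fun_prop

lemma ftS_of_hasLineDerivAt {f g : 𝓢(ℝ × ℝ, ℂ)} {v : ℝ × ℝ}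
    (h : ∀ z, HasLineDerivAt ℝ f (g z) z v) (ζ : ℝ × ℝ) :
    ftS g ζ = 2 * Real.pi * Complex.I * ((v.1 * ζ.1 + v.2 * ζ.2 : ℝ) : ℂ) * ftS f ζ := by
  have hG : compCLMOfContinuousLinearEquiv ℂ Complex.equivRealProdCLM g =
      LineDeriv.lineDerivOp (Complex.equivRealProdCLM.symm v)
      (compCLMOfContinuousLinearEquiv ℂ Complex.equivRealProdCLM f) := by
    ext z
    rw [SchwartzMap.lineDerivOp_apply]
    refine (HasLineDerivAt.lineDeriv ?_).symm
    have := h (Complex.equivRealProdCLM z)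
    simp only [HasLineDerivAt] at this ⊢
    convert this using 2
    · simp; rfl
    · rfl
  unfold ftS
  rw [hG, SchwartzMap.fourier_lineDerivOp_eq]
  have ht : (fun x : ℂ => inner ℝ x (Complex.equivRealProdCLM.symm v)).HasTemperateGrowth := by
    fun_prop
  simp only [SchwartzMap.compCLMOfContinuousLinearEquiv_apply, Function.comp_apply,
    smul_apply, SchwartzMap.smulLeftCLM_apply_apply ht, smul_eq_mul,
    Complex.real_smul]
  rw [← mul_assoc]
  congr 3
  simp [Complex.inner]

lemma ftS_of_hasDerivAt_fst {f g : 𝓢(ℝ × ℝ, ℂ)}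
    (h : ∀ x y, HasDerivAt (fun t => f (t, y)) (g (x, y)) x) (ζ : ℝ × ℝ) :
    ftS g ζ = 2 * Real.pi * Complex.I * ζ.1 * ftS f ζ := by
  rw [ftS_of_hasLineDerivAt (f := f) (v := (1, 0))]
  · simp
  · intro z
    have h0 : HasDerivAt (fun t => f (t, z.2)) (g (z.1, z.2)) (z.1 + 0) := by simpa using h z.1 z.2
    have := h0.comp_const_add z.1 0
    unfold HasLineDerivAt
    convert this using 2 with t
    exact congrArg f (by ext <;> simp)

lemma ftS_of_hasDerivAt_snd {f g : 𝓢(ℝ × ℝ, ℂ)}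
    (h : ∀ x y, HasDerivAt (fun t => f (x, t)) (g (x, y)) y) (ζ : ℝ × ℝ) :
    ftS g ζ = 2 * Real.pi * Complex.I * ζ.2 * ftS f ζ := by
  rw [ftS_of_hasLineDerivAt (f := f) (v := (0, 1))]
  · simp
  · intro z
    have h0 : HasDerivAt (fun t => f (z.1, t)) (g (z.1, z.2)) (z.2 + 0) := by simpa using h z.1 z.2
    have := h0.comp_const_add z.2 0
    unfold HasLineDerivAt
    convert this using 2 with t
    exact congrArg f (by ext <;> simp)

lemma ContDiffOn.partial_fst {U : Set (ℝ × ℝ)} (hU : IsOpen U) {G : ℝ × ℝ → ℂ}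
    (hG : ContDiffOn ℝ (⊤ : ℕ∞) G U) :
    ContDiffOn ℝ (⊤ : ℕ∞) (fun z => deriv (fun t => G (t, z.2)) z.1) U ∧
      ∀ z ∈ U, HasDerivAt (fun t => G (t, z.2)) (deriv (fun t => G (t, z.2)) z.1) z.1 := by
  have hd : ∀ z ∈ U, HasDerivAt (fun t => G (t, z.2)) (fderiv ℝ G z (1, 0)) z.1 := by
    intro z hz
    have h1 : HasFDerivAt G (fderiv ℝ G z) (z.1, z.2) :=
      ((hG.differentiableOn (by simp)).differentiableAt (hU.mem_nhds hz)).hasFDerivAt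
    exact h1.comp_hasDerivAt z.1 ((hasDerivAt_id z.1).prodMk (hasDerivAt_const z.1 z.2))
  refine ⟨?_, fun z hz => (hd z hz).differentiableAt.hasDerivAt⟩
  have h2 : ContDiffOn ℝ (⊤ : ℕ∞) (fun z => fderiv ℝ G z (1, 0)) U :=
    (hG.fderiv_of_isOpen hU (by simp)).clm_apply contDiffOn_const
  exact h2.congr fun z hz => (hd z hz).deriv

lemma ContDiffOn.partial_snd {U : Set (ℝ × ℝ)} (hU : IsOpen U) {G : ℝ × ℝ → ℂ}
    (hG : ContDiffOn ℝ (⊤ : ℕ∞) G U) :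
    ContDiffOn ℝ (⊤ : ℕ∞) (fun z => deriv (fun t => G (z.1, t)) z.2) U ∧
      ∀ z ∈ U, HasDerivAt (fun t => G (z.1, t)) (deriv (fun t => G (z.1, t)) z.2) z.2 := by
  have hd : ∀ z ∈ U, HasDerivAt (fun t => G (z.1, t)) (fderiv ℝ G z (0, 1)) z.2 := by
    intro z hz
    have h1 : HasFDerivAt G (fderiv ℝ G z) (z.1, z.2) :=
      ((hG.differentiableOn (by simp)).differentiableAt (hU.mem_nhds hz)).hasFDerivAt
    exact h1.comp_hasDerivAt z.2 ((hasDerivAt_const z.2 z.1).prodMk (hasDerivAt_id z.2))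
  refine ⟨?_, fun z hz => (hd z hz).differentiableAt.hasDerivAt⟩
  have h2 : ContDiffOn ℝ (⊤ : ℕ∞) (fun z => fderiv ℝ G z (0, 1)) U :=
    (hG.fderiv_of_isOpen hU (by simp)).clm_apply contDiffOn_const
  exact h2.congr fun z hz => (hd z hz).deriv

/-- The mixed partial derivatives as functions on the plane. -/
def pdm (m : ℝ × ℝ → ℂ) (α β : ℕ) (z : ℝ × ℝ) : ℂ := pd α β (fun a b => m (a, b)) z.1 z.2

lemma pdm_zero_zero (m : ℝ × ℝ → ℂ) : pdm m 0 0 = m := by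
  ext z; simp [pdm, pd]

lemma pdm_succ_fst (m : ℝ × ℝ → ℂ) (α β : ℕ) :
    pdm m (α + 1) β = fun z => deriv (fun t => pdm m α β (t, z.2)) z.1 := by
  ext z; simp [pdm, pd, iteratedDeriv_succ]

lemma pdm_succ_snd (m : ℝ × ℝ → ℂ) (β : ℕ) :
    pdm m 0 (β + 1) = fun z => deriv (fun t => pdm m 0 β (z.1, t)) z.2 := by
  ext z; simp [pdm, pd, iteratedDeriv_succ]

lemma contDiffOn_pdm {U : Set (ℝ × ℝ)} (hU : IsOpen U) {m : ℝ × ℝ → ℂ}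
    (hm : ContDiffOn ℝ (⊤ : ℕ∞) m U) (α β : ℕ) : ContDiffOn ℝ (⊤ : ℕ∞) (pdm m α β) U := by
  induction α with
  | zero =>
    induction β with
    | zero => rwa [pdm_zero_zero]
    | succ β ih => rw [pdm_succ_snd]; exact (ih.partial_snd hU).1
  | succ α ih => rw [pdm_succ_fst]; exact (ih.partial_fst hU).1

lemma hasDerivAt_pdm_fst {U : Set (ℝ × ℝ)} (hU : IsOpen U) {m : ℝ × ℝ → ℂ}
    (hm : ContDiffOn ℝ (⊤ : ℕ∞) m U) (α β : ℕ) {x y : ℝ} (hz : (x, y) ∈ U) :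
    HasDerivAt (fun t => pdm m α β (t, y)) (pdm m (α + 1) β (x, y)) x := by
  rw [pdm_succ_fst]; exact ((contDiffOn_pdm hU hm α β).partial_fst hU).2 _ hz

lemma hasDerivAt_pdm_snd {U : Set (ℝ × ℝ)} (hU : IsOpen U) {m : ℝ × ℝ → ℂ}
    (hm : ContDiffOn ℝ (⊤ : ℕ∞) m U) (β : ℕ) {x y : ℝ} (hz : (x, y) ∈ U) :
    HasDerivAt (fun t => pdm m 0 β (x, t)) (pdm m 0 (β + 1) (x, y)) y := by
  rw [pdm_succ_snd]; exact ((contDiffOn_pdm hU hm 0 β).partial_snd hU).2 _ hz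

lemma pdm_eq_zero (m : ℝ × ℝ → ℂ) (α β : ℕ) : ∀ z ∉ tsupport m, pdm m α β z = 0 := by
  have hU : IsOpen (tsupport m)ᶜ := (isClosed_tsupport m).isOpen_compl
  have h1 : ∀ G : ℝ × ℝ → ℂ, (∀ z ∉ tsupport m, G z = 0) → ∀ z ∉ tsupport m,
      deriv (fun t => G (t, z.2)) z.1 = 0 := by
    intro G hG z hz
    have : (fun t => G (t, z.2)) =ᶠ[𝓝 z.1] fun _ => 0 := by
      have hc : ContinuousAt (fun t : ℝ => (t, z.2)) z.1 := by fun_prop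
      filter_upwards [hc.preimage_mem_nhds (hU.mem_nhds hz)] with t ht
      exact hG _ ht
    rw [this.deriv_eq]; simp
  have h2 : ∀ G : ℝ × ℝ → ℂ, (∀ z ∉ tsupport m, G z = 0) → ∀ z ∉ tsupport m,
      deriv (fun t => G (z.1, t)) z.2 = 0 := by
    intro G hG z hz
    have : (fun t => G (z.1, t)) =ᶠ[𝓝 z.2] fun _ => 0 := by
      have hc : ContinuousAt (fun t : ℝ => (z.1, t)) z.2 := by fun_prop
      filter_upwards [hc.preimage_mem_nhds (hU.mem_nhds hz)] with t ht
      exact hG _ ht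
    rw [this.deriv_eq]; simp
  induction α with
  | zero =>
    induction β with
    | zero => rw [pdm_zero_zero]; exact fun z hz => image_eq_zero_of_notMem_tsupport hz
    | succ β ih => rw [pdm_succ_snd]; exact h2 _ ih
  | succ α ih => rw [pdm_succ_fst]; exact h1 _ ih

section

lemma IsAnnular.deriv {m : ℕ} {θ : 𝓢(ℝ, ℂ)} (h : IsAnnular m θ) :
    IsAnnular m (derivCLM ℂ ℂ θ) := by
  intro t ht
  have hcl : IsClosed {t : ℝ | (2 : ℝ) ^ (-m : ℤ) ≤ |t| ∧ |t| ≤ 2 ^ (m : ℤ)} :=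
    (isClosed_le continuous_const continuous_abs).inter
      (isClosed_le continuous_abs continuous_const)
  by_contra hn
  refine ht ?_
  have : θ =ᶠ[𝓝 t] fun _ => 0 := by
    filter_upwards [hcl.isOpen_compl.mem_nhds hn] with x hx
    by_contra h0
    exact hx (h x h0)
  rw [SchwartzMap.derivCLM_apply, this.deriv_eq]
  simp

/-- The `ρ`-rescaled mixed derivative localised to the support of `θ(τ₂)`. -/
def famF (m : ℝ × ℝ → ℂ) (α β : ℕ) (θ : 𝓢(ℝ, ℂ)) (ρ : ℝ) (τ : ℝ × ℝ) : ℂ :=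
  ((ρ ^ (α + β) : ℝ) : ℂ) * pdm m α β (ρ * τ.1, ρ * τ.2) * θ τ.2

/-- Smooth symbols of order zero supported in a cone around the second axis. -/
structure IsConeSymbol (m : ℝ × ℝ → ℂ) (C : ℕ → ℕ → ℝ) (c : ℝ) : Prop where
  smooth : ContDiffOn ℝ (⊤ : ℕ∞) m {((0 : ℝ), (0 : ℝ))}ᶜ
  bound : ∀ β₁ β₂ : ℕ, ∀ τ₁ τ₂ : ℝ, (τ₁, τ₂) ≠ ((0 : ℝ), (0 : ℝ)) →
    ‖pd β₁ β₂ (fun a b => m (a, b)) τ₁ τ₂‖ ≤ C β₁ β₂ * (|τ₁| + |τ₂|) ^ (-(β₁ + β₂ : ℤ))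
  pos : 0 < c
  supp : tsupport m ⊆ {τ : ℝ × ℝ | |τ.1| ≤ c * |τ.2|}

variable {m : ℝ × ℝ → ℂ} {C : ℕ → ℕ → ℝ} {c : ℝ}

lemma famF_support (hm : IsConeSymbol m C c) {θ : 𝓢(ℝ, ℂ)} (hθ : IsAnnular 1 θ) (α β : ℕ)
    {ρ : ℝ} (hρ : 0 < ρ) {τ : ℝ × ℝ} (h : famF m α β θ ρ τ ≠ 0) :
    1 / 2 ≤ |τ.2| ∧ |τ.2| ≤ 2 ∧ |τ.1| ≤ c * |τ.2| := by
  simp only [famF, ne_eq, mul_eq_zero, not_or] at h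
  obtain ⟨h1, h2⟩ := hθ _ h.2
  refine ⟨by norm_num at h1 ⊢; exact h1, by norm_num at h2; exact h2, ?_⟩
  have h3 := hm.supp (not_not.1 fun hn => h.1.2 (pdm_eq_zero m α β _ hn))
  simp only [Set.mem_ofPred_eq, abs_mul, abs_of_pos hρ] at h3
  refine le_of_mul_le_mul_left ?_ hρ
  linarith

lemma contDiff_famF (hm : IsConeSymbol m C c) {θ : 𝓢(ℝ, ℂ)} (hθ : IsAnnular 1 θ) (α β : ℕ)
    {ρ : ℝ} (hρ : 0 < ρ) : ContDiff ℝ (⊤ : ℕ∞) (famF m α β θ ρ) := by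
  rw [contDiff_iff_contDiffAt]
  intro τ
  by_cases h0 : τ.2 = 0
  · have hev : famF m α β θ ρ =ᶠ[𝓝 τ] fun _ => 0 := by
      have hc : ContinuousAt (fun z : ℝ × ℝ => |z.2|) τ := by fun_prop
      have : ∀ᶠ z in 𝓝 τ, |z.2| < 1 / 2 := hc.eventually_lt continuousAt_const (by simp [h0])
      filter_upwards [this] with z hz
      by_contra hn
      linarith [(famF_support hm hθ α β hρ hn).1]
    exact contDiffAt_const.congr_of_eventuallyEq hev
  · have hU : IsOpen ({((0 : ℝ), (0 : ℝ))}ᶜ : Set (ℝ × ℝ)) := isOpen_compl_singleton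
    have hz : (ρ * τ.1, ρ * τ.2) ∈ ({((0 : ℝ), (0 : ℝ))}ᶜ : Set (ℝ × ℝ)) := by
      simp [hρ.ne', h0]
    have h1 := ((contDiffOn_pdm hU hm.smooth α β).contDiffAt (hU.mem_nhds hz))
    have h2 : ContDiffAt ℝ (⊤ : ℕ∞) (fun z : ℝ × ℝ => pdm m α β (ρ * z.1, ρ * z.2)) τ :=
      h1.comp τ (f := fun z : ℝ × ℝ => (ρ * z.1, ρ * z.2)) (by fun_prop)
    exact (contDiffAt_const.mul h2).mul ((θ.smooth _).contDiffAt.comp τ contDiffAt_snd)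

lemma exists_famF (hm : IsConeSymbol m C c) {θ : 𝓢(ℝ, ℂ)} (hθ : IsAnnular 1 θ) (α β : ℕ)
    {ρ : ℝ} (hρ : 0 < ρ) : ∃ G : 𝓢(ℝ × ℝ, ℂ), ∀ τ, G τ = famF m α β θ ρ τ := by
  have hK : IsCompact (Set.Icc (-(2 * c)) (2 * c) ×ˢ Set.Icc (-2 : ℝ) 2) :=
    isCompact_Icc.prod isCompact_Icc
  refine ⟨(HasCompactSupport.intro hK fun τ hτ => ?_).toSchwartzMap
    (contDiff_famF hm hθ α β hρ), fun τ => rfl⟩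
  by_contra hn
  obtain ⟨-, h2, h3⟩ := famF_support hm hθ α β hρ hn
  refine hτ ⟨abs_le.1 ?_, abs_le.1 h2⟩
  nlinarith [hm.pos]

lemma exists_famF_le (hm : IsConeSymbol m C c) {θ : 𝓢(ℝ, ℂ)} (hθ : IsAnnular 1 θ)
    (α β : ℕ) : ∃ A : ℝ, 0 ≤ A ∧ ∀ ρ : ℝ, 0 < ρ → ∀ G : 𝓢(ℝ × ℝ, ℂ),
      (∀ τ, G τ = famF m α β θ ρ τ) → ∀ ζ, ‖ftS G ζ‖ ≤ A := by
  obtain ⟨K, hK⟩ : ∃ K, ∀ x, ‖θ x‖ ≤ K := ⟨_, fun z => θ.norm_le_seminorm ℝ z⟩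
  have hK0 := (norm_nonneg _).trans (hK 0)
  set B : Set (ℝ × ℝ) := Set.Icc (-(2 * c)) (2 * c) ×ˢ Set.Icc (-2 : ℝ) 2
  have hBc : IsCompact B := isCompact_Icc.prod isCompact_Icc
  have hC0 : 0 ≤ C α β := by
    have := (norm_nonneg _).trans (hm.bound α β 0 1 (by simp))
    simpa using this
  set A₀ := C α β * (1 / 2) ^ (-(α + β : ℤ)) * K with hA₀
  refine ⟨∫ z in B, A₀, integral_nonneg fun _ => by positivity, fun ρ hρ G hG ζ => ?_⟩
  rw [ftS_apply, FT2]
  refine (norm_integral_le_integral_norm _).trans ?_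
  rw [← integral_indicator hBc.measurableSet]
  refine integral_mono_of_nonneg (.of_forall fun _ => norm_nonneg _)
    ((integrable_indicator_iff hBc.measurableSet).2
      (integrableOn_const hBc.measure_lt_top.ne)) (.of_forall fun τ => ?_)
  simp only [norm_mul, norm_e2π, mul_one, hG]
  by_cases h0 : famF m α β θ ρ τ = 0
  · rw [h0, norm_zero]
    exact Set.indicator_nonneg (fun _ _ => by positivity) _
  obtain ⟨h1, h2, h3⟩ := famF_support hm hθ α β hρ h0
  have hB : τ ∈ B := ⟨abs_le.1 (by nlinarith [hm.pos]), abs_le.1 h2⟩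
  rw [Set.indicator_of_mem hB]
  simp only [famF, norm_mul, Complex.norm_real, norm_pow, Real.norm_eq_abs, abs_of_pos hρ]
  have hτ : τ.2 ≠ 0 := by
    intro h; rw [h] at h1; norm_num at h1
  have h4 := hm.bound α β (ρ * τ.1) (ρ * τ.2) (by simp [hρ.ne', hτ])
  have h5 : (|ρ * τ.1| + |ρ * τ.2|) ^ (-(α + β : ℤ)) =
      (ρ ^ (α + β))⁻¹ * (|τ.1| + |τ.2|) ^ (-(α + β : ℤ)) := by
    rw [abs_mul, abs_mul, abs_of_pos hρ, ← mul_add, mul_zpow]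
    congr 1
    rw [zpow_neg]
    norm_cast
  have h6 : (|τ.1| + |τ.2|) ^ (-(α + β : ℤ)) ≤ (1 / 2 : ℝ) ^ (-(α + β : ℤ)) := by
    rw [zpow_neg, zpow_neg]
    norm_cast
    gcongr
    linarith [abs_nonneg τ.1]
  rw [h5] at h4
  rw [hA₀]
  refine mul_le_mul ?_ (hK _) (norm_nonneg _) (by positivity)
  calc ρ ^ (α + β) * ‖pdm m α β (ρ * τ.1, ρ * τ.2)‖
      ≤ ρ ^ (α + β) * (C α β * ((ρ ^ (α + β))⁻¹ * (|τ.1| + |τ.2|) ^ (-(α + β : ℤ)))) := by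
        gcongr; exact h4
    _ = C α β * (|τ.1| + |τ.2|) ^ (-(α + β : ℤ)) := by
        field_simp
    _ ≤ _ := by gcongr

lemma hasDerivAt_famF_fst (hm : IsConeSymbol m C c) {θ : 𝓢(ℝ, ℂ)} (hθ : IsAnnular 1 θ)
    (α β : ℕ) {ρ : ℝ} (hρ : 0 < ρ) (x y : ℝ) :
    HasDerivAt (fun t => famF m α β θ ρ (t, y)) (famF m (α + 1) β θ ρ (x, y)) x := by
  by_cases h0 : y = 0
  · simpa [famF, h0, hθ.zero] using hasDerivAt_const x (0 : ℂ)
  have hU : IsOpen ({((0 : ℝ), (0 : ℝ))}ᶜ : Set (ℝ × ℝ)) := isOpen_compl_singleton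
  have h1 := hasDerivAt_pdm_fst hU hm.smooth α β (x := ρ * x) (y := ρ * y) (by simp [hρ.ne', h0])
  have h2 := (h1.scomp x ((hasDerivAt_id x).const_mul ρ)).const_mul ((ρ ^ (α + β) : ℝ) : ℂ)
  refine (h2.mul_const (θ y)).congr_deriv ?_
  simp only [famF, Complex.real_smul]
  push_cast
  ring

lemma hasDerivAt_famF_snd (hm : IsConeSymbol m C c) {θ : 𝓢(ℝ, ℂ)} (hθ : IsAnnular 1 θ)
    (β : ℕ) {ρ : ℝ} (hρ : 0 < ρ) (x y : ℝ) :
    HasDerivAt (fun t => famF m 0 β θ ρ (x, t)) (famF m 0 (β + 1) θ ρ (x, y) +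
      famF m 0 β (derivCLM ℂ ℂ θ) ρ (x, y)) y := by
  by_cases h0 : y = 0
  · have hev : (fun t => famF m 0 β θ ρ (x, t)) =ᶠ[𝓝 y] fun _ => 0 := by
      have hc : ContinuousAt (fun t : ℝ => |t|) y := by fun_prop
      have : ∀ᶠ t in 𝓝 y, |t| < 1 / 2 := hc.eventually_lt continuousAt_const (by simp [h0])
      filter_upwards [this] with z hz
      by_contra hn
      linarith [(famF_support hm hθ 0 β hρ hn).1]
    refine ((hasDerivAt_const y (0 : ℂ)).congr_of_eventuallyEq hev).congr_deriv ?_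
    simp only [famF]
    rw [h0, hθ.zero, hθ.deriv.zero]
    simp
  have hU : IsOpen ({((0 : ℝ), (0 : ℝ))}ᶜ : Set (ℝ × ℝ)) := isOpen_compl_singleton
  have h1 := hasDerivAt_pdm_snd hU hm.smooth β (x := ρ * x) (y := ρ * y) (by simp [hρ.ne', h0])
  have h2 := (h1.scomp y ((hasDerivAt_id y).const_mul ρ)).const_mul ((ρ ^ (0 + β) : ℝ) : ℂ)
  refine (h2.mul (hasDerivAt_schwartz θ y)).congr_deriv ?_
  simp only [famF, Complex.real_smul, Function.comp_apply]
  push_cast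
  ring

lemma exists_famF_decay (hm : IsConeSymbol m C c) (k l : ℕ) :
    ∀ (α β : ℕ) (θ : 𝓢(ℝ, ℂ)), IsAnnular 1 θ → α = 0 ∨ l = 0 →
    ∃ A : ℝ, 0 ≤ A ∧ ∀ ρ : ℝ, 0 < ρ → ∀ G : 𝓢(ℝ × ℝ, ℂ),
      (∀ τ, G τ = famF m α β θ ρ τ) → ∀ ζ : ℝ × ℝ, |ζ.1| ^ k * |ζ.2| ^ l * ‖ftS G ζ‖ ≤ A := by
  have hπ : 1 ≤ 2 * Real.pi := by linarith [Real.two_le_pi]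
  have key : ∀ x t : ℝ, 0 ≤ t → |x| * t ≤ 2 * Real.pi * |x| * t := fun x t ht => by
    have := mul_nonneg (abs_nonneg x) ht
    nlinarith
  induction l with
  | zero =>
    induction k with
    | zero =>
      intro α β θ hθ _
      simpa using exists_famF_le hm hθ α β
    | succ k ih =>
      intro α β θ hθ _
      obtain ⟨A, hA, H⟩ := ih (α + 1) β θ hθ (Or.inr rfl)
      refine ⟨A, hA, fun ρ hρ G hG ζ => ?_⟩
      obtain ⟨G', hG'⟩ := exists_famF hm hθ (α + 1) β hρ
      refine le_trans ?_ (H ρ hρ G' hG' ζ)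
      rw [ftS_of_hasDerivAt_fst (f := G) (g := G') (fun x y => by
        simp only [hG, hG']; exact hasDerivAt_famF_fst hm hθ α β hρ x y)]
      simp only [norm_mul, Complex.norm_real, Complex.norm_I, Complex.norm_ofNat,
        Real.norm_eq_abs, abs_of_pos Real.pi_pos, mul_one, pow_zero]
      have := key ζ.1 (|ζ.1| ^ k * ‖ftS G ζ‖) (by positivity)
      calc _ = |ζ.1| * (|ζ.1| ^ k * ‖ftS G ζ‖) := by ring
        _ ≤ _ := this
        _ = _ := by ring
  | succ l ih =>
    intro α β θ hθ hα
    obtain rfl : α = 0 := by simpa using hα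
    obtain ⟨A, hA, H⟩ := ih 0 (β + 1) θ hθ (Or.inl rfl)
    obtain ⟨A', hA', H'⟩ := ih 0 β _ hθ.deriv (Or.inl rfl)
    refine ⟨A + A', by positivity, fun ρ hρ G hG ζ => ?_⟩
    obtain ⟨G₁, hG₁⟩ := exists_famF hm hθ 0 (β + 1) hρ
    obtain ⟨G₂, hG₂⟩ := exists_famF hm hθ.deriv 0 β hρ
    refine le_trans ?_ (add_le_add (H ρ hρ G₁ hG₁ ζ) (H' ρ hρ G₂ hG₂ ζ))
    have h1 : ftS (G₁ + G₂) ζ = 2 * Real.pi * Complex.I * ζ.2 * ftS G ζ :=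
      ftS_of_hasDerivAt_snd (f := G) (fun x y => by
        simp only [hG, add_apply, hG₁, hG₂]
        exact hasDerivAt_famF_snd hm hθ β hρ x y) ζ
    have h2 : ftS (G₁ + G₂) ζ = ftS G₁ ζ + ftS G₂ ζ := by
      simp [ftS, map_add, FourierTransform.fourier_add]
    have h3 : 2 * Real.pi * |ζ.2| * ‖ftS G ζ‖ ≤ ‖ftS G₁ ζ‖ + ‖ftS G₂ ζ‖ := by
      have := norm_add_le (ftS G₁ ζ) (ftS G₂ ζ)
      rw [← h2, h1] at this
      simpa [abs_of_pos Real.pi_pos] using this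
    have h4 := key ζ.2 ‖ftS G ζ‖ (norm_nonneg _)
    calc _ = |ζ.1| ^ k * |ζ.2| ^ l * (|ζ.2| * ‖ftS G ζ‖) := by ring
      _ ≤ |ζ.1| ^ k * |ζ.2| ^ l * (‖ftS G₁ ζ‖ + ‖ftS G₂ ζ‖) := by gcongr; linarith
      _ = _ := by ring

/-- Uniform Fourier decay of the rescaled pieces of a cone symbol. -/
lemma IsConeSymbol.exists_piece_decay (hm : IsConeSymbol m C c) (n : ℕ) :
    ∃ A : ℝ, 0 ≤ A ∧ ∀ ρ : ℝ, 0 < ρ → ∃ G : 𝓢(ℝ × ℝ, ℂ),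
      (∀ τ, G τ = m (ρ * τ.1, ρ * τ.2) * lpσ τ.2) ∧
      (∀ τ, G τ ≠ 0 → |τ.2| ≤ 2 ∧ |τ.1| ≤ c * |τ.2|) ∧
      ∀ ζ : ℝ × ℝ, (1 + |ζ.1|) ^ n * (1 + |ζ.2|) ^ n * ‖ftS G ζ‖ ≤ A := by
  have H := fun k l => exists_famF_decay hm k l 0 0 lpσ isAnnular_lpσ (Or.inl rfl)
  choose A hA H using H
  refine ⟨∑ i ∈ Finset.range (n + 1), ∑ j ∈ Finset.range (n + 1), n.choose i * n.choose j * A i j,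
    Finset.sum_nonneg fun i _ => Finset.sum_nonneg fun j _ => by have := hA i j; positivity,
    fun ρ hρ => ?_⟩
  obtain ⟨G, hG⟩ := exists_famF hm isAnnular_lpσ 0 0 hρ
  refine ⟨G, fun τ => by rw [hG]; simp [famF, pdm_zero_zero], fun τ hτ => ?_, fun ζ => ?_⟩
  · rw [hG] at hτ
    exact (famF_support hm isAnnular_lpσ 0 0 hρ hτ).2
  · rw [add_comm 1 |ζ.1|, add_comm 1 |ζ.2|, add_pow, add_pow, Finset.sum_mul_sum, Finset.sum_mul]
    refine Finset.sum_le_sum fun i _ => ?_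
    rw [Finset.sum_mul]
    refine Finset.sum_le_sum fun j _ => ?_
    have := H i j ρ hρ G hG ζ
    calc _ = n.choose i * n.choose j * (|ζ.1| ^ i * |ζ.2| ^ j * ‖ftS G ζ‖) := by ring
      _ ≤ _ := by gcongr

end

section

/-- A bump equal to one on the support of `lpσ` and vanishing near zero. -/
def lpϑ : 𝓢(ℝ, ℂ) := dilS (1 / 2) bumpφ - dilS 4 bumpφ

lemma lpϑ_apply (t : ℝ) : lpϑ t = bumpφ (1 / 2 * t) - bumpφ (4 * t) := by
  simp [lpϑ, dilS_apply]

lemma isAnnular_lpϑ : IsAnnular 2 lpϑ := by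
  intro t ht
  rw [lpϑ_apply] at ht
  norm_num
  constructor
  · by_contra! hn
    refine ht ?_
    rw [bumpφ_one, bumpφ_one, sub_self] <;> rw [abs_mul] <;> norm_num <;> linarith
  · by_contra! hn
    refine ht ?_
    rw [bumpφ_zero, bumpφ_zero, sub_self] <;> rw [abs_mul] <;> norm_num <;> linarith

lemma lpϑ_one {t : ℝ} (h : lpσ t ≠ 0) : lpϑ t = 1 := by
  obtain ⟨h1, h2⟩ := lpσ_ne_zero h
  rw [lpϑ_apply, bumpφ_one, bumpφ_zero, sub_zero] <;> rw [abs_mul] <;> norm_num <;> linarith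

variable {m : ℝ × ℝ → ℂ} {C : ℕ → ℕ → ℝ} {c : ℝ}

lemma integrable_decay : Integrable fun ζ : ℝ × ℝ => (1 + ζ.1 ^ 2)⁻¹ * (1 + ζ.2 ^ 2)⁻¹ :=
  integrable_inv_one_add_sq.mul_prod integrable_inv_one_add_sq

lemma IsConeSymbol.exists_norm_le (hm : IsConeSymbol m C c) : ∃ K, ∀ τ, ‖m τ‖ ≤ K := by
  refine ⟨max (C 0 0) ‖m (0, 0)‖, fun τ => ?_⟩
  by_cases h : τ = (0, 0)
  · rw [h]; exact le_max_right _ _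
  · refine le_max_of_le_left ?_
    simpa [pd] using hm.bound 0 0 τ.1 τ.2 h

theorem IsConeSymbol.exists_symBdd_piece (hm : IsConeSymbol m C c) {a : Fin 3 → ℝ}
    (ha : ∀ j, 0 < a j) (h0 : a 0 < 1 / 2) (hsum : ∑ j, a j = 1) :
    ∃ B : ℝ, ∀ J : Finset ℤ, IsTame (fun w : (ℝ × ℝ) × (ℝ × ℝ) =>
        ∑ j ∈ J, m (w.1.1, w.2.2) * lpσ (2 ^ j * w.2.2)) ∧
      SymBdd (1 / a 1) (1 / a 2) (1 / a 0)
        (fun w => ∑ j ∈ J, m (w.1.1, w.2.2) * lpσ (2 ^ j * w.2.2)) B := by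
  obtain ⟨A, hA, H⟩ := hm.exists_piece_decay 7
  obtain ⟨B, hB, HB⟩ := exists_symBdd_bump_mod ha h0 hsum isAnnular_lpϑ
  obtain ⟨Kψ, hKψ⟩ : ∃ K, ∀ x, ‖lpϑ x‖ ≤ K := ⟨_, fun z => lpϑ.norm_le_seminorm ℝ z⟩
  obtain ⟨Kφ, hKφ⟩ : ∃ K, ∀ x, ‖bumpφ x‖ ≤ K := ⟨_, fun z => bumpφ.norm_le_seminorm ℝ z⟩
  have hKψ0 := (norm_nonneg _).trans (hKψ 0)
  have hKφ0 := (norm_nonneg _).trans (hKφ 0)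
  have hc := hm.pos
  choose G hG hGs hGd using fun j : ℤ => H ((2 ^ j)⁻¹) (by positivity)
  set ρ₁ := (2 * c)⁻¹ with hρ₁
  have hρ₁0 : ρ₁ ≠ 0 := by positivity
  set D := (A + 1) * (B * (1 + 2 * c) ^ 5) with hD
  refine ⟨∫ ζ : ℝ × ℝ, D * ((1 + ζ.1 ^ 2)⁻¹ * (1 + ζ.2 ^ 2)⁻¹), fun J => ?_⟩
  have hGm : ∀ (j : ℤ) (w : (ℝ × ℝ) × (ℝ × ℝ)), m (w.1.1, w.2.2) * lpσ (2 ^ j * w.2.2) =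
      G j (2 ^ j * w.1.1, 2 ^ j * w.2.2) := by
    intro j w
    rw [hG]
    have : (2 : ℝ) ^ j ≠ 0 := by positivity
    simp only [inv_mul_cancel_left₀ this]
  simp_rw [hGm]
  constructor
  · refine IsTame.sum _ fun j => ⟨Continuous.aestronglyMeasurable (by fun_prop), ?_⟩
    obtain ⟨K, hK⟩ := (G j).exists_norm_le
    exact ⟨K, fun w => hK _⟩
  set M : ℝ × ℝ → (ℝ × ℝ) × (ℝ × ℝ) → ℂ := fun ζ w => ∑ j ∈ J,
    (ftS (G j) ζ * (bumpφ (2 ^ j * (ρ₁ * w.1.1)) *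
      e2π (ζ.1 / ρ₁ * (2 ^ j * (ρ₁ * w.1.1))))) *
    (lpϑ (2 ^ j * (1 * w.2.2)) * e2π (ζ.2 * (2 ^ j * (1 * w.2.2)))) with hM
  have hMG : ∀ w, ∑ j ∈ J, G j (2 ^ j * w.1.1, 2 ^ j * w.2.2) = ∫ ζ, M ζ w := by
    intro w
    simp only [hM]
    rw [integral_finsetSum]
    · refine Finset.sum_congr rfl fun j _ => ?_
      have e : ∀ ζ : ℝ × ℝ, (ftS (G j) ζ * (bumpφ (2 ^ j * (ρ₁ * w.1.1)) *
          e2π (ζ.1 / ρ₁ * (2 ^ j * (ρ₁ * w.1.1))))) *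
          (lpϑ (2 ^ j * (1 * w.2.2)) * e2π (ζ.2 * (2 ^ j * (1 * w.2.2)))) =
          bumpφ (2 ^ j * (ρ₁ * w.1.1)) * lpϑ (2 ^ j * (1 * w.2.2)) *
          (ftS (G j) ζ * e2π (2 ^ j * w.1.1 * ζ.1 + 2 ^ j * w.2.2 * ζ.2)) := by
        intro ζ
        rw [e2π_add]
        have e1 : ζ.1 / ρ₁ * (2 ^ j * (ρ₁ * w.1.1)) = 2 ^ j * w.1.1 * ζ.1 := by
          field_simp
        have e2 : ζ.2 * (2 ^ j * (1 * w.2.2)) = 2 ^ j * w.2.2 * ζ.2 := by ring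
        rw [e1, e2]
        ring
      simp_rw [e]
      rw [integral_const_mul, ← (G j).eq_integral_ftS (2 ^ j * w.1.1, 2 ^ j * w.2.2)]
      by_cases hz : G j (2 ^ j * w.1.1, 2 ^ j * w.2.2) = 0
      · rw [hz, mul_zero]
      obtain ⟨h1, h2⟩ := hGs j _ hz
      have h3 : lpσ (2 ^ j * w.2.2) ≠ 0 := fun h => hz (by rw [hG]; simp [h])
      simp only at h1 h2
      rw [one_mul, lpϑ_one h3, bumpφ_one, one_mul, one_mul]
      rw [mul_left_comm, abs_mul, hρ₁, abs_of_pos (by positivity), inv_mul_le_iff₀ (by positivity)]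
      nlinarith
    · intro j _
      refine (((ftS (G j)).integrable.mul_bdd (c := Kφ) ?_ ?_).mul_bdd (c := Kψ) ?_ ?_)
      · exact Continuous.aestronglyMeasurable (by fun_prop)
      · exact Eventually.of_forall fun ζ => by rw [norm_mul, norm_e2π, mul_one]; exact hKφ _
      · exact Continuous.aestronglyMeasurable (by fun_prop)
      · exact Eventually.of_forall fun ζ => by rw [norm_mul, norm_e2π, mul_one]; exact hKψ _
  simp_rw [hMG]
  refine SymBdd.integral (K := fun ζ => ∑ j ∈ J, ‖ftS (G j) ζ‖ * Kφ * Kψ)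
    (Continuous.aestronglyMeasurable ?_) (fun ζ w => ?_) ?_ (integrable_decay.const_mul D)
    fun ζ => ?_
  · unfold Function.uncurry
    simp only [hM]
    fun_prop
  · refine norm_sum_le_of_le _ fun j _ => ?_
    rw [norm_mul, norm_mul, norm_mul, norm_mul, norm_e2π, norm_e2π, mul_one, mul_one]
    gcongr
    · exact hKφ _
    · exact hKψ _
  · exact integrable_finsetSum _ fun j _ => ((ftS (G j)).integrable.norm.mul_const _).mul_const _
  · set E := (1 + |ζ.1|) ^ 7 * (1 + |ζ.2|) ^ 7 with hE
    have hE0 : 0 < E := by positivity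
    have h1 := (HB J (fun j => ((E / (A + 1) : ℝ) : ℂ) * ftS (G j) ζ) (ζ.1 / ρ₁) ζ.2 ρ₁ 1 hρ₁0
      one_ne_zero fun k => ?_).const_mul (((A + 1) / E : ℝ) : ℂ)
    · refine SymBdd.mono (A := ‖(((A + 1) / E : ℝ) : ℂ)‖ *
        (B * ((1 + |ζ.1 / ρ₁|) ^ 5 * (1 + |ζ.2|) ^ 4))) ?_ ?_
      · convert h1 using 1
        ext w
        rw [Finset.mul_sum]
        refine Finset.sum_congr rfl fun j _ => ?_
        have e : (((A + 1) / E : ℝ) : ℂ) * ((E / (A + 1) : ℝ) : ℂ) = 1 := by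
          rw [← Complex.ofReal_mul]
          norm_cast
          field_simp
        linear_combination (-(ftS (G j) ζ * (bumpφ (2 ^ j * (ρ₁ * w.1.1)) *
          e2π (ζ.1 / ρ₁ * (2 ^ j * (ρ₁ * w.1.1)))) *
          (lpϑ (2 ^ j * (1 * w.2.2)) * e2π (ζ.2 * (2 ^ j * (1 * w.2.2)))))) * e
      · rw [Complex.norm_real, Real.norm_eq_abs, abs_of_pos (by positivity)]
        have e1 : 1 + |ζ.1 / ρ₁| ≤ (1 + 2 * c) * (1 + |ζ.1|) := by
          rw [hρ₁, div_inv_eq_mul, abs_mul, abs_of_pos (a := 2 * c) (by positivity)]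
          nlinarith [abs_nonneg ζ.1]
        have e2 : ∀ x : ℝ, 1 + x ^ 2 ≤ (1 + |x|) ^ 2 := fun x => by
          rw [← sq_abs x]; nlinarith [abs_nonneg x]
        have e3 : ((1 + |ζ.1|) ^ 2)⁻¹ ≤ (1 + ζ.1 ^ 2)⁻¹ := inv_anti₀ (by positivity) (e2 _)
        have e4 : ((1 + |ζ.2|) ^ 3)⁻¹ ≤ (1 + ζ.2 ^ 2)⁻¹ := inv_anti₀ (by positivity)
          ((e2 _).trans (pow_le_pow_right₀ (by linarith [abs_nonneg ζ.2]) (by norm_num)))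
        calc (A + 1) / E * (B * ((1 + |ζ.1 / ρ₁|) ^ 5 * (1 + |ζ.2|) ^ 4))
            ≤ (A + 1) / E * (B * (((1 + 2 * c) * (1 + |ζ.1|)) ^ 5 * (1 + |ζ.2|) ^ 4)) := by
              gcongr
          _ = D * (((1 + |ζ.1|) ^ 2)⁻¹ * ((1 + |ζ.2|) ^ 3)⁻¹) := by
              rw [hD, hE]
              field_simp
          _ ≤ _ := by gcongr
    · rw [norm_mul, Complex.norm_real, Real.norm_eq_abs, abs_of_pos (by positivity),
        div_mul_eq_mul_div, div_le_one (by positivity)]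
      linarith [hGd k ζ]

theorem IsConeSymbol.exists_symBdd (hm : IsConeSymbol m C c) {a : Fin 3 → ℝ}
    (ha : ∀ j, 0 < a j) (h0 : a 0 < 1 / 2) (hsum : ∑ j, a j = 1) :
    ∃ B : ℝ, SymBdd (1 / a 1) (1 / a 2) (1 / a 0) (fun w => m (w.1.1, w.2.2)) B := by
  obtain ⟨B, H⟩ := hm.exists_symBdd_piece ha h0 hsum
  obtain ⟨Km, hKm⟩ := hm.exists_norm_le
  obtain ⟨Kφ, hKφ⟩ : ∃ K, ∀ x, ‖bumpφ x‖ ≤ K := ⟨_, fun z => bumpφ.norm_le_seminorm ℝ z⟩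
  refine ⟨B, SymBdd.tendsto (l := atTop) (K := Km * (Kφ + Kφ))
    (.of_forall fun N : ℕ => (H (Finset.Icc (-N : ℤ) N)).1.1)
    (.of_forall fun N w => ?_) (.of_forall fun N => (H _).2) ?_⟩
  · rw [← Finset.mul_sum, sum_Icc_lpσ, norm_mul]
    exact mul_le_mul (hKm _) (norm_sub_le_of_le (hKφ _) (hKφ _)) (norm_nonneg _)
      ((norm_nonneg _).trans (hKm 0))
  · filter_upwards [ae_snd_snd_ne_zero] with w hw
    refine tendsto_const_nhds.congr' ?_
    have h5 : Tendsto (fun N : ℕ => (2 : ℝ) ^ N) atTop atTop :=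
      tendsto_pow_atTop_atTop_of_one_lt one_lt_two
    filter_upwards [h5.eventually_ge_atTop |w.2.2|, h5.eventually_ge_atTop |w.2.2|⁻¹] with N h1 h2
    rw [← Finset.mul_sum, sum_Icc_lpσ_eq_one, mul_one]
    · rw [zpow_neg, zpow_natCast]
      exact inv_le_of_inv_le₀ (abs_pos.2 hw) h2
    · rw [zpow_natCast]; exact h1

end

/-- The unit ball of `ℝ³ = ℝ × ℂ`. -/
def ball3 : Set (ℝ × ℂ) := {n | n.1 ^ 2 + ‖n.2‖ ^ 2 < 1}

lemma measurableSet_ball3 : MeasurableSet ball3 :=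
  (isOpen_lt (by fun_prop) continuous_const).measurableSet

lemma integral_ball3_inner (Φ : ℝ → ℂ) (v : WithLp 2 (ℝ × ℂ)) :
    ∫ n : WithLp 2 (ℝ × ℂ), (Metric.ball 0 1).indicator (fun n => Φ (inner ℝ v n)) n =
    ∫ n : WithLp 2 (ℝ × ℂ), (Metric.ball 0 1).indicator (fun n => Φ (‖v‖ * n.fst)) n := by
  set e : WithLp 2 (ℝ × ℂ) := WithLp.toLp 2 (‖v‖, 0) with he
  have hn : ‖v‖ = ‖e‖ := by
    rw [WithLp.prod_norm_eq_of_L2 e]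
    simp [he]
  set R := Submodule.reflection (ℝ ∙ (v - e))ᗮ
  have hR : R v = e := Submodule.reflection_sub hn
  rw [← R.measurePreserving.integral_comp R.toHomeomorph.measurableEmbedding
    (fun n => (Metric.ball 0 1).indicator (fun n => Φ (‖v‖ * n.fst)) n)]
  refine integral_congr_ae (.of_forall fun n => ?_)
  have h1 : inner ℝ v n = ‖v‖ * (R n).fst := by
    rw [← R.inner_map_map v n, hR, WithLp.prod_inner_apply]
    simp [he, mul_comm]
  simp only [Set.indicator, Metric.mem_ball, dist_zero_right, LinearIsometryEquiv.norm_map, h1]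

lemma integral_ball3 {Φ : ℝ → ℂ} (hΦ : Continuous Φ) (v : ℝ × ℂ) :
    ∫ n in ball3, Φ (v.1 * n.1 + (v.2.re * n.2.re + v.2.im * n.2.im)) =
    ∫ t in Set.Ioc (-1 : ℝ) 1, Φ (√(v.1 ^ 2 + ‖v.2‖ ^ 2) * t) * ((Real.pi * (1 - t ^ 2) : ℝ) : ℂ) := by
  have hB : ∀ n : WithLp 2 (ℝ × ℂ), WithLp.ofLp n ∈ ball3 ↔ n ∈ Metric.ball 0 1 := by
    intro n
    rw [Metric.mem_ball, dist_zero_right, WithLp.prod_norm_eq_of_L2, ← Real.sqrt_one,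
      Real.sqrt_lt_sqrt_iff (by positivity)]
    simp [ball3]
  have hmp := WithLp.volume_preserving_ofLp ℝ ℂ
  have hme : MeasurableEmbedding (WithLp.ofLp : WithLp 2 (ℝ × ℂ) → ℝ × ℂ) :=
    (MeasurableEquiv.toLp 2 (ℝ × ℂ)).symm.measurableEmbedding
  rw [← integral_indicator measurableSet_ball3]
  have h1 := integral_ball3_inner Φ (WithLp.toLp 2 v)
  have h2 := hmp.integral_comp hme (fun n => ball3.indicator
    (fun n => Φ (v.1 * n.1 + (v.2.re * n.2.re + v.2.im * n.2.im))) n)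
  have h3 := hmp.integral_comp hme (fun n => ball3.indicator
    (fun n => Φ (√(v.1 ^ 2 + ‖v.2‖ ^ 2) * n.1)) n)
  rw [← h2]
  have e2 : ∀ n : WithLp 2 (ℝ × ℂ), ball3.indicator
      (fun n => Φ (v.1 * n.1 + (v.2.re * n.2.re + v.2.im * n.2.im))) (WithLp.ofLp n) =
      (Metric.ball 0 1).indicator (fun n => Φ (inner ℝ (WithLp.toLp 2 v) n)) n := by
    intro n
    by_cases h : n ∈ Metric.ball (0 : WithLp 2 (ℝ × ℂ)) 1
    · rw [Set.indicator_of_mem h, Set.indicator_of_mem ((hB n).2 h), WithLp.prod_inner_apply]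
      simp [Complex.inner, mul_comm]
    · rw [Set.indicator_of_notMem h, Set.indicator_of_notMem (fun h' => h ((hB n).1 h'))]
  have e3 : ∀ n : WithLp 2 (ℝ × ℂ), ball3.indicator
      (fun n => Φ (√(v.1 ^ 2 + ‖v.2‖ ^ 2) * n.1)) (WithLp.ofLp n) =
      (Metric.ball 0 1).indicator (fun n => Φ (‖WithLp.toLp 2 v‖ * n.fst)) n := by
    intro n
    by_cases h : n ∈ Metric.ball (0 : WithLp 2 (ℝ × ℂ)) 1
    · rw [Set.indicator_of_mem h, Set.indicator_of_mem ((hB n).2 h), WithLp.prod_norm_eq_of_L2]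
      simp
    · rw [Set.indicator_of_notMem h, Set.indicator_of_notMem (fun h' => h ((hB n).1 h'))]
  simp_rw [e2, h1, ← e3]
  rw [h3]
  set r := √(v.1 ^ 2 + ‖v.2‖ ^ 2)
  have hsub : ball3 ⊆ Set.Icc (-1 : ℝ) 1 ×ˢ Metric.closedBall (0 : ℂ) 1 := by
    rintro ⟨t, z⟩ h
    simp only [ball3, Set.mem_ofPred_eq] at h
    refine ⟨abs_le.1 ?_, ?_⟩
    · rw [← sq_le_one_iff_abs_le_one]; nlinarith [sq_nonneg ‖z‖]
    · simp only [Metric.mem_closedBall, dist_zero_right]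
      nlinarith [sq_nonneg t, norm_nonneg z]
  have hInt : Integrable (ball3.indicator fun n : ℝ × ℂ => Φ (r * n.1)) := by
    rw [integrable_indicator_iff measurableSet_ball3]
    exact ((Continuous.continuousOn (by fun_prop)).integrableOn_compact
      (isCompact_Icc.prod (isCompact_closedBall 0 1))).mono_set hsub
  rw [Measure.volume_eq_prod, integral_prod _ hInt, ← integral_indicator measurableSet_Ioc]
  have hne : ∀ᵐ t : ℝ, t ≠ 1 := by simp [ae_iff]
  refine integral_congr_ae ?_
  filter_upwards [hne] with t ht
  have e4 : ∀ z : ℂ, ball3.indicator (fun n : ℝ × ℂ => Φ (r * n.1)) (t, z) =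
      (Metric.ball (0 : ℂ) (√(1 - t ^ 2))).indicator (fun _ => Φ (r * t)) z := by
    intro z
    simp only [Set.indicator, ball3, Set.mem_ofPred_eq, Metric.mem_ball, dist_zero_right,
      Real.lt_sqrt (norm_nonneg z), lt_sub_iff_add_lt']
    congr
  simp_rw [e4]
  rw [integral_indicator Metric.isOpen_ball.measurableSet, setIntegral_const, measureReal_def,
    Complex.volume_ball]
  by_cases h : t ∈ Set.Ioc (-1 : ℝ) 1
  · rw [Set.indicator_of_mem h]
    have h0 : 0 ≤ 1 - t ^ 2 := by nlinarith [h.1, h.2]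
    rw [ENNReal.toReal_mul, ENNReal.toReal_pow, ENNReal.toReal_ofReal (Real.sqrt_nonneg _),
      Real.sq_sqrt h0, ENNReal.coe_toReal, Complex.real_smul]
    push_cast
    simp
    ring
  · rw [Set.indicator_of_notMem h]
    have h0 : 1 - t ^ 2 ≤ 0 := by
      by_contra! hn
      refine h ?_
      have := abs_lt.1 ((sq_lt_one_iff_abs_lt_one t).1 (by linarith))
      exact ⟨this.1, this.2.le⟩
    rw [Real.sqrt_eq_zero_of_nonpos h0]
    simp

lemma IsAnnular.exists_mul {m : ℕ} {φ : 𝓢(ℝ, ℂ)} (hφ : IsAnnular m φ) {F : ℝ → ℂ}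
    (hF : ContDiffOn ℝ (⊤ : ℕ∞) F {0}ᶜ) :
    ∃ G : 𝓢(ℝ, ℂ), (∀ t, G t = φ t * F t) ∧ IsAnnular m G := by
  have hs : ContDiff ℝ (⊤ : ℕ∞) fun t => φ t * F t := by
    rw [contDiff_iff_contDiffAt]
    intro t
    by_cases h0 : t = 0
    · have hev : (fun t => φ t * F t) =ᶠ[𝓝 t] fun _ => 0 := by
        have hc : ContinuousAt (fun z : ℝ => |z|) t := by fun_prop
        have : ∀ᶠ z in 𝓝 t, |z| < 2 ^ (-m : ℤ) :=
          hc.eventually_lt continuousAt_const (by simp [h0])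
        filter_upwards [this] with z hz
        by_cases h : φ z = 0
        · rw [h, zero_mul]
        · linarith [(hφ z h).1]
      exact contDiffAt_const.congr_of_eventuallyEq hev
    · exact (φ.smooth _).contDiffAt.mul
        (hF.contDiffAt (isOpen_compl_singleton.mem_nhds h0))
  have hc : HasCompactSupport fun t => φ t * F t := hφ.hasCompactSupport.mul_right
  exact ⟨hc.toSchwartzMap hs, fun t => rfl, fun t ht => hφ t (left_ne_zero_of_mul ht)⟩

/-- Radial profiles as averages of linear ones over the unit ball of `ℝ³`. -/
lemma IsAnnular.exists_ball_profile {m : ℕ} {β : 𝓢(ℝ, ℂ)} (hβ : IsAnnular m β)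
    (hneg : ∀ t ≤ 0, β t = 0) : ∃ ψ : 𝓢(ℝ, ℂ), IsAnnular m ψ ∧ ∀ r > 0,
      ∫ t in Set.Ioc (-1 : ℝ) 1, ψ (r * t) * ((Real.pi * (1 - t ^ 2) : ℝ) : ℂ) = β r := by
  obtain ⟨k, hk, hkA⟩ := hβ.exists_mul (F := fun t => (t : ℂ) ^ 3)
    (Complex.ofRealCLM.contDiff.pow 3).contDiffOn
  set k' := derivCLM ℂ ℂ k
  have hk'A : IsAnnular m k' := hkA.deriv
  obtain ⟨h, hh, hhA⟩ := hk'A.exists_mul (F := fun t => (((2 * Real.pi * t)⁻¹ : ℝ) : ℂ)) (by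
    refine Complex.ofRealCLM.contDiff.comp_contDiffOn (ContDiffOn.inv (by fun_prop) fun t ht => ?_)
    have : t ≠ 0 := ht
    positivity)
  refine ⟨derivCLM ℂ ℂ h, hhA.deriv, fun r hr => ?_⟩
  have hrel : ∀ s : ℝ, 2 * Real.pi * s * h s = k' s := by
    intro s
    by_cases h0 : s = 0
    · rw [h0, hk'A.zero]; simp
    · rw [hh]
      have : (s : ℂ) ≠ 0 := by exact_mod_cast h0
      have : (Real.pi : ℂ) ≠ 0 := by exact_mod_cast Real.pi_ne_zero
      push_cast
      field_simp
  have hrC : (r : ℂ) ≠ 0 := by exact_mod_cast hr.ne'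
  rw [← intervalIntegral.integral_of_le (by norm_num)]
  have hd : ∀ t ∈ Set.uIcc (-1 : ℝ) 1, HasDerivAt
      (fun t : ℝ => h (r * t) * ((Real.pi * (1 - t ^ 2) / r : ℝ) : ℂ) + k (r * t) * (r ^ 3 : ℂ)⁻¹)
      (derivCLM ℂ ℂ h (r * t) * ((Real.pi * (1 - t ^ 2) : ℝ) : ℂ)) t := by
    intro t _
    have hl : HasDerivAt (fun t : ℝ => r * t) r t := by
      simpa using (hasDerivAt_id t).const_mul r
    have h1 := (hasDerivAt_schwartz h (r * t)).scomp t hl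
    have h2 := (hasDerivAt_schwartz k (r * t)).scomp t hl
    have h3 : HasDerivAt (fun t : ℝ => ((Real.pi * (1 - t ^ 2) / r : ℝ) : ℂ))
        ((-(2 * Real.pi * t) / r : ℝ) : ℂ) t := by
      refine HasDerivAt.ofReal_comp ?_
      refine ((((hasDerivAt_pow 2 t).const_sub 1).const_mul Real.pi).div_const r).congr_deriv ?_
      simp
      ring
    refine ((h1.mul h3).add (h2.mul_const _)).congr_deriv ?_
    have := hrel (r * t)
    simp only [Function.comp_apply, Complex.real_smul]
    change _ + r * k' (r * t) * _ = _
    rw [← this]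
    push_cast
    field_simp
    ring
  rw [intervalIntegral.integral_eq_sub_of_hasDerivAt hd
    (Continuous.intervalIntegrable (by fun_prop) _ _)]
  rw [hk, hk, hneg (r * -1) (by linarith)]
  simp
  field_simp

/-- The symbol of `(I - ∂₁² - e²∂₂²)^{s/2}`. -/
def brk (e s : ℝ) (ζ : ℝ × ℝ) : ℝ :=
  (1 + 4 * Real.pi ^ 2 * (ζ.1 ^ 2 + (e * ζ.2) ^ 2)) ^ (s / 2)

lemma brk_pos (e s : ℝ) (ζ : ℝ × ℝ) : 0 < brk e s ζ := by unfold brk; positivity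

lemma one_le_brk (e : ℝ) {s : ℝ} (hs : 0 ≤ s) (ζ : ℝ × ℝ) : 1 ≤ brk e s ζ := by
  refine Real.one_le_rpow ?_ (by positivity)
  have : 0 ≤ 4 * Real.pi ^ 2 * (ζ.1 ^ 2 + (e * ζ.2) ^ 2) := by positivity
  linarith

lemma brk_eq_rpow (e s : ℝ) (ζ : ℝ × ℝ) : brk e s ζ = brk e 1 ζ ^ s := by
  rw [brk, brk, ← Real.rpow_mul (by positivity)]
  ring_nf

lemma brk_neg (e s : ℝ) (ζ : ℝ × ℝ) : brk e s (-ζ) = brk e s ζ := by simp [brk]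

lemma hasTemperateGrowth_brk (e s : ℝ) : (brk e s).HasTemperateGrowth := by
  set L : ℝ × ℝ →L[ℝ] ℂ := (2 * Real.pi) • (Complex.ofRealCLM ∘L ContinuousLinearMap.fst ℝ ℝ ℝ +
    (ContinuousLinearMap.snd ℝ ℝ ℝ).smulRight ((e : ℂ) * Complex.I)) with hL
  have h := (Function.hasTemperateGrowth_one_add_norm_sq_rpow (H := ℂ) (s / 2)).comp L.hasTemperateGrowth
  suffices he : brk e s = (fun x : ℂ => (1 + ‖x‖ ^ 2) ^ (s / 2)) ∘ L by rwa [he]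
  funext ζ
  have e1 : L ζ = (2 * Real.pi * ζ.1 : ℝ) + (2 * Real.pi * (e * ζ.2) : ℝ) * Complex.I := by
    simp [hL]
    ring
  simp only [Function.comp_apply, brk]
  rw [e1, Complex.sq_norm, Complex.normSq_add_mul_I]
  ring_nf

lemma continuous_brk (e s : ℝ) : Continuous (brk e s) :=
  (hasTemperateGrowth_brk e s).1.continuous

lemma hasTemperateGrowth_comp_brk (β : 𝓢(ℝ, ℂ)) (e k : ℝ) :
    (fun ζ => β (k * brk e 1 ζ)).HasTemperateGrowth :=
  β.hasTemperateGrowth.comp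
    ((Function.HasTemperateGrowth.const k).mul (hasTemperateGrowth_brk e 1))

lemma volume_ball3_lt_top : volume ball3 < ⊤ := by
  have h : ball3 ⊆ Metric.closedBall 0 1 := by
    intro n hn
    replace hn : n.1 ^ 2 + ‖n.2‖ ^ 2 < 1 := hn
    rw [mem_closedBall_zero_iff, Prod.norm_def, max_le_iff]
    constructor
    · rw [Real.norm_eq_abs]
      exact abs_le_one_iff_mul_self_le_one.2 (by nlinarith [sq_nonneg ‖n.2‖])
    · nlinarith [sq_nonneg n.1, norm_nonneg n.2]
  exact (measure_mono h).trans_lt measure_closedBall_lt_top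

/-- The multiplier theorem for lacunary sums in the radial variable `(1 + |ζ|²)^{1/2}`. -/
theorem exists_mulBdd_radial {p : ℝ} (hp : 1 < p) {m : ℕ} {β : 𝓢(ℝ, ℂ)}
    (hβ : IsAnnular m β) (hneg : ∀ t ≤ 0, β t = 0) (e : ℝ) : ∃ C : ℝ, 0 ≤ C ∧
      ∀ (S : Finset ℤ) (c : ℤ → ℂ), (∀ k, ‖c k‖ ≤ 1) →
      MulBdd p (fun ζ => ∑ k ∈ S, c k * β (2 ^ k * brk e 1 ζ)) C := by
  obtain ⟨ψ, hψ, hψβ⟩ := hβ.exists_ball_profile hneg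
  obtain ⟨C₀, hC₀, H₀⟩ := exists_mulBdd_lacSum hp ψ hψ.zero hψ.hasCompactSupport
  obtain ⟨K, hK, HK⟩ := exists_lacSum_le ψ hψ.zero
  have hpq := Real.HolderConjugate.conjExponent hp
  set q := p.conjExponent
  have hp0 := hpq.pos
  have hq0 := hpq.symm.pos
  refine ⟨volume.real ball3 * C₀, by positivity, fun S c hc => ?_⟩
  refine mulBdd_of_bilin hpq (by positivity) (Function.HasTemperateGrowth.sum fun k _ =>
    (Function.HasTemperateGrowth.const _).mul (hasTemperateGrowth_comp_brk β e _)) fun f h => ?_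
  set α : ℝ × ℂ → ℝ × ℝ := fun n => (2 * Real.pi * n.2.re, 2 * Real.pi * e * n.2.im) with hα
  set a : ℝ × ℂ → ℝ × ℝ → ℂ := fun n ζ =>
    lacSum ψ S c 0 ((α n).1 * ζ.1 + (α n).2 * ζ.2 + n.1) with ha
  have hac : Continuous fun z : (ℝ × ℂ) × (ℝ × ℝ) => a z.1 z.2 := by
    simp only [ha, lacSum, hα]
    fun_prop
  have hval : ∀ ζ, ∑ k ∈ S, c k * β (2 ^ k * brk e 1 ζ) = ∫ n in ball3, a n ζ := by
    intro ζ
    have h1 := integral_ball3 (Φ := lacSum ψ S c 0) (by unfold lacSum; fun_prop)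
      (1, ⟨2 * Real.pi * ζ.1, 2 * Real.pi * (e * ζ.2)⟩)
    have h2 : √((1 : ℝ) ^ 2 + ‖(⟨2 * Real.pi * ζ.1, 2 * Real.pi * (e * ζ.2)⟩ : ℂ)‖ ^ 2) =
        brk e 1 ζ := by
      rw [Complex.sq_norm, Complex.normSq_mk, brk, Real.sqrt_eq_rpow]
      ring_nf
    simp only at h1
    rw [h2] at h1
    calc _ = ∫ t in Set.Ioc (-1 : ℝ) 1, lacSum ψ S c 0 (brk e 1 ζ * t) *
          ((Real.pi * (1 - t ^ 2) : ℝ) : ℂ) := by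
          simp_rw [lacSum, zero_mul, e2π_zero, mul_one, Finset.sum_mul]
          rw [integral_finsetSum]
          · refine Finset.sum_congr rfl fun k _ => ?_
            rw [← hψβ _ (mul_pos (by positivity) (brk_pos e 1 ζ)), ← integral_const_mul]
            simp_rw [mul_assoc]
          · intro k _
            exact (Continuous.integrableOn_Icc (by fun_prop)).mono_set Set.Ioc_subset_Icc_self
      _ = _ := by
          rw [← h1]
          refine integral_congr_ae (.of_forall fun n => ?_)
          simp only [ha, hα]
          congr 1
          ring
  have hP := integrable_pair f h
  have hfin : IsFiniteMeasure (volume.restrict ball3) := ⟨by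
    rw [Measure.restrict_apply_univ]; exact volume_ball3_lt_top⟩
  have hswap : bilin (fun ζ => ∑ k ∈ S, c k * β (2 ^ k * brk e 1 ζ)) f h =
      ∫ n in ball3, bilin (a n) f h := by
    unfold bilin
    simp_rw [hval, ← integral_mul_const]
    refine integral_integral_swap ?_
    have h1 : Integrable (fun z : (ℝ × ℝ) × (ℝ × ℂ) => (ftS f z.1 * ftS h (-z.1)) * (1 : ℂ))
        (volume.prod (volume.restrict ball3)) := hP.mul_prod (integrable_const 1)
    simp only [mul_one] at h1
    exact h1.bdd_mul (c := K) (hac.comp continuous_swap).aestronglyMeasurable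
      (.of_forall fun z => HK S c 0 hc _)
  have hn : ∀ n, ‖bilin (a n) f h‖ ≤ C₀ * (nrm p f * nrm q h) := by
    intro n
    have h1 := H₀ S c 0 hc (α n) n.1 f
    rw [abs_zero, add_zero, one_pow, mul_one] at h1
    have h2 : (a n).HasTemperateGrowth := (hasTemperateGrowth_lacSum ψ S c 0).comp
      (hasTemperateGrowth_affine (α n) n.1)
    rw [← integral_fmul_mul h2]
    refine (norm_integral_le_integral_norm _).trans ?_
    simp_rw [norm_mul]
    refine (integral_mul_norm_le_Lp_mul_Lq hpq ((fmul _ f).memLp _) (h.memLp _)).trans ?_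
    rw [← mul_assoc]
    exact mul_le_mul_of_nonneg_right h1 (nrm_nonneg q h)
  rw [hswap, mul_assoc, mul_comm]
  exact norm_setIntegral_le_of_norm_le_const volume_ball3_lt_top fun n _ => hn n

section

variable {m : ℝ × ℝ → ℂ} {C : ℕ → ℕ → ℝ} {c : ℝ}

lemma exists_lpσ_mul_rpow (κ : ℝ) : ∃ β : 𝓢(ℝ, ℂ), IsAnnular 1 β ∧
    (∀ t ≤ 0, β t = 0) ∧ ∀ t > 0, β t = lpσ t * ((t ^ κ : ℝ) : ℂ) := by
  have hF : ContDiffOn ℝ (⊤ : ℕ∞) (fun t : ℝ => if 0 < t then ((t ^ κ : ℝ) : ℂ) else 0) {0}ᶜ := by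
    intro t ht
    refine ContDiffAt.contDiffWithinAt ?_
    rcases lt_or_gt_of_ne (show t ≠ 0 from ht) with h | h
    · refine (contDiffAt_const (c := (0 : ℂ))).congr_of_eventuallyEq ?_
      filter_upwards [gt_mem_nhds h] with z hz
      rw [if_neg hz.le.not_gt]
    · refine ContDiffAt.congr_of_eventuallyEq (f := fun z : ℝ => ((z ^ κ : ℝ) : ℂ)) ?_ ?_
      · exact Complex.ofRealCLM.contDiff.contDiffAt.comp t (Real.contDiffAt_rpow_const_of_ne h.ne')
      · filter_upwards [lt_mem_nhds h] with z hz
        rw [if_pos hz]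
  obtain ⟨β, h, hA⟩ := isAnnular_lpσ.exists_mul hF
  refine ⟨β, hA, fun t ht => ?_, fun t ht => ?_⟩
  · rw [h, if_neg ht.not_gt, mul_zero]
  · rw [h, if_pos ht]

lemma sum_range_lpσ (V : ℝ) (n : ℕ) : ∑ i ∈ Finset.range n, lpσ (2 ^ (-i : ℤ) * V) =
    bumpφ (2 ^ (-n : ℤ) * (2 * V)) - bumpφ (2 * V) := by
  induction n with
  | zero => simp
  | succ n ih =>
    rw [Finset.sum_range_succ, ih, lpσ_apply]
    have h1 : (2 : ℝ) * (2 ^ (-n : ℤ) * V) = 2 ^ (-n : ℤ) * (2 * V) := by ring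
    have h2 : (2 : ℝ) ^ (-((n + 1 : ℕ) : ℤ)) * (2 * V) = 2 ^ (-n : ℤ) * V := by
      rw [show -((n + 1 : ℕ) : ℤ) = -n - 1 by push_cast; ring, zpow_sub_one₀ two_ne_zero]
      ring
    rw [h1, h2]
    ring

lemma IsConeSymbol.isTame (hm : IsConeSymbol m C c) : IsTame fun w => m (w.1.1, w.2.2) := by
  have h : Measurable m := measurable_of_continuousOn_compl_singleton _ hm.smooth.continuousOn
  obtain ⟨K, hK⟩ := hm.exists_norm_le
  exact ⟨(h.comp (by fun_prop)).aestronglyMeasurable, K, fun w => hK _⟩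

lemma IsConeSymbol.brk_le (hm : IsConeSymbol m C c) {w : (ℝ × ℝ) × (ℝ × ℝ)}
    (hw : m (w.1.1, w.2.2) ≠ 0) :
    brk 0 1 (-(w.1 + w.2)) ≤ 2 * (1 + c) * brk 1 1 w.2 := by
  have hc := hm.pos
  have h1 : |w.1.1| ≤ c * |w.2.2| := hm.supp (subset_tsupport m hw)
  have h2 : w.1.1 ^ 2 ≤ c ^ 2 * w.2.2 ^ 2 := by
    have := pow_le_pow_left₀ (abs_nonneg _) h1 2
    rwa [mul_pow, sq_abs, sq_abs] at this
  have h3 : (2 * (1 + c)) = ((2 * (1 + c)) ^ 2) ^ (1 / 2 : ℝ) := by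
    rw [← Real.sqrt_eq_rpow, Real.sqrt_sq (by positivity)]
  rw [brk, brk, h3, ← Real.mul_rpow (by positivity) (by positivity)]
  refine Real.rpow_le_rpow (by positivity) ?_ (by norm_num)
  have h4 : (w.1.1 + w.2.1) ^ 2 ≤ 2 * (c ^ 2 * w.2.2 ^ 2 + w.2.1 ^ 2) := by
    nlinarith [sq_nonneg (w.1.1 - w.2.1)]
  have h5 := mul_le_mul_of_nonneg_left h4 (by positivity : 0 ≤ 4 * Real.pi ^ 2)
  have h6 : 0 ≤ Real.pi ^ 2 * w.2.2 ^ 2 := by positivity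
  have h7 : 0 ≤ Real.pi ^ 2 * w.2.1 ^ 2 := by positivity
  simp only [Prod.fst_neg, Prod.fst_add, zero_mul, one_mul, ne_eq, OfNat.ofNat_ne_zero,
    not_false_eq_true, zero_pow, add_zero, neg_sq]
  nlinarith [mul_nonneg hc.le h6, mul_nonneg hc.le h7, mul_nonneg (sq_nonneg c) h6,
    mul_nonneg (sq_nonneg c) h7]

/-- The bound for one diagonal of the double Littlewood–Paley decomposition. -/
lemma IsConeSymbol.exists_symBdd_diag (hm : IsConeSymbol m C c) {a : Fin 3 → ℝ}
    (ha : ∀ j, 0 < a j) (h0 : a 0 < 1 / 2) (hsum : ∑ j, a j = 1) {β₁ β₂ : 𝓢(ℝ, ℂ)}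
    (h₁ : IsAnnular 1 β₁) (h₁' : ∀ t ≤ 0, β₁ t = 0) (h₂ : IsAnnular 1 β₂)
    (h₂' : ∀ t ≤ 0, β₂ t = 0) : ∃ B : ℝ, 0 ≤ B ∧ ∀ (J : Finset ℤ) (d : ℤ),
      SymBdd (1 / a 1) (1 / a 2) (1 / a 0) (fun w => m (w.1.1, w.2.2) * ∑ j ∈ J,
        β₁ (2 ^ j * brk 0 1 (-(w.1 + w.2))) * β₂ (2 ^ (j + d) * brk 1 1 w.2)) B := by
  have hlt : ∀ j, 1 < 1 / a j := by
    intro j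
    rw [lt_div_iff₀ (ha j), one_mul]
    rw [Fin.sum_univ_three] at hsum
    have := ha 0; have := ha 1; have := ha 2
    fin_cases j <;> simp <;> linarith
  obtain ⟨B, hB⟩ := hm.exists_symBdd ha h0 hsum
  obtain ⟨C₁, hC₁, H₁⟩ := exists_mulBdd_radial (hlt 0) h₁ h₁' 0
  obtain ⟨C₂, hC₂, H₂⟩ := exists_mulBdd_radial (hlt 2) h₂ h₂' 1
  obtain ⟨hmm, K, hK⟩ := hm.isTame
  refine ⟨|B| * (1 * C₂ * C₁), by positivity, fun J d => ?_⟩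
  have hc0 := continuous_brk 0 1
  have hc1 := continuous_brk 1 1
  refine SymBdd.of_signs J hmm (fun j => Continuous.aestronglyMeasurable (by fun_prop))
    (fun j => Continuous.aestronglyMeasurable (by fun_prop)) hK
    (fun j w => β₁.norm_le_seminorm ℝ _) (fun j w => β₂.norm_le_seminorm ℝ _) fun ε hε => ?_
  have hε1 : ∀ k, ‖ε k‖ ≤ 1 := fun k => by rcases hε k with h | h <;> simp [h]
  have hs : ∀ (β : 𝓢(ℝ, ℂ)) (e : ℝ) (S : Finset ℤ) (c : ℤ → ℂ),
      (fun ζ => ∑ k ∈ S, c k * β (2 ^ k * brk e 1 ζ)).HasTemperateGrowth := fun β e S c =>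
    Function.HasTemperateGrowth.sum fun k _ =>
      (Function.HasTemperateGrowth.const _).mul (hasTemperateGrowth_comp_brk β e _)
  have h := SymBdd.mul (Function.HasTemperateGrowth.const 1)
    (hs β₂ 1 (J.map (addRightEmbedding d)) fun k => ε (k - d)) (hs β₁ 0 J ε) (abs_nonneg B)
    zero_le_one hC₂ (hB.mono (le_abs_self B)) (mulBdd_one _) (H₂ _ _ fun k => hε1 _)
    (H₁ _ _ hε1)
  convert h using 1
  funext w
  simp only [Finset.sum_map, addRightEmbedding_apply, add_sub_cancel_right]
  ring

lemma IsConeSymbol.exists_symBdd_brk_of_pos (hm : IsConeSymbol m C c) {a : Fin 3 → ℝ}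
    (ha : ∀ j, 0 < a j) (h0 : a 0 < 1 / 2) (hsum : ∑ j, a j = 1) {s : ℝ} (hs : 0 < s) :
    ∃ B : ℝ, SymBdd (1 / a 1) (1 / a 2) (1 / a 0) (fun w => m (w.1.1, w.2.2) *
      ((brk 0 s (-(w.1 + w.2)) * brk 1 (-s) w.2 : ℝ) : ℂ)) B := by
  obtain ⟨β₁, h₁, h₁', e₁⟩ := exists_lpσ_mul_rpow s
  obtain ⟨β₂, h₂, h₂', e₂⟩ := exists_lpσ_mul_rpow (-s)
  obtain ⟨B, hB, H⟩ := hm.exists_symBdd_diag ha h0 hsum h₁ h₁' h₂ h₂'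
  obtain ⟨Km, hKm⟩ := hm.exists_norm_le
  have hKm0 := (norm_nonneg _).trans (hKm 0)
  obtain ⟨K₁, hK₁, hL⟩ := exists_lacSum_le β₁ h₁.zero
  obtain ⟨K₂, hK₂, hb₂⟩ : ∃ K, 0 < K ∧ ∀ t, ‖β₂ t‖ ≤ K :=
    ⟨_ + 1, add_pos_of_nonneg_of_pos (apply_nonneg _ β₂) one_pos, fun t =>
      (β₂.norm_le_seminorm ℝ t).trans (le_add_of_nonneg_right zero_le_one)⟩
  set τ : ℝ := 2 ^ s with hτ
  have hτ1 : 1 < τ := Real.one_lt_rpow one_lt_two hs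
  have hτ0 : 0 < τ := by positivity
  have hc := hm.pos
  obtain ⟨D, hD⟩ := pow_unbounded_of_one_lt (4 * (2 * (1 + c))) (one_lt_two (α := ℝ))
  set P : ℕ → ℕ → (ℝ × ℝ) × (ℝ × ℝ) → ℂ := fun n i w => m (w.1.1, w.2.2) *
    ∑ j ∈ Finset.Icc (-n : ℤ) n, β₁ (2 ^ j * brk 0 1 (-(w.1 + w.2))) *
      β₂ (2 ^ (j + (D - i : ℤ)) * brk 1 1 w.2) with hP
  have hgeo : ∀ n : ℕ, ∑ i ∈ Finset.range n, τ ^ (D - i : ℤ) ≤ τ ^ D * (1 - τ⁻¹)⁻¹ := by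
    intro n
    have h1 : ∀ i : ℕ, τ ^ (D - i : ℤ) = τ ^ D * τ⁻¹ ^ i := by
      intro i
      rw [zpow_sub₀ hτ0.ne', zpow_natCast, zpow_natCast, inv_pow, div_eq_mul_inv]
    simp_rw [h1]
    rw [← Finset.mul_sum]
    refine mul_le_mul_of_nonneg_left ?_ (by positivity)
    rw [← tsum_geometric_of_lt_one (by positivity) (inv_lt_one_of_one_lt₀ hτ1)]
    exact (summable_geometric_of_lt_one (by positivity) (inv_lt_one_of_one_lt₀ hτ1)).sum_le_tsum _
      fun _ _ => by positivity
  have hPt : ∀ n i, IsTame (P n i) := fun n i => by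
    have hc0 := continuous_brk 0 1
    have hc1 := continuous_brk 1 1
    exact hm.isTame.mul (IsTame.sum _ fun j => (isTame_schwartz _ (by fun_prop)).mul
      (isTame_schwartz _ (by fun_prop)))
  have hPn : ∀ n i w, ‖P n i w‖ ≤ Km * (K₁ * K₂) := by
    intro n i w
    rw [hP, norm_mul]
    refine mul_le_mul (hKm _) ?_ (norm_nonneg _) hKm0
    have h3 := hL (Finset.Icc (-n : ℤ) n)
      (fun j => β₂ (2 ^ (j + (D - i : ℤ)) * brk 1 1 w.2) / K₂) 0 (fun j => by
        rw [norm_div, Complex.norm_real, Real.norm_of_nonneg hK₂.le, div_le_one hK₂]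
        exact hb₂ _) (brk 0 1 (-(w.1 + w.2)))
    have h4 : ∑ j ∈ Finset.Icc (-n : ℤ) n, β₁ (2 ^ j * brk 0 1 (-(w.1 + w.2))) *
        β₂ (2 ^ (j + (D - i : ℤ)) * brk 1 1 w.2) = lacSum β₁ (Finset.Icc (-n : ℤ) n)
        (fun j => β₂ (2 ^ (j + (D - i : ℤ)) * brk 1 1 w.2) / K₂) 0 (brk 0 1 (-(w.1 + w.2))) *
          K₂ := by
      have : (K₂ : ℂ) ≠ 0 := by exact_mod_cast hK₂.ne'
      rw [lacSum, Finset.sum_mul]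
      refine Finset.sum_congr rfl fun j _ => ?_
      rw [zero_mul, e2π_zero]
      field_simp
    rw [h4, norm_mul, Complex.norm_real, Real.norm_of_nonneg hK₂.le]
    exact mul_le_mul_of_nonneg_right h3 hK₂.le
  have hnτ : ∀ k : ℤ, ‖((τ ^ k : ℝ) : ℂ)‖ = τ ^ k := fun k => by
    rw [Complex.norm_real, Real.norm_of_nonneg (by positivity)]
  have hlim : ∀ w, Tendsto (fun n : ℕ => ∑ i ∈ Finset.range n,
      ((τ ^ (D - i : ℤ) : ℝ) : ℂ) * P n i w) atTop
      (𝓝 (m (w.1.1, w.2.2) * ((brk 0 s (-(w.1 + w.2)) * brk 1 (-s) w.2 : ℝ) : ℂ))) := by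
    intro w
    by_cases hw : m (w.1.1, w.2.2) = 0
    · simp [hP, hw]
    refine tendsto_const_nhds.congr' ?_
    have hXY := hm.brk_le hw
    set X := brk 0 1 (-(w.1 + w.2)) with hX
    set Y := brk 1 1 w.2 with hY
    have hX1 : 1 ≤ X := one_le_brk 0 zero_le_one _
    have hY1 : 1 ≤ Y := one_le_brk 1 zero_le_one _
    have hX0 : 0 < X := by linarith
    have hY0 : 0 < Y := by linarith
    have hpow := tendsto_pow_atTop_atTop_of_one_lt (one_lt_two (α := ℝ))
    filter_upwards [hpow.eventually_ge_atTop X, hpow.eventually_ge_atTop (2 ^ D * (4 * Y))]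
      with n hn1 hn2
    have hterm : ∀ j ∈ Finset.Icc (-n : ℤ) n, ∑ i ∈ Finset.range n,
        ((τ ^ (D - i : ℤ) : ℝ) : ℂ) * (β₁ (2 ^ j * X) * β₂ (2 ^ (j + (D - i : ℤ)) * Y)) =
        lpσ (2 ^ j * X) * ((X ^ s * Y ^ (-s) : ℝ) : ℂ) := by
      intro j _
      have h2j : (0 : ℝ) < 2 ^ j := by positivity
      rw [e₁ _ (mul_pos h2j hX0)]
      by_cases hσ : lpσ (2 ^ j * X) = 0
      · simp [hσ]
      obtain ⟨hl, hu⟩ := lpσ_ne_zero hσ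
      rw [abs_of_pos (by positivity)] at hl hu
      set V := 2 ^ j * (2 ^ D * Y) with hV
      have hVl : 1 ≤ V := by
        have h5 : 2 ^ j * X ≤ 2 ^ j * (2 * (1 + c) * Y) := mul_le_mul_of_nonneg_left hXY h2j.le
        have h6 : 4 * (2 * (1 + c)) * (2 ^ j * Y) ≤ 2 ^ D * (2 ^ j * Y) :=
          mul_le_mul_of_nonneg_right hD.le (by positivity)
        rw [hV]
        linarith
      have hVu : 2 * V ≤ 2 ^ n := by
        have h5 : (2 : ℝ) ^ j ≤ 2 := by nlinarith
        have h6 := mul_le_mul_of_nonneg_right h5 (by positivity : 0 ≤ (2 : ℝ) ^ D * Y)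
        rw [hV]
        linarith
      have hone : ∑ i ∈ Finset.range n, lpσ (2 ^ (-i : ℤ) * V) = 1 := by
        rw [sum_range_lpσ, bumpφ_one, bumpφ_zero, sub_zero]
        · rw [abs_of_pos (by linarith)]; linarith
        · rw [abs_of_pos (by positivity), zpow_neg, zpow_natCast, inv_mul_le_iff₀ (by positivity),
            mul_one]
          exact hVu
      rw [← mul_one (lpσ (2 ^ j * X) * ((X ^ s * Y ^ (-s) : ℝ) : ℂ)), ← hone, Finset.mul_sum]
      refine Finset.sum_congr rfl fun i _ => ?_
      have h7 : (2 : ℝ) ^ (j + (D - i : ℤ)) * Y = 2 ^ (-i : ℤ) * V := by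
        rw [hV, zpow_add₀ two_ne_zero, sub_eq_add_neg, zpow_add₀ two_ne_zero, zpow_natCast]
        ring
      rw [e₂ _ (by positivity), h7, ← h7]
      have h8 : ∀ (k : ℤ) (κ : ℝ), ((2 : ℝ) ^ k) ^ κ = (2 ^ κ) ^ k := by
        intro k κ
        rw [← Real.rpow_intCast, ← Real.rpow_intCast, ← Real.rpow_mul two_pos.le,
          ← Real.rpow_mul two_pos.le, mul_comm]
      rw [Real.mul_rpow (by positivity) hX0.le, Real.mul_rpow (by positivity) hY0.le, h8, h8,
        Real.rpow_neg two_pos.le, ← hτ, inv_zpow', neg_add, zpow_add₀ hτ0.ne', zpow_neg, zpow_neg]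
      have h9 : (τ : ℂ) ^ j ≠ 0 := by
        exact_mod_cast zpow_ne_zero j hτ0.ne'
      have h10 : (τ : ℂ) ^ (D - i : ℤ) ≠ 0 := by
        exact_mod_cast zpow_ne_zero (D - i : ℤ) hτ0.ne'
      push_cast
      field_simp
    rw [brk_eq_rpow 0 s, brk_eq_rpow 1 (-s), ← hX, ← hY]
    have h11 : ∑ i ∈ Finset.range n, ((τ ^ (D - i : ℤ) : ℝ) : ℂ) * P n i w =
        m (w.1.1, w.2.2) * ∑ j ∈ Finset.Icc (-n : ℤ) n, ∑ i ∈ Finset.range n,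
        ((τ ^ (D - i : ℤ) : ℝ) : ℂ) * (β₁ (2 ^ j * X) * β₂ (2 ^ (j + (D - i : ℤ)) * Y)) := by
      rw [Finset.sum_comm, Finset.mul_sum]
      refine Finset.sum_congr rfl fun i _ => ?_
      rw [hP, ← Finset.mul_sum]
      ring
    rw [h11, Finset.sum_congr rfl hterm, ← Finset.sum_mul, sum_Icc_lpσ_eq_one, one_mul]
    · rw [abs_of_pos hX0]
      exact (zpow_le_one_of_nonpos₀ one_le_two (by simp)).trans hX1
    · rw [abs_of_pos hX0, zpow_natCast]; exact hn1
  refine ⟨τ ^ D * (1 - τ⁻¹)⁻¹ * B, SymBdd.tendsto (l := atTop)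
    (K := τ ^ D * (1 - τ⁻¹)⁻¹ * (Km * (K₁ * K₂))) (.of_forall fun n =>
      (IsTame.sum _ fun i => (isTame_const _).mul (hPt n i)).1)
    (.of_forall fun n w => ?_) (.of_forall fun n => ?_)
    (.of_forall hlim)⟩
  · refine (norm_sum_le_of_le (n := fun i : ℕ => τ ^ (D - i : ℤ) * (Km * (K₁ * K₂))) _
      fun i _ => ?_).trans
      (((Finset.sum_mul _ _ _).symm.le).trans (mul_le_mul_of_nonneg_right (hgeo n)
        (mul_nonneg hKm0 (mul_nonneg hK₁ hK₂.le))))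
    rw [norm_mul, hnτ]
    exact mul_le_mul_of_nonneg_left (hPn n i w) (by positivity)
  · refine (SymBdd.sum_of_isTame (Finset.range n) (A := fun i => τ ^ (D - i : ℤ) * B)
      (fun i => (isTame_const _).mul (hPt n i)) fun i _ => ?_).mono
      (((Finset.sum_mul _ _ _).symm.le).trans (mul_le_mul_of_nonneg_right (hgeo n) hB))
    have h := (H (Finset.Icc (-n : ℤ) n) (D - i)).const_mul ((τ ^ (D - i : ℤ) : ℝ) : ℂ)
    rwa [hnτ] at h

/-- The trilinear estimate with `s` derivatives moved onto the second function. -/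
theorem IsConeSymbol.exists_symBdd_brk (hm : IsConeSymbol m C c) {a : Fin 3 → ℝ}
    (ha : ∀ j, 0 < a j) (h0 : a 0 < 1 / 2) (hsum : ∑ j, a j = 1) {s : ℝ} (hs : 0 ≤ s) :
    ∃ B : ℝ, 0 ≤ B ∧ SymBdd (1 / a 1) (1 / a 2) (1 / a 0) (fun w => m (w.1.1, w.2.2) *
      ((brk 0 s (-(w.1 + w.2)) * brk 1 (-s) w.2 : ℝ) : ℂ)) B := by
  suffices h : ∃ B : ℝ, SymBdd (1 / a 1) (1 / a 2) (1 / a 0) (fun w => m (w.1.1, w.2.2) *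
      ((brk 0 s (-(w.1 + w.2)) * brk 1 (-s) w.2 : ℝ) : ℂ)) B by
    obtain ⟨B, hB⟩ := h
    exact ⟨|B|, abs_nonneg B, hB.mono (le_abs_self B)⟩
  rcases hs.eq_or_lt with rfl | hs
  · simpa [brk] using hm.exists_symBdd ha h0 hsum
  · exact hm.exists_symBdd_brk_of_pos ha h0 hsum hs

end

lemma integral_character_mul {b h : ℝ × ℝ → ℂ} (hb : Integrable b) (hh : Integrable h) (ε : ℝ) :
    ∫ z : ℝ × ℝ, (∫ ζ : ℝ × ℝ, b ζ * e2π (ε * (z.1 * ζ.1 + z.2 * ζ.2))) * h z =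
      ∫ ζ : ℝ × ℝ, b ζ * ∫ z : ℝ × ℝ, h z * e2π (ε * (ζ.1 * z.1 + ζ.2 * z.2)) := by
  simp_rw [← integral_mul_const, ← integral_const_mul]
  rw [integral_integral_swap]
  · refine integral_congr_ae (.of_forall fun ζ => ?_)
    refine integral_congr_ae (.of_forall fun z => ?_)
    simp only
    rw [mul_comm z.1, mul_comm z.2]
    ring
  · have := (hh.mul_prod hb).mul_bdd (c := 1)
      (g := fun w : (ℝ × ℝ) × (ℝ × ℝ) => e2π (ε * (w.1.1 * w.2.1 + w.1.2 * w.2.2)))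
      (Continuous.aestronglyMeasurable (by fun_prop))
      (.of_forall fun w => (norm_e2π _).le)
    refine this.congr (.of_forall fun w => ?_)
    simp only [Function.uncurry]
    ring

lemma integral_FT2_mul {T : ℝ × ℝ → ℂ} (hT : Integrable T) (k : 𝓢(ℝ × ℝ, ℂ)) :
    ∫ ζ, FT2 T ζ * k ζ = ∫ z, T z * ftS k z := by
  have := integral_character_mul hT k.integrable (-1)
  simp only [neg_one_mul] at this
  simp_rw [ftS_apply, FT2]
  rw [← integral_congr_ae (.of_forall fun ζ => ?_), this]
  · refine integral_congr_ae (.of_forall fun z => ?_)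
    simp only [mul_comm]
  · simp only [mul_comm]

lemma integral_Tmu_mul_ftS {M : (ℝ × ℝ) × (ℝ × ℝ) → ℂ} (hM : IsTame M)
    (f g k : 𝓢(ℝ × ℝ, ℂ)) :
    ∫ z, Tmu M f g z * ftS k z = ∫ w, M w * (ftS f w.1 * ftS g w.2 * k (w.1 + w.2)) := by
  obtain ⟨hM, K, hK⟩ := hM
  simp_rw [Tmu, ← ftS_apply, ← integral_mul_const]
  rw [integral_integral_swap]
  · refine integral_congr_ae (.of_forall fun w => ?_)
    simp only
    rw [k.eq_integral_ftS, ← integral_const_mul, ← integral_const_mul]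
    refine integral_congr_ae (.of_forall fun z => ?_)
    simp only [Prod.fst_add, Prod.snd_add]
    rw [mul_comm z.1, mul_comm z.2]
    ring
  · have h1 : Integrable fun w : (ℝ × ℝ) × (ℝ × ℝ) => M w * (ftS f w.1 * ftS g w.2) :=
      ((ftS f).integrable.mul_prod (ftS g).integrable).bdd_mul hM (.of_forall hK)
    have := ((ftS k).integrable (μ := volume) |>.mul_prod h1).mul_bdd (c := 1)
      (g := fun w : (ℝ × ℝ) × (ℝ × ℝ) × (ℝ × ℝ) =>
        e2π (w.1.1 * (w.2.1.1 + w.2.2.1) + w.1.2 * (w.2.1.2 + w.2.2.2)))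
      (Continuous.aestronglyMeasurable (by fun_prop))
      (.of_forall fun w => (norm_e2π _).le)
    refine this.congr (.of_forall fun w => ?_)
    simp only [Function.uncurry]
    ring

lemma iftS_eq_ftS_neg (h : 𝓢(ℝ × ℝ, ℂ)) (ζ : ℝ × ℝ) : iftS h ζ = ftS h (-ζ) := by
  rw [iftS_apply, ftS_apply, FT2]
  refine integral_congr_ae (.of_forall fun z => ?_)
  simp only [Prod.fst_neg, Prod.snd_neg]
  congr 2
  ring

lemma hasTemperateGrowth_ofReal_brk (e s : ℝ) :
    (fun ζ => ((brk e s ζ : ℝ) : ℂ)).HasTemperateGrowth :=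
  Function.Complex.hasTemperateGrowth_ofReal.comp (hasTemperateGrowth_brk e s)

lemma JsX_eq (s : ℝ) (T : ℝ × ℝ → ℂ) (z : ℝ × ℝ) : JsX s T z =
    ∫ ζ : ℝ × ℝ, (brk 0 s ζ : ℂ) * FT2 T ζ * e2π (1 * (z.1 * ζ.1 + z.2 * ζ.2)) := by
  simp [JsX, brk]

lemma JsFull_schwartz (s : ℝ) (g : 𝓢(ℝ × ℝ, ℂ)) :
    JsFull s g = fmul (fun ζ => (brk 1 s ζ : ℂ)) g := by
  funext z
  rw [SchwartzMap.eq_integral_ftS]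
  simp_rw [ftS_fmul (hasTemperateGrowth_ofReal_brk 1 s), ftS_apply]
  simp [JsFull, brk]

lemma integral_JsX_Tmu_mul {M : (ℝ × ℝ) × (ℝ × ℝ) → ℂ} (hM : IsTame M) (s : ℝ)
    (f g h : 𝓢(ℝ × ℝ, ℂ)) (hT : Integrable (Tmu M f g))
    (hb : Integrable fun ζ => (brk 0 s ζ : ℂ) * FT2 (Tmu M f g) ζ) :
    ∫ z, JsX s (Tmu M f g) z * h z =
      trilin (fun w => M w * ((brk 0 s (-(w.1 + w.2)) * brk 1 (-s) w.2 : ℝ) : ℂ)) f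
        (fmul (fun ζ => (brk 1 s ζ : ℂ)) g) h := by
  set k := smulLeftCLM ℂ (fun ζ => ((brk 0 s ζ : ℝ) : ℂ)) (iftS h) with hk
  have hk' : ∀ ζ, k ζ = (brk 0 s ζ : ℂ) * ftS h (-ζ) := fun ζ => by
    rw [hk, SchwartzMap.smulLeftCLM_apply_apply (hasTemperateGrowth_ofReal_brk 0 s),
      iftS_eq_ftS_neg, smul_eq_mul]
  simp_rw [JsX_eq]
  rw [integral_character_mul hb h.integrable 1, trilin]
  trans ∫ ζ, FT2 (Tmu M f g) ζ * k ζ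
  · refine integral_congr_ae (.of_forall fun ζ => ?_)
    simp only [hk', one_mul]
    rw [← iftS_eq_ftS_neg, iftS_apply]
    ring
  rw [integral_FT2_mul hT, integral_Tmu_mul_ftS hM]
  refine integral_congr_ae (.of_forall fun w => ?_)
  simp only [hk', triFT, ftS_fmul (hasTemperateGrowth_ofReal_brk 1 s)]
  have h1 : ((brk 1 (-s) w.2 : ℝ) : ℂ) * (brk 1 s w.2 : ℂ) = 1 := by
    rw [← Complex.ofReal_mul, ← Complex.ofReal_one]
    congr 1
    have h0 : 0 < 1 + 4 * Real.pi ^ 2 * (w.2.1 ^ 2 + (1 * w.2.2) ^ 2) := by positivity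
    rw [brk, brk, ← Real.rpow_add h0]
    ring_nf
    simp
  rw [brk_neg]
  push_cast
  linear_combination (-(M w * ftS f w.1 * ftS g w.2 * (brk 0 s (w.1 + w.2) : ℂ) *
    ftS h (-(w.1 + w.2)))) * h1

lemma eLpNorm_le_of_forall_schwartz {p q A : ℝ} (hpq : p.HolderConjugate q) (hA : 0 ≤ A)
    {u : ℝ × ℝ → ℂ} (hu : Continuous u)
    (H : ∀ h : 𝓢(ℝ × ℝ, ℂ), ‖∫ z, u z * h z‖ ≤ A * nrm q h) :
    eLpNorm u (ENNReal.ofReal p) volume ≤ ENNReal.ofReal A := by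
  have hp0 := hpq.pos
  have hq0 := hpq.symm.pos
  let χ : ∀ n : ℕ, ContDiffBump (0 : ℝ × ℝ) := fun n =>
    ⟨n + 1, n + 2, by positivity, by linarith⟩
  have hχc : ∀ n, HasCompactSupport fun z => ((χ n z : ℝ) : ℂ) := fun n =>
    (χ n).hasCompactSupport.comp_left (g := fun t : ℝ => (t : ℂ)) Complex.ofReal_zero
  have hχd : ∀ n, ContDiff ℝ (⊤ : ℕ∞) fun z => ((χ n z : ℝ) : ℂ) := fun n =>
    Complex.ofRealCLM.contDiff.comp (χ n).contDiff
  have hcs : ∀ n, HasCompactSupport fun z => u z * ((χ n z : ℝ) : ℂ) := fun n =>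
    (hχc n).mul_left
  have hcont : ∀ n, Continuous fun z => u z * ((χ n z : ℝ) : ℂ) := fun n =>
    hu.mul (hχd n).continuous
  have hmem : ∀ n, MemLp (fun z => u z * ((χ n z : ℝ) : ℂ)) (ENNReal.ofReal p) := fun n =>
    (hcont n).memLp_of_hasCompactSupport (hcs n)
  refine Lp.eLpNorm_le_of_ae_tendsto (u := atTop) (f := fun n z => u z * ((χ n z : ℝ) : ℂ))
    (.of_forall fun n => ?_) (fun n => (hmem n).1) (.of_forall fun z => ?_)
  · have hp : ENNReal.ofReal p ≠ 0 := by simpa using hp0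
    rw [(hmem n).eLpNorm_eq_integral_rpow_norm hp ENNReal.ofReal_ne_top,
      ENNReal.toReal_ofReal hp0.le, ← one_div]
    refine ENNReal.ofReal_le_ofReal
      (integral_rpow_le_of_forall_schwartz hpq hA (hmem n) fun h => ?_)
    let h' : 𝓢(ℝ × ℝ, ℂ) :=
      HasCompactSupport.toSchwartzMap (f := fun z => ((χ n z : ℝ) : ℂ) * h z)
        (hχc n).mul_right ((hχd n).mul h.smooth')
    have hh : ∀ z, h' z = ((χ n z : ℝ) : ℂ) * h z := fun z => rfl
    have h1 : ∫ z, u z * ((χ n z : ℝ) : ℂ) * h z = ∫ z, u z * h' z := by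
      simp_rw [hh, mul_assoc]
    rw [h1]
    refine (H h').trans (mul_le_mul_of_nonneg_left ?_ hA)
    have hInt : ∀ k : 𝓢(ℝ × ℝ, ℂ), Integrable fun z => ‖k z‖ ^ q := fun k => by
      have := (k.memLp (ENNReal.ofReal q) volume).integrable_norm_rpow (by simpa using hq0)
        ENNReal.ofReal_ne_top
      rwa [ENNReal.toReal_ofReal hq0.le] at this
    refine Real.rpow_le_rpow (by positivity) (integral_mono (hInt h') (hInt h) fun z => ?_)
      (by positivity)
    refine Real.rpow_le_rpow (by positivity) ?_ hq0.le
    rw [hh, norm_mul, Complex.norm_real, Real.norm_of_nonneg (χ n).nonneg]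
    exact mul_le_of_le_one_left (norm_nonneg _) (χ n).le_one
  · refine tendsto_const_nhds.congr' ?_
    filter_upwards [eventually_ge_atTop ⌈‖z‖⌉₊] with n hn
    rw [(χ n).one_of_mem_closedBall, Complex.ofReal_one, mul_one]
    rw [mem_closedBall_zero_iff]
    exact (Nat.ceil_le.1 hn).trans (le_add_of_nonneg_right zero_le_one)

lemma JsX_eq_zero_of_not_integrable {s : ℝ} {T : ℝ × ℝ → ℂ}
    (h : ¬ (Integrable T ∧ Integrable fun ζ => (brk 0 s ζ : ℂ) * FT2 T ζ)) : JsX s T = 0 := by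
  have key : ∀ (F : ℝ × ℝ → ℂ) (φ : ℝ × ℝ → ℝ), Continuous φ → ¬ Integrable F →
      ∫ z, F z * e2π (φ z) = 0 := by
    intro F φ hφ hF
    refine integral_undef fun hi => hF ?_
    have := hi.mul_bdd (c := 1) (g := fun z => e2π (-φ z))
      (Continuous.aestronglyMeasurable (by fun_prop))
      (.of_forall fun w => (norm_e2π _).le)
    refine this.congr (.of_forall fun z => ?_)
    simp only [mul_assoc, ← e2π_add, add_neg_cancel, e2π_zero, mul_one]
  funext z
  rw [JsX_eq]
  by_cases hT : Integrable T
  · exact key _ _ (by fun_prop) fun hb => h ⟨hT, hb⟩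
  · have h0 : ∀ ζ, FT2 T ζ = 0 := fun ζ => key T _ (by fun_prop) hT
    simp [h0]

theorem IsConeSymbol.exists_WxNorm_le {m : ℝ × ℝ → ℂ} {C : ℕ → ℕ → ℝ} {c : ℝ}
    (hm : IsConeSymbol m C c) {s p q r : ℝ} (hs : 0 ≤ s) (hp : 1 < p) (hq : 1 < q) (hr : 1 < r)
    (hpqr : 1 / p + 1 / q = 1 / r) (hr2 : 1 / 2 < 1 / r) :
    ∃ C' : ℝ, 0 ≤ C' ∧ ∀ f g : 𝓢(ℝ × ℝ, ℂ),
      WxNorm s r (Tmu (fun w => m (w.1.1, w.2.2)) f g) ≤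
        ENNReal.ofReal C' * LpNorm p f * WNorm s q g := by
  have hp0 : 0 < p := by linarith
  have hq0 : 0 < q := by linarith
  have hr0 : 0 < r := by linarith
  have hr1 : 1 / r < 1 := by rw [div_lt_one hr0]; exact hr
  obtain ⟨B, hB, H⟩ := hm.exists_symBdd_brk (a := ![1 - 1 / r, 1 / p, 1 / q])
    (fun j => by fin_cases j <;> simp <;> first | positivity | simpa using hr1)
    (show 1 - 1 / r < 1 / 2 by linarith)
    (by simp only [Fin.sum_univ_three, Matrix.cons_val_zero, Matrix.cons_val_one,
          Matrix.cons_val]; linarith) hs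
  refine ⟨B, hB, fun f g => ?_⟩
  have hpq := Real.HolderConjugate.conjExponent hr
  have hr' : 1 / (1 - 1 / r) = r.conjExponent := by
    rw [Real.conjExponent]
    have : r - 1 ≠ 0 := by linarith
    field_simp
  simp only [Matrix.cons_val_zero, Matrix.cons_val_one, Matrix.cons_val, one_div_one_div,
    hr'] at H
  rw [WNorm, JsFull_schwartz]
  change _ ≤ _ * _ * LpNorm q (fmul _ g)
  rw [LpNorm_schwartz hp0, LpNorm_schwartz hq0, ← ENNReal.ofReal_mul hB,
    ← ENNReal.ofReal_mul (mul_nonneg hB (nrm_nonneg _ _)), WxNorm]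
  by_cases hi : Integrable (Tmu (fun w => m (w.1.1, w.2.2)) f g) ∧
      Integrable fun ζ => (brk 0 s ζ : ℂ) * FT2 (Tmu (fun w => m (w.1.1, w.2.2)) f g) ζ
  · refine eLpNorm_le_of_forall_schwartz hpq
      (mul_nonneg (mul_nonneg hB (nrm_nonneg _ _)) (nrm_nonneg _ _)) ?_ fun h => ?_
    · rw [show JsX s _ = _ from funext (JsX_eq s _)]
      refine continuous_of_dominated (fun z => hi.2.1.mul
        (Continuous.aestronglyMeasurable (by fun_prop))) (fun z => Eventually.of_forall fun ζ => ?_)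
        hi.2.norm (.of_forall fun ζ => by fun_prop)
      rw [norm_mul, norm_e2π, mul_one]
    · rw [integral_JsX_Tmu_mul hm.isTame s f g h hi.1 hi.2]
      refine (H f _ h).trans_eq ?_
      ring
  · rw [JsX_eq_zero_of_not_integrable hi, eLpNorm_zero]
    exact zero_le

end

/-- Theorem 2 of the paper. A symbol `m(ξ₁,η₂)`, smooth away from the origin,
satisfying homogeneous symbol estimates of order `0` and supported in `|τ₁| ≤ c |τ₂|`, yields a
bilinear multiplier bounded from `L^p × W^{s,q}` to `L^r_y(W^{s,r}_x)` for `s ≥ 0`,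
`1 < p, q, r < ∞`, `1/p + 1/q = 1/r > 1/2`. -/
theorem statement2 (m : ℝ × ℝ → ℂ) (C : ℕ → ℕ → ℝ)
    (hsm : ContDiffOn ℝ (⊤ : ℕ∞) m ({((0 : ℝ), (0 : ℝ))}ᶜ))
    (hder : ∀ β₁ β₂ : ℕ, ∀ τ₁ τ₂ : ℝ, (τ₁, τ₂) ≠ ((0 : ℝ), (0 : ℝ)) →
      ‖pd β₁ β₂ (fun a b => m (a, b)) τ₁ τ₂‖ ≤ C β₁ β₂ * (|τ₁| + |τ₂|) ^ (-(β₁ + β₂ : ℤ)))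
    (c : ℝ) (hc : 0 < c)
    (hsupp : tsupport m ⊆ {τ : ℝ × ℝ | |τ.1| ≤ c * |τ.2|}) :
    ∀ s p q r : ℝ, 0 ≤ s → 1 < p → 1 < q → 1 < r →
      1 / p + 1 / q = 1 / r → 1 / 2 < 1 / r →
      ∃ C' : ℝ, 0 ≤ C' ∧ ∀ f g : SchwartzMap (ℝ × ℝ) ℂ,
        WxNorm s r (Tmu (fun w => m (w.1.1, w.2.2)) ⇑f ⇑g) ≤
          ENNReal.ofReal C' * LpNorm p ⇑f * WNorm s q ⇑g := by
  exact fun s p q r hs hp hq hr hpqr hr2 =>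
    IsConeSymbol.exists_WxNorm_le ⟨hsm, hder, hc, hsupp⟩ hs hp hq hr hpqr hr2
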